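/- Let 0 < α ≤ 1/2 and let ℐ be a closed ideal of the Banach algebra 𝒜_α = 𝒟 ∩ lip_α with ℐ ≠ {0}. Set E_ℐ := {ξ ∈ 𝕋 : f(ξ) = 0 for all f ∈ ℐ}. Then there exists an inner function U (a bounded analytic function on 𝔻 whose radial limits have modulus 1 at almost every point of 𝕋) such that ℐ = { f ∈ 𝒜_α : f vanishes identically on E_ℐ and there exists a bounded analytic function h on 𝔻 with f = U·h on 𝔻 }. -/

import Mathlib

open Complex MeasureTheory Set Metric Filter
open scoped ENNReal Classical

noncomputable section

/-- The open unit disc in `ℂ`. -/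
def uDisc : Set ℂ := Metric.ball 0 1

/-- The unit circle in `ℂ`. -/
def uCircle : Set ℂ := Metric.sphere (0 : ℂ) 1

/-- `f` is analytic on the open unit disc and continuous on the closed unit disc. -/
def IsDiscReg (f : ℂ → ℂ) : Prop :=
  DifferentiableOn ℂ f uDisc ∧ ContinuousOn f (Metric.closedBall 0 1)

/-- The little-o Lipschitz condition of order `α` on the closed unit disc:
`|f z - f w| = o(|z-w|^α)` as `|z - w| → 0`. -/
def LittleLip (α : ℝ) (f : ℂ → ℂ) : Prop :=
  ∀ ε > 0, ∃ δ > 0, ∀ z ∈ Metric.closedBall (0 : ℂ) 1, ∀ w ∈ Metric.closedBall (0 : ℂ) 1,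
    ‖z - w‖ < δ → ‖f z - f w‖ ≤ ε * ‖z - w‖ ^ α

/-- Membership in `lip_α`. -/
def MemLip (α : ℝ) (f : ℂ → ℂ) : Prop := IsDiscReg f ∧ LittleLip α f

/-- The Dirichlet integral `D(f) = ∫_𝔻 |f'|² dA` with respect to the normalized
area measure `dA = (1/π)·(Lebesgue)`. -/
def dirInt (f : ℂ → ℂ) : ℝ := (1 / Real.pi) * ∫ z in uDisc, ‖deriv f z‖ ^ 2

/-- Membership in the Dirichlet space `𝒟`. -/
def MemDir (f : ℂ → ℂ) : Prop :=
  DifferentiableOn ℂ f uDisc ∧ IntegrableOn (fun z => ‖deriv f z‖ ^ 2) uDisc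

/-- Sup norm over the unit disc. -/
def supNorm (f : ℂ → ℂ) : ℝ := sSup ((fun z => ‖f z‖) '' uDisc)

/-- The `lip_α` norm `‖f‖_α = ‖f‖_∞ + sup_{z∈𝔻} (1-|z|)^{1-α}|f'(z)|`. -/
def lipNorm (α : ℝ) (f : ℂ → ℂ) : ℝ :=
  supNorm f + sSup ((fun z => (1 - ‖z‖) ^ (1 - α) * ‖deriv f z‖) '' uDisc)

/-- The `𝒜_α` norm `‖f‖_{𝒜_α} = ‖f‖_α + D(f)^{1/2}`. -/
def ANorm (α : ℝ) (f : ℂ → ℂ) : ℝ := lipNorm α f + Real.sqrt (dirInt f)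

/-- Membership in `𝒜_α = 𝒟 ∩ lip_α`. -/
def MemA (α : ℝ) (f : ℂ → ℂ) : Prop := MemDir f ∧ MemLip α f

/-- A closed ideal of the Banach algebra `𝒜_α`, encoded as a set of functions `ℂ → ℂ`
(two functions agreeing on the closed disc represent the same element of `𝒜_α`). -/
structure IsClosedIdeal (α : ℝ) (J : Set (ℂ → ℂ)) : Prop where
  mem_A : ∀ f ∈ J, MemA α f
  zero_mem : (0 : ℂ → ℂ) ∈ J
  add_mem : ∀ f ∈ J, ∀ g ∈ J, f + g ∈ J
  smul_mem : ∀ (c : ℂ), ∀ f ∈ J, c • f ∈ J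
  mul_mem : ∀ f ∈ J, ∀ g : ℂ → ℂ, MemA α g → f * g ∈ J
  ext_mem : ∀ f ∈ J, ∀ g : ℂ → ℂ, MemA α g →
    (∀ z ∈ Metric.closedBall (0 : ℂ) 1, g z = f z) → g ∈ J
  closed : ∀ (F : ℕ → ℂ → ℂ) (f : ℂ → ℂ), (∀ n, F n ∈ J) → MemA α f →
    Tendsto (fun n => ANorm α (F n - f)) atTop (nhds 0) → f ∈ J

/-- The boundary zero set `E_f = {ξ ∈ 𝕋 : f ξ = 0}`. -/
def bZeros (f : ℂ → ℂ) : Set ℂ := {ξ | ξ ∈ uCircle ∧ f ξ = 0}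

/-- An inner function: bounded analytic on `𝔻` with radial limits of modulus `1`
at almost every point of `𝕋`. -/
def IsInner (U : ℂ → ℂ) : Prop :=
  DifferentiableOn ℂ U uDisc ∧ (∀ z ∈ uDisc, ‖U z‖ ≤ 1) ∧
    ∀ᵐ θ : ℝ, Tendsto (fun r : ℝ => ‖U ((r : ℂ) * Complex.exp ((θ : ℂ) * Complex.I))‖)
      (nhdsWithin 1 (Set.Iio 1)) (nhds 1)

/-- The Schwarz/Herglotz kernel `(e^{iθ}+z)/(e^{iθ}-z)`. -/
def circleKernel (z : ℂ) (θ : ℝ) : ℂ :=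
  (Complex.exp ((θ : ℂ) * Complex.I) + z) / (Complex.exp ((θ : ℂ) * Complex.I) - z)

/-- `f` is an outer function. -/
def IsOuter (f : ℂ → ℂ) : Prop :=
  IsDiscReg f ∧ (∃ z ∈ uDisc, f z ≠ 0) ∧
    ∀ z ∈ uDisc, f z = Complex.exp ((1 / (2 * (Real.pi : ℂ))) *
      ∫ θ in (0:ℝ)..(2 * Real.pi),
        circleKernel z θ * (Real.log ‖f (Complex.exp ((θ : ℂ) * Complex.I))‖ : ℂ))

/-- The outer power `f^ρ`, the outer function with boundary modulus `|f|^ρ`. -/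
def outerPow (f : ℂ → ℂ) (ρ : ℝ) (z : ℂ) : ℂ :=
  Complex.exp (((ρ : ℂ) / (2 * (Real.pi : ℂ))) *
    ∫ θ in (0:ℝ)..(2 * Real.pi),
      circleKernel z θ * (Real.log ‖f (Complex.exp ((θ : ℂ) * Complex.I))‖ : ℂ))

/-- The set of angles in `[0, 2π)` whose corresponding point of the circle lies in `A`. -/
def angSet (A : Set ℂ) : Set ℝ :=
  {θ | θ ∈ Set.Ico (0 : ℝ) (2 * Real.pi) ∧ Complex.exp ((θ : ℂ) * Complex.I) ∈ A}

/-- The outer factor `f_Γ` associated with a boundary set `Γ ⊆ 𝕋`. -/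
def outerPart (f : ℂ → ℂ) (Γ : Set ℂ) (z : ℂ) : ℂ :=
  Complex.exp ((1 / (2 * (Real.pi : ℂ))) *
    ∫ θ in angSet Γ, circleKernel z θ * (Real.log ‖f (Complex.exp ((θ : ℂ) * Complex.I))‖ : ℂ))

/-- `𝕋 \ E_f`, the set of boundary points where `f` does not vanish. -/
def offZeros (f : ℂ → ℂ) : Set ℂ := {ξ | ξ ∈ uCircle ∧ f ξ ≠ 0}

/-- `γ` is a component arc (connected component) of `𝕋 \ E_f`. -/
def IsCompArc (f : ℂ → ℂ) (γ : Set ℂ) : Prop :=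
  ∃ x ∈ offZeros f, γ = connectedComponentIn (offZeros f) x

/-- `Γ` is a union of component arcs of `𝕋 \ E_f`. -/
def IsArcUnion (f : ℂ → ℂ) (Γ : Set ℂ) : Prop :=
  Γ ⊆ offZeros f ∧ ∀ x ∈ Γ, connectedComponentIn (offZeros f) x ⊆ Γ

/-- The sector `Δ_γ = {z ∈ 𝔻 : z/|z| ∈ γ}`. -/
def discSector (γ : Set ℂ) : Set ℂ := {z | z ∈ uDisc ∧ ((‖z‖ : ℂ))⁻¹ * z ∈ γ}

/-- Lower integral of `g` over `S` with respect to the normalized area measure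
`dA = (1/π)·(Lebesgue)`. -/
def nlint (S : Set ℂ) (g : ℂ → ℝ) : ℝ≥0∞ :=
  ENNReal.ofReal (1 / Real.pi) * ∫⁻ z in S, ENNReal.ofReal (g z)

/-- `d(z) = min(|z-a|, |z-b|)`, distance to the endpoints of the arc `γ = (a,b)`. -/
def dd (a b z : ℂ) : ℝ := min ‖z - a‖ ‖z - b‖

/-- `Λ_γ`: equals `Γ` if `γ ⊄ Γ`, and `𝕋 \ Γ` if `γ ⊆ Γ`. -/
def lamSet (Γ γ : Set ℂ) : Set ℂ := if γ ⊆ Γ then uCircle \ Γ else Γ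

/-- The function `a_γ(z) = (1/2π)∫_{Λ_γ} (−log|f(e^{iθ})|)/|e^{iθ}−z|² dθ`. -/
def aFun (f : ℂ → ℂ) (Γ γ : Set ℂ) (z : ℂ) : ℝ :=
  (1 / (2 * Real.pi)) * ∫ θ in angSet (lamSet Γ γ),
    (-(Real.log ‖f (Complex.exp ((θ : ℂ) * Complex.I))‖)) /
      ‖Complex.exp ((θ : ℂ) * Complex.I) - z‖ ^ 2

/-- `Δ_γ¹ = {z ∈ Δ_γ : d(z) < 2(1−|z|)}`. -/
def sector1 (a b : ℂ) (γ : Set ℂ) : Set ℂ :=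
  {z | z ∈ discSector γ ∧ dd a b z < 2 * (1 - ‖z‖)}

/-- `Δ_γ² = {z ∈ Δ_γ : d(z) ≥ 2(1−|z|)}`. -/
def sector2 (a b : ℂ) (γ : Set ℂ) : Set ℂ :=
  {z | z ∈ discSector γ ∧ 2 * (1 - ‖z‖) ≤ dd a b z}

/-- `Δ_γ²¹ = {z ∈ Δ_γ² : a_γ(z) ≤ 8|log d(z)|/d(z)}`. -/
def sector21 (f : ℂ → ℂ) (Γ γ : Set ℂ) (a b : ℂ) : Set ℂ :=
  {z | z ∈ sector2 a b γ ∧ aFun f Γ γ z ≤ 8 * |Real.log (dd a b z)| / dd a b z}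

/-- `Δ_γ²² = {z ∈ Δ_γ² : 8|log d(z)|/d(z) < a_γ(z) < 8|log d(z)|/(1−|z|)}`. -/
def sector22 (f : ℂ → ℂ) (Γ γ : Set ℂ) (a b : ℂ) : Set ℂ :=
  {z | z ∈ sector2 a b γ ∧ 8 * |Real.log (dd a b z)| / dd a b z < aFun f Γ γ z ∧
    aFun f Γ γ z < 8 * |Real.log (dd a b z)| / (1 - ‖z‖)}

/-- `Δ_γ²³ = {z ∈ Δ_γ² : a_γ(z) ≥ 8|log d(z)|/(1−|z|)}`. -/
def sector23 (f : ℂ → ℂ) (Γ γ : Set ℂ) (a b : ℂ) : Set ℂ :=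
  {z | z ∈ sector2 a b γ ∧ 8 * |Real.log (dd a b z)| / (1 - ‖z‖) ≤ aFun f Γ γ z}

/-- `μ_z = 1 − 8|log d(z)|/a_γ(z)`. -/
def muOf (f : ℂ → ℂ) (Γ γ : Set ℂ) (a b : ℂ) (z : ℂ) : ℝ :=
  1 - 8 * |Real.log (dd a b z)| / aFun f Γ γ z

/-- The tail union `Γ_m = ⋃_{p ≥ m} γ_p`. -/
def tailUnion (γ : ℕ → Set ℂ) (m : ℕ) : Set ℂ := ⋃ p ∈ Set.Ici m, γ p

end

open scoped ComplexConjugate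

noncomputable section

namespace ClosedIdeals

lemma mem_uDisc {z : ℂ} : z ∈ uDisc ↔ ‖z‖ < 1 := by simp [uDisc]

lemma mem_cDisc {z : ℂ} : z ∈ closedBall (0 : ℂ) 1 ↔ ‖z‖ ≤ 1 := by simp

lemma mem_uCircle {z : ℂ} : z ∈ uCircle ↔ ‖z‖ = 1 := by simp [uCircle]

lemma isOpen_uDisc : IsOpen uDisc := isOpen_ball

lemma measurableSet_uDisc : MeasurableSet uDisc := isOpen_ball.measurableSet

lemma uDisc_subset : uDisc ⊆ closedBall (0 : ℂ) 1 := ball_subset_closedBall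

lemma volume_uDisc_lt_top : volume uDisc < ⊤ := measure_ball_lt_top

lemma volume_uDisc : volume uDisc = ENNReal.ofReal Real.pi := by
  rw [uDisc, Complex.volume_ball]
  simp [NNReal.pi, ENNReal.ofReal, Real.toNNReal]
  congr 1
  ext
  simp only [max_eq_left Real.pi_pos.le]
  rfl

lemma volume_real_uDisc : volume.real uDisc = Real.pi := by
  rw [Measure.real, volume_uDisc, ENNReal.toReal_ofReal Real.pi_pos.le]

lemma smul_mem_uDisc {r : ℝ} (h0 : 0 ≤ r) (h1 : r ≤ 1) {z : ℂ} (hz : z ∈ uDisc) :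
    (r : ℂ) * z ∈ uDisc := by
  rw [mem_uDisc] at *
  rw [norm_mul, Complex.norm_real, Real.norm_of_nonneg h0]
  nlinarith [norm_nonneg z]

lemma smul_mem_uDisc' {r : ℝ} (h0 : 0 ≤ r) (h1 : r < 1) {z : ℂ} (hz : z ∈ closedBall (0 : ℂ) 1) :
    (r : ℂ) * z ∈ uDisc := by
  rw [mem_uDisc]
  rw [mem_cDisc] at hz
  rw [norm_mul, Complex.norm_real, Real.norm_of_nonneg h0]
  nlinarith [norm_nonneg z]

lemma hasDerivAt_of_mem {f : ℂ → ℂ} (hf : DifferentiableOn ℂ f uDisc) {z : ℂ} (hz : z ∈ uDisc) :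
    HasDerivAt f (deriv f z) z :=
  (hf.differentiableAt (isOpen_uDisc.mem_nhds hz)).hasDerivAt

lemma continuousOn_deriv {f : ℂ → ℂ} (hf : DifferentiableOn ℂ f uDisc) :
    ContinuousOn (deriv f) uDisc :=
  (hf.deriv isOpen_uDisc).continuousOn

/-- Radial integration of a Hardy–Littlewood type derivative bound. -/
lemma radial_bound {α ε M : ℝ} (hα : 0 < α) (hα1 : α ≤ 1) (hε : 0 ≤ ε) {f : ℂ → ℂ}
    (hf : DifferentiableOn ℂ f uDisc)
    (hb : ∀ z ∈ uDisc, ‖deriv f z‖ ≤ ε * (1 - ‖z‖) ^ (α - 1) + M) (hM : 0 ≤ M)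
    {z : ℂ} (hz : z ∈ uDisc) {δ : ℝ} (h0 : 0 ≤ δ) (h1 : δ ≤ 1) :
    ‖f z - f ((1 - δ : ℝ) * z)‖ ≤ ε / α * δ ^ α + M * δ := by
  have hz1 := mem_uDisc.1 hz
  set B : ℝ → ℝ := fun s => ε / α * (-(1 - s * ‖z‖) ^ α + (1 - (1 - δ) * ‖z‖) ^ α)
    + M * (s - (1 - δ)) with hB
  set B' : ℝ → ℝ := fun s => ε * (‖z‖ * (1 - s * ‖z‖) ^ (α - 1)) + M with hB'
  have hmem : ∀ s ∈ Icc (1 - δ) 1, (s : ℂ) * z ∈ uDisc := fun s hs =>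
    smul_mem_uDisc (by linarith [hs.1]) hs.2 hz
  have hpos : ∀ s ≤ 1, 0 < 1 - s * ‖z‖ := fun s hs => by nlinarith [norm_nonneg z]
  have hfd : ∀ s ∈ Icc (1 - δ) 1, HasDerivAt (fun s : ℝ => f (s * z) - f ((1 - δ : ℝ) * z))
      (deriv f (s * z) * z) s := by
    intro s hs
    have h2 : HasDerivAt (fun s : ℝ => (s : ℂ) * z) (1 * z) s :=
      (Complex.ofRealCLM.hasDerivAt (x := s)).mul_const z
    have := (hasDerivAt_of_mem hf (hmem s hs)).comp s h2
    simpa using this.sub_const (f ((1 - δ : ℝ) * z))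
  have hBd : ∀ s ∈ Iic (1 : ℝ), HasDerivAt B (B' s) s := by
    intro s hs
    have h2 : HasDerivAt (fun s : ℝ => 1 - s * ‖z‖) (-‖z‖) s := by
      simpa using ((hasDerivAt_id s).mul_const ‖z‖).const_sub 1
    have h3 := h2.rpow_const (p := α) (Or.inl (hpos s hs).ne')
    have h4 := ((h3.neg.add_const ((1 - (1 - δ) * ‖z‖) ^ α)).const_mul (ε / α)).add
      (((hasDerivAt_id s).sub_const (1 - δ)).const_mul M)
    refine h4.congr_deriv ?_
    simp only [hB', mul_one]
    field_simp
  have key := image_norm_le_of_norm_deriv_right_le_deriv_boundary'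
    (f := fun s : ℝ => f (s * z) - f ((1 - δ : ℝ) * z)) (f' := fun s => deriv f (s * z) * z)
    (a := 1 - δ) (b := 1) (B := B) (B' := B')
    (fun s hs => (hfd s hs).continuousAt.continuousWithinAt)
    (fun s hs => (hfd s ⟨hs.1, hs.2.le⟩).hasDerivWithinAt)
    (by simp [hB])
    (fun s hs => (hBd s hs.2).continuousAt.continuousWithinAt)
    (fun s hs => (hBd s hs.2.le).hasDerivWithinAt)
    (by
      intro s hs
      have h2 := hb _ (hmem s ⟨hs.1, hs.2.le⟩)
      have hs0 : 0 ≤ s := by linarith [hs.1]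
      rw [norm_mul, Complex.norm_real, Real.norm_of_nonneg hs0] at h2
      rw [norm_mul]
      simp only [hB']
      have h3 : 0 ≤ (1 - s * ‖z‖) ^ (α - 1) := Real.rpow_nonneg (hpos s hs.2.le).le _
      calc _ ≤ (ε * (1 - s * ‖z‖) ^ (α - 1) + M) * ‖z‖ := by gcongr
        _ ≤ _ := by nlinarith [norm_nonneg z])
  have := key (x := 1) ⟨by linarith, le_rfl⟩
  simp only [ofReal_one, one_mul, hB] at this
  refine this.trans ?_
  have h5 : (1 - (1 - δ) * ‖z‖) ^ α ≤ (1 - ‖z‖) ^ α + (δ * ‖z‖) ^ α := by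
    have := Real.rpow_add_le_add_rpow (p := α) (a := 1 - ‖z‖) (b := δ * ‖z‖) (by linarith)
      (by positivity) hα.le hα1
    convert this using 2
    ring
  have h6 : (δ * ‖z‖) ^ α ≤ δ ^ α := by
    apply Real.rpow_le_rpow (by positivity) _ hα.le
    nlinarith [norm_nonneg z]
  have h7 : 0 ≤ ε / α := by positivity
  have : -(1 - ‖z‖) ^ α + (1 - (1 - δ) * ‖z‖) ^ α ≤ δ ^ α := by linarith
  have := mul_le_mul_of_nonneg_left this h7
  linarith

lemma hardyLittlewood {α ε M : ℝ} (hα : 0 < α) (hα1 : α ≤ 1) (hε : 0 ≤ ε) {f : ℂ → ℂ}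
    (hf : DifferentiableOn ℂ f uDisc)
    (hb : ∀ z ∈ uDisc, ‖deriv f z‖ ≤ ε * (1 - ‖z‖) ^ (α - 1) + M) (hM : 0 ≤ M)
    {z w : ℂ} (hz : z ∈ uDisc) (hw : w ∈ uDisc) (hzw : ‖z - w‖ ≤ 1) :
    ‖f z - f w‖ ≤ (2 / α + 1) * ε * ‖z - w‖ ^ α + 3 * M * ‖z - w‖ := by
  rcases eq_or_ne z w with rfl | hne
  · simp [hα.ne']
  set δ := ‖z - w‖ with hδ
  have hδ0 : 0 < δ := by simpa [hδ, sub_eq_zero] using hne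
  have r1 := radial_bound hα hα1 hε hf hb hM hz hδ0.le hzw
  have r2 := radial_bound hα hα1 hε hf hb hM hw hδ0.le hzw
  have r3 : ‖f ((1 - δ : ℝ) * z) - f ((1 - δ : ℝ) * w)‖ ≤
      (ε * δ ^ (α - 1) + M) * ‖((1 - δ : ℝ) : ℂ) * z - (1 - δ : ℝ) * w‖ := by
    have hsub : closedBall (0 : ℂ) (1 - δ) ⊆ {z | z ∈ uDisc ∧ ‖z‖ ≤ 1 - δ} := by
      intro x hx
      have : ‖x‖ ≤ 1 - δ := by simpa using hx
      exact ⟨mem_uDisc.2 (by linarith), this⟩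
    have hin : ∀ x ∈ uDisc, ((1 - δ : ℝ) : ℂ) * x ∈ closedBall (0 : ℂ) (1 - δ) := by
      intro x hx
      rw [mem_closedBall_zero_iff, norm_mul, Complex.norm_real,
        Real.norm_of_nonneg (by linarith)]
      have := mem_uDisc.1 hx
      nlinarith [norm_nonneg x]
    refine (convex_closedBall (0 : ℂ) (1 - δ)).norm_image_sub_le_of_norm_deriv_le
      (fun x hx => (hasDerivAt_of_mem hf (hsub hx).1).differentiableAt) ?_ (hin w hw) (hin z hz)
    intro x hx
    refine (hb x (hsub hx).1).trans ?_
    gcongr ?_ * ?_ + _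
    exact Real.rpow_le_rpow_of_nonpos hδ0 (by linarith [(hsub hx).2]) (by linarith)
  have r4 : ‖((1 - δ : ℝ) : ℂ) * z - (1 - δ : ℝ) * w‖ ≤ δ := by
    rw [← mul_sub, norm_mul, Complex.norm_real, Real.norm_of_nonneg (by linarith), ← hδ]
    nlinarith
  have r5 : (ε * δ ^ (α - 1) + M) * ‖((1 - δ : ℝ) : ℂ) * z - (1 - δ : ℝ) * w‖ ≤
      ε * δ ^ α + M * δ := by
    have : 0 ≤ ε * δ ^ (α - 1) + M := by positivity
    calc _ ≤ (ε * δ ^ (α - 1) + M) * δ := by gcongr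
      _ = _ := by
        rw [add_mul, mul_assoc]
        congr 2
        rw [Real.rpow_sub_one hδ0.ne']; field_simp
  calc ‖f z - f w‖ = ‖(f z - f ((1 - δ : ℝ) * z)) + (f ((1 - δ : ℝ) * z) - f ((1 - δ : ℝ) * w))
        - (f w - f ((1 - δ : ℝ) * w))‖ := by congr 1; ring
    _ ≤ ‖f z - f ((1 - δ : ℝ) * z)‖ + ‖f ((1 - δ : ℝ) * z) - f ((1 - δ : ℝ) * w)‖
        + ‖f w - f ((1 - δ : ℝ) * w)‖ := (norm_sub_le _ _).trans (by gcongr; exact norm_add_le _ _)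
    _ ≤ _ := by
      have : (2 / α + 1) * ε * δ ^ α = ε / α * δ ^ α + ε / α * δ ^ α + ε * δ ^ α := by ring
      rw [this]
      linarith

/-- The derivative characterization of `𝒜_α`, without reference to boundary values. -/
structure IsA (α : ℝ) (f : ℂ → ℂ) : Prop where
  diff : DifferentiableOn ℂ f uDisc
  dir : IntegrableOn (fun z => ‖deriv f z‖ ^ 2) uDisc
  small : ∀ ε > 0, ∃ r < 1, ∀ z ∈ uDisc, r < ‖z‖ → ‖deriv f z‖ ≤ ε * (1 - ‖z‖) ^ (α - 1)

lemma _root_.MemA.diff {α : ℝ} {f : ℂ → ℂ} (h : MemA α f) : DifferentiableOn ℂ f uDisc := h.1.1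

lemma _root_.MemA.cont {α : ℝ} {f : ℂ → ℂ} (h : MemA α f) : ContinuousOn f (closedBall 0 1) := h.2.1.2

lemma IsA.mixed_bound {α : ℝ} {f : ℂ → ℂ} (h : IsA α f) {ε : ℝ} (hε : 0 < ε) :
    ∃ M, 0 ≤ M ∧ ∀ z ∈ uDisc, ‖deriv f z‖ ≤ ε * (1 - ‖z‖) ^ (α - 1) + M := by
  obtain ⟨r, hr, hb⟩ := h.small ε hε
  have hsub : closedBall (0 : ℂ) r ⊆ uDisc := closedBall_subset_ball hr
  obtain ⟨M, hM⟩ := (isCompact_closedBall (0 : ℂ) r).exists_bound_of_continuousOn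
    ((continuousOn_deriv h.diff).mono hsub)
  refine ⟨max M 0, le_max_right _ _, fun z hz => ?_⟩
  have h1 : 0 ≤ (1 - ‖z‖) ^ (α - 1) := Real.rpow_nonneg (by linarith [mem_uDisc.1 hz]) _
  by_cases hzr : r < ‖z‖
  · exact (hb z hz hzr).trans (by linarith [le_max_right M 0])
  · refine (hM z (by simpa using not_lt.1 hzr)).trans ?_
    have := le_max_left M 0
    have : 0 ≤ ε * (1 - ‖z‖) ^ (α - 1) := by positivity
    linarith

lemma one_le_rpow {α : ℝ} (hα1 : α ≤ 1) {z : ℂ} (hz : z ∈ uDisc) :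
    1 ≤ (1 - ‖z‖) ^ (α - 1) :=
  Real.one_le_rpow_of_pos_of_le_one_of_nonpos (by linarith [mem_uDisc.1 hz])
    (by linarith [norm_nonneg z]) (by linarith)

lemma IsA.exists_bound {α : ℝ} (hα1 : α ≤ 1) {f : ℂ → ℂ} (h : IsA α f) :
    ∃ A, 0 ≤ A ∧ ∀ z ∈ uDisc, ‖deriv f z‖ ≤ A * (1 - ‖z‖) ^ (α - 1) := by
  obtain ⟨M, hM, hb⟩ := h.mixed_bound one_pos
  refine ⟨1 + M, by linarith, fun z hz => (hb z hz).trans ?_⟩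
  nlinarith [one_le_rpow hα1 hz]

lemma tendsto_dilate {f : ℂ → ℂ} (hf : ContinuousOn f (closedBall 0 1)) {z : ℂ}
    (hz : z ∈ closedBall (0 : ℂ) 1) :
    Tendsto (fun r : ℝ => f (r * z)) (nhdsWithin 1 (Iio 1)) (nhds (f z)) := by
  have h1 : Tendsto (fun r : ℝ => (r : ℂ) * z) (nhdsWithin 1 (Iio 1))
      (nhdsWithin z (closedBall 0 1)) := by
    refine tendsto_nhdsWithin_iff.2 ⟨?_, ?_⟩
    · have : Continuous (fun r : ℝ => (r : ℂ) * z) := by fun_prop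
      simpa using (this.tendsto 1).mono_left nhdsWithin_le_nhds
    · have : ∀ᶠ r : ℝ in nhdsWithin 1 (Iio 1), r ∈ Ioo (0 : ℝ) 1 :=
        Ioo_mem_nhdsLT one_pos
      filter_upwards [this] with r hr
      exact uDisc_subset (smul_mem_uDisc' hr.1.le hr.2 hz)
  exact (hf z hz).tendsto.comp h1

lemma le_of_interior {f : ℂ → ℂ} (hf : ContinuousOn f (closedBall 0 1)) {G : ℝ → ℝ}
    (hG : MonotoneOn G (Ici 0))
    (h : ∀ z ∈ uDisc, ∀ w ∈ uDisc, ‖z - w‖ ≤ 1 → ‖f z - f w‖ ≤ G ‖z - w‖)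
    {z w : ℂ} (hz : z ∈ closedBall (0 : ℂ) 1) (hw : w ∈ closedBall (0 : ℂ) 1)
    (hzw : ‖z - w‖ ≤ 1) : ‖f z - f w‖ ≤ G ‖z - w‖ := by
  refine le_of_tendsto (((tendsto_dilate hf hz).sub (tendsto_dilate hf hw)).norm) ?_
  have : ∀ᶠ r : ℝ in nhdsWithin 1 (Iio 1), r ∈ Ioo (0 : ℝ) 1 := Ioo_mem_nhdsLT one_pos
  filter_upwards [this] with r hr
  have h3 : ‖(r : ℂ) * z - r * w‖ ≤ ‖z - w‖ := by
    rw [← mul_sub, norm_mul, Complex.norm_real, Real.norm_of_nonneg hr.1.le]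
    nlinarith [norm_nonneg (z - w), hr.2]
  exact (h _ (smul_mem_uDisc' hr.1.le hr.2 hz) _ (smul_mem_uDisc' hr.1.le hr.2 hw)
    (h3.trans hzw)).trans (hG (norm_nonneg _) (norm_nonneg _) h3)

lemma IsA.lip {α : ℝ} (hα : 0 < α) (hα1 : α ≤ 1) {f : ℂ → ℂ} (h : IsA α f)
    (hc : ContinuousOn f (closedBall 0 1)) {ε : ℝ} (hε : 0 < ε) :
    ∃ M, 0 ≤ M ∧ ∀ z ∈ closedBall (0 : ℂ) 1, ∀ w ∈ closedBall (0 : ℂ) 1, ‖z - w‖ ≤ 1 →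
      ‖f z - f w‖ ≤ ε * ‖z - w‖ ^ α + M * ‖z - w‖ := by
  obtain ⟨M, hM, hb⟩ := h.mixed_bound (ε := ε / (2 / α + 1)) (by positivity)
  refine ⟨3 * M, by positivity, fun z hz w hw hzw => ?_⟩
  refine le_of_interior (G := fun x => ε * x ^ α + 3 * M * x) hc ?_ ?_ hz hw hzw
  · intro x hx y hy hxy
    have hx' : 0 ≤ x := hx
    dsimp only
    gcongr
  · intro z hz w hw hzw
    have := hardyLittlewood hα hα1 (by positivity) h.diff hb hM hz hw hzw
    rwa [mul_div_cancel₀ _ (by positivity)] at this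

lemma IsA.memA {α : ℝ} (hα : 0 < α) (hα1 : α < 1) {f : ℂ → ℂ} (h : IsA α f)
    (hc : ContinuousOn f (closedBall 0 1)) : MemA α f := by
  refine ⟨⟨h.diff, h.dir⟩, ⟨h.diff, hc⟩, fun ε hε => ?_⟩
  obtain ⟨M, hM, hb⟩ := h.lip hα hα1.le hc (half_pos hε)
  have h1 : Tendsto (fun x : ℝ => M * x ^ (1 - α)) (nhds 0) (nhds 0) := by
    have : Continuous (fun x : ℝ => M * x ^ (1 - α)) :=
      (Real.continuous_rpow_const (by linarith)).const_mul M
    simpa [Real.zero_rpow (by linarith : (1 : ℝ) - α ≠ 0)] using this.tendsto 0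
  obtain ⟨δ, hδ, hd⟩ := Metric.eventually_nhds_iff.1 (h1.eventually_lt_const (half_pos hε))
  refine ⟨min δ 1, by positivity, fun z hz w hw hzw => ?_⟩
  refine (hb z hz w hw (hzw.le.trans (min_le_right _ _))).trans ?_
  rcases eq_or_ne z w with rfl | hne
  · simp [Real.zero_rpow hα.ne']
  have hp : 0 < ‖z - w‖ := by simpa [sub_eq_zero] using hne
  have h2 := hd (y := ‖z - w‖) (by simpa using hzw.trans_le (min_le_left _ _))
  have h3 : M * ‖z - w‖ = M * ‖z - w‖ ^ (1 - α) * ‖z - w‖ ^ α := by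
    rw [mul_assoc, ← Real.rpow_add hp]; simp
  rw [h3]
  have : 0 ≤ ‖z - w‖ ^ α := by positivity
  nlinarith

lemma _root_.MemA.isA {α : ℝ} (hα : 0 < α) (hα1 : α < 1) {f : ℂ → ℂ} (h : MemA α f) : IsA α f := by
  refine ⟨h.1.1, h.1.2, fun ε hε => ?_⟩
  obtain ⟨δ, hδ, hd⟩ := h.2.2 (ε / 2) (half_pos hε)
  refine ⟨1 - δ, by linarith, fun z hz hzr => ?_⟩
  have hz1 := mem_uDisc.1 hz
  set y := 1 - ‖z‖ with hy
  have hy0 : 0 < y := by linarith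
  have hsub : closedBall z (y / 2) ⊆ uDisc := by
    intro w hw
    rw [mem_closedBall, dist_eq_norm] at hw
    rw [mem_uDisc]
    have := norm_sub_norm_le w z
    linarith
  have h1 : DiffContOnCl ℂ (fun w => f w - f z) (ball z (y / 2)) := by
    apply DifferentiableOn.diffContOnCl
    rw [closure_ball _ (by positivity)]
    exact (h.diff.mono hsub).sub_const _
  have h2 := Complex.norm_deriv_le_of_forall_mem_sphere_norm_le (C := ε / 2 * (y / 2) ^ α)
    (half_pos hy0) h1 (by
      intro w hw
      have hw' : ‖w - z‖ = y / 2 := by simpa [dist_eq_norm] using hw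
      have := hd w (uDisc_subset (hsub (sphere_subset_closedBall hw))) z (uDisc_subset hz)
        (by rw [hw']; linarith)
      rwa [hw'] at this)
  rw [deriv_sub_const] at h2
  refine h2.trans ?_
  rw [mul_div_assoc, ← Real.rpow_sub_one (by positivity), Real.div_rpow hy0.le (by norm_num)]
  have : (2 : ℝ) ^ (α - 1) ≥ 2⁻¹ := by
    rw [← Real.rpow_neg_one]
    exact Real.rpow_le_rpow_of_exponent_le (by norm_num) (by linarith)
  have h3 : 0 ≤ y ^ (α - 1) := by positivity
  have h4 : y ^ (α - 1) / 2 ^ (α - 1) ≤ 2 * y ^ (α - 1) := by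
    rw [div_le_iff₀ (by positivity)]
    nlinarith
  calc ε / 2 * (y ^ (α - 1) / 2 ^ (α - 1)) ≤ ε / 2 * (2 * y ^ (α - 1)) := by gcongr
    _ = _ := by ring

lemma IsA.congr {α : ℝ} {f g : ℂ → ℂ} (h : IsA α f) (hfg : ∀ z ∈ uDisc, g z = f z) : IsA α g := by
  have hd : ∀ z ∈ uDisc, deriv g z = deriv f z := fun z hz =>
    (Filter.eventuallyEq_of_mem (isOpen_uDisc.mem_nhds hz) hfg).deriv_eq
  refine ⟨h.diff.congr hfg, ?_, fun ε hε => ?_⟩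
  · exact h.dir.congr_fun (fun z hz => by simp only [hd z hz]) measurableSet_uDisc
  · obtain ⟨r, hr, hb⟩ := h.small ε hε
    exact ⟨r, hr, fun z hz hzr => by rw [hd z hz]; exact hb z hz hzr⟩

/-- Every function satisfying the derivative characterization extends to a member of `𝒜_α`. -/
lemma IsA.exists_extension {α : ℝ} (hα : 0 < α) (hα1 : α < 1) {f : ℂ → ℂ} (h : IsA α f) :
    ∃ g, MemA α g ∧ ∀ z ∈ uDisc, g z = f z := by
  have hcl : closedBall (0 : ℂ) 1 = closure uDisc := by
    rw [uDisc, closure_ball _ one_ne_zero]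
  have hext : ∀ z ∈ uDisc, extendFrom uDisc f z = f z := fun z hz =>
    extendFrom_eq (subset_closure hz)
      ((hasDerivAt_of_mem h.diff hz).continuousAt.tendsto.mono_left nhdsWithin_le_nhds)
  obtain ⟨A, hA, hb⟩ := h.exists_bound hα1.le
  have hc : ContinuousOn (extendFrom uDisc f) (closedBall 0 1) := by
    refine continuousOn_extendFrom hcl.subset fun x hx => ?_
    have hne : (nhdsWithin x uDisc).NeBot := mem_closure_iff_nhdsWithin_neBot.1 (hcl ▸ hx)
    refine cauchy_map_iff_exists_tendsto.1 ?_
    refine Metric.cauchy_iff.2 ⟨hne.map f, fun ε hε => ?_⟩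
    have h1 : Tendsto (fun x : ℝ => (2 / α + 1) * A * x ^ α) (nhds 0) (nhds 0) := by
      have : Continuous (fun x : ℝ => (2 / α + 1) * A * x ^ α) :=
        (Real.continuous_rpow_const hα.le).const_mul _
      simpa [Real.zero_rpow hα.ne'] using this.tendsto 0
    obtain ⟨δ, hδ, hd⟩ := Metric.eventually_nhds_iff.1 (h1.eventually_lt_const hε)
    refine ⟨f '' (uDisc ∩ ball x (min δ 1 / 2)), image_mem_map (inter_mem self_mem_nhdsWithin
      (mem_nhdsWithin_of_mem_nhds (ball_mem_nhds _ (by positivity)))), ?_⟩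
    rintro _ ⟨z, ⟨hz, hzx⟩, rfl⟩ _ ⟨w, ⟨hw, hwx⟩, rfl⟩
    have hzw : ‖z - w‖ < min δ 1 := by
      rw [← dist_eq_norm]
      have := dist_triangle_right z w x
      rw [mem_ball] at hzx hwx
      linarith
    rw [dist_eq_norm]
    have := hardyLittlewood hα hα1.le hA h.diff (M := 0) (by simpa using hb) le_rfl hz hw
      (hzw.le.trans (min_le_right _ _))
    refine this.trans_lt ?_
    have h2 := hd (y := ‖z - w‖) (by simpa using hzw.trans_le (min_le_left _ _))
    simpa using h2
  exact ⟨_, (h.congr hext).memA hα hα1 hc, hext⟩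

/-- Quantitative control of the `𝒜_α` norm by a constant. -/
structure ABd (α C : ℝ) (f : ℂ → ℂ) : Prop where
  diff : DifferentiableOn ℂ f uDisc
  bd : ∀ z ∈ uDisc, ‖f z‖ ≤ C
  der : ∀ z ∈ uDisc, ‖deriv f z‖ ≤ C * (1 - ‖z‖) ^ (α - 1)
  dirI : IntegrableOn (fun z => ‖deriv f z‖ ^ 2) uDisc
  dir : ∫ z in uDisc, ‖deriv f z‖ ^ 2 ≤ C ^ 2

lemma zero_mem_uDisc : (0 : ℂ) ∈ uDisc := by simp [uDisc]

lemma ABd.nonneg {α C : ℝ} {f : ℂ → ℂ} (h : ABd α C f) : 0 ≤ C :=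
  (norm_nonneg _).trans (h.bd 0 zero_mem_uDisc)

lemma integrableOn_one_uDisc (c : ℝ) : IntegrableOn (fun _ : ℂ => c) uDisc :=
  integrableOn_const volume_uDisc_lt_top.ne

lemma dominated_dir {F f g : ℂ → ℂ} {B : ℝ}
    (hF : DifferentiableOn ℂ F uDisc)
    (hf : IntegrableOn (fun z => ‖deriv f z‖ ^ 2) uDisc)
    (hg : IntegrableOn (fun z => ‖deriv g z‖ ^ 2) uDisc)
    (hb : ∀ z ∈ uDisc, ‖deriv F z‖ ≤ B * (‖deriv f z‖ + ‖deriv g z‖ + 1)) :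
    IntegrableOn (fun z => ‖deriv F z‖ ^ 2) uDisc ∧ ∫ z in uDisc, ‖deriv F z‖ ^ 2 ≤
      3 * B ^ 2 * ((∫ z in uDisc, ‖deriv f z‖ ^ 2) + (∫ z in uDisc, ‖deriv g z‖ ^ 2)
        + Real.pi) := by
  have hI : IntegrableOn (fun z => 3 * B ^ 2 * (‖deriv f z‖ ^ 2 + ‖deriv g z‖ ^ 2 + 1)) uDisc :=
    ((hf.add hg).add (integrableOn_one_uDisc 1)).const_mul _
  have hle : ∀ z ∈ uDisc, ‖deriv F z‖ ^ 2 ≤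
      3 * B ^ 2 * (‖deriv f z‖ ^ 2 + ‖deriv g z‖ ^ 2 + 1) := by
    intro z hz
    calc ‖deriv F z‖ ^ 2 ≤ (B * (‖deriv f z‖ + ‖deriv g z‖ + 1)) ^ 2 := by
          gcongr; exact hb z hz
      _ = B ^ 2 * (‖deriv f z‖ + ‖deriv g z‖ + 1) ^ 2 := by ring
      _ ≤ B ^ 2 * (3 * (‖deriv f z‖ ^ 2 + ‖deriv g z‖ ^ 2 + 1)) := by
          gcongr
          nlinarith [sq_nonneg (‖deriv f z‖ - ‖deriv g z‖), sq_nonneg (‖deriv f z‖ - 1),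
            sq_nonneg (‖deriv g z‖ - 1)]
      _ = _ := by ring
  have hFI : IntegrableOn (fun z => ‖deriv F z‖ ^ 2) uDisc := by
    refine hI.mono' ((continuousOn_deriv hF).norm.pow 2 |>.aestronglyMeasurable
      measurableSet_uDisc) ?_
    filter_upwards [ae_restrict_mem measurableSet_uDisc] with z hz
    rw [Real.norm_of_nonneg (by positivity)]
    exact hle z hz
  refine ⟨hFI, (setIntegral_mono_on hFI hI measurableSet_uDisc hle).trans_eq ?_⟩
  have e1 : IntegrableOn (fun z => ‖deriv f z‖ ^ 2 + ‖deriv g z‖ ^ 2) uDisc := hf.add hg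
  rw [integral_const_mul, integral_add e1 (integrableOn_one_uDisc 1),
    integral_add hf hg]
  simp [volume_real_uDisc]

lemma IsA.dominated {α : ℝ} {F f g : ℂ → ℂ} {B : ℝ} (hα1 : α < 1)
    (hf : IsA α f) (hg : IsA α g) (hF : DifferentiableOn ℂ F uDisc)
    (hb : ∀ z ∈ uDisc, ‖deriv F z‖ ≤ B * (‖deriv f z‖ + ‖deriv g z‖ + 1)) : IsA α F := by
  wlog hB : 0 < B generalizing B
  · exact this (B := 1) (fun z hz => (hb z hz).trans (by
      have : 0 ≤ ‖deriv f z‖ + ‖deriv g z‖ + 1 := by positivity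
      nlinarith)) one_pos
  refine ⟨hF, (dominated_dir hF hf.dir hg.dir hb).1, fun ε hε => ?_⟩
  obtain ⟨r1, hr1, h1⟩ := hf.small (ε / (3 * B)) (by positivity)
  obtain ⟨r2, hr2, h2⟩ := hg.small (ε / (3 * B)) (by positivity)
  have h3 : Tendsto (fun r : ℝ => (1 - r) ^ (1 - α)) (nhds 1) (nhds 0) := by
    have : Continuous (fun r : ℝ => (1 - r) ^ (1 - α)) :=
      (Real.continuous_rpow_const (by linarith)).comp (by fun_prop)
    simpa [Real.zero_rpow (by linarith : (1 : ℝ) - α ≠ 0)] using this.tendsto 1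
  obtain ⟨δ, hδ, hd⟩ := Metric.eventually_nhds_iff.1
    (h3.eventually_lt_const (u := ε / (3 * B)) (by positivity))
  refine ⟨max (max r1 r2) (1 - δ), by simp [hr1, hr2, hδ], fun z hz hzr => ?_⟩
  simp only [max_lt_iff] at hzr
  have hz1 := mem_uDisc.1 hz
  have h4 := hd (y := ‖z‖) (by rw [Real.dist_eq, abs_lt]; constructor <;> linarith)
  have hy : 0 < 1 - ‖z‖ := by linarith
  have h5 : 1 ≤ ε / (3 * B) * (1 - ‖z‖) ^ (α - 1) := by
    have h6 : (1 - ‖z‖) ^ (1 - α) * (1 - ‖z‖) ^ (α - 1) = 1 := by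
      rw [← Real.rpow_add hy]; simp
    calc (1 : ℝ) = (1 - ‖z‖) ^ (1 - α) * (1 - ‖z‖) ^ (α - 1) := h6.symm
      _ ≤ _ := by gcongr
  calc ‖deriv F z‖ ≤ B * (‖deriv f z‖ + ‖deriv g z‖ + 1) := hb z hz
    _ ≤ B * (ε / (3 * B) * (1 - ‖z‖) ^ (α - 1) + ε / (3 * B) * (1 - ‖z‖) ^ (α - 1)
        + ε / (3 * B) * (1 - ‖z‖) ^ (α - 1)) := by
      gcongr
      · exact h1 z hz hzr.1.1
      · exact h2 z hz hzr.1.2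
    _ = _ := by field_simp; ring

lemma ABd.dominated {α : ℝ} {F f g : ℂ → ℂ} {B B' C : ℝ} (hα1 : α < 1) (hB : 0 ≤ B)
    (hf : ABd α C f) (hg : ABd α C g) (hF : DifferentiableOn ℂ F uDisc)
    (hB' : ∀ z ∈ uDisc, ‖F z‖ ≤ B')
    (hb : ∀ z ∈ uDisc, ‖deriv F z‖ ≤ B * (‖deriv f z‖ + ‖deriv g z‖ + 1)) :
    ABd α (B' + B * (3 * C + 4)) F := by
  have hC := hf.nonneg
  have hB0 : 0 ≤ B' := (norm_nonneg _).trans (hB' 0 zero_mem_uDisc)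
  have hd := dominated_dir hF hf.dirI hg.dirI hb
  refine ⟨hF, fun z hz => (hB' z hz).trans (by nlinarith), fun z hz => ?_, hd.1,
    hd.2.trans ?_⟩
  · have h1 := one_le_rpow hα1.le hz
    set y := (1 - ‖z‖) ^ (α - 1)
    calc _ ≤ B * (‖deriv f z‖ + ‖deriv g z‖ + 1) := hb z hz
      _ ≤ B * (C * y + C * y + 1) := by
        gcongr
        · exact hf.der z hz
        · exact hg.der z hz
      _ ≤ B * ((3 * C + 4) * y) := by gcongr; nlinarith
      _ ≤ (B' + B * (3 * C + 4)) * y := by nlinarith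
  · have h1 := hf.dir
    have h2 := hg.dir
    have h3 := Real.pi_lt_d2
    calc _ ≤ 3 * B ^ 2 * (C ^ 2 + C ^ 2 + 4) := by gcongr; linarith
      _ ≤ (B * (3 * C + 4)) ^ 2 := by rw [mul_pow]; nlinarith [sq_nonneg B, mul_nonneg hC (sq_nonneg B), mul_nonneg (sq_nonneg C) (sq_nonneg B)]
      _ ≤ _ := by gcongr; linarith

lemma isA_const {α : ℝ} (c : ℂ) : IsA α (fun _ => c) := by
  refine ⟨differentiableOn_const c, by simp, fun ε hε => ⟨0, one_pos, ?_⟩⟩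
  intro z hz _
  simp only [deriv_const, norm_zero]
  have : 0 ≤ 1 - ‖z‖ := by linarith [mem_uDisc.1 hz]
  positivity

lemma _root_.MemA.of_dominated {α : ℝ} {F f g : ℂ → ℂ} {B : ℝ} (hα : 0 < α) (hα1 : α < 1)
    (hf : MemA α f) (hg : MemA α g) (hF : DifferentiableOn ℂ F uDisc)
    (hFc : ContinuousOn F (closedBall 0 1))
    (hb : ∀ z ∈ uDisc, ‖deriv F z‖ ≤ B * (‖deriv f z‖ + ‖deriv g z‖ + 1)) : MemA α F :=
  (IsA.dominated hα1 (hf.isA hα hα1) (hg.isA hα hα1) hF hb).memA hα hα1 hFc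

lemma _root_.MemA.exists_norm_le {α : ℝ} {f : ℂ → ℂ} (h : MemA α f) :
    ∃ C, 0 < C ∧ ∀ z ∈ closedBall (0 : ℂ) 1, ‖f z‖ ≤ C := by
  obtain ⟨C, hC⟩ := (isCompact_closedBall (0 : ℂ) 1).exists_bound_of_continuousOn h.cont
  exact ⟨max C 1, by positivity, fun z hz => (hC z hz).trans (le_max_left _ _)⟩

lemma memA_const {α : ℝ} (hα : 0 < α) (hα1 : α < 1) (c : ℂ) : MemA α (fun _ => c) :=
  (isA_const c).memA hα hα1 continuousOn_const

/-- Functions analytic with bounded derivative on the disc are in `𝒜_α`. -/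
lemma memA_of_deriv_bdd {α : ℝ} (hα : 0 < α) (hα1 : α < 1) {F : ℂ → ℂ} {B : ℝ}
    (hF : DifferentiableOn ℂ F uDisc) (hFc : ContinuousOn F (closedBall 0 1))
    (hb : ∀ z ∈ uDisc, ‖deriv F z‖ ≤ B) : MemA α F :=
  (memA_const hα hα1 0).of_dominated (B := B) hα hα1 (memA_const hα hα1 0) hF hFc (by simpa using hb)

lemma memA_of_differentiableOn_ball {α : ℝ} (hα : 0 < α) (hα1 : α < 1) {F : ℂ → ℂ} {R : ℝ}
    (hR : 1 < R) (hF : DifferentiableOn ℂ F (ball 0 R)) : MemA α F := by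
  have hsub : closedBall (0 : ℂ) 1 ⊆ ball 0 R := closedBall_subset_ball hR
  obtain ⟨B, hB⟩ := (isCompact_closedBall (0 : ℂ) 1).exists_bound_of_continuousOn
    ((hF.deriv isOpen_ball).continuousOn.mono hsub)
  exact memA_of_deriv_bdd hα hα1 (hF.mono (uDisc_subset.trans hsub)) (hF.continuousOn.mono hsub)
    fun z hz => hB z (uDisc_subset hz)

lemma memA_of_differentiable {α : ℝ} (hα : 0 < α) (hα1 : α < 1) {F : ℂ → ℂ}
    (hF : Differentiable ℂ F) : MemA α F :=
  memA_of_differentiableOn_ball hα hα1 one_lt_two hF.differentiableOn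

lemma _root_.MemA.add {α : ℝ} (hα : 0 < α) (hα1 : α < 1) {f g : ℂ → ℂ} (hf : MemA α f)
    (hg : MemA α g) : MemA α (f + g) := by
  refine hf.of_dominated (B := 1) hα hα1 hg (hf.diff.add hg.diff) (hf.cont.add hg.cont)
    fun z hz => ?_
  rw [deriv_add (hasDerivAt_of_mem hf.diff hz).differentiableAt
    (hasDerivAt_of_mem hg.diff hz).differentiableAt]
  linarith [norm_add_le (deriv f z) (deriv g z)]

lemma _root_.MemA.mul {α : ℝ} (hα : 0 < α) (hα1 : α < 1) {f g : ℂ → ℂ} (hf : MemA α f)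
    (hg : MemA α g) : MemA α (f * g) := by
  obtain ⟨C, hC, hfC⟩ := hf.exists_norm_le
  obtain ⟨D, hD, hgD⟩ := hg.exists_norm_le
  refine hf.of_dominated (B := C + D) hα hα1 hg (hf.diff.mul hg.diff) (hf.cont.mul hg.cont)
    fun z hz => ?_
  rw [deriv_mul (hasDerivAt_of_mem hf.diff hz).differentiableAt
    (hasDerivAt_of_mem hg.diff hz).differentiableAt]
  refine (norm_add_le _ _).trans ?_
  rw [norm_mul, norm_mul]
  have h1 := hfC z (uDisc_subset hz)
  have h2 := hgD z (uDisc_subset hz)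
  calc _ ≤ ‖deriv f z‖ * D + C * ‖deriv g z‖ := by gcongr
    _ ≤ _ := by nlinarith [norm_nonneg (deriv f z), norm_nonneg (deriv g z)]

lemma _root_.MemA.smul {α : ℝ} (hα : 0 < α) (hα1 : α < 1) {f : ℂ → ℂ} (c : ℂ) (hf : MemA α f) :
    MemA α (c • f) := (memA_const hα hα1 c).mul hα hα1 hf

lemma _root_.MemA.neg {α : ℝ} (hα : 0 < α) (hα1 : α < 1) {f : ℂ → ℂ} (hf : MemA α f) :
    MemA α (-f) := by
  simpa using hf.smul hα hα1 (-1)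

lemma _root_.MemA.sub {α : ℝ} (hα : 0 < α) (hα1 : α < 1) {f g : ℂ → ℂ} (hf : MemA α f)
    (hg : MemA α g) : MemA α (f - g) := by
  rw [sub_eq_add_neg]; exact hf.add hα hα1 (hg.neg hα hα1)

lemma _root_.MemA.pow {α : ℝ} (hα : 0 < α) (hα1 : α < 1) {f : ℂ → ℂ} (hf : MemA α f) (n : ℕ) :
    MemA α (f ^ n) := by
  induction n with
  | zero => rw [pow_zero]; exact memA_const hα hα1 1
  | succ n ih => rw [pow_succ]; exact ih.mul hα hα1 hf

lemma _root_.MemA.inv {α : ℝ} (hα : 0 < α) (hα1 : α < 1) {f : ℂ → ℂ} (hf : MemA α f)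
    (h0 : ∀ z ∈ closedBall (0 : ℂ) 1, f z ≠ 0) : MemA α f⁻¹ := by
  have hc : ContinuousOn f⁻¹ (closedBall 0 1) := hf.cont.inv₀ h0
  obtain ⟨C, hC⟩ := (isCompact_closedBall (0 : ℂ) 1).exists_bound_of_continuousOn hc
  refine hf.of_dominated (B := C ^ 2) hα hα1 hf
    (hf.diff.inv fun z hz => h0 z (uDisc_subset hz)) hc fun z hz => ?_
  have hz' := uDisc_subset hz
  rw [((hasDerivAt_of_mem hf.diff hz).inv (h0 z hz')).deriv, norm_div, norm_neg, norm_pow]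
  have := hC z hz'
  rw [Pi.inv_apply, norm_inv] at this
  rw [div_eq_mul_inv, ← inv_pow, mul_comm]
  have h2 : 0 ≤ ‖f z‖⁻¹ := by positivity
  gcongr
  linarith [norm_nonneg (deriv f z)]

/-- Agreement on the open disc propagates to the closed disc. -/
lemma eqOn_closed {f g : ℂ → ℂ} (hf : ContinuousOn f (closedBall 0 1))
    (hg : ContinuousOn g (closedBall 0 1)) (h : ∀ z ∈ uDisc, f z = g z) :
    ∀ z ∈ closedBall (0 : ℂ) 1, f z = g z := by
  intro z hz
  refine tendsto_nhds_unique_of_eventuallyEq (tendsto_dilate hf hz) (tendsto_dilate hg hz) ?_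
  have : ∀ᶠ r : ℝ in nhdsWithin 1 (Iio 1), r ∈ Ioo (0 : ℝ) 1 := Ioo_mem_nhdsLT one_pos
  filter_upwards [this] with r hr
  exact h _ (smul_mem_uDisc' hr.1.le hr.2 hz)

lemma le_on_closed {f : ℂ → ℂ} (hf : ContinuousOn f (closedBall 0 1)) {C : ℝ}
    (h : ∀ z ∈ uDisc, ‖f z‖ ≤ C) : ∀ z ∈ closedBall (0 : ℂ) 1, ‖f z‖ ≤ C := by
  intro z hz
  refine le_of_tendsto (tendsto_dilate hf hz).norm ?_
  have : ∀ᶠ r : ℝ in nhdsWithin 1 (Iio 1), r ∈ Ioo (0 : ℝ) 1 := Ioo_mem_nhdsLT one_pos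
  filter_upwards [this] with r hr
  exact h _ (smul_mem_uDisc' hr.1.le hr.2 hz)

/-! ### The norm -/

lemma aNorm_le {α : ℝ} {f : ℂ → ℂ} {a b c : ℝ} (ha : ∀ z ∈ uDisc, ‖f z‖ ≤ a)
    (hb : ∀ z ∈ uDisc, ‖deriv f z‖ ≤ b * (1 - ‖z‖) ^ (α - 1)) (hc : 0 ≤ c)
    (hd : ∫ z in uDisc, ‖deriv f z‖ ^ 2 ≤ Real.pi * c ^ 2) : ANorm α f ≤ a + b + c := by
  have hne : uDisc.Nonempty := ⟨0, zero_mem_uDisc⟩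
  have h1 : supNorm f ≤ a := csSup_le (hne.image _) (by rintro _ ⟨z, hz, rfl⟩; exact ha z hz)
  have h2 : sSup ((fun z => (1 - ‖z‖) ^ (1 - α) * ‖deriv f z‖) '' uDisc) ≤ b := by
    refine csSup_le (hne.image _) ?_
    rintro _ ⟨z, hz, rfl⟩
    have hy : 0 < 1 - ‖z‖ := by linarith [mem_uDisc.1 hz]
    have h3 := mul_le_mul_of_nonneg_left (hb z hz) (Real.rpow_nonneg hy.le (1 - α))
    refine h3.trans_eq ?_
    rw [mul_left_comm, ← Real.rpow_add hy]; simp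
  have h3 : Real.sqrt (dirInt f) ≤ c := by
    refine Real.sqrt_le_iff.2 ⟨hc, ?_⟩
    rw [dirInt, one_div, inv_mul_le_iff₀ Real.pi_pos]
    exact hd
  unfold ANorm lipNorm
  linarith

lemma ABd.aNorm_le {α C : ℝ} {f : ℂ → ℂ} (h : ABd α C f) : ANorm α f ≤ 3 * C := by
  have := ClosedIdeals.aNorm_le h.bd h.der h.nonneg
    (h.dir.trans (by nlinarith [Real.pi_gt_three, sq_nonneg C]))
  linarith

lemma _root_.MemA.norm_parts {α : ℝ} (hα : 0 < α) (hα1 : α < 1) {f : ℂ → ℂ} (h : MemA α f) :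
    ∃ a b c : ℝ, 0 ≤ a ∧ 0 ≤ b ∧ 0 ≤ c ∧ ANorm α f = a + b + c ∧ (∀ z ∈ uDisc, ‖f z‖ ≤ a) ∧
    (∀ z ∈ uDisc, ‖deriv f z‖ ≤ b * (1 - ‖z‖) ^ (α - 1)) ∧
    ∫ z in uDisc, ‖deriv f z‖ ^ 2 = Real.pi * c ^ 2 := by
  obtain ⟨C, hC, hfC⟩ := h.exists_norm_le
  obtain ⟨A, hA, hfA⟩ := (h.isA hα hα1).exists_bound hα1.le
  have b1 : BddAbove ((fun z => ‖f z‖) '' uDisc) :=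
    ⟨C, by rintro _ ⟨z, hz, rfl⟩; exact hfC z (uDisc_subset hz)⟩
  have b2 : BddAbove ((fun z => (1 - ‖z‖) ^ (1 - α) * ‖deriv f z‖) '' uDisc) := by
    refine ⟨A, ?_⟩
    rintro _ ⟨z, hz, rfl⟩
    have hy : 0 < 1 - ‖z‖ := by linarith [mem_uDisc.1 hz]
    have h3 := mul_le_mul_of_nonneg_left (hfA z hz) (Real.rpow_nonneg hy.le (1 - α))
    refine h3.trans_eq ?_
    rw [mul_left_comm, ← Real.rpow_add hy]; simp
  have i1 : ∀ z ∈ uDisc, ‖f z‖ ≤ supNorm f := fun z hz => le_csSup b1 ⟨z, hz, rfl⟩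
  have i2 : ∀ z ∈ uDisc, (1 - ‖z‖) ^ (1 - α) * ‖deriv f z‖ ≤
      sSup ((fun z => (1 - ‖z‖) ^ (1 - α) * ‖deriv f z‖) '' uDisc) :=
    fun z hz => le_csSup b2 ⟨z, hz, rfl⟩
  have hint : 0 ≤ ∫ z in uDisc, ‖deriv f z‖ ^ 2 := by positivity
  refine ⟨supNorm f, sSup ((fun z => (1 - ‖z‖) ^ (1 - α) * ‖deriv f z‖) '' uDisc),
    Real.sqrt (dirInt f), ?_, ?_, Real.sqrt_nonneg _, rfl, i1, fun z hz => ?_, ?_⟩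
  · exact (norm_nonneg _).trans (i1 0 zero_mem_uDisc)
  · exact le_trans (by simp) (i2 0 zero_mem_uDisc)
  · have hy : 0 < 1 - ‖z‖ := by linarith [mem_uDisc.1 hz]
    have h3 := mul_le_mul_of_nonneg_right (i2 z hz) (Real.rpow_nonneg hy.le (α - 1))
    rwa [mul_right_comm, ← Real.rpow_add hy, sub_add_sub_cancel, sub_self, Real.rpow_zero,
      one_mul] at h3
  · rw [Real.sq_sqrt, dirInt]
    · field_simp
    · rw [dirInt]; positivity

lemma _root_.MemA.aBd {α : ℝ} (hα : 0 < α) (hα1 : α < 1) {f : ℂ → ℂ} (h : MemA α f) :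
    ABd α (2 * ANorm α f) f := by
  obtain ⟨a, b, c, ha, hb, hc, hN, h1, h2, h3⟩ := h.norm_parts hα hα1
  rw [hN]
  refine ⟨h.diff, fun z hz => (h1 z hz).trans (by linarith), fun z hz => (h2 z hz).trans ?_,
    h.1.2, ?_⟩
  · have := one_le_rpow hα1.le hz
    gcongr; linarith
  · rw [h3]
    nlinarith [Real.pi_le_four, sq_nonneg c, mul_nonneg ha hc, mul_nonneg hb hc, mul_nonneg ha hb,
      sq_nonneg (a + b)]

lemma _root_.MemA.exists_aBd {α : ℝ} (hα : 0 < α) (hα1 : α < 1) {f : ℂ → ℂ} (h : MemA α f) :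
    ∃ C, 0 < C ∧ ABd α C f := by
  have := h.aBd hα hα1
  refine ⟨2 * ANorm α f + 1, by linarith [this.nonneg], this.diff,
    fun z hz => (this.bd z hz).trans (by linarith), fun z hz => (this.der z hz).trans ?_,
    this.dirI, this.dir.trans (by nlinarith [this.nonneg])⟩
  have := one_le_rpow hα1.le hz
  gcongr; linarith

lemma aNorm_nonneg {α : ℝ} (hα : 0 < α) (hα1 : α < 1) {f : ℂ → ℂ} (h : MemA α f) :
    0 ≤ ANorm α f := by linarith [(h.aBd hα hα1).nonneg]

lemma le_sq_of_young {I x y : ℝ} (hx : 0 ≤ x) (hy : 0 ≤ y)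
    (h : ∀ t > 0, I ≤ (1 + t) * x ^ 2 + (1 + t⁻¹) * y ^ 2) : I ≤ (x + y) ^ 2 := by
  have h1 : ∀ ε > 0, I ≤ ((x + ε) + (y + ε)) ^ 2 := by
    intro ε hε
    refine (h ((y + ε) / (x + ε)) (by positivity)).trans ?_
    calc _ ≤ (1 + (y + ε) / (x + ε)) * (x + ε) ^ 2 + (1 + ((y + ε) / (x + ε))⁻¹) * (y + ε) ^ 2 := by
          gcongr <;> linarith
      _ = _ := by field_simp; ring
  have h2 : Tendsto (fun ε : ℝ => ((x + ε) + (y + ε)) ^ 2) (nhdsWithin 0 (Ioi 0))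
      (nhds ((x + y) ^ 2)) := by
    have : Continuous (fun ε : ℝ => ((x + ε) + (y + ε)) ^ 2) := by fun_prop
    simpa using (this.tendsto 0).mono_left nhdsWithin_le_nhds
  exact ge_of_tendsto h2 (by filter_upwards [self_mem_nhdsWithin] with ε hε using h1 ε hε)

lemma aNorm_add_le {α : ℝ} (hα : 0 < α) (hα1 : α < 1) {f g : ℂ → ℂ} (hf : MemA α f)
    (hg : MemA α g) : ANorm α (f + g) ≤ ANorm α f + ANorm α g := by
  obtain ⟨a, b, c, ha, hb, hc, hN, h1, h2, h3⟩ := hf.norm_parts hα hα1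
  obtain ⟨a', b', c', ha', hb', hc', hN', h1', h2', h3'⟩ := hg.norm_parts hα hα1
  have hd : ∀ z ∈ uDisc, deriv (f + g) z = deriv f z + deriv g z := fun z hz =>
    deriv_add (hasDerivAt_of_mem hf.diff hz).differentiableAt
      (hasDerivAt_of_mem hg.diff hz).differentiableAt
  have hfg := hf.add hα hα1 hg
  have := ClosedIdeals.aNorm_le (α := α) (f := f + g) (a := a + a') (b := b + b') (c := c + c')
    (fun z hz => (norm_add_le _ _).trans (add_le_add (h1 z hz) (h1' z hz)))
    (fun z hz => by
      rw [hd z hz, add_mul]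
      exact (norm_add_le _ _).trans (add_le_add (h2 z hz) (h2' z hz))) (by positivity) (by
      have hpi := Real.pi_pos
      rw [← div_le_iff₀' hpi]
      refine le_sq_of_young hc hc' fun t ht => ?_
      rw [div_le_iff₀' hpi]
      have : Real.pi * ((1 + t) * c ^ 2 + (1 + t⁻¹) * c' ^ 2) =
          ∫ z in uDisc, ((1 + t) * ‖deriv f z‖ ^ 2 + (1 + t⁻¹) * ‖deriv g z‖ ^ 2) := by
        rw [integral_add (hf.1.2.const_mul _) (hg.1.2.const_mul _), integral_const_mul,
          integral_const_mul, h3, h3']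
        ring
      rw [this]
      refine setIntegral_mono_on hfg.1.2 ((hf.1.2.const_mul _).add (hg.1.2.const_mul _))
        measurableSet_uDisc fun z hz => ?_
      rw [hd z hz]
      have h5 : ‖deriv f z + deriv g z‖ ^ 2 ≤ (‖deriv f z‖ + ‖deriv g z‖) ^ 2 := by
        gcongr; exact norm_add_le _ _
      refine h5.trans ?_
      have h6 : 0 ≤ t⁻¹ * (t * ‖deriv f z‖ - ‖deriv g z‖) ^ 2 := by positivity
      have h7 : t⁻¹ * (t * ‖deriv f z‖ - ‖deriv g z‖) ^ 2 = t * ‖deriv f z‖ ^ 2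
          - 2 * ‖deriv f z‖ * ‖deriv g z‖ + t⁻¹ * ‖deriv g z‖ ^ 2 := by field_simp; ring
      nlinarith)
  linarith

lemma aNorm_smul_le {α : ℝ} (hα : 0 < α) (hα1 : α < 1) {f : ℂ → ℂ} (c : ℂ) (hf : MemA α f) :
    ANorm α (c • f) ≤ ‖c‖ * ANorm α f := by
  obtain ⟨a, b, d, ha, hb, hd, hN, h1, h2, h3⟩ := hf.norm_parts hα hα1
  have hder : ∀ z ∈ uDisc, deriv (c • f) z = c * deriv f z := fun z hz => by
    simpa using ((hasDerivAt_of_mem hf.diff hz).const_smul c).deriv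
  have := ClosedIdeals.aNorm_le (α := α) (f := c • f) (a := ‖c‖ * a) (b := ‖c‖ * b)
    (c := ‖c‖ * d)
    (fun z hz => by
      rw [Pi.smul_apply, norm_smul]; exact mul_le_mul_of_nonneg_left (h1 z hz) (norm_nonneg _))
    (fun z hz => by
      rw [hder z hz, norm_mul, mul_assoc]
      exact mul_le_mul_of_nonneg_left (h2 z hz) (norm_nonneg _)) (by positivity) (by
      have : ∫ z in uDisc, ‖deriv (c • f) z‖ ^ 2 = ∫ z in uDisc, ‖c‖ ^ 2 * ‖deriv f z‖ ^ 2 :=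
        setIntegral_congr_fun measurableSet_uDisc fun z hz => by
          simp only [hder z hz, norm_mul, mul_pow]
      rw [this, integral_const_mul, h3]
      exact le_of_eq (by ring))
  rw [hN]; linarith

/-- `𝒜_α` as a submodule of the space of all functions. -/
def aSub (α : ℝ) (hα : 0 < α) (hα1 : α < 1) : Submodule ℂ (ℂ → ℂ) where
  carrier := {f | MemA α f}
  add_mem' hf hg := hf.add hα hα1 hg
  zero_mem' := memA_const hα hα1 0
  smul_mem' c _ hf := hf.smul hα hα1 c

/-- The `𝒜_α` norm as a seminorm. -/
def aSeminorm (α : ℝ) (hα : 0 < α) (hα1 : α < 1) : Seminorm ℂ (aSub α hα hα1) :=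
  Seminorm.ofSMulLE (fun f => ANorm α f.1)
    (by
      have h := (aNorm_smul_le hα hα1 0 (memA_const hα hα1 0))
      have h2 := aNorm_nonneg hα hα1 (memA_const hα hα1 0)
      rw [norm_zero, zero_mul] at h
      have h3 : ((0 : ℂ) • fun _ : ℂ => (0 : ℂ)) = 0 := by ext; simp
      rw [h3] at h
      exact le_antisymm h h2)
    (fun f g => aNorm_add_le hα hα1 f.2 g.2) (fun c f => aNorm_smul_le hα hα1 c f.2)

/-- A linear functional bounded on `𝒜_α`. -/
def BddFn (α : ℝ) (φ : (ℂ → ℂ) →ₗ[ℂ] ℂ) : Prop :=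
  ∃ C, 0 ≤ C ∧ ∀ f, MemA α f → ‖φ f‖ ≤ C * ANorm α f

lemma seminorm_separation {E : Type*} [AddCommGroup E] [Module ℂ E] (p : Seminorm ℂ E)
    (T : Submodule ℂ E) (x : E) {ε : ℝ} (hε : 0 < ε) (hdist : ∀ s ∈ T, ε ≤ p (x - s)) :
    ∃ (g : E →ₗ[ℂ] ℂ) (C : ℝ), 0 ≤ C ∧ (∀ f, ‖g f‖ ≤ C * p f) ∧ (∀ s ∈ T, g s = 0) ∧ g x ≠ 0 := by
  let i1 : SeminormedAddCommGroup E := p.toSeminormedAddCommGroup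
  let i2 : NormedSpace ℂ E :=
    { norm_smul_le := fun c f => (map_smul_eq_mul p c f).le }
  have hnorm : ∀ f : E, ‖f‖ = p f := fun _ => rfl
  have hdisj : Disjoint (ball x ε) (T : Set E) := by
    refine Set.disjoint_left.2 fun f hf hfT => ?_
    have h1 := hdist _ hfT
    rw [mem_ball, dist_comm, dist_eq_norm, hnorm] at hf
    exact absurd hf (not_lt.2 h1)
  obtain ⟨g, u, hg1, hg2⟩ := RCLike.geometric_hahn_banach_open (𝕜 := ℂ) (convex_ball x ε)
    isOpen_ball (T.restrictScalars ℝ).convex hdisj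
  have hu : u ≤ 0 := by simpa using hg2 0 T.zero_mem
  have hgT : ∀ s ∈ T, g s = 0 := by
    intro s hs
    by_contra hne
    have h1 := hg2 (((u - 1 : ℝ) : ℂ) • (g s)⁻¹ • s) (T.smul_mem _ (T.smul_mem _ hs))
    have h2 : g (((u - 1 : ℝ) : ℂ) • (g s)⁻¹ • s) = ((u - 1 : ℝ) : ℂ) := by
      simp only [map_smul, smul_eq_mul]
      rw [inv_mul_cancel₀ hne, mul_one]
    rw [h2] at h1
    have h3 : u ≤ (((u - 1 : ℝ) : ℂ)).re := h1
    rw [ofReal_re] at h3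
    linarith
  refine ⟨g, ‖g‖, norm_nonneg _, fun f => g.le_opNorm _, hgT, fun h0 => ?_⟩
  have h1 : RCLike.re (g x) < u := hg1 x (mem_ball_self hε)
  have h2 : g x = 0 := h0
  rw [h2] at h1
  simp at h1
  linarith

lemma exists_separating {α : ℝ} (hα : 0 < α) (hα1 : α < 1) {S : Set (ℂ → ℂ)}
    (hS : ∀ s ∈ S, MemA α s) (h0 : 0 ∈ S) (hadd : ∀ s ∈ S, ∀ t ∈ S, s + t ∈ S)
    (hsmul : ∀ c : ℂ, ∀ s ∈ S, c • s ∈ S) {x : ℂ → ℂ} (hx : MemA α x) {ε : ℝ} (hε : 0 < ε)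
    (hdist : ∀ s ∈ S, ε ≤ ANorm α (x - s)) :
    ∃ φ : (ℂ → ℂ) →ₗ[ℂ] ℂ, BddFn α φ ∧ (∀ s ∈ S, φ s = 0) ∧ φ x ≠ 0 := by
  let T : Submodule ℂ (aSub α hα hα1) :=
    { carrier := {f | f.1 ∈ S}
      add_mem' := fun hf hg => hadd _ hf _ hg
      zero_mem' := h0
      smul_mem' := fun c f hf => hsmul c _ hf }
  obtain ⟨g, C, hC, hg, hgT, hgx⟩ := seminorm_separation (aSeminorm α hα hα1) T ⟨x, hx⟩ hε
    (fun s hs => hdist _ hs)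
  obtain ⟨φ, hφ⟩ := g.exists_extend
  have hval : ∀ f : aSub α hα hα1, φ f.1 = g f := fun f => LinearMap.congr_fun hφ f
  exact ⟨φ, ⟨C, hC, fun f hf => (congrArg norm (hval ⟨f, hf⟩)).trans_le (hg _)⟩,
    fun s hs => (hval ⟨s, hS s hs⟩).trans (hgT _ hs), by rw [hval ⟨x, hx⟩]; exact hgx⟩

lemma separate_ideal {α : ℝ} (hα : 0 < α) (hα1 : α < 1) {J : Set (ℂ → ℂ)}
    (hJ : IsClosedIdeal α J) {f : ℂ → ℂ} (hf : MemA α f) (hfJ : f ∉ J) :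
    ∃ φ : (ℂ → ℂ) →ₗ[ℂ] ℂ, BddFn α φ ∧ (∀ s ∈ J, φ s = 0) ∧ φ f ≠ 0 := by
  by_cases h : ∃ ε > 0, ∀ s ∈ J, ε ≤ ANorm α (f - s)
  · obtain ⟨ε, hε, h⟩ := h
    exact exists_separating hα hα1 hJ.mem_A hJ.zero_mem hJ.add_mem hJ.smul_mem hf hε h
  · push Not at h
    choose! F hF hlt using fun n : ℕ => h (1 / (n + 1)) (by positivity)
    refine absurd (hJ.closed F f hF hf ?_) hfJ
    refine squeeze_zero (fun n => aNorm_nonneg hα hα1 ((hJ.mem_A _ (hF n)).sub hα hα1 hf))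
      (fun n => ?_) tendsto_one_div_add_atTop_nhds_zero_nat
    have h1 := aNorm_smul_le hα hα1 (-1) (hf.sub hα hα1 (hJ.mem_A _ (hF n)))
    have h2 : (-1 : ℂ) • (f - F n) = F n - f := by simp
    rw [h2, norm_neg, norm_one, one_mul] at h1
    exact h1.trans (hlt n).le

lemma BddFn.le_of_aBd {α : ℝ} {φ : (ℂ → ℂ) →ₗ[ℂ] ℂ} (h : BddFn α φ) :
    ∃ C, 0 ≤ C ∧ ∀ f B, MemA α f → ABd α B f → ‖φ f‖ ≤ C * B := by
  obtain ⟨C, hC, hb⟩ := h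
  refine ⟨C * 3, by positivity, fun f B hf hB => (hb f hf).trans ?_⟩
  rw [mul_assoc]
  exact mul_le_mul_of_nonneg_left hB.aNorm_le hC

lemma BddFn.congr {α : ℝ} (hα : 0 < α) (hα1 : α < 1) {φ : (ℂ → ℂ) →ₗ[ℂ] ℂ} (h : BddFn α φ)
    {f g : ℂ → ℂ} (hf : MemA α f) (hg : MemA α g) (hfg : ∀ z ∈ uDisc, f z = g z) : φ f = φ g := by
  obtain ⟨C, hC, hb⟩ := h.le_of_aBd
  have h0 : ∀ z ∈ uDisc, (f - g) z = 0 := fun z hz => by simp [hfg z hz]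
  have hd : ∀ z ∈ uDisc, deriv (f - g) z = 0 := fun z hz => by
    have := (Filter.eventuallyEq_of_mem (isOpen_uDisc.mem_nhds hz) h0).deriv_eq
    simpa using this
  have hm := hf.sub hα hα1 hg
  have : ABd α 0 (f - g) := ⟨hm.diff, fun z hz => by simp [hfg z hz],
    fun z hz => by simp [hd z hz], hm.1.2, by
      rw [setIntegral_congr_fun (g := fun _ => (0 : ℝ)) measurableSet_uDisc
        (fun z hz => by simp [hd z hz])]
      simp⟩
  have := hb _ _ hm this
  rw [mul_zero, norm_le_zero_iff, map_sub, sub_eq_zero] at this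
  exact this

lemma ABd.holder {α C : ℝ} (hα : 0 < α) (hα1 : α < 1) {f : ℂ → ℂ} (h : ABd α C f) {z w : ℂ}
    (hz : z ∈ uDisc) (hw : w ∈ uDisc) (hzw : ‖z - w‖ ≤ 1) :
    ‖f z - f w‖ ≤ (2 / α + 1) * C * ‖z - w‖ ^ α := by
  have := hardyLittlewood hα hα1.le h.nonneg h.diff (M := 0) (by simpa using h.der) le_rfl hz hw hzw
  simpa using this

lemma eventually_small {α C : ℝ} (hα : 0 < α) (hα1 : α < 1) {x : ℕ → ℂ → ℂ}
    (hb : ∀ n, ABd α C (x n)) (h0 : ∀ z ∈ uDisc, Tendsto (fun n => x n z) atTop (nhds 0))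
    {ε : ℝ} (hε : 0 < ε) : ∀ᶠ n in atTop, ∀ z ∈ uDisc, ‖x n z‖ ≤ ε := by
  have h1 : Tendsto (fun x : ℝ => (2 / α + 1) * C * x ^ α) (nhds 0) (nhds 0) := by
    have : Continuous (fun x : ℝ => (2 / α + 1) * C * x ^ α) :=
      (Real.continuous_rpow_const hα.le).const_mul _
    simpa [Real.zero_rpow hα.ne'] using this.tendsto 0
  obtain ⟨δ, hδ, hd⟩ := Metric.eventually_nhds_iff.1 (h1.eventually_lt_const (half_pos hε))
  have htb : TotallyBounded uDisc :=
    (isCompact_closedBall (0 : ℂ) 1).totallyBounded.subset uDisc_subset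
  obtain ⟨t, hts, htf, hcov⟩ := Metric.finite_approx_of_totallyBounded htb (min δ 1) (by positivity)
  have h2 : ∀ᶠ n in atTop, ∀ y ∈ t, ‖x n y‖ < ε / 2 := by
    rw [Filter.eventually_all_finite htf]
    intro y hy
    have := (h0 y (hts hy)).norm
    rw [norm_zero] at this
    exact this.eventually_lt_const (half_pos hε)
  filter_upwards [h2] with n hn z hz
  obtain ⟨y, hy, hzy⟩ := mem_iUnion₂.1 (hcov hz)
  rw [mem_ball, dist_eq_norm] at hzy
  have h3 := (hb n).holder hα hα1 hz (hts hy) (hzy.le.trans (min_le_right _ _))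
  have h4 := hd (y := ‖z - y‖) (by simpa using hzy.trans_le (min_le_left _ _))
  have h5 := hn y hy
  have h6 : ‖x n z‖ ≤ ‖x n z - x n y‖ + ‖x n y‖ := by
    simpa using norm_add_le (x n z - x n y) (x n y)
  linarith

lemma norm_deriv_le_of_bound {f : ℂ → ℂ} (hf : DifferentiableOn ℂ f uDisc) {B : ℝ}
    (hb : ∀ z ∈ uDisc, ‖f z‖ ≤ B) {z : ℂ} (hz : z ∈ uDisc) :
    ‖deriv f z‖ ≤ 2 * B / (1 - ‖z‖) := by
  have hz1 := mem_uDisc.1 hz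
  have hsub : closedBall z ((1 - ‖z‖) / 2) ⊆ uDisc := by
    intro w hw
    rw [mem_closedBall, dist_eq_norm] at hw
    rw [mem_uDisc]
    have := norm_sub_norm_le w z
    linarith
  have h1 : DiffContOnCl ℂ f (ball z ((1 - ‖z‖) / 2)) := by
    apply DifferentiableOn.diffContOnCl
    rw [closure_ball _ (by linarith)]
    exact hf.mono hsub
  have := Complex.norm_deriv_le_of_forall_mem_sphere_norm_le (by linarith) h1
    (fun w hw => hb w (hsub (sphere_subset_closedBall hw)))
  refine this.trans_eq ?_
  field_simp

lemma tendsto_deriv_of_bdd {α C : ℝ} (hα : 0 < α) (hα1 : α < 1) {x : ℕ → ℂ → ℂ}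
    (hb : ∀ n, ABd α C (x n)) (h0 : ∀ z ∈ uDisc, Tendsto (fun n => x n z) atTop (nhds 0))
    {r ε : ℝ} (hr : r < 1) (hε : 0 < ε) :
    ∀ᶠ n in atTop, ∀ z ∈ uDisc, ‖z‖ ≤ r → ‖deriv (x n) z‖ ≤ ε := by
  filter_upwards [eventually_small hα hα1 hb h0 (ε := ε * (1 - r) / 2)
    (by have : 0 < 1 - r := by linarith
        positivity)] with n hn z hz hzr
  refine (norm_deriv_le_of_bound (hb n).diff hn hz).trans ?_
  rw [div_le_iff₀ (by linarith)]
  nlinarith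

lemma weak_step {α C η : ℝ} (hα : 0 < α) (hα1 : α < 1) (hη : 0 < η) {x : ℕ → ℂ → ℂ}
    (hb : ∀ n, ABd α C (x n)) (h0 : ∀ z ∈ uDisc, Tendsto (fun n => x n z) atTop (nhds 0))
    {S : ℂ → ℂ} (hS : MemA α S) {N : ℝ} (hN : 0 ≤ N) (h1 : ∀ z ∈ uDisc, ‖S z‖ ≤ N * η)
    (h2 : ∀ z ∈ uDisc, ‖deriv S z‖ ≤ (C + N * η) * (1 - ‖z‖) ^ (α - 1))
    (h3 : ∫ z in uDisc, ‖deriv S z‖ ^ 2 ≤ N * (C ^ 2 + η)) :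
    ∀ᶠ n in atTop, ∀ c : ℂ, ‖c‖ = 1 →
      (∀ z ∈ uDisc, ‖(S + c • x n) z‖ ≤ (N + 1) * η) ∧
      (∀ z ∈ uDisc, ‖deriv (S + c • x n) z‖ ≤ (C + (N + 1) * η) * (1 - ‖z‖) ^ (α - 1)) ∧
      ∫ z in uDisc, ‖deriv (S + c • x n) z‖ ^ 2 ≤ (N + 1) * (C ^ 2 + η) := by
  obtain ⟨r, hr, hSr⟩ := (hS.isA hα hα1).small η hη
  have hC : 0 ≤ C := (hb 0).nonneg
  set t : ℝ := η / (2 * (C ^ 2 + 1)) with ht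
  have ht0 : 0 < t := by positivity
  have hmeas : ∀ n, ContinuousOn (fun z => min (‖deriv S z‖ ^ 2 / t)
      (2 * ‖deriv S z‖ * ‖deriv (x n) z‖)) uDisc := fun n => by
    have c1 := (continuousOn_deriv hS.diff).norm
    have c2 := (continuousOn_deriv (hb n).diff).norm
    exact ((c1.pow 2).div_const t).inf ((continuousOn_const.mul c1).mul c2)
  have hdom : IntegrableOn (fun z => ‖deriv S z‖ ^ 2 / t) uDisc := hS.1.2.div_const _
  have hbound : ∀ n z, ‖min (‖deriv S z‖ ^ 2 / t) (2 * ‖deriv S z‖ * ‖deriv (x n) z‖)‖ ≤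
      ‖deriv S z‖ ^ 2 / t := fun n z => by
    rw [Real.norm_of_nonneg (le_min (by positivity) (by positivity))]
    exact min_le_left _ _
  have hlim : Tendsto (fun n => ∫ z in uDisc, min (‖deriv S z‖ ^ 2 / t)
      (2 * ‖deriv S z‖ * ‖deriv (x n) z‖)) atTop (nhds 0) := by
    have := tendsto_integral_of_dominated_convergence (μ := volume.restrict uDisc)
      (F := fun n z => min (‖deriv S z‖ ^ 2 / t) (2 * ‖deriv S z‖ * ‖deriv (x n) z‖))
      (f := fun _ => 0)
      (fun z => ‖deriv S z‖ ^ 2 / t)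
      (fun n => (hmeas n).aestronglyMeasurable measurableSet_uDisc) hdom
      (fun n => ae_of_all _ (hbound n)) (by
        filter_upwards [ae_restrict_mem measurableSet_uDisc] with z hz
        have hx : Tendsto (fun n => ‖deriv (x n) z‖) atTop (nhds 0) := by
          rw [Metric.tendsto_nhds]
          intro ε hε
          filter_upwards [tendsto_deriv_of_bdd hα hα1 hb h0 (mem_uDisc.1 hz) (half_pos hε)]
            with n hn
          rw [dist_zero_right, norm_norm]
          linarith [hn z hz le_rfl]
        have h5 : Tendsto (fun n => 2 * ‖deriv S z‖ * ‖deriv (x n) z‖) atTop (nhds 0) := by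
          simpa using hx.const_mul (2 * ‖deriv S z‖)
        have h6 := (tendsto_const_nhds (x := ‖deriv S z‖ ^ 2 / t)).min h5
        rwa [min_eq_right (by positivity)] at h6)
    simpa using this
  filter_upwards [eventually_small hα hα1 hb h0 hη, tendsto_deriv_of_bdd hα hα1 hb h0 hr hη,
    hlim.eventually_lt_const (half_pos hη)] with n e1 e2 e3 c hc
  have hd : ∀ z ∈ uDisc, deriv (S + c • x n) z = deriv S z + c * deriv (x n) z := fun z hz => by
    simpa using ((hasDerivAt_of_mem hS.diff hz).add
      ((hasDerivAt_of_mem (hb n).diff hz).const_smul c)).deriv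
  have hd' : ∀ z ∈ uDisc, ‖deriv (S + c • x n) z‖ ≤ ‖deriv S z‖ + ‖deriv (x n) z‖ := fun z hz => by
    rw [hd z hz]
    refine (norm_add_le _ _).trans_eq ?_
    rw [norm_mul, hc, one_mul]
  refine ⟨fun z hz => ?_, fun z hz => ?_, ?_⟩
  · rw [Pi.add_apply, Pi.smul_apply]
    refine (norm_add_le _ _).trans ?_
    rw [norm_smul, hc, one_mul]
    linarith [h1 z hz, e1 z hz]
  · refine (hd' z hz).trans ?_
    have hy := one_le_rpow hα1.le hz
    have hNη : 0 ≤ N * η := by positivity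
    by_cases hzr : r < ‖z‖
    · have := hSr z hz hzr
      have h4 := (hb n).der z hz
      nlinarith
    · have := e2 z hz (not_lt.1 hzr)
      have h4 := h2 z hz
      nlinarith
  · have hI1 : IntegrableOn (fun z => min (‖deriv S z‖ ^ 2 / t)
      (2 * ‖deriv S z‖ * ‖deriv (x n) z‖)) uDisc := hdom.mono'
        ((hmeas n).aestronglyMeasurable measurableSet_uDisc) (ae_of_all _ (hbound n))
    have hI2 : IntegrableOn (fun z => ‖deriv S z‖ ^ 2 + (1 + t) * ‖deriv (x n) z‖ ^ 2) uDisc :=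
      hS.1.2.add ((hb n).dirI.const_mul _)
    have hle : ∀ z ∈ uDisc, ‖deriv (S + c • x n) z‖ ^ 2 ≤ ‖deriv S z‖ ^ 2 +
        (1 + t) * ‖deriv (x n) z‖ ^ 2 +
        min (‖deriv S z‖ ^ 2 / t) (2 * ‖deriv S z‖ * ‖deriv (x n) z‖) := by
      intro z hz
      have h5 : ‖deriv (S + c • x n) z‖ ^ 2 ≤ (‖deriv S z‖ + ‖deriv (x n) z‖) ^ 2 := by
        gcongr; exact hd' z hz
      refine h5.trans ?_
      rcases min_choice (‖deriv S z‖ ^ 2 / t) (2 * ‖deriv S z‖ * ‖deriv (x n) z‖) with h | h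
      · rw [h]
        have h6 : 0 ≤ (‖deriv S z‖ - t * ‖deriv (x n) z‖) ^ 2 / t := by positivity
        have h7 : (‖deriv S z‖ - t * ‖deriv (x n) z‖) ^ 2 / t = ‖deriv S z‖ ^ 2 / t
          - 2 * ‖deriv S z‖ * ‖deriv (x n) z‖ + t * ‖deriv (x n) z‖ ^ 2 := by
          field_simp
          ring
        nlinarith
      · rw [h]; nlinarith [mul_nonneg ht0.le (sq_nonneg ‖deriv (x n) z‖)]
    have hmem : IntegrableOn (fun z => ‖deriv (S + c • x n) z‖ ^ 2) uDisc := by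
      refine (hI2.add hI1).mono' ?_ ?_
      · exact ((continuousOn_deriv (hS.diff.add ((hb n).diff.const_smul c))).norm.pow
          2).aestronglyMeasurable measurableSet_uDisc
      · filter_upwards [ae_restrict_mem measurableSet_uDisc] with z hz
        rw [Real.norm_of_nonneg (by positivity)]
        exact hle z hz
    have h8 := setIntegral_mono_on hmem (hI2.add hI1) measurableSet_uDisc hle
    have h9 : ∫ z in uDisc, ((fun z => ‖deriv S z‖ ^ 2 + (1 + t) * ‖deriv (x n) z‖ ^ 2 : ℂ → ℝ) +
        (fun z => min (‖deriv S z‖ ^ 2 / t) (2 * ‖deriv S z‖ * ‖deriv (x n) z‖) : ℂ → ℝ)) z =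
        (∫ z in uDisc, ‖deriv S z‖ ^ 2) + (1 + t) * (∫ z in uDisc, ‖deriv (x n) z‖ ^ 2) +
        ∫ z in uDisc, min (‖deriv S z‖ ^ 2 / t) (2 * ‖deriv S z‖ * ‖deriv (x n) z‖) := by
      rw [integral_add' hI2 hI1, integral_add hS.1.2 ((hb n).dirI.const_mul _),
        integral_const_mul]
    rw [h9] at h8
    refine h8.trans ?_
    have h10 := (hb n).dir
    have h11 : t * C ^ 2 ≤ η / 2 := by
      rw [ht, div_mul_eq_mul_div, div_le_div_iff₀ (by positivity) two_pos]
      nlinarith [sq_nonneg C]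
    have h12 : (1 + t) * (∫ z in uDisc, ‖deriv (x n) z‖ ^ 2) ≤ (1 + t) * C ^ 2 := by gcongr
    nlinarith

/-- Bounded sequences of `𝒜_α` converging pointwise to zero on the disc converge weakly. -/
lemma BddFn.tendsto_zero {α C : ℝ} (hα : 0 < α) (hα1 : α < 1) {φ : (ℂ → ℂ) →ₗ[ℂ] ℂ}
    (hφ : BddFn α φ) {x : ℕ → ℂ → ℂ} (hx : ∀ n, MemA α (x n)) (hb : ∀ n, ABd α C (x n))
    (h0 : ∀ z ∈ uDisc, Tendsto (fun n => x n z) atTop (nhds 0)) :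
    Tendsto (fun n => φ (x n)) atTop (nhds 0) := by
  have hC : 0 ≤ C := (hb 0).nonneg
  obtain ⟨K, hK, hφK⟩ := hφ.le_of_aBd
  rw [tendsto_zero_iff_norm_tendsto_zero]
  by_contra hnot
  obtain ⟨δ, hδ, hfreq⟩ : ∃ δ > 0, ∃ᶠ n in atTop, δ ≤ ‖φ (x n)‖ := by
    by_contra hcon
    push Not at hcon
    refine hnot (Metric.tendsto_nhds.2 fun ε hε => ?_)
    filter_upwards [hcon ε hε] with n hn
    simpa using hn
  obtain ⟨η, hη0, hη1, hηK⟩ : ∃ η : ℝ, 0 < η ∧ η ≤ 1 ∧ K * η ≤ δ / 2 := by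
    refine ⟨min 1 (δ / (2 * (K + 1))), by positivity, min_le_left _ _, ?_⟩
    calc K * min 1 (δ / (2 * (K + 1))) ≤ (K + 1) * (δ / (2 * (K + 1))) := by
          gcongr
          · linarith
          · exact min_le_right _ _
      _ = δ / 2 := by field_simp
  have main : ∀ N : ℕ, ∃ S, MemA α S ∧ (∀ z ∈ uDisc, ‖S z‖ ≤ N * η) ∧
      (∀ z ∈ uDisc, ‖deriv S z‖ ≤ (C + N * η) * (1 - ‖z‖) ^ (α - 1)) ∧
      ∫ z in uDisc, ‖deriv S z‖ ^ 2 ≤ N * (C ^ 2 + η) ∧ N * δ ≤ (φ S).re := by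
    intro N
    induction N with
    | zero =>
      refine ⟨fun _ => 0, memA_const hα hα1 0, by simp, fun z hz => ?_, by simp, ?_⟩
      · have := one_le_rpow hα1.le hz
        simp only [deriv_const, norm_zero]
        positivity
      · have : φ (fun _ => 0) = 0 := φ.map_zero
        simp [this]
    | succ N ih =>
      obtain ⟨S, hS, s1, s2, s3, s4⟩ := ih
      obtain ⟨n, hn, hst⟩ := (hfreq.and_eventually
        (weak_step hα hα1 hη0 hb h0 hS (Nat.cast_nonneg N) s1 s2 s3)).exists
      have hne : φ (x n) ≠ 0 := by
        intro h; rw [h, norm_zero] at hn; linarith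
      set c : ℂ := ‖φ (x n)‖ / φ (x n) with hc
      have hc1 : ‖c‖ = 1 := by
        rw [hc, norm_div, Complex.norm_real, norm_norm, div_self (norm_ne_zero_iff.2 hne)]
      obtain ⟨t1, t2, t3⟩ := hst c hc1
      refine ⟨S + c • x n, hS.add hα hα1 ((hx n).smul hα hα1 c), ?_, ?_, ?_, ?_⟩
      · push_cast; exact t1
      · push_cast; exact t2
      · push_cast; exact t3
      · rw [map_add, map_smul, smul_eq_mul, hc, div_mul_cancel₀ _ hne, add_re, ofReal_re]
        push_cast
        linarith
  obtain ⟨M, hM⟩ := exists_nat_gt (2 * (K * (2 * C + 1)) / δ)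
  obtain ⟨S, hS, s1, s2, s3, s4⟩ := main ((M + 1) ^ 2)
  push_cast at s1 s2 s3 s4
  set m : ℝ := (M : ℝ) + 1 with hm
  have hm1 : 1 ≤ m := by simp [hm]
  have hB : ABd α (C + m ^ 2 * η + m * (C + 1)) S := by
    have hpos : 0 ≤ m * (C + 1) := by positivity
    refine ⟨hS.diff, fun z hz => (s1 z hz).trans (by linarith), fun z hz => (s2 z hz).trans ?_,
      hS.1.2, s3.trans ?_⟩
    · have := one_le_rpow hα1.le hz
      exact mul_le_mul_of_nonneg_right (by linarith) (by linarith)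
    · calc m ^ 2 * (C ^ 2 + η) ≤ (m * (C + 1)) ^ 2 := by
            rw [mul_pow]; gcongr; nlinarith
        _ ≤ _ := by
          gcongr
          have : 0 ≤ m ^ 2 * η := by positivity
          linarith
  have h5 := hφK S _ hS hB
  have h6 := (Complex.re_le_norm (φ S))
  rw [div_lt_iff₀ hδ] at hM
  have h7 : m ^ 2 * δ ≤ K * (C + m * (C + 1)) + m ^ 2 * (δ / 2) := by
    calc m ^ 2 * δ ≤ K * (C + m ^ 2 * η + m * (C + 1)) := by linarith
      _ = K * (C + m * (C + 1)) + m ^ 2 * (K * η) := by ring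
      _ ≤ _ := by gcongr
  have h8 : K * (C + m * (C + 1)) ≤ m * (K * (2 * C + 1)) := by nlinarith [mul_nonneg hK hC]
  have h9 : m * (m * δ) ≤ m * (2 * (K * (2 * C + 1))) := by nlinarith
  have h10 := le_of_mul_le_mul_left h9 (by linarith)
  nlinarith

lemma ABd.sub_const_bound {α C D : ℝ} (hα1 : α < 1) {f g : ℂ → ℂ} (hf : ABd α C f)
    (hg : ABd α D g) : ABd α (C + D + (3 * (C + D) + 4)) (f - g) := by
  have hC := hf.nonneg
  have hD := hg.nonneg
  have mono : ∀ {E h}, ABd α E h → E ≤ C + D → ABd α (C + D) h := fun {E h} hh hE =>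
    ⟨hh.diff, fun z hz => (hh.bd z hz).trans hE, fun z hz => (hh.der z hz).trans (by
      have := one_le_rpow hα1.le hz
      gcongr), hh.dirI, hh.dir.trans (by have := hh.nonneg; gcongr)⟩
  have := ABd.dominated (F := f - g) (B := 1) (B' := C + D) hα1 zero_le_one
    (mono hf (by linarith)) (mono hg (by linarith))
    (hf.diff.sub hg.diff)
    (fun z hz => (norm_sub_le _ _).trans (add_le_add (hf.bd z hz) (hg.bd z hz)))
    (fun z hz => by
      rw [deriv_sub (hasDerivAt_of_mem hf.diff hz).differentiableAt
        (hasDerivAt_of_mem hg.diff hz).differentiableAt]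
      linarith [norm_sub_le (deriv f z) (deriv g z)])
  simpa using this

lemma BddFn.tendsto {α C : ℝ} (hα : 0 < α) (hα1 : α < 1) {φ : (ℂ → ℂ) →ₗ[ℂ] ℂ}
    (hφ : BddFn α φ) {x : ℕ → ℂ → ℂ} {f : ℂ → ℂ} (hx : ∀ n, MemA α (x n))
    (hb : ∀ n, ABd α C (x n)) (hf : MemA α f)
    (h0 : ∀ z ∈ uDisc, Tendsto (fun n => x n z) atTop (nhds (f z))) :
    Tendsto (fun n => φ (x n)) atTop (nhds (φ f)) := by
  obtain ⟨D, hD, hfD⟩ := hf.exists_aBd hα hα1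
  have := hφ.tendsto_zero hα hα1 (x := fun n => x n - f) (fun n => (hx n).sub hα hα1 hf)
    (fun n => (hb n).sub_const_bound hα1 hfD)
    (fun z hz => by simpa using (h0 z hz).sub_const (f z))
  simp only [map_sub] at this
  simpa using this.add_const (φ f)

/-- Closed ideals are closed under bounded pointwise limits. -/
lemma mem_of_bounded_limit {α C : ℝ} (hα : 0 < α) (hα1 : α < 1) {J : Set (ℂ → ℂ)}
    (hJ : IsClosedIdeal α J) {x : ℕ → ℂ → ℂ} {f : ℂ → ℂ} (hx : ∀ n, x n ∈ J)
    (hb : ∀ n, ABd α C (x n)) (hf : MemA α f)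
    (h0 : ∀ z ∈ uDisc, Tendsto (fun n => x n z) atTop (nhds (f z))) : f ∈ J := by
  by_contra hne
  obtain ⟨φ, hφ, hφJ, hφf⟩ := separate_ideal hα hα1 hJ hf hne
  have := hφ.tendsto hα hα1 (fun n => hJ.mem_A _ (hx n)) hb hf h0
  simp only [hφJ _ (hx _)] at this
  exact hφf (tendsto_nhds_unique this tendsto_const_nhds)

/-- The point `e^{iθ}` of the circle. -/
def e (θ : ℝ) : ℂ := Complex.exp ((θ : ℂ) * Complex.I)

/-- Normalized Lebesgue measure on `(0, 2π]`. -/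
def nu : Measure ℝ := (ENNReal.ofReal (2 * Real.pi))⁻¹ • volume.restrict (Ioc 0 (2 * Real.pi))

lemma nu_univ : nu univ = 1 := by
  have h : ENNReal.ofReal (2 * Real.pi) ≠ 0 := by
    simpa using Real.pi_pos
  simp only [nu, Measure.smul_apply, Measure.restrict_apply_univ, Real.volume_Ioc, sub_zero,
    smul_eq_mul]
  exact ENNReal.inv_mul_cancel h ENNReal.ofReal_ne_top

instance : IsProbabilityMeasure nu := ⟨nu_univ⟩

lemma ae_nu {p : ℝ → Prop} : (∀ᵐ θ ∂nu, p θ) ↔ ∀ᵐ θ ∂(volume.restrict (Ioc 0 (2 * Real.pi))), p θ := by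
  rw [nu, Measure.ae_ennreal_smul_measure_iff]
  exact ENNReal.inv_ne_zero.2 ENNReal.ofReal_ne_top

lemma integral_nu {E : Type*} [NormedAddCommGroup E] [NormedSpace ℝ E] (F : ℝ → E) :
    ∫ θ, F θ ∂nu = (2 * Real.pi)⁻¹ • ∫ θ in (0 : ℝ)..(2 * Real.pi), F θ := by
  rw [nu, integral_smul_measure, intervalIntegral.integral_of_le Real.two_pi_pos.le,
    ENNReal.toReal_inv, ENNReal.toReal_ofReal Real.two_pi_pos.le]

lemma continuous_e : Continuous e := by unfold e; fun_prop

@[simp] lemma norm_e (θ : ℝ) : ‖e θ‖ = 1 := Complex.norm_exp_ofReal_mul_I θ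

lemma e_ne_zero (θ : ℝ) : e θ ≠ 0 := Complex.exp_ne_zero _

lemma e_mem_circle (θ : ℝ) : e θ ∈ uCircle := mem_uCircle.2 (norm_e θ)

lemma e_mem_closed (θ : ℝ) : e θ ∈ closedBall (0 : ℂ) 1 := mem_cDisc.2 (norm_e θ).le

lemma exists_e {t : ℂ} (ht : t ∈ uCircle) : ∃ θ, e θ = t := by
  refine ⟨t.arg, ?_⟩
  have := Complex.norm_mul_exp_arg_mul_I t
  rw [mem_uCircle.1 ht] at this
  simpa [e] using this

lemma circleMap_eq (r θ : ℝ) : circleMap 0 r θ = r * e θ := by simp [circleMap, e]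

lemma circleMap_one (θ : ℝ) : circleMap 0 1 θ = e θ := by simp [circleMap, e]

lemma e_sub_ne {z : ℂ} (hz : z ∈ uDisc) (θ : ℝ) : e θ - z ≠ 0 := by
  intro h
  have := mem_uDisc.1 hz
  rw [← sub_eq_zero.1 h, norm_e] at this
  exact lt_irrefl _ this

lemma conj_e (θ : ℝ) : conj (e θ) = (e θ)⁻¹ := by
  rw [Complex.inv_def, Complex.normSq_eq_norm_sq, norm_e]; simp

lemma integral_nu_eq_circleAverage (F : ℂ → ℂ) (r : ℝ) :
    ∫ θ, F (r * e θ) ∂nu = Real.circleAverage F 0 r := by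
  rw [integral_nu, Real.circleAverage]
  simp only [circleMap_eq]

lemma integrable_of_continuous {E : Type*} [NormedAddCommGroup E] {F : ℝ → E}
    (hF : Continuous F) : Integrable F nu := by
  refine Integrable.smul_measure ?_ (by simp [Real.pi_pos])
  exact (hF.integrableOn_Icc).mono_set Ioc_subset_Icc_self

lemma mean_value {g : ℂ → ℂ} (hg : DiffContOnCl ℂ g (ball 0 1)) :
    ∫ θ, g (e θ) ∂nu = g 0 := by
  have := integral_nu_eq_circleAverage g 1
  simp only [ofReal_one, one_mul] at this
  rw [this]
  exact DiffContOnCl.circleAverage (by simpa using hg)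

lemma continuous_comp_e {g : ℂ → ℂ} (hg : ContinuousOn g (closedBall 0 1)) :
    Continuous fun θ => g (e θ) :=
  hg.comp_continuous continuous_e e_mem_closed

lemma _root_.DiffContOnCl.contClosed {g : ℂ → ℂ} (hg : DiffContOnCl ℂ g (ball 0 1)) :
    ContinuousOn g (closedBall 0 1) := by
  have := hg.continuousOn
  rwa [closure_ball _ one_ne_zero] at this

lemma diffContOnCl_of {g : ℂ → ℂ} (h1 : DifferentiableOn ℂ g uDisc)
    (h2 : ContinuousOn g (closedBall 0 1)) : DiffContOnCl ℂ g (ball 0 1) :=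
  ⟨h1, by rwa [closure_ball _ one_ne_zero]⟩

lemma cauchy_formula {g : ℂ → ℂ} (hg : DiffContOnCl ℂ g (ball 0 1)) {z : ℂ} (hz : z ∈ uDisc) :
    ∫ θ, g (e θ) * (e θ / (e θ - z)) ∂nu = g z := by
  have h := DiffContOnCl.circleAverage_smul_div (c := 0) (R := 1) (w := z) (f := g)
    (by simpa using hg) (by simpa using mem_uDisc.1 hz)
  have h2 := integral_nu_eq_circleAverage (fun t => g t * (t / (t - z))) 1
  simp only [ofReal_one, one_mul] at h2
  rw [h2, ← h]
  congr 1
  ext t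
  simp [mul_comm]

lemma one_sub_ne {z : ℂ} (hz : z ∈ uDisc) {t : ℂ} (ht : t ∈ closedBall (0 : ℂ) 1) :
    1 - conj z * t ≠ 0 := by
  intro h
  have h1 := mem_uDisc.1 hz
  have h2 := mem_cDisc.1 ht
  have h3 : conj z * t = 1 := (sub_eq_zero.1 h).symm
  have h4 : ‖z‖ * ‖t‖ = 1 := by
    rw [← RCLike.norm_conj z, ← norm_mul, h3, norm_one]
  nlinarith [norm_nonneg z, norm_nonneg t]

lemma diffContOnCl_const_mul_id {z : ℂ} (hz : z ∈ uDisc) :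
    DiffContOnCl ℂ (fun t => (1 - conj z * t)⁻¹) (ball 0 1) := by
  refine DiffContOnCl.inv ?_ fun t ht => ?_
  · exact (differentiable_const (1 : ℂ)).sub (differentiable_id.const_mul (conj z))
      |>.diffContOnCl
  · rw [closure_ball _ one_ne_zero] at ht
    exact one_sub_ne hz ht

/-- The Poisson kernel. -/
def P (z : ℂ) (θ : ℝ) : ℝ := (1 - ‖z‖ ^ 2) / ‖e θ - z‖ ^ 2

lemma conj_kernel {z : ℂ} (hz : z ∈ uDisc) (θ : ℝ) :
    conj (e θ / (e θ - z)) = (1 - conj z * e θ)⁻¹ := by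
  have h1 := one_sub_ne hz (e_mem_closed θ)
  rw [map_div₀, map_sub, conj_e]
  have := e_ne_zero θ
  have h2 : (e θ)⁻¹ - conj z ≠ 0 := by
    intro h; apply h1; field_simp at h; linear_combination h
  field_simp

lemma P_eq {z : ℂ} (hz : z ∈ uDisc) (θ : ℝ) :
    (P z θ : ℂ) = e θ / (e θ - z) + (1 - conj z * e θ)⁻¹ - 1 := by
  rw [← conj_kernel hz]
  have h0 := e_sub_ne hz θ
  have h0' : conj (e θ - z) ≠ 0 := (map_ne_zero _).2 h0
  have h1 : ((‖e θ - z‖ ^ 2 : ℝ) : ℂ) = (e θ - z) * conj (e θ - z) := by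
    rw [Complex.mul_conj, Complex.normSq_eq_norm_sq]
  have h2 : ((‖z‖ ^ 2 : ℝ) : ℂ) = z * conj z := by
    rw [Complex.mul_conj, Complex.normSq_eq_norm_sq]
  have h3 : e θ * conj (e θ) = 1 := by
    rw [Complex.mul_conj, Complex.normSq_eq_norm_sq, norm_e]; simp
  rw [P, ofReal_div, h1, ofReal_sub, h2, map_div₀]
  field_simp
  rw [map_sub] at *
  simp only [ofReal_one]
  linear_combination (-1) * h3

lemma P_re {z : ℂ} (hz : z ∈ uDisc) (θ : ℝ) : P z θ = (circleKernel z θ).re := by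
  have h0 := e_sub_ne hz θ
  have h1 : circleKernel z θ = e θ / (e θ - z) + e θ / (e θ - z) - 1 := by
    unfold circleKernel
    change (e θ + z) / (e θ - z) = _
    field_simp
    ring
  have h2 := congrArg Complex.re (P_eq hz θ)
  rw [ofReal_re, ← conj_kernel hz] at h2
  rw [h2, h1, sub_re, sub_re, add_re, add_re, Complex.conj_re]

lemma P_nonneg {z : ℂ} (hz : z ∈ uDisc) (θ : ℝ) : 0 ≤ P z θ := by
  have := mem_uDisc.1 hz
  have h : 0 ≤ 1 - ‖z‖ ^ 2 := by nlinarith [norm_nonneg z]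
  unfold P; positivity

lemma norm_sub_ge (z : ℂ) (θ : ℝ) : 1 - ‖z‖ ≤ ‖e θ - z‖ := by
  have := norm_sub_norm_le (e θ) z
  rwa [norm_e] at this

lemma P_le {z : ℂ} (hz : z ∈ uDisc) (θ : ℝ) : P z θ ≤ 2 / (1 - ‖z‖) := by
  have h1 := mem_uDisc.1 hz
  have h2 := norm_sub_ge z θ
  have h3 : 0 < 1 - ‖z‖ := by linarith
  have h4 : 0 < ‖e θ - z‖ := by linarith
  rw [P, div_le_div_iff₀ (by positivity) h3]
  nlinarith [norm_nonneg z, mul_le_mul h2 h2 h3.le (norm_nonneg (e θ - z))]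

lemma continuous_kernel {z : ℂ} (hz : z ∈ uDisc) : Continuous fun θ => e θ / (e θ - z) :=
  continuous_e.div (continuous_e.sub continuous_const) (e_sub_ne hz)

lemma continuous_P {z : ℂ} (hz : z ∈ uDisc) : Continuous (P z) := by
  unfold P
  exact continuous_const.div (((continuous_e.sub continuous_const).norm).pow 2)
    fun θ => by have := norm_pos_iff.2 (e_sub_ne hz θ); positivity

lemma continuous_circleKernel {z : ℂ} (hz : z ∈ uDisc) : Continuous (circleKernel z) :=
  (continuous_e.add continuous_const).div (continuous_e.sub continuous_const) (e_sub_ne hz)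

lemma conj_cauchy_sq {g : ℂ → ℂ} (hg : DiffContOnCl ℂ g (ball 0 1)) {z : ℂ} (hz : z ∈ uDisc) :
    ∫ θ, conj (g (e θ)) * (e θ / (e θ - z) ^ 2) ∂nu = 0 := by
  have hd := diffContOnCl_const_mul_id hz
  have hid : DiffContOnCl ℂ (fun t : ℂ => t) (ball 0 1) := differentiable_id.diffContOnCl
  have h := mean_value (hg.smul (hid.smul (hd.smul hd)))
  have h2 := congrArg conj h
  rw [← integral_conj] at h2
  simp only [smul_eq_mul, map_mul, zero_mul, mul_zero, map_zero] at h2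
  rw [← h2]
  congr 1; ext θ
  rw [← conj_kernel hz, Complex.conj_conj, conj_e]
  have := e_ne_zero θ
  have := e_sub_ne hz θ
  field_simp

lemma deriv_formula {g : ℂ → ℂ} {R : ℝ} (hR : 1 < R) (hg : DifferentiableOn ℂ g (ball 0 R))
    {z : ℂ} (hz : z ∈ uDisc) :
    ∫ θ, g (e θ) * (e θ / (e θ - z) ^ 2) ∂nu = deriv g z := by
  have h := Complex.two_pi_I_inv_smul_circleIntegral_sub_sq_inv_smul_of_differentiable
    isOpen_ball (closedBall_subset_ball hR) hg (w₀ := z) (by simpa using mem_uDisc.1 hz)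
  rw [← h, integral_nu, circleIntegral]
  simp only [circleMap_one, deriv_circleMap, smul_eq_mul, real_smul]
  rw [← intervalIntegral.integral_const_mul, ← intervalIntegral.integral_const_mul]
  congr 1; ext θ
  push_cast
  have := Real.pi_ne_zero
  have : (Real.pi : ℂ) ≠ 0 := by exact_mod_cast this
  have h2 := e_sub_ne hz θ
  field_simp

lemma poisson_formula {g : ℂ → ℂ} (hg : DiffContOnCl ℂ g (ball 0 1)) {z : ℂ} (hz : z ∈ uDisc) :
    ∫ θ, (P z θ : ℂ) * g (e θ) ∂nu = g z := by
  have h1 := cauchy_formula hg hz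
  have h2 := mean_value (hg.smul (diffContOnCl_const_mul_id hz))
  have h3 := mean_value hg
  have c0 := continuous_comp_e hg.contClosed
  have c1 : Integrable (fun θ => g (e θ) * (e θ / (e θ - z))) nu :=
    integrable_of_continuous (c0.mul (continuous_kernel hz))
  have c2 : Integrable (fun θ => g (e θ) • (1 - conj z * e θ)⁻¹) nu :=
    integrable_of_continuous (c0.smul (continuous_comp_e (diffContOnCl_const_mul_id hz).contClosed))
  have c3 : Integrable (fun θ => g (e θ)) nu := integrable_of_continuous c0
  have : ∀ θ, (P z θ : ℂ) * g (e θ) = g (e θ) * (e θ / (e θ - z)) +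
      g (e θ) • (1 - conj z * e θ)⁻¹ - g (e θ) := fun θ => by
    rw [P_eq hz, smul_eq_mul]; ring
  simp only [this]
  have c12 : Integrable (fun θ => g (e θ) * (e θ / (e θ - z)) + g (e θ) • (1 - conj z * e θ)⁻¹) nu :=
    c1.add c2
  rw [integral_sub c12 c3, integral_add c1 c2, h1, h2, h3]
  simp

lemma integral_P {z : ℂ} (hz : z ∈ uDisc) : ∫ θ, P z θ ∂nu = 1 := by
  have := poisson_formula (g := fun _ => 1) diffContOnCl_const hz
  simp only [mul_one] at this
  rw [← Complex.ofReal_inj, ofReal_one, ← this]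
  exact (integral_ofReal (𝕜 := ℂ)).symm

/-- Dilations of functions analytic on the disc. -/
lemma dilate_differentiableOn {f : ℂ → ℂ} (hf : DifferentiableOn ℂ f uDisc) {r : ℝ} (h0 : 0 < r) :
    DifferentiableOn ℂ (fun z => f (r * z)) (ball 0 (1 / r)) := by
  refine hf.comp (by fun_prop) fun z hz => ?_
  rw [mem_ball_zero_iff, lt_div_iff₀ h0] at hz
  rw [mem_uDisc, norm_mul, Complex.norm_real, Real.norm_of_nonneg h0.le]
  linarith

lemma dilate_diffContOnCl {f : ℂ → ℂ} (hf : DifferentiableOn ℂ f uDisc) {r : ℝ} (h0 : 0 < r)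
    (h1 : r < 1) : DiffContOnCl ℂ (fun z => f (r * z)) (ball 0 1) := by
  have h := dilate_differentiableOn hf h0
  have hR : 1 < 1 / r := (one_lt_div h0).2 h1
  apply DifferentiableOn.diffContOnCl
  rw [closure_ball _ one_ne_zero]
  exact h.mono (closedBall_subset_ball hR)

lemma dilate_deriv {f : ℂ → ℂ} (hf : DifferentiableOn ℂ f uDisc) {r : ℝ} {z : ℂ}
    (hz : (r : ℂ) * z ∈ uDisc) : deriv (fun z => f (r * z)) z = r * deriv f (r * z) := by
  have h2 : HasDerivAt (fun z : ℂ => (r : ℂ) * z) (r : ℂ) z := by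
    simpa using (hasDerivAt_id z).const_mul (r : ℂ)
  have := (hasDerivAt_of_mem hf hz).comp z h2
  rw [mul_comm]
  exact this.deriv

lemma cauchy_kernel_dyadic {η x : ℝ} (hη : 0 < η) (K : ℕ) :
    η / (η ^ 2 + x ^ 2) ≤ 4 / η * (∑ k ∈ Finset.range K,
      (4 : ℝ)⁻¹ ^ k * (if |x| ≤ 2 ^ k * η then 1 else 0) + (4 : ℝ)⁻¹ ^ K) := by
  induction K with
  | zero =>
    simp only [Finset.range_zero, Finset.sum_empty, pow_zero, zero_add, mul_one]
    rw [div_le_div_iff₀ (by positivity) hη]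
    nlinarith [sq_nonneg x, sq_nonneg η]
  | succ K ih =>
    rw [Finset.sum_range_succ]
    by_cases h : |x| ≤ 2 ^ K * η
    · rw [if_pos h]
      refine ih.trans ?_
      have : (0 : ℝ) ≤ (4 : ℝ)⁻¹ ^ (K + 1) := by positivity
      exact mul_le_mul_of_nonneg_left (by linarith) (by positivity)
    · rw [if_neg h]
      push Not at h
      have h1 : (2 ^ K * η) ^ 2 ≤ x ^ 2 := by
        rw [← sq_abs x]; gcongr
      have h2 : η / (η ^ 2 + x ^ 2) ≤ 4 / η * (4 : ℝ)⁻¹ ^ (K + 1) := by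
        have h3 : (4 : ℝ)⁻¹ ^ (K + 1) = 4⁻¹ * ((2 : ℝ) ^ K ^ 1 * 2 ^ K)⁻¹ := by
          rw [pow_succ, pow_one, ← mul_pow, mul_comm, inv_pow]; norm_num
        rw [h3, pow_one, div_le_iff₀ (by positivity)]
        field_simp
        nlinarith [sq_nonneg η, pow_pos (two_pos (α := ℝ)) K]
      have h4 : 0 ≤ ∑ k ∈ Finset.range K,
        (4 : ℝ)⁻¹ ^ k * (if |x| ≤ 2 ^ k * η then (1 : ℝ) else 0) :=
        Finset.sum_nonneg fun k _ => by positivity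
      refine h2.trans ?_
      gcongr
      linarith

lemma tendsto_cauchy_kernel {μ : Measure ℝ} {w : ℝ → ℝ} (hw : Integrable w μ)
    (hw0 : ∀ s, 0 ≤ w s) {θ : ℝ}
    (h : ∀ ε > 0, ∃ h0 > 0, ∀ h, 0 < h → h < h0 → ∫ s in closedBall θ h, w s ∂μ ≤ ε * h) :
    Tendsto (fun η => ∫ s, η / (η ^ 2 + (s - θ) ^ 2) * w s ∂μ) (nhdsWithin 0 (Ioi 0)) (nhds 0) := by
  have hA : 0 ≤ ∫ s, w s ∂μ := integral_nonneg hw0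
  set A := ∫ s, w s ∂μ
  have key : ∀ ε > 0, ∃ h0 > 0, ∀ η > 0,
      ∫ s, η / (η ^ 2 + (s - θ) ^ 2) * w s ∂μ ≤ 8 * ε + 4 * A / h0 ^ 2 * η := by
    intro ε hε
    obtain ⟨h0, hh0, hb⟩ := h ε hε
    refine ⟨h0, hh0, fun η hη => ?_⟩
    have hex : ∃ K : ℕ, h0 ≤ 2 ^ K * η := by
      obtain ⟨K, hK⟩ := pow_unbounded_of_one_lt (h0 / η) (one_lt_two (α := ℝ))
      exact ⟨K, by rw [div_lt_iff₀ hη] at hK; exact hK.le⟩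
    set K := Nat.find hex
    have hK : h0 ≤ 2 ^ K * η := Nat.find_spec hex
    have hK' : ∀ k < K, 2 ^ k * η < h0 := fun k hk => by
      have := Nat.find_min hex hk; push Not at this; exact this
    have hind : ∀ k s, w s * (if |s - θ| ≤ 2 ^ k * η then (1 : ℝ) else 0) =
        (closedBall θ (2 ^ k * η)).indicator w s := fun k s => by
      simp only [indicator, mem_closedBall, Real.dist_eq]
      split_ifs <;> simp
    have hint : ∀ k : ℕ, Integrable (fun s => (closedBall θ (2 ^ k * η)).indicator w s) μ :=
      fun k => hw.indicator measurableSet_closedBall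
    have hint2 : Integrable (fun s => 4 / η * (∑ k ∈ Finset.range K,
      (4 : ℝ)⁻¹ ^ k * (closedBall θ (2 ^ k * η)).indicator w s + (4 : ℝ)⁻¹ ^ K * w s)) μ :=
      ((integrable_finsetSum _ fun k _ => (hint k).const_mul _).add (hw.const_mul _)).const_mul _
    calc ∫ s, η / (η ^ 2 + (s - θ) ^ 2) * w s ∂μ
        ≤ ∫ s, 4 / η * (∑ k ∈ Finset.range K,
      (4 : ℝ)⁻¹ ^ k * (closedBall θ (2 ^ k * η)).indicator w s + (4 : ℝ)⁻¹ ^ K * w s) ∂μ := by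
          refine integral_mono_of_nonneg (ae_of_all _ fun s => ?_) hint2 (ae_of_all _ fun s => ?_)
          · have := hw0 s
            simp only [Pi.zero_apply]; positivity
          · refine (mul_le_mul_of_nonneg_right (cauchy_kernel_dyadic hη K) (hw0 s)).trans_eq ?_
            simp only [← hind]
            rw [mul_assoc, add_mul, Finset.sum_mul]
            congr 2
            exact Finset.sum_congr rfl fun k _ => by ring
      _ = 4 / η * (∑ k ∈ Finset.range K,
          (4 : ℝ)⁻¹ ^ k * (∫ s in closedBall θ (2 ^ k * η), w s ∂μ) + (4 : ℝ)⁻¹ ^ K * A) := by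
          rw [integral_const_mul, integral_add
            (integrable_finsetSum _ fun k _ => (hint k).const_mul _) (hw.const_mul _),
            integral_finsetSum _ fun k _ => (hint k).const_mul _, integral_const_mul]
          simp only [integral_const_mul, integral_indicator measurableSet_closedBall]
          rfl
      _ ≤ 4 / η * (2 * ε * η + η ^ 2 / h0 ^ 2 * A) := by
          gcongr
          · calc ∑ k ∈ Finset.range K, (4 : ℝ)⁻¹ ^ k * (∫ s in closedBall θ (2 ^ k * η), w s ∂μ)
                ≤ ∑ k ∈ Finset.range K, (2 : ℝ)⁻¹ ^ k * (ε * η) := by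
                  refine Finset.sum_le_sum fun k hk => ?_
                  have h1 := hb (2 ^ k * η) (by positivity) (hK' k (Finset.mem_range.1 hk))
                  refine (mul_le_mul_of_nonneg_left h1 (by positivity)).trans_eq ?_
                  have : (4 : ℝ)⁻¹ ^ k * 2 ^ k = 2⁻¹ ^ k := by rw [← mul_pow]; norm_num
                  linear_combination (ε * η) * this
              _ = (∑ k ∈ Finset.range K, (2 : ℝ)⁻¹ ^ k) * (ε * η) := by rw [Finset.sum_mul]
              _ ≤ 2 * (ε * η) := by
                  gcongr
                  rw [geom_sum_eq (by norm_num)]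
                  have : (0 : ℝ) ≤ 2⁻¹ ^ K := by positivity
                  rw [div_le_iff_of_neg (by norm_num)]
                  norm_num at *
              _ = 2 * ε * η := by ring
          · rw [le_div_iff₀ (by positivity)]
            calc (4 : ℝ)⁻¹ ^ K * h0 ^ 2 ≤ (4 : ℝ)⁻¹ ^ K * (2 ^ K * η) ^ 2 := by gcongr
              _ = η ^ 2 * ((4 : ℝ)⁻¹ * (2 * 2)) ^ K := by rw [mul_pow, mul_pow, mul_pow]; ring
              _ = η ^ 2 := by norm_num
      _ = 8 * ε + 4 * A / h0 ^ 2 * η := by field_simp; ring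
  rw [Metric.tendsto_nhdsWithin_nhds]
  intro ε hε
  obtain ⟨h0, hh0, hb⟩ := key (ε / 16) (by positivity)
  refine ⟨ε / 4 / (4 * A / h0 ^ 2 + 1), by positivity, fun η hη hd => ?_⟩
  have hη : 0 < η := hη
  rw [Real.dist_eq, sub_zero, abs_of_pos hη, lt_div_iff₀ (by positivity)] at hd
  rw [Real.dist_eq, sub_zero, abs_of_nonneg (integral_nonneg fun s => by have := hw0 s; positivity)]
  have := hb η hη
  nlinarith

lemma e_eq_of_mem {θ s : ℝ} (hθ : θ ∈ Ioo 0 (2 * Real.pi)) (hs : s ∈ Icc 0 (2 * Real.pi))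
    (h : e s = e θ) : s = θ := by
  unfold e at h
  rw [Complex.exp_eq_exp_iff_exists_int] at h
  obtain ⟨n, hn⟩ := h
  have h2 : (s : ℂ) = ((θ + n * (2 * Real.pi) : ℝ) : ℂ) := by
    have := mul_right_cancel₀ Complex.I_ne_zero
      (show (s : ℂ) * Complex.I = (θ + n * (2 * Real.pi)) * Complex.I by rw [hn]; ring)
    rw [this]; push_cast; ring
  have h3 : s = θ + n * (2 * Real.pi) := by exact_mod_cast h2
  have hp := Real.pi_pos
  have h4 : (-1 : ℝ) < n := by
    by_contra hc; push Not at hc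
    nlinarith [hθ.2, hs.1]
  have h5 : (n : ℝ) < 1 := by
    by_contra hc; push Not at hc
    nlinarith [hθ.1, hs.2]
  have h6 : n = 0 := by
    have h7 : (-1 : ℤ) < n := by exact_mod_cast h4
    have h8 : n < (1 : ℤ) := by exact_mod_cast h5
    omega
  rw [h3, h6]; simp

lemma hasDerivAt_e (θ : ℝ) : HasDerivAt e (Complex.I * e θ) θ := by
  have h1 : HasDerivAt (fun x : ℝ => (x : ℂ) * Complex.I) (1 * Complex.I) θ :=
    (HasDerivAt.ofReal_comp (hasDerivAt_id θ)).mul_const _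
  have := h1.cexp
  unfold e
  convert this using 1
  ring

lemma exists_chord_ge {θ : ℝ} (hθ : θ ∈ Ioo 0 (2 * Real.pi)) :
    ∃ c > 0, ∀ s ∈ Icc 0 (2 * Real.pi), c * |s - θ| ≤ ‖e s - e θ‖ := by
  have hc : ContinuousOn (fun s => ‖dslope e θ s‖) (Icc 0 (2 * Real.pi)) := by
    refine Continuous.continuousOn (Continuous.norm ?_)
    rw [continuous_iff_continuousAt]
    intro s
    rcases eq_or_ne s θ with rfl | h
    · exact continuousAt_dslope_same.2 (hasDerivAt_e s).differentiableAt
    · exact (continuousAt_dslope_of_ne h).2 continuous_e.continuousAt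
  obtain ⟨s0, hs0, hmin⟩ := isCompact_Icc.exists_isMinOn (nonempty_Icc.2 Real.two_pi_pos.le) hc
  refine ⟨‖dslope e θ s0‖, ?_, fun s hs => ?_⟩
  · rw [gt_iff_lt, norm_pos_iff]
    rcases eq_or_ne s0 θ with rfl | h
    · rw [dslope_same, (hasDerivAt_e s0).deriv]
      exact mul_ne_zero Complex.I_ne_zero (e_ne_zero _)
    · rw [dslope_of_ne _ h, slope_def_module]
      refine smul_ne_zero (inv_ne_zero (sub_ne_zero.2 h)) (sub_ne_zero.2 fun h' => h ?_)
      exact e_eq_of_mem hθ hs0 h'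
  · have := sub_smul_dslope e θ s
    rw [← this, norm_smul, Real.norm_eq_abs, mul_comm]
    gcongr
    exact hmin hs

lemma exists_P_le {θ : ℝ} (hθ : θ ∈ Ioo 0 (2 * Real.pi)) :
    ∃ C > 0, ∀ r : ℝ, 0 ≤ r → r < 1 → ∀ s ∈ Ioc 0 (2 * Real.pi),
      P (r * e θ) s ≤ C * ((1 - r) / ((1 - r) ^ 2 + (s - θ) ^ 2)) := by
  obtain ⟨c, hc, hb⟩ := exists_chord_ge hθ
  set d := min 1 (c ^ 2 / 4)
  have hd : 0 < d := by positivity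
  refine ⟨4 / d, by positivity, fun r h0 h1 s hs => ?_⟩
  have hn : ‖(r : ℂ) * e θ‖ = r := by
    rw [norm_mul, norm_e, Complex.norm_real, Real.norm_of_nonneg h0, mul_one]
  have g1 : 1 - r ≤ ‖e s - r * e θ‖ := by
    have := norm_sub_ge ((r : ℂ) * e θ) s
    rwa [hn] at this
  have g2 : c * |s - θ| ≤ 2 * ‖e s - r * e θ‖ := by
    refine (hb s (Ioc_subset_Icc_self hs)).trans ?_
    calc ‖e s - e θ‖ = ‖(e s - r * e θ) - ((1 - r : ℝ) : ℂ) * e θ‖ := by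
          congr 1; push_cast; ring
      _ ≤ ‖e s - r * e θ‖ + ‖((1 - r : ℝ) : ℂ) * e θ‖ := norm_sub_le _ _
      _ = ‖e s - r * e θ‖ + (1 - r) := by
          rw [norm_mul, norm_e, Complex.norm_real, Real.norm_of_nonneg (by linarith), mul_one]
      _ ≤ _ := by linarith
  set N := ‖e s - r * e θ‖
  have hN : 0 < N := by linarith
  have h3 : d * ((1 - r) ^ 2 + (s - θ) ^ 2) ≤ 2 * N ^ 2 := by
    have a1 : (1 - r) ^ 2 ≤ N ^ 2 := by gcongr
    have a2 : (c * |s - θ|) ^ 2 ≤ (2 * N) ^ 2 := by gcongr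
    rw [mul_pow, sq_abs] at a2
    have a3 : d ≤ 1 := min_le_left _ _
    have a4 : d ≤ c ^ 2 / 4 := min_le_right _ _
    nlinarith [mul_le_mul_of_nonneg_right a3 (sq_nonneg (1 - r)),
      mul_le_mul_of_nonneg_right a4 (sq_nonneg (s - θ))]
  have h4 : 0 < (1 - r) ^ 2 + (s - θ) ^ 2 := by
    have : 0 < 1 - r := by linarith
    positivity
  rw [P, hn, ← mul_div_assoc, div_le_div_iff₀ (by positivity) h4, div_mul_eq_mul_div,
    div_mul_eq_mul_div, le_div_iff₀ hd]
  have h5 : 1 - r ^ 2 ≤ 2 * (1 - r) := by nlinarith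
  have h6 : 0 ≤ 1 - r ^ 2 := by nlinarith
  nlinarith [mul_le_mul h5 h3 (by positivity) (by linarith)]

lemma integrable_nu_iff {E : Type*} [NormedAddCommGroup E] {v : ℝ → E} :
    Integrable v nu ↔ IntegrableOn v (Ioc 0 (2 * Real.pi)) :=
  integrable_smul_measure (ENNReal.inv_ne_zero.2 ENNReal.ofReal_ne_top)
    (ENNReal.inv_ne_top.2 (by simpa using Real.pi_pos))

/-- Fatou's theorem for Poisson integrals. -/
lemma fatou {E : Type*} [NormedAddCommGroup E] [NormedSpace ℝ E] [CompleteSpace E] {v : ℝ → E}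
    (hv : Integrable v nu) :
    ∀ᵐ θ ∂nu, Tendsto (fun r : ℝ => ∫ s, P (r * e θ) s • v s ∂nu) (nhdsWithin 1 (Iio 1))
      (nhds (v θ)) := by
  have hv' := integrable_nu_iff.1 hv
  have hloc : LocallyIntegrable ((Ioc 0 (2 * Real.pi)).indicator v) volume :=
    ((integrable_indicator_iff measurableSet_Ioc).2 hv').locallyIntegrable
  have hL := IsUnifLocDoublingMeasure.ae_tendsto_average_norm_sub volume hloc 1
  have hne : ∀ᵐ θ : ℝ ∂volume, θ ≠ 2 * Real.pi := by
    simp [ae_iff, measure_singleton]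
  rw [ae_nu, ae_restrict_iff' measurableSet_Ioc]
  filter_upwards [hL, hne] with θ hθ hθ2 hmem
  have hθ' : θ ∈ Ioo 0 (2 * Real.pi) := ⟨hmem.1, lt_of_le_of_ne hmem.2 hθ2⟩
  have hθ3 := hθ (fun _ : ℝ => θ) (fun h => h) (l := nhdsWithin 0 (Ioi 0)) tendsto_id
    (eventually_mem_nhdsWithin.mono fun h hh => by
      have : (0 : ℝ) < h := hh
      simp [this.le])
  rw [indicator_of_mem hmem] at hθ3
  set w : ℝ → ℝ := fun s => ‖v s - v θ‖
  have hw : Integrable w (volume.restrict (Ioc 0 (2 * Real.pi))) := (hv'.sub (integrable_const _)).norm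
  have hk := tendsto_cauchy_kernel hw (fun s => norm_nonneg _) (θ := θ) (by
    intro ε hε
    have := (Metric.tendsto_nhdsWithin_nhds.1 hθ3) (ε / 2) (by positivity)
    obtain ⟨h0, hh0, hb⟩ := this
    refine ⟨h0, hh0, fun h hp hlt => ?_⟩
    have hb1 := hb (show h ∈ Ioi 0 from hp) (by simpa [abs_of_pos hp] using hlt)
    rw [Real.dist_eq, sub_zero, setAverage_eq, measureReal_def, Real.volume_closedBall,
      ENNReal.toReal_ofReal (by positivity), smul_eq_mul] at hb1
    have hb2 := (le_abs_self _).trans hb1.le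
    rw [inv_mul_le_iff₀ (by positivity)] at hb2
    rw [Measure.restrict_restrict measurableSet_closedBall]
    have hlocb : IntegrableOn (fun y => ‖(Ioc 0 (2 * Real.pi)).indicator v y - v θ‖)
        (closedBall θ h) := by
      refine (IntegrableOn.sub ?_ ?_).norm
      · exact ((integrable_indicator_iff measurableSet_Ioc).2 hv').integrableOn
      · exact integrableOn_const measure_closedBall_lt_top.ne
    calc ∫ s in closedBall θ h ∩ Ioc 0 (2 * Real.pi), w s
        = ∫ s in closedBall θ h ∩ Ioc 0 (2 * Real.pi),
          ‖(Ioc 0 (2 * Real.pi)).indicator v s - v θ‖ :=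
          setIntegral_congr_fun (measurableSet_closedBall.inter measurableSet_Ioc) fun s hs => by
            simp only [w]; rw [indicator_of_mem hs.2]
      _ ≤ ∫ s in closedBall θ h, ‖(Ioc 0 (2 * Real.pi)).indicator v s - v θ‖ :=
          setIntegral_mono_set hlocb (ae_of_all _ fun s => norm_nonneg _)
            inter_subset_left.eventuallyLE
      _ ≤ ε * h := by linarith)
  obtain ⟨C, hC, hP⟩ := exists_P_le hθ'
  have hsub : Tendsto (fun r : ℝ => 1 - r) (nhdsWithin 1 (Iio 1)) (nhdsWithin 0 (Ioi 0)) := by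
    refine tendsto_nhdsWithin_iff.2 ⟨?_, eventually_mem_nhdsWithin.mono fun r hr => ?_⟩
    · have : Tendsto (fun r : ℝ => 1 - r) (nhds 1) (nhds (1 - 1)) := by
        exact (continuous_const.sub continuous_id).tendsto 1
      rw [sub_self] at this
      exact this.mono_left nhdsWithin_le_nhds
    · exact sub_pos.2 (show r < 1 from hr)
  have hk2 := ((hk.comp hsub).const_mul ((2 * Real.pi)⁻¹ * C))
  rw [mul_zero] at hk2
  rw [tendsto_iff_norm_sub_tendsto_zero]
  refine squeeze_zero' (Eventually.of_forall fun _ => norm_nonneg _) ?_ hk2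
  have hr0 : ∀ᶠ r : ℝ in nhdsWithin 1 (Iio 1), 0 < r :=
    nhdsWithin_le_nhds (lt_mem_nhds one_pos)
  filter_upwards [hr0, eventually_mem_nhdsWithin] with r h0 h1
  have h1 : r < 1 := h1
  have hz : (r : ℂ) * e θ ∈ uDisc := by
    rw [mem_uDisc, norm_mul, norm_e, Complex.norm_real, Real.norm_of_nonneg h0.le, mul_one]
    exact h1
  have hPb : ∀ s, ‖P (r * e θ) s‖ ≤ 2 / (1 - ‖(r : ℂ) * e θ‖) := fun s => by
    rw [Real.norm_of_nonneg (P_nonneg hz s)]; exact P_le hz s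
  have hi1 : Integrable (fun s => P (r * e θ) s • v s) nu :=
    hv.bdd_smul _ (continuous_P hz).aestronglyMeasurable (ae_of_all _ hPb)
  have hi2 : Integrable (fun s => P (r * e θ) s • v θ) nu :=
    (integrable_of_continuous (continuous_P hz)).smul_const _
  have e1 : ∫ s, P (r * e θ) s • v s ∂nu - v θ = ∫ s, P (r * e θ) s • (v s - v θ) ∂nu := by
    simp only [smul_sub]
    rw [integral_sub hi1 hi2, integral_smul_const, integral_P hz, one_smul]
  rw [e1]
  have hi3 : Integrable (fun s => P (r * e θ) s * w s) nu := by
    have := (hv.sub (integrable_const (v θ))).norm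
    exact this.bdd_mul (continuous_P hz).aestronglyMeasurable (ae_of_all _ hPb)
  calc ‖∫ s, P (r * e θ) s • (v s - v θ) ∂nu‖ ≤ ∫ s, ‖P (r * e θ) s • (v s - v θ)‖ ∂nu :=
        norm_integral_le_integral_norm _
    _ = ∫ s, P (r * e θ) s * w s ∂nu := by
        congr 1; ext s; rw [norm_smul, Real.norm_of_nonneg (P_nonneg hz s)]
    _ = (2 * Real.pi)⁻¹ * ∫ s in Ioc 0 (2 * Real.pi), P (r * e θ) s * w s := by
        rw [integral_nu, intervalIntegral.integral_of_le Real.two_pi_pos.le, smul_eq_mul]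
    _ ≤ (2 * Real.pi)⁻¹ * ∫ s in Ioc 0 (2 * Real.pi),
          C * ((1 - r) / ((1 - r) ^ 2 + (s - θ) ^ 2) * w s) := by
        refine mul_le_mul_of_nonneg_left ?_ (by positivity)
        refine setIntegral_mono_on (integrable_nu_iff.1 hi3) ?_ measurableSet_Ioc fun s hs => ?_
        · refine Integrable.const_mul ?_ _
          have hr2 : 0 < 1 - r := by linarith
          refine hw.bdd_mul (c := (1 - r)⁻¹) (Continuous.aestronglyMeasurable ?_)
            (ae_of_all _ fun s => ?_)
          · exact continuous_const.div (by fun_prop) fun s => by positivity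
          · rw [Real.norm_of_nonneg (by positivity), div_le_iff₀ (by positivity),
              inv_mul_eq_div, le_div_iff₀ hr2]
            nlinarith [sq_nonneg (s - θ)]
        · rw [← mul_assoc]
          exact mul_le_mul_of_nonneg_right (hP r h0.le h1 s hs) (norm_nonneg _)
    _ = _ := by rw [integral_const_mul, ← mul_assoc]; rfl

lemma norm_herglotz_le {w z : ℂ} (hw : 1 ≤ ‖w‖) {r : ℝ} (hr : r < 1) (hz : ‖z‖ ≤ r) :
    ‖(w + z) / (w - z)‖ ≤ 2 / (1 - r) ∧ ‖2 * w / (w - z) ^ 2‖ ≤ 2 / (1 - r) ^ 2 := by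
  have h1 : ‖w‖ - r ≤ ‖w - z‖ := by
    have := norm_sub_norm_le w z; linarith
  have h2 : 0 < 1 - r := by linarith
  have h3 : 0 < ‖w - z‖ := by linarith
  have h0 := norm_nonneg z
  constructor
  · rw [norm_div, div_le_div_iff₀ h3 h2]
    have := norm_add_le w z
    nlinarith [norm_nonneg w]
  · rw [norm_div, norm_mul, norm_pow, div_le_div_iff₀ (by positivity) (by positivity)]
    have h4 : (‖w‖ - r) ^ 2 ≤ ‖w - z‖ ^ 2 := by gcongr; linarith
    have h5 : ‖w‖ * (1 - r) ^ 2 ≤ (‖w‖ - r) ^ 2 := by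
      nlinarith [mul_nonneg (sub_nonneg.2 hw) (by nlinarith : (0:ℝ) ≤ ‖w‖ - r ^ 2)]
    simp only [Complex.norm_ofNat]
    nlinarith

lemma sub_ne_of_one_le {w z : ℂ} (hw : 1 ≤ ‖w‖) (hz : z ∈ uDisc) : w - z ≠ 0 := by
  intro h
  rw [sub_eq_zero.1 h] at hw
  exact absurd (mem_uDisc.1 hz) (by linarith)

lemma herglotz_hasDerivAt {w : ℝ → ℂ} (hw : Continuous w) (hw1 : ∀ s, 1 ≤ ‖w s‖) {v : ℝ → ℂ}
    (hv : Integrable v nu) {z : ℂ} (hz : z ∈ uDisc) :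
    HasDerivAt (fun z => ∫ s, (w s + z) / (w s - z) * v s ∂nu)
      (∫ s, 2 * w s / (w s - z) ^ 2 * v s ∂nu) z := by
  obtain ⟨r, hzr, hr1⟩ := exists_between (mem_uDisc.1 hz)
  have hball : ball (0 : ℂ) r ∈ nhds z := isOpen_ball.mem_nhds (by simpa using hzr)
  have hsub : ∀ x ∈ ball (0 : ℂ) r, x ∈ uDisc := fun x hx => by
    rw [mem_ball_zero_iff] at hx; exact mem_uDisc.2 (hx.trans hr1)
  have hm : ∀ x ∈ uDisc, Continuous fun s => (w s + x) / (w s - x) := fun x hx =>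
    (hw.add continuous_const).div (hw.sub continuous_const) fun s => sub_ne_of_one_le (hw1 s) hx
  have hm' : Continuous fun s => 2 * w s / (w s - z) ^ 2 :=
    (continuous_const.mul hw).div ((hw.sub continuous_const).pow 2)
      fun s => pow_ne_zero 2 (sub_ne_of_one_le (hw1 s) hz)
  refine (hasDerivAt_integral_of_dominated_loc_of_deriv_le (F := fun z s => (w s + z) / (w s - z) * v s)
    (F' := fun z s => 2 * w s / (w s - z) ^ 2 * v s) (bound := fun s => 2 / (1 - r) ^ 2 * ‖v s‖)
    hball ?_ ?_ ?_ ?_ ?_ ?_).2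
  · filter_upwards [hball] with x hx
    exact ((hm x (hsub x hx)).aestronglyMeasurable).mul hv.aestronglyMeasurable
  · refine hv.bdd_mul (c := 2 / (1 - r)) (hm z hz).aestronglyMeasurable (ae_of_all _ fun s => ?_)
    exact (norm_herglotz_le (hw1 s) hr1 hzr.le).1
  · exact hm'.aestronglyMeasurable.mul hv.aestronglyMeasurable
  · refine ae_of_all _ fun s x hx => ?_
    rw [norm_mul]
    refine mul_le_mul_of_nonneg_right ?_ (norm_nonneg _)
    exact (norm_herglotz_le (hw1 s) hr1 (by rw [mem_ball_zero_iff] at hx; exact hx.le)).2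
  · exact hv.norm.const_mul _
  · refine ae_of_all _ fun s x hx => ?_
    have hne := sub_ne_of_one_le (hw1 s) (hsub x hx)
    have h1 : HasDerivAt (fun z => (w s + z) / (w s - z))
        ((1 * (w s - x) - (w s + x) * (-1)) / (w s - x) ^ 2) x :=
      ((hasDerivAt_id x).const_add (w s)).div ((hasDerivAt_id x).const_sub (w s)) hne
    have h2 : 2 * w s / (w s - x) ^ 2 * v s =
        (1 * (w s - x) - (w s + x) * (-1)) / (w s - x) ^ 2 * v s := by ring
    rw [h2]
    exact h1.mul_const (v s)

/-- The Poisson integral. -/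
def PI (v : ℝ → ℝ) (z : ℂ) : ℝ := ∫ s, P z s * v s ∂nu

/-- The Herglotz integral. -/
def HI (v : ℝ → ℝ) (z : ℂ) : ℂ := ∫ s, circleKernel z s * (v s : ℂ) ∂nu

lemma HI_differentiableOn {v : ℝ → ℝ} (hv : Integrable v nu) : DifferentiableOn ℂ (HI v) uDisc :=
  fun _ hz => (herglotz_hasDerivAt continuous_e (fun s => (norm_e s).ge) hv.ofReal
    hz).differentiableAt.differentiableWithinAt

lemma integrable_P_mul {v : ℝ → ℝ} (hv : Integrable v nu) {z : ℂ} (hz : z ∈ uDisc) :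
    Integrable (fun s => P z s * v s) nu :=
  hv.bdd_mul (c := 2 / (1 - ‖z‖)) (continuous_P hz).aestronglyMeasurable (ae_of_all _ fun s => by
    rw [Real.norm_of_nonneg (P_nonneg hz s)]; exact P_le hz s)

lemma HI_re {v : ℝ → ℝ} (hv : Integrable v nu) {z : ℂ} (hz : z ∈ uDisc) :
    (HI v z).re = PI v z := by
  have hi : Integrable (fun s => circleKernel z s * (v s : ℂ)) nu :=
    hv.ofReal.bdd_mul (c := 2 / (1 - ‖z‖)) (continuous_circleKernel hz).aestronglyMeasurable
      (ae_of_all _ fun s => (norm_herglotz_le (norm_e s).ge (mem_uDisc.1 hz) le_rfl).1)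
  have := integral_re hi
  simp only [RCLike.re_eq_complex_re] at this
  rw [HI, ← this, PI]
  congr 1; ext s
  rw [P_re hz, Complex.re_mul_ofReal]

lemma PI_mono {v w : ℝ → ℝ} (hv : Integrable v nu) (hw : Integrable w nu) (h : ∀ᵐ s ∂nu, v s ≤ w s)
    {z : ℂ} (hz : z ∈ uDisc) : PI v z ≤ PI w z :=
  integral_mono_ae (integrable_P_mul hv hz) (integrable_P_mul hw hz)
    (h.mono fun s hs => mul_le_mul_of_nonneg_left hs (P_nonneg hz s))

lemma PI_const (c : ℝ) {z : ℂ} (hz : z ∈ uDisc) : PI (fun _ => c) z = c := by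
  rw [PI, integral_mul_const, integral_P hz, one_mul]

lemma PI_add {v w : ℝ → ℝ} (hv : Integrable v nu) (hw : Integrable w nu) {z : ℂ} (hz : z ∈ uDisc) :
    PI (fun s => v s + w s) z = PI v z + PI w z := by
  unfold PI
  rw [← integral_add (integrable_P_mul hv hz) (integrable_P_mul hw hz)]
  simp only [mul_add]

lemma PI_smul (c : ℝ) (v : ℝ → ℝ) (z : ℂ) : PI (fun s => c * v s) z = c * PI v z := by
  unfold PI
  rw [← integral_const_mul]
  congr 1; ext s; ring

lemma PI_nonneg {v : ℝ → ℝ} (h : ∀ s, 0 ≤ v s) {z : ℂ} (hz : z ∈ uDisc) : 0 ≤ PI v z :=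
  integral_nonneg fun s => mul_nonneg (P_nonneg hz s) (h s)

lemma PI_le_of_le {v : ℝ → ℝ} (hv : Integrable v nu) {c : ℝ} (h : ∀ᵐ s ∂nu, v s ≤ c) {z : ℂ}
    (hz : z ∈ uDisc) : PI v z ≤ c := by
  have := PI_mono hv (integrable_const c) h hz
  rwa [PI_const c hz] at this

lemma le_PI_of_le {v : ℝ → ℝ} (hv : Integrable v nu) {c : ℝ} (h : ∀ᵐ s ∂nu, c ≤ v s) {z : ℂ}
    (hz : z ∈ uDisc) : c ≤ PI v z := by
  have := PI_mono (integrable_const c) hv h hz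
  rwa [PI_const c hz] at this

lemma mul_e_mem {r : ℝ} (h0 : 0 ≤ r) (h1 : r < 1) (θ : ℝ) : (r : ℂ) * e θ ∈ uDisc := by
  rw [mem_uDisc, norm_mul, norm_e, Complex.norm_real, Real.norm_of_nonneg h0, mul_one]
  exact h1

lemma continuous_comp_e_circle {V : ℂ → ℝ} (hV : ContinuousOn V uCircle) :
    Continuous fun s => V (e s) := hV.comp_continuous continuous_e e_mem_circle

/-- Poisson integrals of continuous functions converge uniformly to their boundary values. -/
lemma poisson_uniform {V : ℂ → ℝ} (hV : ContinuousOn V uCircle) {ε : ℝ} (hε : 0 < ε) :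
    ∃ ρ0 < 1, ∀ ρ : ℝ, 0 ≤ ρ → ρ0 < ρ → ρ < 1 → ∀ θ,
      |PI (fun s => V (e s)) (ρ * e θ) - V (e θ)| ≤ ε := by
  have hcpt : IsCompact uCircle := isCompact_sphere 0 1
  have huc := hcpt.uniformContinuousOn_of_continuous hV
  rw [Metric.uniformContinuousOn_iff] at huc
  obtain ⟨δ, hδ, huc⟩ := huc (ε / 2) (by positivity)
  obtain ⟨M, hM⟩ := hcpt.exists_bound_of_continuousOn hV
  have hM0 : 0 ≤ M := (norm_nonneg _).trans (hM _ (e_mem_circle 0))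
  set κ := min (δ / 2) (δ ^ 2 * ε / (16 * 2 * (M + 1)))
  have hκ : 0 < κ := by positivity
  refine ⟨1 - κ, by linarith, fun ρ h0 h1 h2 θ => ?_⟩
  have hz := mul_e_mem h0 h2 θ
  have hVc := continuous_comp_e_circle hV
  have hVi : Integrable (fun s => V (e s)) nu := integrable_of_continuous hVc
  have hk1 : 1 - ρ < δ / 2 := by
    have : κ ≤ δ / 2 := min_le_left _ _
    linarith
  have hk2 : (1 - ρ) * (16 * 2 * (M + 1)) ≤ δ ^ 2 * ε := by
    have : κ ≤ _ := min_le_right _ _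
    rw [← le_div_iff₀ (by positivity)]; linarith
  have hn : ‖(ρ : ℂ) * e θ‖ = ρ := by
    rw [norm_mul, norm_e, Complex.norm_real, Real.norm_of_nonneg h0, mul_one]
  have hpt : ∀ s, P (ρ * e θ) s * |V (e s) - V (e θ)| ≤ P (ρ * e θ) s * (ε / 2) + ε / 2 := by
    intro s
    have hP := P_nonneg hz s
    by_cases hs : dist (e s) (e θ) < δ
    · have := huc _ (e_mem_circle s) _ (e_mem_circle θ) hs
      rw [Real.dist_eq] at this
      nlinarith
    · push Not at hs
      have hd : δ / 2 ≤ ‖e s - ρ * e θ‖ := by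
        have : ‖e s - e θ‖ ≤ ‖e s - ρ * e θ‖ + (1 - ρ) := by
          calc ‖e s - e θ‖ = ‖(e s - ρ * e θ) - ((1 - ρ : ℝ) : ℂ) * e θ‖ := by
                congr 1; push_cast; ring
            _ ≤ ‖e s - ρ * e θ‖ + ‖((1 - ρ : ℝ) : ℂ) * e θ‖ := norm_sub_le _ _
            _ = _ := by
              rw [norm_mul, norm_e, Complex.norm_real, Real.norm_of_nonneg (by linarith), mul_one]
        rw [dist_eq_norm] at hs
        linarith
      have hb : |V (e s) - V (e θ)| ≤ 2 * M := by
        have h3 := hM _ (e_mem_circle s)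
        have h4 := hM _ (e_mem_circle θ)
        rw [Real.norm_eq_abs] at h3 h4
        have := abs_sub (V (e s)) (V (e θ))
        linarith
      have hPb : P (ρ * e θ) s * (2 * M) ≤ ε / 2 := by
        have hd2 : (δ / 2) ^ 2 ≤ ‖e s - ρ * e θ‖ ^ 2 := by gcongr
        rw [P, hn, div_mul_eq_mul_div, div_le_iff₀ (by nlinarith)]
        have h5 : (1 - ρ ^ 2) ≤ 2 * (1 - ρ) := by nlinarith
        nlinarith
      have h6 : 0 ≤ P (ρ * e θ) s * (ε / 2) := by positivity
      have := mul_le_mul_of_nonneg_left hb hP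
      linarith
  have hi1 := integrable_P_mul hVi hz
  have hi2 : Integrable (fun s => P (ρ * e θ) s * V (e θ)) nu :=
    (integrable_of_continuous (continuous_P hz)).mul_const _
  have e1 : PI (fun s => V (e s)) (ρ * e θ) - V (e θ) =
      ∫ s, P (ρ * e θ) s * (V (e s) - V (e θ)) ∂nu := by
    simp only [mul_sub]
    rw [integral_sub hi1 hi2, integral_mul_const, integral_P hz, one_mul, PI]
  rw [e1]
  calc |∫ s, P (ρ * e θ) s * (V (e s) - V (e θ)) ∂nu|
      ≤ ∫ s, |P (ρ * e θ) s * (V (e s) - V (e θ))| ∂nu := abs_integral_le_integral_abs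
    _ ≤ ∫ s, (P (ρ * e θ) s * (ε / 2) + ε / 2) ∂nu := by
        refine integral_mono_of_nonneg (ae_of_all _ fun s => abs_nonneg _) ?_
          (ae_of_all _ fun s => ?_)
        · exact ((integrable_of_continuous (continuous_P hz)).mul_const _).add (integrable_const _)
        · simp only
          rw [abs_mul, abs_of_nonneg (P_nonneg hz s)]
          exact hpt s
    _ = ε := by
        rw [integral_add ((integrable_of_continuous (continuous_P hz)).mul_const _)
          (integrable_const _), integral_mul_const, integral_P hz]
        simp

lemma tendsto_dilate_disc {E : Type*} [TopologicalSpace E] {g : ℂ → E} {z : ℂ}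
    (hg : ContinuousAt g z) :
    Tendsto (fun r : ℝ => g (r * z)) (nhdsWithin 1 (Iio 1)) (nhds (g z)) := by
  have h1 : Tendsto (fun r : ℝ => (r : ℂ) * z) (nhds 1) (nhds ((1 : ℝ) * z)) :=
    (Complex.continuous_ofReal.mul continuous_const).tendsto 1
  rw [ofReal_one, one_mul] at h1
  exact hg.tendsto.comp (h1.mono_left nhdsWithin_le_nhds)

lemma norm_le_exp_PI {f : ℂ → ℂ} (hf : DiffContOnCl ℂ f (ball 0 1)) {V : ℂ → ℝ}
    (hV : ContinuousOn V uCircle) (hfV : ∀ θ, ‖f (e θ)‖ ≤ Real.exp (V (e θ))) {z : ℂ}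
    (hz : z ∈ uDisc) : ‖f z‖ ≤ Real.exp (PI (fun s => V (e s)) z) := by
  have hVi : Integrable (fun s => V (e s)) nu :=
    integrable_of_continuous (continuous_comp_e_circle hV)
  set H := HI fun s => V (e s)
  have hH : DifferentiableOn ℂ H uDisc := HI_differentiableOn hVi
  have key : ∀ ε > 0, ‖f z‖ ≤ Real.exp (PI (fun s => V (e s)) z + ε) := by
    intro ε hε
    obtain ⟨ρ0, hρ0, hu⟩ := poisson_uniform hV hε
    have hev : ∀ᶠ ρ : ℝ in nhdsWithin 1 (Iio 1), ‖f z‖ ≤ Real.exp ((H (ρ * z)).re + ε) := by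
      filter_upwards [eventually_mem_nhdsWithin, nhdsWithin_le_nhds (lt_mem_nhds hρ0),
        nhdsWithin_le_nhds (lt_mem_nhds one_pos)] with ρ h1 h2 h3
      have h1 : ρ < 1 := h1
      have hd := dilate_diffContOnCl hH h3 h1
      have hq : DiffContOnCl ℂ (fun z => f z * Complex.exp (-H (ρ * z))) (ball 0 1) := by
        refine hf.smul ?_
        have : DiffContOnCl ℂ (fun z => -H (ρ * z)) (ball 0 1) := hd.neg
        exact Complex.differentiable_exp.comp_diffContOnCl this
      have hle := Complex.norm_le_of_forall_mem_frontier_norm_le (U := ball (0 : ℂ) 1)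
        isBounded_ball hq (C := Real.exp ε) (fun t ht => by
          rw [frontier_ball _ one_ne_zero] at ht
          obtain ⟨θ, rfl⟩ := exists_e (t := t) ht
          rw [norm_mul, Complex.norm_exp, neg_re, HI_re hVi (mul_e_mem h3.le h1 θ)]
          have h4 := abs_le.1 (hu ρ h3.le h2 h1 θ)
          refine (mul_le_mul_of_nonneg_right (hfV θ) (Real.exp_nonneg _)).trans ?_
          rw [← Real.exp_add]
          exact Real.exp_le_exp.2 (by linarith [h4.1])) (z := z)
          (subset_closure hz)
      rw [norm_mul, Complex.norm_exp, neg_re, Real.exp_neg, ← div_eq_mul_inv,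
        div_le_iff₀ (Real.exp_pos _), ← Real.exp_add, add_comm] at hle
      exact hle
    have hcont : Tendsto (fun ρ : ℝ => Real.exp ((H (ρ * z)).re + ε)) (nhdsWithin 1 (Iio 1))
        (nhds (Real.exp ((H z).re + ε))) := by
      have h5 := tendsto_dilate_disc ((hH.differentiableAt (isOpen_uDisc.mem_nhds hz)).continuousAt)
      exact (Real.continuous_exp.tendsto _).comp
        (((Complex.continuous_re.tendsto _).comp h5).add_const ε)
    have := ge_of_tendsto hcont hev
    rwa [HI_re hVi hz] at this
  have hlim : Tendsto (fun ε : ℝ => Real.exp (PI (fun s => V (e s)) z + ε)) (nhdsWithin 0 (Ioi 0))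
      (nhds (Real.exp (PI (fun s => V (e s)) z + 0))) :=
    ((Real.continuous_exp.comp (continuous_const.add continuous_id)).tendsto 0).mono_left
      nhdsWithin_le_nhds
  rw [add_zero] at hlim
  exact ge_of_tendsto hlim (eventually_mem_nhdsWithin.mono fun ε hε => key ε hε)

/-- `½ log(|w|² + a²)`. -/
def slog (a : ℝ) (w : ℂ) : ℝ := Real.log (‖w‖ ^ 2 + a ^ 2) / 2

lemma continuous_slog {a : ℝ} (ha : a ≠ 0) : Continuous (slog a) := by
  unfold slog
  refine (Continuous.log (by fun_prop) fun w => ?_).div_const 2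
  positivity

lemma exp_slog {a : ℝ} (w : ℂ) (h : 0 < ‖w‖ ^ 2 + a ^ 2) :
    Real.exp (slog a w) ^ 2 = ‖w‖ ^ 2 + a ^ 2 := by
  rw [← Real.exp_nat_mul, slog]
  push_cast
  rw [mul_div_cancel₀ _ two_ne_zero, Real.exp_log h]

lemma norm_le_exp_slog {a : ℝ} (ha : a ≠ 0) (w : ℂ) : ‖w‖ ≤ Real.exp (slog a w) := by
  have h : 0 < ‖w‖ ^ 2 + a ^ 2 := by positivity
  refine le_of_sq_le_sq ?_ (Real.exp_nonneg _)
  rw [exp_slog w h]; nlinarith [sq_nonneg a]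

lemma slog_zero (w : ℂ) : slog 0 w = Real.log ‖w‖ := by
  simp [slog, Real.log_pow]

lemma abs_slog_le {a B : ℝ} (ha : a ≠ 0) {w : ℂ} (hw : ‖w‖ ≤ B) :
    |slog a w| ≤ |Real.log (a ^ 2)| + |Real.log (B ^ 2 + a ^ 2)| := by
  have h0 : 0 < a ^ 2 := by positivity
  have h1 : Real.log (a ^ 2) ≤ Real.log (‖w‖ ^ 2 + a ^ 2) :=
    Real.log_le_log h0 (by nlinarith [sq_nonneg ‖w‖])
  have h2 : Real.log (‖w‖ ^ 2 + a ^ 2) ≤ Real.log (B ^ 2 + a ^ 2) :=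
    Real.log_le_log (by positivity) (by gcongr)
  have h3 := neg_abs_le (Real.log (a ^ 2))
  have h4 := le_abs_self (Real.log (B ^ 2 + a ^ 2))
  have h5 := abs_nonneg (Real.log (a ^ 2))
  have h6 := abs_nonneg (Real.log (B ^ 2 + a ^ 2))
  rw [slog, abs_le]
  constructor <;> linarith

/-- Bounded analytic functions on the disc together with their radial boundary values. -/
structure HasBd (G : ℂ → ℂ) (Gs : ℝ → ℂ) : Prop where
  diff : DifferentiableOn ℂ G uDisc
  bdd : ∃ B, ∀ z ∈ uDisc, ‖G z‖ ≤ B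
  lim : ∀ᵐ θ ∂nu, Tendsto (fun r : ℝ => G (r * e θ)) (nhdsWithin 1 (Iio 1)) (nhds (Gs θ))

lemma continuous_dilate_e {G : ℂ → ℂ} (hG : DifferentiableOn ℂ G uDisc) {r : ℝ} (h0 : 0 ≤ r)
    (h1 : r < 1) : Continuous fun θ => G (r * e θ) :=
  hG.continuousOn.comp_continuous (continuous_const.mul continuous_e) fun θ => mul_e_mem h0 h1 θ

lemma exists_radii : ∃ r : ℕ → ℝ, (∀ n, 0 < r n ∧ r n < 1) ∧
    Tendsto r atTop (nhdsWithin 1 (Iio 1)) := by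
  refine ⟨fun n => 1 - 1 / ((n : ℝ) + 2), fun n => ⟨?_, ?_⟩, tendsto_nhdsWithin_iff.2 ⟨?_, ?_⟩⟩
  · rw [sub_pos, div_lt_one (by positivity)]; linarith [(n.cast_nonneg : (0 : ℝ) ≤ n)]
  · have : (0 : ℝ) < 1 / ((n : ℝ) + 2) := by positivity
    linarith
  · have h : Tendsto (fun n : ℕ => 1 / ((n : ℝ) + 2)) atTop (nhds 0) := by
      have := tendsto_const_div_atTop_nhds_zero_nat (1 : ℝ)
      have h2 := (tendsto_add_atTop_iff_nat 2).2 this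
      simpa using h2
    simpa using h.const_sub 1
  · refine Eventually.of_forall fun n => ?_
    have : (0 : ℝ) < 1 / ((n : ℝ) + 2) := by positivity
    exact show 1 - 1 / ((n : ℝ) + 2) < 1 by linarith

lemma HasBd.norm_le {G : ℂ → ℂ} {Gs : ℝ → ℂ} (h : HasBd G Gs) {B : ℝ}
    (hB : ∀ z ∈ uDisc, ‖G z‖ ≤ B) : ∀ᵐ θ ∂nu, ‖Gs θ‖ ≤ B := by
  filter_upwards [h.lim] with θ hθ
  refine le_of_tendsto hθ.norm ?_
  filter_upwards [eventually_mem_nhdsWithin, nhdsWithin_le_nhds (lt_mem_nhds one_pos)] with r h1 h0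
  exact hB _ (mul_e_mem h0.le h1 θ)

lemma HasBd.aestronglyMeasurable {G : ℂ → ℂ} {Gs : ℝ → ℂ} (h : HasBd G Gs) :
    AEStronglyMeasurable Gs nu := by
  obtain ⟨r, hr, hr1⟩ := exists_radii
  refine aestronglyMeasurable_of_tendsto_ae atTop (f := fun n θ => G (r n * e θ))
    (fun n => (continuous_dilate_e h.diff (hr n).1.le (hr n).2).aestronglyMeasurable) ?_
  filter_upwards [h.lim] with θ hθ
  exact hθ.comp hr1

lemma HasBd.integrable_slog {G : ℂ → ℂ} {Gs : ℝ → ℂ} (h : HasBd G Gs) {a : ℝ} (ha : a ≠ 0) :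
    Integrable (fun θ => slog a (Gs θ)) nu := by
  obtain ⟨B, hB⟩ := h.bdd
  refine Integrable.of_bound ((continuous_slog ha).comp_aestronglyMeasurable
    h.aestronglyMeasurable) (|Real.log (a ^ 2)| + |Real.log (B ^ 2 + a ^ 2)|) ?_
  filter_upwards [h.norm_le hB] with θ hθ
  exact abs_slog_le ha hθ

lemma HasBd.norm_le_exp_slog {G : ℂ → ℂ} {Gs : ℝ → ℂ} (h : HasBd G Gs) {a : ℝ} (ha : a ≠ 0)
    {z : ℂ} (hz : z ∈ uDisc) : ‖G z‖ ≤ Real.exp (PI (fun s => slog a (Gs s)) z) := by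
  obtain ⟨B, hB⟩ := h.bdd
  obtain ⟨r, hr, hr1⟩ := exists_radii
  have h1 : ∀ n, ‖G (r n * z)‖ ≤ Real.exp (PI (fun s => slog a (G (r n * e s))) z) := fun n => by
    have hd := dilate_diffContOnCl h.diff (hr n).1 (hr n).2
    refine norm_le_exp_PI hd (V := fun t => slog a (G (r n * t))) ?_
      (fun θ => ClosedIdeals.norm_le_exp_slog ha _) hz
    exact (continuous_slog ha).comp_continuousOn (hd.contClosed.mono sphere_subset_closedBall)
  have h2 : Tendsto (fun n => PI (fun s => slog a (G (r n * e s))) z) atTop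
      (nhds (PI (fun s => slog a (Gs s)) z)) := by
    refine tendsto_integral_of_dominated_convergence
      (fun s => P z s * (|Real.log (a ^ 2)| + |Real.log (B ^ 2 + a ^ 2)|)) (fun n => ?_) ?_
      (fun n => ae_of_all _ fun s => ?_) ?_
    · exact ((continuous_P hz).mul ((continuous_slog ha).comp
        (continuous_dilate_e h.diff (hr n).1.le (hr n).2))).aestronglyMeasurable
    · exact (integrable_of_continuous (continuous_P hz)).mul_const _
    · rw [norm_mul, Real.norm_of_nonneg (P_nonneg hz s)]
      exact mul_le_mul_of_nonneg_left (abs_slog_le ha (hB _ (mul_e_mem (hr n).1.le (hr n).2 s)))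
        (P_nonneg hz s)
    · filter_upwards [h.lim] with s hs
      exact (((continuous_slog ha).tendsto _).comp (hs.comp hr1)).const_mul _
  have h3 := (tendsto_dilate_disc ((h.diff.differentiableAt
    (isOpen_uDisc.mem_nhds hz)).continuousAt)).norm.comp hr1
  exact le_of_tendsto_of_tendsto' h3 ((Real.continuous_exp.tendsto _).comp h2) h1

lemma tendsto_slog {a : ℕ → ℝ} (ha0 : Tendsto a atTop (nhds 0)) {w : ℂ} (hw : w ≠ 0) :
    Tendsto (fun n => slog (a n) w) atTop (nhds (Real.log ‖w‖)) := by
  rw [← slog_zero]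
  unfold slog
  refine (Tendsto.log ((ha0.pow 2).const_add _) ?_).div_const 2
  have := norm_pos_iff.2 hw
  positivity

lemma slog_le_of_norm_le {a B : ℝ} (ha : a ≠ 0) (ha1 : a ^ 2 ≤ 1) {w : ℂ} (hw : ‖w‖ ≤ B) :
    slog a w ≤ Real.log (B ^ 2 + 1) / 2 := by
  unfold slog
  have : 0 < a ^ 2 := by positivity
  gcongr

lemma log_norm_le_slog {a : ℝ} {w : ℂ} (hw : w ≠ 0) : Real.log ‖w‖ ≤ slog a w := by
  rw [← slog_zero]
  unfold slog
  have := norm_pos_iff.2 hw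
  have h2 : Real.log (‖w‖ ^ 2 + 0 ^ 2) ≤ Real.log (‖w‖ ^ 2 + a ^ 2) :=
    Real.log_le_log (by positivity) (by nlinarith [sq_nonneg a])
  exact div_le_div_of_nonneg_right h2 zero_le_two

lemma le_P {z : ℂ} (hz : z ∈ uDisc) (s : ℝ) : (1 - ‖z‖ ^ 2) / 4 ≤ P z s := by
  have h1 := mem_uDisc.1 hz
  have h2 : ‖e s - z‖ ≤ 2 := by
    have := norm_sub_le (e s) z
    rw [norm_e] at this; linarith
  have h3 : 0 < ‖e s - z‖ := norm_pos_iff.2 (e_sub_ne hz s)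
  have h4 : 0 ≤ 1 - ‖z‖ ^ 2 := by nlinarith [norm_nonneg z]
  unfold P
  gcongr
  nlinarith

lemma exists_small_seq : ∃ a : ℕ → ℝ, (∀ n, 0 < a n ∧ a n ^ 2 ≤ 1) ∧
    Tendsto a atTop (nhds 0) := by
  refine ⟨fun n => 1 / ((n : ℝ) + 1), fun n => ⟨by positivity, ?_⟩,
    tendsto_one_div_add_atTop_nhds_zero_nat⟩
  have : 1 / ((n : ℝ) + 1) ≤ 1 := by
    rw [div_le_one (by positivity)]; linarith [(n.cast_nonneg : (0 : ℝ) ≤ n)]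
  have h2 : 0 < 1 / ((n : ℝ) + 1) := by positivity
  nlinarith

lemma aemeasurable_liminf_ennreal {μ : Measure ℝ} {f : ℕ → ℝ → ℝ≥0∞}
    (hf : ∀ n, AEMeasurable (f n) μ) :
    AEMeasurable (fun s => liminf (fun n => f n s) atTop) μ := by
  refine ⟨fun s => liminf (fun n => (hf n).mk _ s) atTop,
    Measurable.liminf fun n => (hf n).measurable_mk, ?_⟩
  filter_upwards [ae_all_iff.2 fun n => (hf n).ae_eq_mk] with s hs
  exact congrArg (fun u => liminf u atTop) (funext hs)

lemma HasBd.log_aux {G : ℂ → ℂ} {Gs : ℝ → ℂ} (h : HasBd G Gs) {z0 : ℂ} (hz0 : z0 ∈ uDisc)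
    (hG : G z0 ≠ 0) :
    (∀ᵐ s ∂nu, Gs s ≠ 0) ∧ Integrable (fun s => Real.log ‖Gs s‖) nu := by
  obtain ⟨B, hB⟩ := h.bdd
  obtain ⟨a, ha, ha0⟩ := exists_small_seq
  have hae := h.norm_le hB
  set M := Real.log (B ^ 2 + 1) / 2
  set c := (1 - ‖z0‖ ^ 2) / 4
  have hc : 0 < c := by
    have := mem_uDisc.1 hz0
    have h2 : ‖z0‖ ^ 2 < 1 := by nlinarith [norm_nonneg z0]
    simp only [c]; linarith
  have hi : ∀ n, Integrable (fun s => M - slog (a n) (Gs s)) nu := fun n =>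
    (integrable_const M).sub (h.integrable_slog (ha n).1.ne')
  have hnn : ∀ n, ∀ᵐ s ∂nu, 0 ≤ M - slog (a n) (Gs s) := fun n => by
    filter_upwards [hae] with s hs
    exact sub_nonneg.2 (slog_le_of_norm_le (ha n).1.ne' (ha n).2 hs)
  have hK : ∀ n, ∫ s, (M - slog (a n) (Gs s)) ∂nu ≤ (M - Real.log ‖G z0‖) / c := fun n => by
    rw [le_div_iff₀ hc, mul_comm, ← integral_const_mul]
    have h1 : ∫ s, c * (M - slog (a n) (Gs s)) ∂nu ≤ ∫ s, P z0 s * (M - slog (a n) (Gs s)) ∂nu := by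
      refine integral_mono_ae ((hi n).const_mul _) (integrable_P_mul (hi n) hz0) ?_
      filter_upwards [hnn n] with s hs
      exact mul_le_mul_of_nonneg_right (le_P hz0 s) hs
    refine h1.trans ?_
    have h2 : ∫ s, P z0 s * (M - slog (a n) (Gs s)) ∂nu = M - PI (fun s => slog (a n) (Gs s)) z0 := by
      simp only [mul_sub]
      rw [integral_sub (integrable_P_mul (integrable_const M) hz0)
        (integrable_P_mul (h.integrable_slog (ha n).1.ne') hz0), integral_mul_const,
        integral_P hz0, one_mul, PI]
    rw [h2]
    have h3 := h.norm_le_exp_slog (ha n).1.ne' hz0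
    rw [← Real.log_le_iff_le_exp (norm_pos_iff.2 hG)] at h3
    linarith
  have hmeas : ∀ n, AEMeasurable (fun s => ENNReal.ofReal (M - slog (a n) (Gs s))) nu := fun n =>
    (hi n).aestronglyMeasurable.aemeasurable.ennreal_ofReal
  have hlint : ∫⁻ s, liminf (fun n => ENNReal.ofReal (M - slog (a n) (Gs s))) atTop ∂nu ≤
      ENNReal.ofReal ((M - Real.log ‖G z0‖) / c) := by
    refine (lintegral_liminf_le' hmeas).trans ?_
    refine liminf_le_of_frequently_le' (Frequently.of_forall fun n => ?_)
    rw [← ofReal_integral_eq_lintegral_ofReal (hi n) (hnn n)]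
    exact ENNReal.ofReal_le_ofReal (hK n)
  have hfin := ae_lt_top' (aemeasurable_liminf_ennreal hmeas)
    (hlint.trans_lt ENNReal.ofReal_lt_top).ne
  have hne : ∀ᵐ s ∂nu, Gs s ≠ 0 := by
    filter_upwards [hfin] with s hs h0
    have ht : Tendsto (fun n => M - slog (a n) (Gs s)) atTop atTop := by
      have h1 : Tendsto (fun n => Real.log (a n)) atTop atBot :=
        Real.tendsto_log_nhdsGT_zero.comp
          (tendsto_nhdsWithin_iff.2 ⟨ha0, Eventually.of_forall fun n => (ha n).1⟩)
      have h2 : ∀ n, slog (a n) (Gs s) = Real.log (a n) := fun n => by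
        simp [slog, h0, Real.log_pow]
      simp only [h2, sub_eq_add_neg]
      exact tendsto_atTop_add_const_left _ _ (tendsto_neg_atBot_atTop.comp h1)
    have := (ENNReal.tendsto_ofReal_atTop.comp ht).liminf_eq
    simp only [Function.comp_def] at this
    rw [this] at hs
    exact lt_irrefl _ hs
  have hlimeq : ∀ᵐ s ∂nu, liminf (fun n => ENNReal.ofReal (M - slog (a n) (Gs s))) atTop =
      ENNReal.ofReal (M - Real.log ‖Gs s‖) := by
    filter_upwards [hne] with s hs
    exact ((ENNReal.continuous_ofReal.tendsto _).comp
      ((tendsto_slog ha0 hs).const_sub M)).liminf_eq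
  refine ⟨hne, ?_⟩
  have hm2 : AEStronglyMeasurable (fun s => Real.log ‖Gs s‖) nu :=
    (Real.measurable_log.comp_aemeasurable
      h.aestronglyMeasurable.norm.aemeasurable).aestronglyMeasurable
  have hint : Integrable (fun s => M - Real.log ‖Gs s‖) nu := by
    refine ⟨aestronglyMeasurable_const.sub hm2, ?_⟩
    rw [hasFiniteIntegral_iff_ofReal]
    · rw [← lintegral_congr_ae hlimeq]
      exact hlint.trans_lt ENNReal.ofReal_lt_top
    · filter_upwards [hne, hnn 0] with s hs h1
      have := log_norm_le_slog (a := a 0) hs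
      simp only [Pi.zero_apply]; linarith
  have := (integrable_const M).sub hint
  refine this.congr (ae_of_all _ fun s => ?_)
  simp

lemma HasBd.norm_le_exp_log {G : ℂ → ℂ} {Gs : ℝ → ℂ} (h : HasBd G Gs)
    (h0 : ∀ᵐ s ∂nu, Gs s ≠ 0) (hi : Integrable (fun s => Real.log ‖Gs s‖) nu) {z : ℂ}
    (hz : z ∈ uDisc) : ‖G z‖ ≤ Real.exp (PI (fun s => Real.log ‖Gs s‖) z) := by
  obtain ⟨B, hB⟩ := h.bdd
  obtain ⟨a, ha, ha0⟩ := exists_small_seq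
  have hae := h.norm_le hB
  set M := Real.log (B ^ 2 + 1) / 2
  have h2 : Tendsto (fun n => PI (fun s => slog (a n) (Gs s)) z) atTop
      (nhds (PI (fun s => Real.log ‖Gs s‖) z)) := by
    refine tendsto_integral_of_dominated_convergence
      (fun s => P z s * (|M| + |Real.log ‖Gs s‖|)) (fun n => ?_) ?_
      (fun n => ?_) ?_
    · exact (integrable_P_mul (h.integrable_slog (ha n).1.ne') hz).aestronglyMeasurable
    · exact integrable_P_mul ((integrable_const _).add hi.abs) hz
    · filter_upwards [h0, hae] with s hs hb
      rw [norm_mul, Real.norm_of_nonneg (P_nonneg hz s)]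
      refine mul_le_mul_of_nonneg_left ?_ (P_nonneg hz s)
      have h3 := log_norm_le_slog (a := a n) hs
      have h4 : slog (a n) (Gs s) ≤ M := slog_le_of_norm_le (ha n).1.ne' (ha n).2 hb
      rw [Real.norm_eq_abs, abs_le]
      have h5 := neg_abs_le (Real.log ‖Gs s‖)
      have h6 := le_abs_self M
      have h7 := abs_nonneg M
      have h8 := abs_nonneg (Real.log ‖Gs s‖)
      constructor <;> linarith
    · filter_upwards [h0] with s hs
      exact (tendsto_slog ha0 hs).const_mul _
  exact ge_of_tendsto' ((Real.continuous_exp.tendsto _).comp h2)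
    fun n => h.norm_le_exp_slog (ha n).1.ne' hz

lemma norm_e_sub {z : ℂ} (s : ℝ) : ‖e s - z‖ = ‖1 - conj z * e s‖ := by
  have h : 1 - conj z * e s = e s * conj (e s - z) := by
    rw [map_sub, conj_e, mul_sub, mul_inv_cancel₀ (e_ne_zero s)]; ring
  rw [h, norm_mul, norm_e, one_mul, RCLike.norm_conj]

/-- `∫ P_z(t) |t - z|^α dt` is comparable with `(1-|z|²)^α`. -/
lemma integral_P_rpow {α : ℝ} (hα : 0 < α) (hα1 : α < 1) {z : ℂ} (hz : z ∈ uDisc) :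
    ∫ s, P z s * ‖e s - z‖ ^ α ∂nu ≤ (1 - ‖z‖ ^ 2) ^ α / Real.cos (α * (Real.pi / 2)) := by
  have hpi := Real.pi_pos
  have hcos : 0 < Real.cos (α * (Real.pi / 2)) :=
    Real.cos_pos_of_mem_Ioo ⟨by nlinarith, by nlinarith⟩
  set g : ℂ → ℂ := fun w => (1 - conj z * w) ^ (α : ℂ) with hg
  have hre : ∀ w ∈ closedBall (0 : ℂ) 1, 0 < (1 - conj z * w).re := fun w hw => by
    have h1 : ‖conj z * w‖ < 1 := by
      rw [norm_mul, RCLike.norm_conj]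
      have := mem_uDisc.1 hz
      have := mem_cDisc.1 hw
      nlinarith [norm_nonneg z, norm_nonneg w]
    have := (Complex.abs_re_le_norm _).trans_lt h1
    rw [sub_re, one_re]
    linarith [(abs_lt.1 this).2]
  have hgd : DiffContOnCl ℂ g (ball 0 1) := by
    have hdiff : ∀ w ∈ closedBall (0 : ℂ) 1, DifferentiableAt ℂ g w := fun w hw => by
      refine DifferentiableAt.cpow (by fun_prop) (by fun_prop) (Or.inl (hre w hw))
    apply DifferentiableOn.diffContOnCl
    rw [closure_ball _ one_ne_zero]
    exact fun w hw => (hdiff w hw).differentiableWithinAt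
  have hpf := poisson_formula hgd hz
  have hcont := continuous_comp_e hgd.contClosed
  have hint : Integrable (fun s => (P z s : ℂ) * g (e s)) nu :=
    integrable_of_continuous ((Complex.continuous_ofReal.comp (continuous_P hz)).mul hcont)
  have hpf2 := congrArg Complex.re hpf
  have hir := integral_re hint
  simp only [RCLike.re_eq_complex_re] at hir
  rw [← hir] at hpf2
  have hgz : g z = (((1 - ‖z‖ ^ 2) ^ α : ℝ) : ℂ) := by
    have h1 : 1 - conj z * z = ((1 - ‖z‖ ^ 2 : ℝ) : ℂ) := by
      rw [mul_comm, Complex.mul_conj, Complex.normSq_eq_norm_sq]; push_cast; ring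
    have h2 : 0 ≤ 1 - ‖z‖ ^ 2 := by
      have := mem_uDisc.1 hz; nlinarith [norm_nonneg z]
    simp only [hg]
    rw [h1, Complex.ofReal_cpow h2]
  rw [hgz, ofReal_re] at hpf2
  rw [le_div_iff₀ hcos, ← hpf2, ← integral_mul_const]
  refine integral_mono (integrable_of_continuous ?_) hint.re fun s => ?_
  · refine (Continuous.mul (continuous_P hz) ?_).mul continuous_const
    exact ((continuous_e.sub continuous_const).norm).rpow_const fun s => Or.inr hα.le
  · simp only [Complex.re_ofReal_mul]
    rw [mul_assoc]
    refine mul_le_mul_of_nonneg_left ?_ (P_nonneg hz s)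
    have hw := hre _ (e_mem_closed s)
    have hne : 1 - conj z * e s ≠ 0 := fun h => by rw [h] at hw; simp at hw
    rw [norm_e_sub]
    set w := 1 - conj z * e s
    have harg : |w.arg| ≤ Real.pi / 2 := Complex.abs_arg_le_pi_div_two_iff.2 hw.le
    simp only [hg]
    rw [Complex.cpow_def_of_ne_zero hne, Complex.exp_re]
    have e1 : (Complex.log w * α).re = Real.log ‖w‖ * α := by
      rw [Complex.re_mul_ofReal, Complex.log_re]
    have e2 : (Complex.log w * α).im = w.arg * α := by
      rw [Complex.im_mul_ofReal, Complex.log_im]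
    change _ ≤ Real.exp (Complex.log w * α).re * Real.cos (Complex.log w * α).im
    rw [e1, e2, ← Real.rpow_def_of_pos (norm_pos_iff.2 hne)]
    refine mul_le_mul_of_nonneg_left ?_ (by positivity)
    rw [← Real.cos_abs (w.arg * α), abs_mul, abs_of_pos hα]
    refine Real.cos_le_cos_of_nonneg_of_le_pi (by positivity) (by nlinarith) (by nlinarith)

/-- The difference quotient integral controlling derivatives of Toeplitz images. -/
def KF (F : ℂ → ℂ) (z : ℂ) : ℝ := ∫ s, ‖F (e s) - F z‖ / ‖e s - z‖ ^ 2 ∂nu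

lemma KF_le {α : ℝ} (hα : 0 < α) (hα1 : α < 1) {F : ℂ → ℂ} (hF : MemA α F) {ε : ℝ} (hε : 0 < ε) :
    ∃ M, 0 ≤ M ∧ ∀ z ∈ uDisc, KF F z ≤ ε * (1 - ‖z‖) ^ (α - 1) + M := by
  have hpi := Real.pi_pos
  have hcos : 0 < Real.cos (α * (Real.pi / 2)) :=
    Real.cos_pos_of_mem_Ioo ⟨by nlinarith, by nlinarith⟩
  set c := Real.cos (α * (Real.pi / 2))
  obtain ⟨δ, hδ, hlip⟩ := hF.2.2 (ε * c) (by positivity)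
  obtain ⟨B, hB0, hB⟩ := hF.exists_norm_le
  refine ⟨2 * B / δ ^ 2, by positivity, fun z hz => ?_⟩
  have hz1 := mem_uDisc.1 hz
  have hz2 : 0 < 1 - ‖z‖ ^ 2 := by nlinarith [norm_nonneg z]
  have hzc : z ∈ closedBall (0 : ℂ) 1 := uDisc_subset hz
  have hpos : ∀ s, 0 < ‖e s - z‖ := fun s => norm_pos_iff.2 (e_sub_ne hz s)
  have hpt : ∀ s, ‖F (e s) - F z‖ / ‖e s - z‖ ^ 2 ≤
      ε * c / (1 - ‖z‖ ^ 2) * (P z s * ‖e s - z‖ ^ α) + 2 * B / δ ^ 2 := fun s => by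
    have hp := hpos s
    by_cases hs : ‖e s - z‖ < δ
    · have h1 := hlip _ (e_mem_closed s) _ hzc hs
      have h2 : ‖F (e s) - F z‖ / ‖e s - z‖ ^ 2 ≤ ε * c * ‖e s - z‖ ^ α / ‖e s - z‖ ^ 2 := by gcongr
      refine h2.trans ?_
      have h3 : ε * c / (1 - ‖z‖ ^ 2) * (P z s * ‖e s - z‖ ^ α) =
          ε * c * ‖e s - z‖ ^ α / ‖e s - z‖ ^ 2 := by
        unfold P; field_simp
      rw [h3]
      have : 0 ≤ 2 * B / δ ^ 2 := by positivity
      linarith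
    · push Not at hs
      have h1 : ‖F (e s) - F z‖ ≤ 2 * B := by
        have := norm_sub_le (F (e s)) (F z)
        have := hB _ (e_mem_closed s)
        have := hB _ hzc
        linarith
      have h2 : ‖F (e s) - F z‖ / ‖e s - z‖ ^ 2 ≤ 2 * B / δ ^ 2 := by gcongr
      have h3 : 0 ≤ ε * c / (1 - ‖z‖ ^ 2) * (P z s * ‖e s - z‖ ^ α) := by
        have := P_nonneg hz s
        positivity
      linarith
  have hcα : Continuous fun s => P z s * ‖e s - z‖ ^ α :=
    (continuous_P hz).mul (((continuous_e.sub continuous_const).norm).rpow_const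
      fun s => Or.inr hα.le)
  calc KF F z ≤ ∫ s, (ε * c / (1 - ‖z‖ ^ 2) * (P z s * ‖e s - z‖ ^ α) + 2 * B / δ ^ 2) ∂nu := by
        refine integral_mono_of_nonneg (ae_of_all _ fun s => by positivity) ?_ (ae_of_all _ hpt)
        exact integrable_of_continuous (by fun_prop)
    _ = ε * c / (1 - ‖z‖ ^ 2) * ∫ s, P z s * ‖e s - z‖ ^ α ∂nu + 2 * B / δ ^ 2 := by
        rw [integral_add (integrable_of_continuous (by fun_prop)) (integrable_const _),
          integral_const_mul]
        simp
    _ ≤ ε * c / (1 - ‖z‖ ^ 2) * ((1 - ‖z‖ ^ 2) ^ α / c) + 2 * B / δ ^ 2 := by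
        gcongr
        exact integral_P_rpow hα hα1 hz
    _ = ε * (1 - ‖z‖ ^ 2) ^ (α - 1) + 2 * B / δ ^ 2 := by
        rw [Real.rpow_sub_one hz2.ne']; field_simp
    _ ≤ _ := by
        gcongr ε * ?_ + _
        exact Real.rpow_le_rpow_of_nonpos (by linarith) (by nlinarith [norm_nonneg z]) (by linarith)

/-- `h` is a bounded co-analytic perturbation of `conj I * F` on the circle. -/
structure Toep (F h I e₀ : ℂ → ℂ) : Prop where
  dh : DifferentiableOn ℂ h uDisc
  dI : DifferentiableOn ℂ I uDisc
  de : DifferentiableOn ℂ e₀ uDisc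
  bh : ∃ B, ∀ z ∈ uDisc, ‖h z‖ ≤ B
  bI : ∀ z ∈ uDisc, ‖I z‖ ≤ 1
  be : ∃ B, ∀ z ∈ uDisc, ‖e₀ z‖ ≤ B
  lim : ∀ᵐ s ∂nu, Tendsto (fun r : ℝ => h (r * e s) - conj (I (r * e s)) * F (r * e s) -
    conj (e₀ (r * e s))) (nhdsWithin 1 (Iio 1)) (nhds 0)

/-- The error term on the circle of radius `r`. -/
def Terr (F h I e₀ : ℂ → ℂ) (r : ℝ) (s : ℝ) : ℂ :=
  h (r * e s) - conj (I (r * e s)) * F (r * e s) - conj (e₀ (r * e s))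

lemma Toep.err_cont {F h I e₀ : ℂ → ℂ} (hT : Toep F h I e₀) (hF : DifferentiableOn ℂ F uDisc)
    {r : ℝ} (h0 : 0 ≤ r) (h1 : r < 1) : Continuous (Terr F h I e₀ r) :=
  ((continuous_dilate_e hT.dh h0 h1).sub ((Complex.continuous_conj.comp
    (continuous_dilate_e hT.dI h0 h1)).mul (continuous_dilate_e hF h0 h1))).sub
    (Complex.continuous_conj.comp (continuous_dilate_e hT.de h0 h1))

lemma Toep.tendsto_err {F h I e₀ : ℂ → ℂ} (hT : Toep F h I e₀) (hF : DifferentiableOn ℂ F uDisc)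
    (hFb : ∃ B, ∀ z ∈ uDisc, ‖F z‖ ≤ B) {r : ℕ → ℝ} (hr : ∀ n, 0 < r n ∧ r n < 1)
    (hr1 : Tendsto r atTop (nhdsWithin 1 (Iio 1))) :
    Tendsto (fun n => ∫ s, ‖Terr F h I e₀ (r n) s‖ ∂nu) atTop (nhds 0) := by
  obtain ⟨B1, hB1⟩ := hT.bh
  obtain ⟨B2, hB2⟩ := hT.be
  obtain ⟨B3, hB3⟩ := hFb
  have : (0 : ℝ) = ∫ _ : ℝ, (0 : ℝ) ∂nu := by simp
  rw [this]
  refine tendsto_integral_of_dominated_convergence (fun _ => B1 + 1 * B3 + B2)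
    (fun n => (hT.err_cont hF (hr n).1.le (hr n).2).norm.aestronglyMeasurable)
    (integrable_const _) (fun n => ae_of_all _ fun s => ?_) ?_
  · rw [norm_norm]
    have hm := mul_e_mem (hr n).1.le (hr n).2 s
    unfold Terr
    refine (norm_sub_le _ _).trans (add_le_add ((norm_sub_le _ _).trans
      (add_le_add (hB1 _ hm) ?_)) ?_)
    · rw [norm_mul, RCLike.norm_conj]
      exact mul_le_mul (hT.bI _ hm) (hB3 _ hm) (norm_nonneg _) zero_le_one
    · rw [RCLike.norm_conj]; exact hB2 _ hm
  · filter_upwards [hT.lim] with s hs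
    have := (hs.comp hr1).norm
    rw [norm_zero] at this
    exact this

lemma Toep.norm_deriv_le {α : ℝ} {F h I e₀ : ℂ → ℂ} (hT : Toep F h I e₀)
    (hF : MemA α F) {z : ℂ} (hz : z ∈ uDisc) : ‖deriv h z‖ ≤ KF F z := by
  obtain ⟨r, hr, hr1⟩ := exists_radii
  obtain ⟨B, hB0, hB⟩ := hF.exists_norm_le
  have hFd : DifferentiableOn ℂ F uDisc := hF.diff
  have hz1 := mem_uDisc.1 hz
  have hzc : z ∈ closedBall (0 : ℂ) 1 := uDisc_subset hz
  have hpos : ∀ s, 0 < ‖e s - z‖ := fun s => norm_pos_iff.2 (e_sub_ne hz s)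
  have hk : Continuous fun s => e s / (e s - z) ^ 2 :=
    continuous_e.div ((continuous_e.sub continuous_const).pow 2)
      fun s => pow_ne_zero 2 (e_sub_ne hz s)
  have hknorm : ∀ s, ‖e s / (e s - z) ^ 2‖ = 1 / ‖e s - z‖ ^ 2 := fun s => by
    rw [norm_div, norm_e, norm_pow]
  have hmain : ∀ n, ‖(r n : ℂ) * deriv h (r n * z)‖ ≤
      ((1 - ‖z‖) ^ 2)⁻¹ * ∫ s, ‖Terr F h I e₀ (r n) s‖ ∂nu +
        ∫ s, ‖F (r n * e s) - F z‖ / ‖e s - z‖ ^ 2 ∂nu := fun n => by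
    obtain ⟨h0, h1⟩ := hr n
    have hrz : (r n : ℂ) * z ∈ uDisc := smul_mem_uDisc' h0.le h1 hzc
    have hR : 1 < 1 / r n := (one_lt_div h0).2 h1
    have c1 := continuous_dilate_e hT.dI h0.le h1
    have c2 := continuous_dilate_e hT.de h0.le h1
    have c3 := continuous_dilate_e hFd h0.le h1
    have ce := hT.err_cont hFd h0.le h1
    rw [← dilate_deriv hT.dh hrz, ← deriv_formula hR (dilate_differentiableOn hT.dh h0) hz]
    have i1 := conj_cauchy_sq (dilate_diffContOnCl hT.dI h0 h1) hz
    have i2 := conj_cauchy_sq (dilate_diffContOnCl hT.de h0 h1) hz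
    have hsplit : ∀ s, h (r n * e s) * (e s / (e s - z) ^ 2) =
        Terr F h I e₀ (r n) s * (e s / (e s - z) ^ 2) +
        conj (I (r n * e s)) * (F (r n * e s) - F z) * (e s / (e s - z) ^ 2) +
        F z * (conj (I (r n * e s)) * (e s / (e s - z) ^ 2)) +
        conj (e₀ (r n * e s)) * (e s / (e s - z) ^ 2) := fun s => by
      unfold Terr; ring
    simp only [hsplit]
    have cI : Continuous fun s => conj (I (r n * e s)) := Complex.continuous_conj.comp c1
    have cE : Continuous fun s => conj (e₀ (r n * e s)) := Complex.continuous_conj.comp c2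
    have j1 : Integrable (fun s => Terr F h I e₀ (r n) s * (e s / (e s - z) ^ 2)) nu :=
      integrable_of_continuous (ce.mul hk)
    have j2 : Integrable (fun s => conj (I (r n * e s)) * (F (r n * e s) - F z) *
        (e s / (e s - z) ^ 2)) nu :=
      integrable_of_continuous ((cI.mul (c3.sub continuous_const)).mul hk)
    have j3 : Integrable (fun s => F z * (conj (I (r n * e s)) * (e s / (e s - z) ^ 2))) nu :=
      integrable_of_continuous (continuous_const.mul (cI.mul hk))
    have j4 : Integrable (fun s => conj (e₀ (r n * e s)) * (e s / (e s - z) ^ 2)) nu :=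
      integrable_of_continuous (cE.mul hk)
    rw [integral_add (f := fun s => _ + _ + _) ((j1.add j2).add j3) j4, integral_add (f := fun s => _ + _) (j1.add j2) j3,
      integral_add j1 j2,
      integral_const_mul, i1, i2, mul_zero, add_zero, add_zero]
    refine (norm_add_le _ _).trans (add_le_add ?_ ?_)
    · refine (norm_integral_le_integral_norm _).trans ?_
      rw [← integral_const_mul]
      refine integral_mono j1.norm ((integrable_of_continuous ce.norm).const_mul _) fun s => ?_
      simp only [norm_mul, hknorm]
      rw [mul_comm, one_div]
      refine mul_le_mul_of_nonneg_right ?_ (norm_nonneg _)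
      have := norm_sub_ge z s
      have h3 : 0 < 1 - ‖z‖ := by linarith
      gcongr
    · refine (norm_integral_le_integral_norm _).trans ?_
      refine integral_mono j2.norm (integrable_of_continuous ?_) fun s => ?_
      · exact (c3.sub continuous_const).norm.div (((continuous_e.sub continuous_const).norm).pow 2)
          fun s => (pow_pos (hpos s) 2).ne'
      · simp only [norm_mul, hknorm, RCLike.norm_conj]
        rw [mul_one_div]
        have := hT.bI _ (mul_e_mem h0.le h1 s)
        refine div_le_div_of_nonneg_right ?_ (by positivity)
        nlinarith [norm_nonneg (F (r n * e s) - F z)]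
  have hL : Tendsto (fun n => ‖(r n : ℂ) * deriv h (r n * z)‖) atTop (nhds ‖(1 : ℝ) * deriv h z‖) := by
    have hc : ContinuousAt (deriv h) z :=
      (continuousOn_deriv hT.dh).continuousAt (isOpen_uDisc.mem_nhds hz)
    have h1 := (tendsto_dilate_disc hc).comp hr1
    have h2 : Tendsto (fun n => (r n : ℂ)) atTop (nhds ((1 : ℝ) : ℂ)) :=
      (Complex.continuous_ofReal.tendsto 1).comp (hr1.mono_right nhdsWithin_le_nhds)
    exact (h2.mul h1).norm
  rw [ofReal_one, one_mul] at hL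
  have hR1 := (hT.tendsto_err hFd ⟨B, fun z hz => hB z (uDisc_subset hz)⟩ hr hr1).const_mul
    ((1 - ‖z‖) ^ 2)⁻¹
  have hR2 : Tendsto (fun n => ∫ s, ‖F (r n * e s) - F z‖ / ‖e s - z‖ ^ 2 ∂nu) atTop
      (nhds (KF F z)) := by
    refine tendsto_integral_of_dominated_convergence (fun _ => 2 * B / (1 - ‖z‖) ^ 2)
      (fun n => Continuous.aestronglyMeasurable ?_) (integrable_const _)
      (fun n => ae_of_all _ fun s => ?_) (ae_of_all _ fun s => ?_)
    · exact ((continuous_dilate_e hFd (hr n).1.le (hr n).2).sub continuous_const).norm.div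
        (((continuous_e.sub continuous_const).norm).pow 2) fun s => (pow_pos (hpos s) 2).ne'
    · rw [Real.norm_of_nonneg (by positivity)]
      have := norm_sub_ge z s
      have h3 : 0 < 1 - ‖z‖ := by linarith
      gcongr
      have := norm_sub_le (F (r n * e s)) (F z)
      have := hB _ (uDisc_subset (mul_e_mem (hr n).1.le (hr n).2 s))
      have := hB _ hzc
      linarith
    · exact ((((tendsto_dilate hF.cont (e_mem_closed s)).comp hr1).sub_const _).norm).div_const _
  have := le_of_tendsto_of_tendsto' hL (hR1.add hR2) hmain
  simpa using this

lemma polar_eq_e (p : ℝ × ℝ) : (Complex.polarCoord.symm p : ℂ) = p.1 * e p.2 := by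
  rw [Complex.polarCoord_symm_apply, e, Complex.exp_mul_I]
  push_cast; ring

lemma e_periodic : Function.Periodic e (2 * Real.pi) := fun s => by
  simp only [e]
  rw [← Complex.exp_periodic ((s : ℂ) * I)]
  push_cast; ring_nf

lemma integral_polar {Φ : ℂ → ℂ} (hΦ : ContinuousOn Φ (closedBall 0 1)) :
    ∫ z in uDisc, Φ z = ∫ r in (0 : ℝ)..1, (2 * Real.pi * r) • ∫ s, Φ (r * e s) ∂nu := by
  rw [← integral_indicator measurableSet_uDisc, ← Complex.integral_comp_polarCoord_symm]
  set S : Set (ℝ × ℝ) := Ioo (0 : ℝ) 1 ×ˢ Ioo (-Real.pi) Real.pi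
  have hpt : ∀ p ∈ _root_.polarCoord.target, p.1 • uDisc.indicator Φ (Complex.polarCoord.symm p) =
      S.indicator (fun p => p.1 • Φ (p.1 * e p.2)) p := fun p hp => by
    rw [_root_.polarCoord_target] at hp
    rw [polar_eq_e]
    have hn : ‖(p.1 : ℂ) * e p.2‖ = p.1 := by
      rw [norm_mul, norm_e, mul_one, Complex.norm_real, Real.norm_of_nonneg (le_of_lt hp.1)]
    by_cases h : p.1 < 1
    · rw [indicator_of_mem (mem_uDisc.2 (by rwa [hn])), indicator_of_mem]
      exact ⟨⟨hp.1, h⟩, hp.2⟩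
    · rw [indicator_of_notMem (fun h' => h (by rwa [← hn, ← mem_uDisc])), smul_zero,
        indicator_of_notMem]
      exact fun h' => h h'.1.2
  have hmS : MeasurableSet S := measurableSet_Ioo.prod measurableSet_Ioo
  have hsub : S ⊆ _root_.polarCoord.target := by
    rw [_root_.polarCoord_target]
    exact prod_mono (fun x hx => hx.1) subset_rfl
  have hmT : MeasurableSet _root_.polarCoord.target := by
    rw [_root_.polarCoord_target]
    exact measurableSet_Ioi.prod measurableSet_Ioo
  have hcont : ContinuousOn (fun p : ℝ × ℝ => p.1 • Φ (p.1 * e p.2))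
      (Icc (0 : ℝ) 1 ×ˢ Icc (-Real.pi) Real.pi) := by
    refine continuousOn_fst.smul (hΦ.comp ?_ ?_)
    · exact ((Complex.continuous_ofReal.comp continuous_fst).mul
        (continuous_e.comp continuous_snd)).continuousOn
    · intro p hp
      rw [mem_cDisc, norm_mul, norm_e, mul_one, Complex.norm_real, Real.norm_of_nonneg hp.1.1]
      exact hp.1.2
  rw [setIntegral_congr_fun hmT hpt, setIntegral_indicator hmS, inter_eq_self_of_subset_right hsub,
    Measure.volume_eq_prod, setIntegral_prod, intervalIntegral.integral_of_le zero_le_one,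
    integral_Ioc_eq_integral_Ioo]
  · refine setIntegral_congr_fun measurableSet_Ioo fun r _ => ?_
    change ∫ y in Ioo (-Real.pi) Real.pi, r • Φ (r * e y) = _
    have hper : Function.Periodic (fun s => Φ (r * e s)) (2 * Real.pi) := fun s => by
      simp only [e_periodic s]
    have h1 := hper.intervalIntegral_add_eq (-Real.pi) 0
    rw [show -Real.pi + 2 * Real.pi = Real.pi by ring, zero_add] at h1
    rw [integral_smul, integral_nu, ← integral_Ioc_eq_integral_Ioo,
      ← intervalIntegral.integral_of_le (by linarith [Real.pi_pos]), h1, smul_smul]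
    congr 1
    field_simp
  · rw [← Measure.volume_eq_prod]
    exact (hcont.integrableOn_compact (isCompact_Icc.prod isCompact_Icc)).mono_set
      (prod_mono Ioo_subset_Icc_self Ioo_subset_Icc_self)

lemma nu_swap {f : ℝ → ℝ → ℂ}
    (hf : ContinuousOn (Function.uncurry f) (Icc (0 : ℝ) 1 ×ˢ Icc 0 (2 * Real.pi))) :
    ∫ r in (0 : ℝ)..1, ∫ s, f r s ∂nu = ∫ s, (∫ r in (0 : ℝ)..1, f r s) ∂nu := by
  apply intervalIntegral_integral_swap
  rw [nu, Measure.prod_smul_right, Measure.prod_restrict, ← Measure.volume_eq_prod]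
  refine Integrable.smul_measure ?_ (by simp [Real.pi_pos])
  refine (hf.integrableOn_compact (isCompact_Icc.prod isCompact_Icc)).mono_set
      (prod_mono ?_ Ioc_subset_Icc_self)
  rw [uIoc_of_le zero_le_one]
  exact Ioc_subset_Icc_self

lemma avg_invariant_aux {h k : ℂ → ℂ} {R₁ R₂ a b a' b' : ℝ} (hh : DifferentiableOn ℂ h (ball 0 R₁))
    (hk : DifferentiableOn ℂ k (ball 0 R₂)) (ha : 0 < a) (hb' : 0 < b') (haa : a ≤ a')
    (ha' : a' < R₁) (hb : b < R₂) (hab : a * b = a' * b') :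
    ∫ s, h (a * e s) * conj (k (b * e s)) ∂nu = ∫ s, h (a' * e s) * conj (k (b' * e s)) ∂nu := by
  set c : ℝ := a * b
  have ha'0 : 0 < a' := ha.trans_le haa
  have hc : 0 < c := by simp only [c, hab]; positivity
  set Φ : ℂ → ℂ := fun w => h w * conj (k (conj (c / w))) with hΦ
  have hd : ∀ w : ℂ, a ≤ ‖w‖ → ‖w‖ ≤ a' → DifferentiableAt ℂ Φ w := fun w h1 h2 => by
    have hw : 0 < ‖w‖ := ha.trans_le h1
    have hw0 : w ≠ 0 := norm_pos_iff.1 hw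
    have hcw : ‖(c : ℂ) / w‖ < R₂ := by
      rw [norm_div, Complex.norm_real, Real.norm_of_nonneg hc.le]
      refine lt_of_le_of_lt ?_ hb
      rw [div_le_iff₀ hw]
      have : 0 < b := by
        by_contra h0
        push Not at h0
        have : c ≤ 0 := mul_nonpos_of_nonneg_of_nonpos ha.le h0
        linarith
      simp only [c]
      nlinarith
    refine ((hh.differentiableAt (isOpen_ball.mem_nhds (by simpa using h2.trans_lt ha')))).mul ?_
    have hkk : DifferentiableAt ℂ k (conj ((c : ℂ) / w)) :=
      hk.differentiableAt (isOpen_ball.mem_nhds (by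
        rw [mem_ball_zero_iff, RCLike.norm_conj]; exact hcw))
    have h3 := hkk.conj_conj
    rw [Complex.conj_conj] at h3
    exact h3.comp w ((differentiableAt_const _).div differentiableAt_id hw0)
  have hav : ∀ t u : ℝ, 0 < t → t * u = c →
      ∫ s, h (t * e s) * conj (k (u * e s)) ∂nu = Real.circleAverage Φ 0 t := fun t u ht hu => by
    rw [← integral_nu_eq_circleAverage]
    refine integral_congr_ae (ae_of_all _ fun s => ?_)
    simp only [hΦ]
    congr 3
    rw [← hu, map_div₀, map_mul, conj_e, Complex.conj_ofReal, Complex.conj_ofReal]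
    have := e_ne_zero s
    have : (t : ℂ) ≠ 0 := by exact_mod_cast ht.ne'
    push_cast
    field_simp
  rw [hav a b ha rfl, hav a' b' ha'0 hab.symm, Real.circleAverage_eq_circleIntegral ha.ne',
    Real.circleAverage_eq_circleIntegral ha'0.ne']
  congr 1
  symm
  refine Complex.circleIntegral_sub_center_inv_smul_eq_of_differentiable_on_annulus_off_countable
    ha haa countable_empty (fun w hw => ?_) (fun w hw => ?_)
  · have h1 : ‖w‖ ≤ a' := by simpa using hw.1
    have h2 : a ≤ ‖w‖ := by simpa using hw.2
    exact (hd w h2 h1).continuousAt.continuousWithinAt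
  · have h1 : ‖w‖ < a' := by simpa using hw.1.1
    have h2 : a < ‖w‖ := by simpa using hw.1.2
    exact hd w h2.le h1.le

/-- Circle averages of `h(at) conj k(bt)` depend only on the product `ab`. -/
lemma avg_invariant {h k : ℂ → ℂ} {R₁ R₂ a b a' b' : ℝ} (hh : DifferentiableOn ℂ h (ball 0 R₁))
    (hk : DifferentiableOn ℂ k (ball 0 R₂)) (ha : 0 < a) (hb : 0 < b) (ha' : 0 < a') (hb' : 0 < b')
    (haR : a < R₁) (haR' : a' < R₁) (hbR : b < R₂) (hbR' : b' < R₂) (hab : a * b = a' * b') :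
    ∫ s, h (a * e s) * conj (k (b * e s)) ∂nu = ∫ s, h (a' * e s) * conj (k (b' * e s)) ∂nu := by
  rcases le_total a a' with h1 | h1
  · exact avg_invariant_aux hh hk ha hb' h1 haR' hbR hab
  · exact (avg_invariant_aux hh hk ha' hb h1 haR hbR' hab.symm).symm

lemma diffContOnCl_ball {f : ℂ → ℂ} {R : ℝ} (hR : 1 < R) (hf : DifferentiableOn ℂ f (ball 0 R)) :
    DiffContOnCl ℂ f (ball 0 1) := by
  apply DifferentiableOn.diffContOnCl
  rw [closure_ball _ one_ne_zero]
  exact hf.mono (closedBall_subset_ball hR)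

lemma dirichlet_pairing {h p : ℂ → ℂ} {R : ℝ} (hR : 1 < R) (hh : DifferentiableOn ℂ h (ball 0 R))
    (hp : DifferentiableOn ℂ p (ball 0 R)) :
    ∫ z in uDisc, deriv h z * conj (p z) =
      Real.pi * ∫ s, h (e s) * conj (e s * p (e s)) ∂nu := by
  have hh' : DifferentiableOn ℂ (deriv h) (ball 0 R) := hh.deriv isOpen_ball
  have hsub : closedBall (0 : ℂ) 1 ⊆ ball 0 R := closedBall_subset_ball hR
  rw [integral_polar (Φ := fun z => deriv h z * conj (p z)) (((hh'.continuousOn.mono hsub)).mul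
    (Complex.continuous_conj.comp_continuousOn (hp.continuousOn.mono hsub)))]
  have h1 : ∀ r ∈ Icc (0 : ℝ) 1, (2 * Real.pi * r) • ∫ s, deriv h (r * e s) * conj (p (r * e s)) ∂nu =
      Real.pi * ∫ s, 2 * r * (deriv h (r ^ 2 * e s) * conj (p (e s))) ∂nu := fun r hr => by
    rcases hr.1.eq_or_lt with h0 | h0
    · simp [← h0]
    have := avg_invariant hh' hp h0 h0 (pow_pos h0 2) one_pos (by linarith [hr.2])
      (by nlinarith [hr.2]) (by linarith [hr.2]) hR (by ring)
    rw [this, integral_const_mul, Complex.real_smul]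
    push_cast
    simp only [one_mul]
    ring
  rw [intervalIntegral.integral_congr (g := fun r : ℝ =>
    Real.pi * ∫ s, 2 * r * (deriv h (r ^ 2 * e s) * conj (p (e s))) ∂nu)
    (fun r hr => h1 r (by rwa [uIcc_of_le zero_le_one] at hr)), intervalIntegral.integral_const_mul]
  congr 1
  have hcp : Continuous fun s => conj (p (e s)) :=
    Complex.continuous_conj.comp (continuous_comp_e (hp.continuousOn.mono hsub))
  have hmem : ∀ r ∈ Icc (0 : ℝ) 1, ∀ s, (r : ℂ) ^ 2 * e s ∈ ball (0 : ℂ) R := fun r hr s => by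
    apply hsub
    rw [mem_cDisc, norm_mul, norm_e, mul_one, norm_pow, Complex.norm_real,
      Real.norm_of_nonneg hr.1]
    exact pow_le_one₀ hr.1 hr.2
  rw [nu_swap]
  · have h2 : ∀ s, ∫ r in (0 : ℝ)..1, 2 * r * (deriv h (r ^ 2 * e s) * conj (p (e s))) =
        h (e s) * conj (e s * p (e s)) - h 0 * conj (e s * p (e s)) := fun s => by
      have h3 : ∀ r ∈ uIcc (0 : ℝ) 1, HasDerivAt
          (fun r : ℝ => h (r ^ 2 * e s) * conj (e s * p (e s)))
          (2 * r * (deriv h (r ^ 2 * e s) * conj (p (e s)))) r := fun r hr => by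
        rw [uIcc_of_le zero_le_one] at hr
        have h4 := (hh.differentiableAt (isOpen_ball.mem_nhds (hmem r hr s))).hasDerivAt
        have h5 : HasDerivAt (fun w : ℂ => w ^ 2 * e s) (2 * r * e s) (r : ℂ) := by
          simpa using (hasDerivAt_pow 2 (r : ℂ)).mul_const (e s)
        have h6 := ((h4.comp (r : ℂ) h5).comp_ofReal).mul_const (conj (e s * p (e s)))
        refine h6.congr_deriv ?_
        rw [map_mul, conj_e]
        have := e_ne_zero s
        field_simp
      rw [intervalIntegral.integral_eq_sub_of_hasDerivAt h3]
      · simp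
      · apply ContinuousOn.intervalIntegrable
        rw [uIcc_of_le zero_le_one]
        refine (by fun_prop : Continuous fun r : ℝ => (2 * r : ℂ)).continuousOn.mul (ContinuousOn.mul ?_ continuousOn_const)
        exact hh'.continuousOn.comp (by fun_prop) fun r hr => hmem r hr s
    simp only [h2]
    have hce : Continuous fun s => conj (e s * p (e s)) := by
      simp only [map_mul]
      exact (Complex.continuous_conj.comp continuous_e).mul hcp
    rw [integral_sub, integral_const_mul]
    · have h7 := mean_value (g := fun w => w * p w) (diffContOnCl_ball hR (differentiableOn_id.mul hp))
      have h8 : ∫ s, conj (e s * p (e s)) ∂nu = 0 := by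
        rw [integral_conj, h7]; simp
      rw [h8, mul_zero, sub_zero]
    · exact integrable_of_continuous ((continuous_comp_e (hh.continuousOn.mono hsub)).mul hce)
    · exact integrable_of_continuous (continuous_const.mul hce)
  · simp only [Function.uncurry_def]
    refine (by fun_prop : Continuous fun x : ℝ × ℝ => (2 * x.1 : ℂ)).continuousOn.mul (ContinuousOn.mul ?_ (hcp.comp continuous_snd).continuousOn)
    refine hh'.continuousOn.comp ?_ fun x hx => hmem x.1 hx.1 x.2
    exact (((Complex.continuous_ofReal.comp continuous_fst).pow 2).mul
      (continuous_e.comp continuous_snd)).continuousOn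

open scoped Pointwise in
lemma smul_uDisc {σ : ℝ} (h0 : 0 < σ) : σ • uDisc = ball (0 : ℂ) σ := by
  rw [uDisc, smul_unitBall_of_pos h0]

lemma dir_dilate {h : ℂ → ℂ} (hh : DifferentiableOn ℂ h uDisc) {σ : ℝ} (h0 : 0 < σ) (h1 : σ < 1) :
    ∫ z in uDisc, ‖deriv (fun z => h (σ * z)) z‖ ^ 2 = ∫ z in ball 0 σ, ‖deriv h z‖ ^ 2 := by
  have h2 := Measure.setIntegral_comp_smul volume (fun z : ℂ => ‖deriv h z‖ ^ 2) uDisc h0.ne'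
  rw [smul_uDisc h0, Complex.finrank_real_complex, abs_of_pos (by positivity), smul_eq_mul] at h2
  have h3 : ∀ z ∈ uDisc, ‖deriv (fun z => h (σ * z)) z‖ ^ 2 = σ ^ 2 * ‖deriv h (σ • z)‖ ^ 2 :=
    fun z hz => by
      have hσ : (σ : ℂ) * z ∈ uDisc := smul_mem_uDisc' h0.le h1 (uDisc_subset hz)
      rw [dilate_deriv hh hσ, norm_mul, Complex.norm_real, Real.norm_of_nonneg h0.le, mul_pow,
        Complex.real_smul]
  rw [setIntegral_congr_fun measurableSet_uDisc h3, integral_const_mul, h2]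
  field_simp

lemma Toep.dir_aux {F h I e₀ : ℂ → ℂ} (hT : Toep F h I e₀) (hF : DifferentiableOn ℂ F uDisc)
    (hFi : IntegrableOn (fun z => ‖deriv F z‖ ^ 2) uDisc) {ρ r B : ℝ} (hρ : 0 < ρ) (hρr : ρ < r)
    (hr : r < 1) (hB : ∀ z ∈ closedBall (0 : ℂ) ρ, ‖z * deriv h z‖ ≤ B) :
    ∫ z in ball 0 ρ, ‖deriv h z‖ ^ 2 ≤ (∫ z in uDisc, ‖deriv F z‖ ^ 2) +
      2 * Real.pi * B * ∫ s, ‖Terr F h I e₀ r s‖ ∂nu := by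
  have hr0 : 0 < r := hρ.trans hρr
  have hρ1 : ρ < 1 := hρr.trans hr
  set σ : ℝ := ρ ^ 2 / r with hσd
  have hσ0 : 0 < σ := by positivity
  have hσρ : σ ≤ ρ := by rw [div_le_iff₀ hr0]; nlinarith
  have hσ1 : σ < 1 := hσρ.trans_lt hρ1
  have hdd : DifferentiableOn ℂ (deriv h) uDisc := hT.dh.deriv isOpen_uDisc
  set N : ℂ → ℂ := fun z => z * deriv h z with hN
  have hNd : DifferentiableOn ℂ N uDisc := differentiableOn_id.mul hdd
  have hball : ∀ {t : ℝ}, 0 < t → t < 1 → ∀ {f : ℂ → ℂ}, DifferentiableOn ℂ f uDisc →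
      DifferentiableOn ℂ (deriv fun z => f (t * z)) (ball 0 (1 / t)) := fun ht0 _ _ hf =>
    (dilate_differentiableOn hf ht0).deriv isOpen_ball
  have hNe : ∀ t : ℝ, 0 < t → t < 1 → ∀ s, e s * deriv (fun z => h (t * z)) (e s) = N (t * e s) :=
    fun t h0 h1 s => by
      rw [dilate_deriv hT.dh (mul_e_mem h0.le h1 s)]
      simp only [hN]; ring
  set p := deriv fun z => h (σ * z) with hp
  set X := ∫ z in ball 0 ρ, ‖deriv h z‖ ^ 2 with hX
  have e1 : (X : ℂ) = Real.pi * ∫ s, h (r * e s) * conj (N (σ * e s)) ∂nu := by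
    rw [hX, ← dir_dilate hT.dh hρ hρ1, ← integral_complex_ofReal]
    have : ∀ z : ℂ, ((‖deriv (fun z => h (ρ * z)) z‖ ^ 2 : ℝ) : ℂ) =
        deriv (fun z => h (ρ * z)) z * conj (deriv (fun z => h (ρ * z)) z) := fun z => by
      rw [Complex.mul_conj, Complex.normSq_eq_norm_sq]
    simp only [this]
    rw [dirichlet_pairing ((one_lt_div hρ).2 hρ1) (dilate_differentiableOn hT.dh hρ)
      (hball hρ hρ1 hT.dh)]
    simp only [hNe ρ hρ hρ1]
    rw [avg_invariant hT.dh hNd hρ hρ hr0 hσ0 hρ1 hr hρ1 hσ1 (by rw [hσd]; field_simp)]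
  have cN : Continuous fun s => conj (N (σ * e s)) :=
    Complex.continuous_conj.comp (continuous_dilate_e hNd hσ0.le hσ1)
  have cI : Continuous fun s => conj (I (r * e s)) :=
    Complex.continuous_conj.comp (continuous_dilate_e hT.dI hr0.le hr)
  have cE : Continuous fun s => conj (e₀ (r * e s)) :=
    Complex.continuous_conj.comp (continuous_dilate_e hT.de hr0.le hr)
  have cF := continuous_dilate_e hF hr0.le hr
  have cT := hT.err_cont hF hr0.le hr
  set R := min (1 / r) (1 / σ)
  have hR : 1 < R := lt_min ((one_lt_div hr0).2 hr) ((one_lt_div hσ0).2 hσ1)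
  have hRr : ball (0 : ℂ) R ⊆ ball 0 (1 / r) := ball_subset_ball (min_le_left _ _)
  have hRσ : ball (0 : ℂ) R ⊆ ball 0 (1 / σ) := ball_subset_ball (min_le_right _ _)
  have pd : DifferentiableOn ℂ p (ball 0 R) := (hball hσ0 hσ1 hT.dh).mono hRσ
  have Id : DifferentiableOn ℂ (fun z => I (r * z)) (ball 0 R) :=
    (dilate_differentiableOn hT.dI hr0).mono hRr
  have Ed : DifferentiableOn ℂ (fun z => e₀ (r * z)) (ball 0 R) :=
    (dilate_differentiableOn hT.de hr0).mono hRr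
  have Fd : DifferentiableOn ℂ (fun z => F (r * z)) (ball 0 R) :=
    (dilate_differentiableOn hF hr0).mono hRr
  have e3 : ∫ s, conj (e₀ (r * e s)) * conj (N (σ * e s)) ∂nu = 0 := by
    have := mean_value (g := fun w => e₀ (r * w) * (w * p w))
      (diffContOnCl_ball hR (Ed.mul (differentiableOn_id.mul pd)))
    simp only [hp, hNe σ hσ0 hσ1] at this
    simp only [← map_mul]
    rw [integral_conj, this]; simp
  have e2 : Real.pi * ∫ s, conj (I (r * e s)) * F (r * e s) * conj (N (σ * e s)) ∂nu =
      ∫ z in uDisc, deriv (fun z => F (r * z)) z * conj (I (r * z) * p z) := by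
    rw [dirichlet_pairing (p := fun z => I (r * z) * p z) hR Fd (Id.mul pd)]
    congr 1
    refine integral_congr_ae (ae_of_all _ fun s => ?_)
    simp only [← hNe σ hσ0 hσ1, map_mul]
    ring
  have e4 : (X : ℂ) = Real.pi * ∫ s, Terr F h I e₀ r s * conj (N (σ * e s)) ∂nu +
      ∫ z in uDisc, deriv (fun z => F (r * z)) z * conj (I (r * z) * p z) := by
    have hs : ∀ s, h (r * e s) * conj (N (σ * e s)) = Terr F h I e₀ r s * conj (N (σ * e s)) +
        conj (I (r * e s)) * F (r * e s) * conj (N (σ * e s)) +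
        conj (e₀ (r * e s)) * conj (N (σ * e s)) := fun s => by
      unfold Terr; ring
    have j1 : Integrable (fun s => Terr F h I e₀ r s * conj (N (σ * e s))) nu :=
      integrable_of_continuous (cT.mul cN)
    have j2 : Integrable (fun s => conj (I (r * e s)) * F (r * e s) * conj (N (σ * e s))) nu :=
      integrable_of_continuous ((cI.mul cF).mul cN)
    have j3 : Integrable (fun s => conj (e₀ (r * e s)) * conj (N (σ * e s))) nu :=
      integrable_of_continuous (cE.mul cN)
    rw [e1, ← e2, ← mul_add]
    simp only [hs]
    rw [integral_add (f := fun s => _ + _) (j1.add j2) j3, integral_add j1 j2, e3, add_zero]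
  have hX0 : 0 ≤ X := integral_nonneg fun z => by positivity
  have hhi : IntegrableOn (fun z => ‖deriv h z‖ ^ 2) (ball 0 ρ) :=
    ((((hdd.continuousOn.mono (closedBall_subset_ball hρ1)).norm.pow 2).integrableOn_compact
      (isCompact_closedBall 0 ρ))).mono_set ball_subset_closedBall
  have b1 : ‖∫ s, Terr F h I e₀ r s * conj (N (σ * e s)) ∂nu‖ ≤
      B * ∫ s, ‖Terr F h I e₀ r s‖ ∂nu := by
    refine (norm_integral_le_integral_norm _).trans ?_
    rw [← integral_const_mul]
    refine integral_mono (integrable_of_continuous (cT.mul cN).norm)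
      ((integrable_of_continuous cT.norm).const_mul _) fun s => ?_
    simp only [norm_mul, RCLike.norm_conj]
    rw [mul_comm]
    refine mul_le_mul_of_nonneg_right (hB _ ?_) (norm_nonneg _)
    rw [mem_closedBall_zero_iff, norm_mul, norm_e, mul_one, Complex.norm_real,
      Real.norm_of_nonneg hσ0.le]
    exact hσρ
  have hcl : ∀ {f : ℂ → ℂ}, DifferentiableOn ℂ f (ball 0 R) →
      IntegrableOn (fun z => ‖f z‖ ^ 2) uDisc := fun hf =>
    (((hf.continuousOn.mono (closedBall_subset_ball hR)).norm.pow 2).integrableOn_compact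
      (isCompact_closedBall 0 1)).mono_set uDisc_subset
  have iF := hcl (Fd.deriv isOpen_ball)
  have ip := hcl pd
  have b2 : ‖∫ z in uDisc, deriv (fun z => F (r * z)) z * conj (I (r * z) * p z)‖ ≤
      (∫ z in uDisc, ‖deriv F z‖ ^ 2) / 2 + X / 2 := by
    calc _ ≤ ∫ z in uDisc, (‖deriv (fun z => F (r * z)) z‖ ^ 2 / 2 + ‖p z‖ ^ 2 / 2) := by
          refine norm_integral_le_of_norm_le ((iF.div_const 2).add (ip.div_const 2)) ?_
          refine (ae_restrict_mem measurableSet_uDisc).mono fun z hz => ?_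
          rw [norm_mul, RCLike.norm_conj, norm_mul]
          have h1 := hT.bI _ (smul_mem_uDisc' hr0.le hr (uDisc_subset hz))
          have h2 : ‖I (r * z)‖ * ‖p z‖ ≤ ‖p z‖ := by nlinarith [norm_nonneg (p z)]
          nlinarith [norm_nonneg (deriv (fun z => F (r * z)) z), norm_nonneg (p z),
            sq_nonneg (‖deriv (fun z => F (r * z)) z‖ - ‖p z‖)]
      _ = (∫ z in ball 0 r, ‖deriv F z‖ ^ 2) / 2 + (∫ z in ball 0 σ, ‖deriv h z‖ ^ 2) / 2 := by
          rw [integral_add (iF.div_const 2) (ip.div_const 2), integral_div, integral_div,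
            dir_dilate hF hr0 hr, hp, dir_dilate hT.dh hσ0 hσ1]
      _ ≤ _ := by
          have m1 := setIntegral_mono_set hFi (ae_of_all _ fun z => by positivity)
              (ball_subset_ball hr.le).eventuallyLE
          have m2 := setIntegral_mono_set hhi (ae_of_all _ fun z => by positivity)
              (ball_subset_ball hσρ).eventuallyLE
          linarith
  have b3 := congrArg norm e4
  rw [Complex.norm_real, Real.norm_of_nonneg hX0] at b3
  have b4 := norm_add_le ((Real.pi : ℂ) * ∫ s, Terr F h I e₀ r s * conj (N (σ * e s)) ∂nu)
    (∫ z in uDisc, deriv (fun z => F (r * z)) z * conj (I (r * z) * p z))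
  rw [← b3, norm_mul, Complex.norm_real, Real.norm_of_nonneg Real.pi_pos.le] at b4
  have b5 := mul_le_mul_of_nonneg_left b1 Real.pi_pos.le
  linarith

lemma Toep.dir {F h I e₀ : ℂ → ℂ} (hT : Toep F h I e₀) (hF : DifferentiableOn ℂ F uDisc)
    (hFb : ∃ B, ∀ z ∈ uDisc, ‖F z‖ ≤ B)
    (hFi : IntegrableOn (fun z => ‖deriv F z‖ ^ 2) uDisc) :
    IntegrableOn (fun z => ‖deriv h z‖ ^ 2) uDisc ∧
      ∫ z in uDisc, ‖deriv h z‖ ^ 2 ≤ ∫ z in uDisc, ‖deriv F z‖ ^ 2 := by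
  obtain ⟨r, hr, hr1⟩ := exists_radii
  have hr1' : Tendsto r atTop (nhds 1) := hr1.mono_right nhdsWithin_le_nhds
  have hdd : DifferentiableOn ℂ (deriv h) uDisc := hT.dh.deriv isOpen_uDisc
  have hcpt : ∀ n, ContinuousOn (deriv h) (closedBall 0 (r n)) := fun n =>
    hdd.continuousOn.mono (closedBall_subset_ball (hr n).2)
  have hk : ∀ m, ∫ z in ball 0 (r m), ‖deriv h z‖ ^ 2 ≤ ∫ z in uDisc, ‖deriv F z‖ ^ 2 := fun m => by
    obtain ⟨B, hB⟩ := (isCompact_closedBall (0 : ℂ) (r m)).exists_bound_of_continuousOn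
      (continuousOn_id.mul (hcpt m))
    have hlim := ((hT.tendsto_err hF hFb hr hr1).const_mul (2 * Real.pi * B)).const_add
      (∫ z in uDisc, ‖deriv F z‖ ^ 2)
    rw [mul_zero, add_zero] at hlim
    refine ge_of_tendsto hlim ?_
    filter_upwards [hr1'.eventually_const_lt (hr m).2] with n hn
    exact hT.dir_aux hF hFi (hr m).1 hn (hr n).2 hB
  have hcov : AECover (volume.restrict uDisc) atTop fun n => ball (0 : ℂ) (r n) := by
    refine ⟨(ae_restrict_mem measurableSet_uDisc).mono fun z hz => ?_, fun n => measurableSet_ball⟩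
    filter_upwards [hr1'.eventually_const_lt (mem_uDisc.1 hz)] with n hn
    simpa using hn
  have hres : ∀ n, (volume.restrict uDisc).restrict (ball (0 : ℂ) (r n)) =
      volume.restrict (ball (0 : ℂ) (r n)) := fun n =>
    Measure.restrict_restrict_of_subset (ball_subset_ball (hr n).2.le)
  have hint : IntegrableOn (fun z => ‖deriv h z‖ ^ 2) uDisc := by
    refine hcov.integrable_of_integral_bounded_of_nonneg_ae (∫ z in uDisc, ‖deriv F z‖ ^ 2)
      (fun n => ?_) (ae_of_all _ fun z => by positivity) (Eventually.of_forall fun n => ?_)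
    · rw [IntegrableOn, hres]
      exact (((hcpt n).norm.pow 2).integrableOn_compact (isCompact_closedBall _ _)).mono_set
        ball_subset_closedBall
    · rw [hres]; exact hk n
  refine ⟨hint, le_of_tendsto' (hcov.integral_tendsto_of_countably_generated hint) fun n => ?_⟩
  rw [hres]; exact hk n

lemma Toep.isA {α : ℝ} (hα : 0 < α) (hα1 : α < 1) {F h I e₀ : ℂ → ℂ} (hT : Toep F h I e₀)
    (hF : MemA α F) : IsA α h := by
  obtain ⟨B, hB0, hB⟩ := hF.exists_norm_le
  refine ⟨hT.dh, (hT.dir hF.diff ⟨B, fun z hz => hB z (uDisc_subset hz)⟩ hF.1.2).1, fun ε hε => ?_⟩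
  obtain ⟨M, hM, hK⟩ := KF_le hα hα1 hF (half_pos hε)
  have hlin := (memA_of_differentiable hα hα1 (F := fun z => (M : ℂ) * z) (by fun_prop)).isA hα hα1
  obtain ⟨r, hr, hs⟩ := hlin.small (ε / 2) (half_pos hε)
  refine ⟨r, hr, fun z hz hrz => ?_⟩
  have h1 := hs z hz hrz
  rw [deriv_const_mul _ differentiableAt_fun_id, deriv_id'', mul_one, Complex.norm_real,
    Real.norm_of_nonneg hM] at h1
  linarith [hT.norm_deriv_le hF hz, hK z hz]

lemma toep_bound {α : ℝ} (hα : 0 < α) (hα1 : α < 1) {F : ℂ → ℂ} (hF : MemA α F) :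
    ∃ C, 0 ≤ C ∧ ∀ h I e₀ B, Toep F h I e₀ → (∀ z ∈ uDisc, ‖h z‖ ≤ B) → ABd α (C + B) h := by
  obtain ⟨B, hB0, hB⟩ := hF.exists_norm_le
  obtain ⟨M, hM, hK⟩ := KF_le hα hα1 hF one_pos
  set D := ∫ z in uDisc, ‖deriv F z‖ ^ 2
  have hD : 0 ≤ D := integral_nonneg fun z => by positivity
  refine ⟨1 + M + √D, by positivity, fun h I e₀ B' hT hB' => ?_⟩
  have hB'0 : 0 ≤ B' := (norm_nonneg _).trans (hB' 0 zero_mem_uDisc)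
  obtain ⟨h1, h2⟩ := hT.dir hF.diff ⟨B, fun z hz => hB z (uDisc_subset hz)⟩ hF.1.2
  have hsD := Real.sqrt_nonneg D
  refine ⟨hT.dh, fun z hz => (hB' z hz).trans (by linarith), fun z hz => ?_, h1, h2.trans ?_⟩
  · have h3 := one_le_rpow hα1.le hz
    have h4 := (hT.norm_deriv_le hF hz).trans (hK z hz)
    nlinarith
  · nlinarith [Real.sq_sqrt hD]

lemma ABd.dominated_three {α : ℝ} {F f g k : ℂ → ℂ} {B B' C : ℝ} (hα1 : α < 1) (hB : 0 ≤ B)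
    (hf : ABd α C f) (hg : ABd α C g) (hk : ABd α C k) (hF : DifferentiableOn ℂ F uDisc)
    (hB' : ∀ z ∈ uDisc, ‖F z‖ ≤ B')
    (hb : ∀ z ∈ uDisc, ‖deriv F z‖ ≤ B * (‖deriv f z‖ + ‖deriv g z‖ + ‖deriv k z‖)) :
    ABd α (B' + B * (3 * C)) F := by
  have hC := hf.nonneg
  have hB0 : 0 ≤ B' := (norm_nonneg _).trans (hB' 0 zero_mem_uDisc)
  have e1 : IntegrableOn (fun z => ‖deriv f z‖ ^ 2 + ‖deriv g z‖ ^ 2) uDisc := hf.dirI.add hg.dirI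
  have e2 : IntegrableOn (fun z => ‖deriv f z‖ ^ 2 + ‖deriv g z‖ ^ 2 + ‖deriv k z‖ ^ 2) uDisc :=
    e1.add hk.dirI
  have hI : IntegrableOn (fun z => 3 * B ^ 2 * (‖deriv f z‖ ^ 2 + ‖deriv g z‖ ^ 2 +
      ‖deriv k z‖ ^ 2)) uDisc := e2.const_mul _
  have hle : ∀ z ∈ uDisc, ‖deriv F z‖ ^ 2 ≤
      3 * B ^ 2 * (‖deriv f z‖ ^ 2 + ‖deriv g z‖ ^ 2 + ‖deriv k z‖ ^ 2) := by
    intro z hz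
    calc ‖deriv F z‖ ^ 2 ≤ (B * (‖deriv f z‖ + ‖deriv g z‖ + ‖deriv k z‖)) ^ 2 := by
          gcongr; exact hb z hz
      _ = B ^ 2 * (‖deriv f z‖ + ‖deriv g z‖ + ‖deriv k z‖) ^ 2 := by ring
      _ ≤ B ^ 2 * (3 * (‖deriv f z‖ ^ 2 + ‖deriv g z‖ ^ 2 + ‖deriv k z‖ ^ 2)) := by
          gcongr
          nlinarith [sq_nonneg (‖deriv f z‖ - ‖deriv g z‖), sq_nonneg (‖deriv f z‖ - ‖deriv k z‖),
            sq_nonneg (‖deriv g z‖ - ‖deriv k z‖)]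
      _ = _ := by ring
  have hFI : IntegrableOn (fun z => ‖deriv F z‖ ^ 2) uDisc := by
    refine hI.mono' ((continuousOn_deriv hF).norm.pow 2 |>.aestronglyMeasurable
      measurableSet_uDisc) ?_
    filter_upwards [ae_restrict_mem measurableSet_uDisc] with z hz
    rw [Real.norm_of_nonneg (by positivity)]
    exact hle z hz
  refine ⟨hF, fun z hz => (hB' z hz).trans (by nlinarith), fun z hz => ?_, hFI,
    (setIntegral_mono_on hFI hI measurableSet_uDisc hle).trans ?_⟩
  · have h1 := one_le_rpow hα1.le hz
    set y := (1 - ‖z‖) ^ (α - 1)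
    calc _ ≤ B * (‖deriv f z‖ + ‖deriv g z‖ + ‖deriv k z‖) := hb z hz
      _ ≤ B * (C * y + C * y + C * y) := by
        gcongr
        · exact hf.der z hz
        · exact hg.der z hz
        · exact hk.der z hz
      _ ≤ (B' + B * (3 * C)) * y := by nlinarith
  · rw [integral_const_mul, integral_add e1 hk.dirI, integral_add hf.dirI hg.dirI]
    have h1 := hf.dir
    have h2 := hg.dir
    have h3 := hk.dir
    calc _ ≤ 3 * B ^ 2 * (C ^ 2 + C ^ 2 + C ^ 2) := by gcongr
      _ = (B * (3 * C)) ^ 2 := by ring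
      _ ≤ _ := by gcongr; linarith

lemma _root_.MemA.hasBd {α : ℝ} {f : ℂ → ℂ} (hf : MemA α f) : HasBd f fun s => f (e s) := by
  obtain ⟨B, -, hB⟩ := hf.exists_norm_le
  exact ⟨hf.diff, ⟨B, fun z hz => hB z (uDisc_subset hz)⟩,
    ae_of_all _ fun θ => tendsto_dilate hf.cont (e_mem_closed θ)⟩

/-- The outer function with boundary modulus `(|f|² + a²)^{1/2}`. -/
def Qf (f : ℂ → ℂ) (a : ℝ) (z : ℂ) : ℂ := exp (HI (fun s => slog a (f (e s))) z)

lemma Qf_ne_zero (f : ℂ → ℂ) (a : ℝ) (z : ℂ) : Qf f a z ≠ 0 := exp_ne_zero _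

lemma ae_ne {α : ℝ} {f : ℂ → ℂ} (hf : MemA α f)
    (hne : ∃ z ∈ uDisc, f z ≠ 0) : ∀ᵐ s ∂nu, f (e s) ≠ 0 := by
  obtain ⟨z0, hz0, h0⟩ := hne
  exact (hf.hasBd.log_aux hz0 h0).1

lemma integrable_slog {α : ℝ} {f : ℂ → ℂ} (hf : MemA α f)
    (hne : ∃ z ∈ uDisc, f z ≠ 0) (a : ℝ) : Integrable (fun s => slog a (f (e s))) nu := by
  rcases eq_or_ne a 0 with rfl | ha
  · obtain ⟨z0, hz0, h0⟩ := hne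
    simpa only [slog_zero] using (hf.hasBd.log_aux hz0 h0).2
  · exact hf.hasBd.integrable_slog ha

lemma Qf_diff {α : ℝ} {f : ℂ → ℂ} (hf : MemA α f)
    (hne : ∃ z ∈ uDisc, f z ≠ 0) (a : ℝ) : DifferentiableOn ℂ (Qf f a) uDisc :=
  (HI_differentiableOn (integrable_slog hf hne a)).cexp

lemma norm_Qf {α : ℝ} {f : ℂ → ℂ} (hf : MemA α f)
    (hne : ∃ z ∈ uDisc, f z ≠ 0) (a : ℝ) {z : ℂ} (hz : z ∈ uDisc) :
    ‖Qf f a z‖ = Real.exp (PI (fun s => slog a (f (e s))) z) := by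
  rw [Qf, norm_exp, HI_re (integrable_slog hf hne a) hz]

lemma Qf_mono {α : ℝ} {f : ℂ → ℂ} (hf : MemA α f)
    (hne : ∃ z ∈ uDisc, f z ≠ 0) (a : ℝ) {z : ℂ} (hz : z ∈ uDisc) : ‖Qf f 0 z‖ ≤ ‖Qf f a z‖ := by
  rw [norm_Qf hf hne _ hz, norm_Qf hf hne _ hz]
  refine Real.exp_le_exp.2 (PI_mono (integrable_slog hf hne 0) (integrable_slog hf hne a) ?_ hz)
  filter_upwards [ae_ne hf hne] with s hs
  rw [slog_zero]
  exact log_norm_le_slog hs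

lemma norm_le_Qf {α : ℝ} {f : ℂ → ℂ} (hf : MemA α f)
    (hne : ∃ z ∈ uDisc, f z ≠ 0) (a : ℝ) {z : ℂ} (hz : z ∈ uDisc) : ‖f z‖ ≤ ‖Qf f a z‖ := by
  refine le_trans ?_ (Qf_mono hf hne a hz)
  rw [norm_Qf hf hne _ hz]
  simp only [slog_zero]
  obtain ⟨z0, hz0, h0⟩ := hne
  have := hf.hasBd.log_aux hz0 h0
  exact hf.hasBd.norm_le_exp_log this.1 this.2 hz

lemma le_Qf {α : ℝ} {f : ℂ → ℂ} (hf : MemA α f)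
    (hne : ∃ z ∈ uDisc, f z ≠ 0) {a : ℝ} (ha : 0 < a) {z : ℂ} (hz : z ∈ uDisc) : a ≤ ‖Qf f a z‖ := by
  rw [norm_Qf hf hne _ hz, ← Real.log_le_iff_le_exp ha]
  refine le_PI_of_le (integrable_slog hf hne a) (ae_of_all _ fun s => ?_) hz
  have h1 : Real.log a = Real.log (a ^ 2) / 2 := by rw [Real.log_pow]; push_cast; ring
  rw [h1, slog]
  have : 0 < a ^ 2 := by positivity
  gcongr
  nlinarith [sq_nonneg ‖f (e s)‖]

lemma Qf_bound {α : ℝ} {f : ℂ → ℂ} (hf : MemA α f)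
    (hne : ∃ z ∈ uDisc, f z ≠ 0) : ∃ M, ∀ a : ℝ, a ^ 2 ≤ 1 → ∀ z ∈ uDisc, ‖Qf f a z‖ ≤ M := by
  obtain ⟨B, hB0, hB⟩ := hf.exists_norm_le
  have key : ∀ a : ℝ, a ≠ 0 → a ^ 2 ≤ 1 → ∀ z ∈ uDisc,
      ‖Qf f a z‖ ≤ Real.exp (Real.log (B ^ 2 + 1) / 2) := fun a ha ha1 z hz => by
    rw [norm_Qf hf hne _ hz]
    exact Real.exp_le_exp.2 (PI_le_of_le (integrable_slog hf hne a) (ae_of_all _ fun s =>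
      slog_le_of_norm_le ha ha1 (hB _ (e_mem_closed s))) hz)
  refine ⟨Real.exp (Real.log (B ^ 2 + 1) / 2), fun a ha1 z hz => ?_⟩
  rcases eq_or_ne a 0 with rfl | ha
  · exact (Qf_mono hf hne 1 hz).trans (key 1 one_ne_zero (by norm_num) z hz)
  · exact key a ha ha1 z hz

lemma Qf_tendsto_bd {α : ℝ} {f : ℂ → ℂ} (hf : MemA α f)
    (hne : ∃ z ∈ uDisc, f z ≠ 0) (a : ℝ) : ∀ᵐ s ∂nu, Tendsto (fun r : ℝ => ‖Qf f a (r * e s)‖ ^ 2)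
    (nhdsWithin 1 (Iio 1)) (nhds (‖f (e s)‖ ^ 2 + a ^ 2)) := by
  filter_upwards [fatou (integrable_slog hf hne a), ae_ne hf hne] with s hs h0
  have := norm_pos_iff.2 h0
  rw [← exp_slog _ (by positivity)]
  refine (((Real.continuous_exp.tendsto _).comp hs).pow 2).congr' ?_
  filter_upwards [Ioo_mem_nhdsLT one_pos] with r hr
  rw [norm_Qf hf hne _ (mul_e_mem hr.1.le hr.2 s)]
  rfl

lemma Qf_toep {α : ℝ} {f : ℂ → ℂ} (hf : MemA α f)
    (hne : ∃ z ∈ uDisc, f z ≠ 0) {a : ℝ} (ha : 0 ≤ a) (ha1 : a ^ 2 ≤ 1) :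
    Toep f (Qf f a) (fun z => f z / Qf f a z) (fun z => (a : ℂ) ^ 2 / Qf f a z) := by
  obtain ⟨M, hM⟩ := Qf_bound hf hne
  refine ⟨Qf_diff hf hne a, hf.diff.div (Qf_diff hf hne a) fun z _ => Qf_ne_zero f a z,
    (differentiableOn_const _).div (Qf_diff hf hne a) fun z _ => Qf_ne_zero f a z,
    ⟨M, hM a ha1⟩, fun z hz => ?_, ⟨a, fun z hz => ?_⟩, ?_⟩
  · rw [norm_div]
    exact div_le_one_of_le₀ (norm_le_Qf hf hne a hz) (norm_nonneg _)
  · rw [norm_div, norm_pow, Complex.norm_real, Real.norm_of_nonneg ha,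
      div_le_iff₀ (norm_pos_iff.2 (Qf_ne_zero f a z)), sq]
    rcases ha.eq_or_lt with rfl | ha
    · simp
    · exact mul_le_mul_of_nonneg_left (le_Qf hf hne ha hz) ha.le
  · filter_upwards [Qf_tendsto_bd hf hne a, ae_ne hf hne] with s hs h0
    have h1 := norm_pos_iff.2 h0
    have hf1 := ((tendsto_dilate hf.cont (e_mem_closed s)).norm.pow 2)
    have h2 : Tendsto (fun r : ℝ => |‖Qf f a (r * e s)‖ ^ 2 - ‖f (r * e s)‖ ^ 2 - a ^ 2| /
        √(‖Qf f a (r * e s)‖ ^ 2)) (nhdsWithin 1 (Iio 1)) (nhds 0) := by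
      have h3 := ((((hs.sub hf1).sub_const (a ^ 2))).abs).div hs.sqrt (by positivity)
      simpa [Pi.div_def] using h3
    rw [tendsto_zero_iff_norm_tendsto_zero]
    refine h2.congr fun r => ?_
    have hQ := Qf_ne_zero f a (r * e s)
    set Q := Qf f a (r * e s)
    have hQc : conj Q ≠ 0 := by simpa using hQ
    have h4 : Q - conj (f (r * e s) / Q) * f (r * e s) - conj ((a : ℂ) ^ 2 / Q) =
        ((‖Q‖ ^ 2 - ‖f (r * e s)‖ ^ 2 - a ^ 2 : ℝ) : ℂ) / conj Q := by
      push_cast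
      rw [← Complex.mul_conj', ← Complex.mul_conj']
      simp only [map_div₀, map_pow, conj_ofReal]
      field_simp
    rw [h4, norm_div, Complex.norm_real, RCLike.norm_conj, Real.sqrt_sq (norm_nonneg _),
      Real.norm_eq_abs]

lemma Qf_tendsto {α : ℝ} {f : ℂ → ℂ} (hf : MemA α f)
    (hne : ∃ z ∈ uDisc, f z ≠ 0) {a : ℕ → ℝ} (ha : ∀ n, 0 < a n ∧ a n ^ 2 ≤ 1) (ha0 : Tendsto a atTop (nhds 0))
    {z : ℂ} (hz : z ∈ uDisc) : Tendsto (fun n => Qf f (a n) z) atTop (nhds (Qf f 0 z)) := by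
  obtain ⟨B, hB0, hB⟩ := hf.exists_norm_le
  set K := 2 / (1 - ‖z‖)
  set M := Real.log (B ^ 2 + 1) / 2
  have hint0 := integrable_slog hf hne 0
  refine (Complex.continuous_exp.tendsto _).comp (tendsto_integral_of_dominated_convergence
    (fun s => K * (|slog 0 (f (e s))| + |M|)) (fun n => ?_)
    ((hint0.abs.add (integrable_const _)).const_mul _) (fun n => ?_) ?_)
  · exact (continuous_circleKernel hz).aestronglyMeasurable.mul
      (integrable_slog hf hne (a n)).ofReal.aestronglyMeasurable
  · filter_upwards [ae_ne hf hne] with s hs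
    have h1 := (norm_herglotz_le (norm_e s).ge (mem_uDisc.1 hz) le_rfl).1
    rw [norm_mul, Complex.norm_real, Real.norm_eq_abs]
    have h2 := log_norm_le_slog (a := a n) hs
    rw [← slog_zero] at h2
    have h3 : slog (a n) (f (e s)) ≤ M :=
      slog_le_of_norm_le (ha n).1.ne' (ha n).2 (hB _ (e_mem_closed s))
    have h4 : |slog (a n) (f (e s))| ≤ |slog 0 (f (e s))| + |M| := by
      rw [abs_le]
      constructor
      · linarith [neg_abs_le (slog 0 (f (e s))), abs_nonneg M]
      · linarith [le_abs_self M, abs_nonneg (slog 0 (f (e s)))]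
    exact mul_le_mul h1 h4 (abs_nonneg _) ((norm_nonneg _).trans h1)
  · filter_upwards [ae_ne hf hne] with s hs
    rw [slog_zero]
    exact ((continuous_ofReal.tendsto _).comp (tendsto_slog ha0 hs)).const_mul _

/-- Two continuous functions on the circle agreeing almost everywhere agree. -/
lemma eq_of_ae_eq {u v : ℝ → ℝ} (hu : Continuous u) (hv : Continuous v)
    (hup : ∀ t, u (t + 2 * Real.pi) = u t) (hvp : ∀ t, v (t + 2 * Real.pi) = v t)
    (h : u =ᵐ[nu] v) : u = v := by
  have h1 : u =ᵐ[volume.restrict (Ioc 0 (2 * Real.pi))] v := by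
    rw [Filter.EventuallyEq, ← ae_nu]; exact h
  have h2 := Measure.eqOn_Ioc_of_ae_eq volume (a := 0) (b := 2 * Real.pi) (f := u) (g := v) h1
    hu.continuousOn hv.continuousOn
  funext t
  obtain ⟨n, hn, -⟩ := existsUnique_add_zsmul_mem_Ioc Real.two_pi_pos t 0
  rw [zero_add] at hn
  have h3 := h2 hn
  rwa [(Function.Periodic.zsmul hup n) t, (Function.Periodic.zsmul hvp n) t] at h3

/-- Data attached to the outer part of a function in `𝒜_α`. -/
theorem exists_outer {α : ℝ} (hα : 0 < α) (hα1 : α < 1) {f : ℂ → ℂ} (hf : MemA α f)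
    (hne : ∃ z ∈ uDisc, f z ≠ 0) :
    ∃ (O : ℂ → ℂ) (C : ℝ) (Q : ℕ → ℂ → ℂ), MemA α O ∧ ABd α C O ∧ (∀ z ∈ uDisc, O z ≠ 0) ∧
      (∀ z ∈ uDisc, ‖f z‖ ≤ ‖O z‖) ∧ (∀ s, ‖O (e s)‖ = ‖f (e s)‖) ∧
      (∀ n, MemA α (Q n)⁻¹ ∧ ABd α C (Q n)) ∧ (∀ n, ∀ z ∈ uDisc, Q n z ≠ 0 ∧ ‖O z‖ ≤ ‖Q n z‖) ∧
      ∀ z ∈ uDisc, Tendsto (fun n => Q n z) atTop (nhds (O z)) := by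
  obtain ⟨a, ha, ha0⟩ := exists_small_seq
  obtain ⟨M, hM⟩ := Qf_bound hf hne
  obtain ⟨C, hC0, hC⟩ := toep_bound hα hα1 hf
  have hab : ∀ b : ℝ, 0 ≤ b → b ^ 2 ≤ 1 → ∃ g, MemA α g ∧ ABd α (C + M) g ∧
      ∀ z ∈ uDisc, g z = Qf f b z := fun b hb hb1 => by
    have hT := Qf_toep hf hne hb hb1
    obtain ⟨g, hg, hge⟩ := (hT.isA hα hα1 hf).exists_extension hα hα1
    have h1 := hC _ _ _ M hT (hM b hb1)
    have hd : ∀ z ∈ uDisc, deriv g z = deriv (Qf f b) z := fun z hz =>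
      (Filter.eventuallyEq_of_mem (isOpen_uDisc.mem_nhds hz) hge).deriv_eq
    refine ⟨g, hg, ⟨hg.diff, fun z hz => ?_, fun z hz => ?_, hg.1.2, ?_⟩, hge⟩
    · rw [hge z hz]; exact h1.bd z hz
    · rw [hd z hz]; exact h1.der z hz
    · refine le_trans (le_of_eq ?_) h1.dir
      exact setIntegral_congr_fun measurableSet_uDisc fun z hz => by simp only [hd z hz]
  obtain ⟨O, hO, hOb, hOe⟩ := hab 0 le_rfl (by norm_num)
  choose Q hQ hQb hQe using fun n => hab (a n) (ha n).1.le (ha n).2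
  refine ⟨O, C + M, Q, hO, hOb, fun z hz => ?_, fun z hz => ?_, ?_, fun n => ⟨?_, hQb n⟩,
    fun n z hz => ⟨?_, ?_⟩, fun z hz => ?_⟩
  · rw [hOe z hz]; exact Qf_ne_zero _ _ _
  · rw [hOe z hz]; exact norm_le_Qf hf hne 0 hz
  · have hp : ∀ t, e (t + 2 * Real.pi) = e t := fun t => e_periodic t
    refine congrFun (eq_of_ae_eq (u := fun s => ‖O (e s)‖) (v := fun s => ‖f (e s)‖)
      (continuous_comp_e hO.cont).norm (continuous_comp_e hf.cont).norm
      (fun t => by simp only [hp]) (fun t => by simp only [hp]) ?_)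
    filter_upwards [Qf_tendsto_bd hf hne 0] with s hs
    have h1 := (tendsto_dilate hO.cont (e_mem_closed s)).norm.pow 2
    have h2 : ‖O (e s)‖ ^ 2 = ‖f (e s)‖ ^ 2 + 0 ^ 2 := by
      refine tendsto_nhds_unique_of_eventuallyEq h1 hs ?_
      filter_upwards [Ioo_mem_nhdsLT one_pos] with r hr
      rw [hOe _ (mul_e_mem hr.1.le hr.2 s)]
    rw [zero_pow two_ne_zero, add_zero] at h2
    exact (pow_left_inj₀ (norm_nonneg _) (norm_nonneg _) two_ne_zero).1 h2
  · refine MemA.inv hα hα1 (hQ n) fun z hz h0 => ?_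
    have h1 : a n ≤ ‖Q n z‖ := by
      refine ge_of_tendsto (tendsto_dilate (hQ n).cont hz).norm ?_
      filter_upwards [Ioo_mem_nhdsLT one_pos] with r hr
      have hm : (r : ℂ) * z ∈ uDisc := smul_mem_uDisc' hr.1.le hr.2 hz
      rw [hQe n _ hm]
      exact le_Qf hf hne (ha n).1 hm
    rw [h0, norm_zero] at h1
    exact absurd (ha n).1 (not_lt.2 h1)
  · rw [hQe n z hz]; exact Qf_ne_zero _ _ _
  · rw [hOe z hz, hQe n z hz]; exact Qf_mono hf hne _ hz
  · simp only [hOe z hz, fun n => hQe n z hz]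
    exact Qf_tendsto hf hne ha ha0 hz

lemma ABd.mono {α C D : ℝ} {f : ℂ → ℂ} (h : ABd α C f) (hCD : C ≤ D) : ABd α D f := by
  have hC := h.nonneg
  refine ⟨h.diff, fun z hz => (h.bd z hz).trans hCD, fun z hz => (h.der z hz).trans ?_, h.dirI,
    h.dir.trans (by gcongr)⟩
  have : 0 ≤ 1 - ‖z‖ := by linarith [mem_uDisc.1 hz]
  gcongr

lemma ABd.mul {α C D : ℝ} (hα1 : α < 1) {f g : ℂ → ℂ} (hf : ABd α C f) (hg : ABd α D g) :
    ∃ K, K = max C D * max C D + max C D * (3 * max C D + 4) ∧ ABd α K (f * g) := by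
  have hC := hf.nonneg
  have hf' := hf.mono (le_max_left C D)
  have hg' := hg.mono (le_max_right C D)
  have h0 : 0 ≤ max C D := hC.trans (le_max_left _ _)
  refine ⟨_, rfl, ABd.dominated hα1 h0 hf' hg' (hf.diff.mul hg.diff) (fun z hz => ?_)
    fun z hz => ?_⟩
  · rw [Pi.mul_apply, norm_mul]
    exact mul_le_mul (hf'.bd z hz) (hg'.bd z hz) (norm_nonneg _) h0
  · rw [deriv_mul (hf.diff.differentiableAt (isOpen_uDisc.mem_nhds hz))
      (hg.diff.differentiableAt (isOpen_uDisc.mem_nhds hz))]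
    refine (norm_add_le _ _).trans ?_
    rw [norm_mul, norm_mul]
    have h1 := mul_le_mul_of_nonneg_left (hg'.bd z hz) (norm_nonneg (deriv f z))
    have h2 := mul_le_mul_of_nonneg_right (hf'.bd z hz) (norm_nonneg (deriv g z))
    nlinarith

/-- Powers of the outer part can be cancelled in a closed ideal. -/
theorem exists_outer_cancel {α : ℝ} (hα : 0 < α) (hα1 : α < 1) {f : ℂ → ℂ} (hf : MemA α f)
    (hne : ∃ z ∈ uDisc, f z ≠ 0) :
    ∃ O, MemA α O ∧ (∀ s, ‖O (e s)‖ = ‖f (e s)‖) ∧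
      ∀ J, IsClosedIdeal α J → ∀ N : ℕ, f * O ^ N ∈ J → f ∈ J := by
  obtain ⟨O, C, Q, hO, hOb, hO0, hfO, hOe, hQ, hQO, hQt⟩ := exists_outer hα hα1 hf hne
  refine ⟨O, hO, hOe, fun J hJ N => ?_⟩
  obtain ⟨D, hD, hfb⟩ := hf.exists_aBd hα hα1
  set E := max C D
  have hE : 0 ≤ E := hD.le.trans (le_max_right _ _)
  set X : ℕ → ℂ → ℂ := fun n => f * O * (Q n)⁻¹ with hX
  have hXb : ∀ n, ABd α (E + 1 * (3 * E)) (X n) := fun n => by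
    have hfE := hfb.mono (le_max_right C D)
    refine ABd.dominated_three hα1 zero_le_one hfE (hOb.mono (le_max_left C D))
      ((hQ n).2.mono (le_max_left C D)) ((hf.diff.mul hO.diff).mul (hQ n).1.diff)
      (fun z hz => ?_) fun z hz => ?_
    · obtain ⟨h0, h1⟩ := hQO n z hz
      simp only [hX, Pi.mul_apply, Pi.inv_apply, norm_mul, norm_inv]
      rw [← div_eq_mul_inv, mul_div_assoc]
      have : ‖O z‖ / ‖Q n z‖ ≤ 1 := div_le_one_of_le₀ h1 (norm_nonneg _)
      have h2 := hfE.bd z hz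
      nlinarith [norm_nonneg (f z)]
    · obtain ⟨h0, h1⟩ := hQO n z hz
      have hn := isOpen_uDisc.mem_nhds hz
      have hdf := (hf.diff.differentiableAt hn).hasDerivAt
      have hdO := (hO.diff.differentiableAt hn).hasDerivAt
      have hdQ := ((hQ n).2.diff.differentiableAt hn).hasDerivAt
      have hd := (hdf.mul hdO).mul (hdQ.inv h0)
      have h3 : deriv (X n) z = deriv f z * (O z / Q n z) + deriv O z * (f z / Q n z) -
          deriv (Q n) z * ((f z / Q n z) * (O z / Q n z)) := by
        rw [hX, hd.deriv]
        simp only [Pi.mul_apply, Pi.inv_apply]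
        field_simp
        ring
      have h4 : ‖O z / Q n z‖ ≤ 1 := by
        rw [norm_div]; exact div_le_one_of_le₀ h1 (norm_nonneg _)
      have h5 : ‖f z / Q n z‖ ≤ 1 := by
        rw [norm_div]; exact div_le_one_of_le₀ ((hfO z hz).trans h1) (norm_nonneg _)
      have h6 : ‖(f z / Q n z) * (O z / Q n z)‖ ≤ 1 := by
        rw [norm_mul]; exact mul_le_one₀ h5 (norm_nonneg _) h4
      rw [h3, one_mul]
      refine (norm_sub_le _ _).trans (add_le_add ((norm_add_le _ _).trans (add_le_add ?_ ?_)) ?_)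
      all_goals
        rw [norm_mul]
        exact mul_le_of_le_one_right (norm_nonneg _) (by assumption)
  induction N with
  | zero => intro h; simpa using h
  | succ N ih =>
    intro h
    refine ih ?_
    obtain ⟨D', hD', hON⟩ := (hO.pow hα hα1 N).exists_aBd hα hα1
    refine mem_of_bounded_limit hα hα1 hJ (x := fun n => X n * O ^ N) (fun n => ?_)
      (fun n => ?_) (hf.mul hα hα1 (hO.pow hα hα1 N)) (fun z hz => ?_)
      (C := max (E + 1 * (3 * E)) D' * max (E + 1 * (3 * E)) D' +
        max (E + 1 * (3 * E)) D' * (3 * max (E + 1 * (3 * E)) D' + 4))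
    · have h1 := hJ.mul_mem _ h _ (hQ n).1
      convert h1 using 1
      simp only [hX]; ring
    · obtain ⟨K, hK, hKb⟩ := (hXb n).mul hα1 hON
      rw [← hK]; exact hKb
    · have h1 := (hQt z hz).inv₀ (hO0 z hz)
      have h2 := ((h1.const_mul (f z * O z))).mul_const (O z ^ N)
      rw [mul_inv_cancel_right₀ (hO0 z hz)] at h2
      exact h2

/-! ### Functions with vanishing positive moments -/

lemma integral_geom_eq_zero {u : ℝ → ℂ} (hu : Integrable u nu)
    (hm : ∀ n : ℕ, ∫ s, e s ^ (n + 1) * u s ∂nu = 0) {a : ℂ} (ha : ‖a‖ < 1) :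
    ∫ s, ((1 - a * e s)⁻¹ - 1) * u s ∂nu = 0 := by
  have hi : ∀ n : ℕ, Integrable (fun s => (a * e s) ^ (n + 1) * u s) nu := fun n =>
    hu.bdd_mul (c := 1) ((continuous_const.mul continuous_e).pow _).aestronglyMeasurable
      (ae_of_all _ fun s => by
        rw [norm_pow, norm_mul, norm_e, mul_one]; exact pow_le_one₀ (norm_nonneg _) ha.le)
  have h1 := hasSum_integral_of_summable_integral_norm hi (by
    simp only [norm_mul, norm_pow, norm_e, mul_one, integral_const_mul]
    refine Summable.mul_right _ ?_
    exact (summable_nat_add_iff 1).2 (summable_geometric_of_lt_one (norm_nonneg _) ha))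
  have h2 : ∀ s, ∑' n : ℕ, (a * e s) ^ (n + 1) * u s = ((1 - a * e s)⁻¹ - 1) * u s := fun s => by
    have hn : ‖a * e s‖ < 1 := by rwa [norm_mul, norm_e, mul_one]
    rw [tsum_mul_right]
    congr 1
    have h3 := (summable_geometric_of_norm_lt_one hn).tsum_eq_zero_add
    rw [tsum_geometric_of_norm_lt_one hn, pow_zero] at h3
    rw [h3]; ring
  simp only [h2] at h1
  have h3 : ∀ n : ℕ, ∫ s, (a * e s) ^ (n + 1) * u s ∂nu = 0 := fun n => by
    simp only [mul_pow, mul_assoc, integral_const_mul, hm, mul_zero]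
  simp only [h3] at h1
  exact h1.unique hasSum_zero

/-- The Poisson integral of a complex function. -/
def PC (u : ℝ → ℂ) (z : ℂ) : ℂ := ∫ s, P z s • u s ∂nu

lemma PC_eq {u : ℝ → ℂ} (hu : Integrable u nu) (hm : ∀ n : ℕ, ∫ s, e s ^ (n + 1) * u s ∂nu = 0)
    {z : ℂ} (hz : z ∈ uDisc) :
    PC u z = (1 / 2 : ℂ) * (∫ s, (e s + z) / (e s - z) * u s ∂nu) + (1 / 2 : ℂ) * ∫ s, u s ∂nu := by
  have hz1 : ‖conj z‖ < 1 := by rw [RCLike.norm_conj]; exact mem_uDisc.1 hz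
  have hne := fun s => e_sub_ne hz s
  have hc : Integrable (fun s => (e s + z) / (e s - z) * u s) nu :=
    hu.bdd_mul (c := 2 / (1 - ‖z‖)) (continuous_circleKernel hz).aestronglyMeasurable
      (ae_of_all _ fun s => (norm_herglotz_le (norm_e s).ge (mem_uDisc.1 hz) le_rfl).1)
  have hne2 : ∀ s, 1 - conj z * e s ≠ 0 := fun s h => by
    have : ‖conj z * e s‖ = 1 := by rw [← sub_eq_zero.1 h, norm_one]
    rw [norm_mul, norm_e, mul_one] at this
    linarith
  have hg : Integrable (fun s => ((1 - conj z * e s)⁻¹ - 1) * u s) nu := by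
    refine hu.bdd_mul (c := (1 - ‖z‖)⁻¹ + 1) ?_ (ae_of_all _ fun s => ?_)
    · exact (((continuous_const.sub (continuous_const.mul continuous_e)).inv₀ hne2).sub
        continuous_const).aestronglyMeasurable
    · refine (norm_sub_le _ _).trans ?_
      rw [norm_one, norm_inv, ← norm_e_sub]
      have := norm_sub_ge z s
      have h3 : 0 < 1 - ‖z‖ := by linarith [mem_uDisc.1 hz]
      gcongr
  have h1 : PC u z = ∫ s, ((1 / 2 : ℂ) * ((e s + z) / (e s - z) * u s) + (1 / 2 : ℂ) * u s) +
      ((1 - conj z * e s)⁻¹ - 1) * u s ∂nu := by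
    unfold PC
    congr 1; ext s
    rw [real_smul, P_eq hz]
    have := hne s
    field_simp
    ring
  have i1 : Integrable (fun s => (1 / 2 : ℂ) * ((e s + z) / (e s - z) * u s) + (1 / 2 : ℂ) * u s)
    nu := (hc.const_mul _).add (hu.const_mul _)
  rw [h1, integral_add i1 hg, integral_geom_eq_zero hu hm hz1, add_zero,
    integral_add (hc.const_mul _) (hu.const_mul _), integral_const_mul, integral_const_mul]

lemma PC_diff {u : ℝ → ℂ} (hu : Integrable u nu)
    (hm : ∀ n : ℕ, ∫ s, e s ^ (n + 1) * u s ∂nu = 0) : DifferentiableOn ℂ (PC u) uDisc := by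
  refine DifferentiableOn.congr (f := fun z => (1 / 2 : ℂ) * (∫ s, (e s + z) / (e s - z) * u s ∂nu)
    + (1 / 2 : ℂ) * ∫ s, u s ∂nu) (fun z hz => ?_) fun z hz => PC_eq hu hm hz
  exact (((herglotz_hasDerivAt continuous_e (fun s => (norm_e s).ge) hu
    hz).differentiableAt.const_mul _).add_const _).differentiableWithinAt

lemma PC_norm_le {u : ℝ → ℂ} (hu : Integrable u nu) {B : ℝ} (hB : ∀ᵐ s ∂nu, ‖u s‖ ≤ B)
    {z : ℂ} (hz : z ∈ uDisc) : ‖PC u z‖ ≤ B := by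
  refine (norm_integral_le_integral_norm _).trans ?_
  simp only [norm_smul, Real.norm_of_nonneg (P_nonneg hz _)]
  exact PI_le_of_le hu.norm hB hz

lemma hasBd_PC {u : ℝ → ℂ} (hu : Integrable u nu)
    (hm : ∀ n : ℕ, ∫ s, e s ^ (n + 1) * u s ∂nu = 0) {B : ℝ} (hB : ∀ᵐ s ∂nu, ‖u s‖ ≤ B) :
    HasBd (PC u) u :=
  ⟨PC_diff hu hm, ⟨B, fun _ hz => PC_norm_le hu hB hz⟩, fatou hu⟩

lemma HasBd.mul {G H : ℂ → ℂ} {Gs Hs : ℝ → ℂ} (hG : HasBd G Gs) (hH : HasBd H Hs) :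
    HasBd (fun z => G z * H z) fun s => Gs s * Hs s := by
  obtain ⟨B, hB⟩ := hG.bdd
  obtain ⟨C, hC⟩ := hH.bdd
  refine ⟨hG.diff.mul hH.diff, ⟨B * C, fun z hz => ?_⟩, ?_⟩
  · rw [norm_mul]
    exact mul_le_mul (hB z hz) (hC z hz) (norm_nonneg _) ((norm_nonneg _).trans (hB z hz))
  · filter_upwards [hG.lim, hH.lim] with s h1 h2
    exact h1.mul h2

lemma HasBd.sub {G H : ℂ → ℂ} {Gs Hs : ℝ → ℂ} (hG : HasBd G Gs) (hH : HasBd H Hs) :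
    HasBd (fun z => G z - H z) fun s => Gs s - Hs s := by
  obtain ⟨B, hB⟩ := hG.bdd
  obtain ⟨C, hC⟩ := hH.bdd
  refine ⟨hG.diff.sub hH.diff, ⟨B + C, fun z hz => (norm_sub_le _ _).trans
    (add_le_add (hB z hz) (hC z hz))⟩, ?_⟩
  filter_upwards [hG.lim, hH.lim] with s h1 h2
  exact h1.sub h2

/-- Uniqueness: bounded analytic functions are determined by their radial limits. -/
lemma HasBd.eq_of_ae_eq {G H : ℂ → ℂ} {Gs Hs : ℝ → ℂ} (hG : HasBd G Gs) (hH : HasBd H Hs)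
    (h : ∀ᵐ s ∂nu, Gs s = Hs s) {z : ℂ} (hz : z ∈ uDisc) : G z = H z := by
  by_contra hne
  have h1 := ((hG.sub hH).log_aux hz (sub_ne_zero.2 hne)).1
  have h2 : ∀ᵐ s ∂nu, False := by
    filter_upwards [h, h1] with s h3 h4
    exact h4 (sub_eq_zero.2 h3)
  have : NeBot (ae nu) := inferInstance
  exact h2.exists.elim fun _ h => h

/-! ### Almost everywhere statements on the line -/

lemma ae_volume_of_ae_nu {p : ℝ → Prop} (hp : ∀ (t : ℝ) (n : ℤ), p (t + n * (2 * Real.pi)) → p t)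
    (h : ∀ᵐ s ∂nu, p s) : ∀ᵐ s, p s := by
  rw [ae_nu] at h
  have h0 : ∀ᵐ s : ℝ, s ∈ Ioc 0 (2 * Real.pi) → p s := by
    rwa [ae_restrict_iff' measurableSet_Ioc] at h
  have h1 : ∀ n : ℤ, ∀ᵐ s : ℝ, s + n * (2 * Real.pi) ∈ Ioc 0 (2 * Real.pi) →
      p (s + n * (2 * Real.pi)) := fun n =>
    (measurePreserving_add_right volume ((n : ℝ) * (2 * Real.pi))).quasiMeasurePreserving.ae h0
  filter_upwards [ae_all_iff.2 h1] with s hs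
  obtain ⟨n, hn, -⟩ := existsUnique_add_zsmul_mem_Ioc Real.two_pi_pos s 0
  rw [zero_add, zsmul_eq_mul] at hn
  exact hp s n (hs n hn)

/-! ### `L²` -/

lemma L2_tendsto {w u : ℝ → ℂ} {x : ℕ → ℝ → ℂ} (hw : MemLp w 2 nu) (hu : MemLp u 2 nu)
    (hx : ∀ n, MemLp (x n) 2 nu)
    (h : Tendsto (fun n => ∫ s, ‖x n s - u s‖ ^ 2 ∂nu) atTop (nhds 0)) :
    Tendsto (fun n => ∫ s, w s * x n s ∂nu) atTop (nhds (∫ s, w s * u s ∂nu)) := by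
  rw [tendsto_iff_norm_sub_tendsto_zero]
  have h1 : Tendsto (fun n => √(∫ s, ‖w s‖ ^ 2 ∂nu) * √(∫ s, ‖x n s - u s‖ ^ 2 ∂nu)) atTop
      (nhds 0) := by simpa using (h.sqrt).const_mul (√(∫ s, ‖w s‖ ^ 2 ∂nu))
  refine squeeze_zero (fun _ => norm_nonneg _) (fun n => ?_) h1
  have hi1 : Integrable (fun s => w s * x n s) nu := MemLp.integrable_mul hw (hx n)
  have hi2 : Integrable (fun s => w s * u s) nu := MemLp.integrable_mul hw hu
  rw [← integral_sub hi1 hi2]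
  refine (norm_integral_le_integral_norm _).trans ?_
  simp only [← mul_sub, norm_mul]
  have := integral_mul_le_Lp_mul_Lq_of_nonneg (μ := nu) Real.HolderConjugate.two_two
    (f := fun s => ‖w s‖) (g := fun s => ‖x n s - u s‖) (ae_of_all _ fun s => norm_nonneg _)
    (ae_of_all _ fun s => norm_nonneg _) (by simpa using hw.norm)
    (by simpa using ((hx n).sub hu).norm)
  simpa [Real.sqrt_eq_rpow] using this

lemma memLp_of_continuous {u : ℝ → ℂ} (hu : Continuous u) {B : ℝ} (hB : ∀ s, ‖u s‖ ≤ B) :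
    MemLp u 2 nu := MemLp.of_bound hu.aestronglyMeasurable B (ae_of_all _ hB)

lemma _root_.MemA.memLp {α : ℝ} {f : ℂ → ℂ} (hf : MemA α f) : MemLp (fun s => f (e s)) 2 nu := by
  obtain ⟨B, -, hB⟩ := hf.exists_norm_le
  exact memLp_of_continuous (continuous_comp_e hf.cont) fun s => hB _ (e_mem_closed s)

lemma L2_norm_sq (x : Lp ℂ 2 nu) : ‖x‖ ^ 2 = ∫ s, ‖x s‖ ^ 2 ∂nu := by
  have h1 := inner_self_eq_norm_sq_to_K (𝕜 := ℂ) x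
  rw [L2.inner_def] at h1
  simp only [inner_self_eq_norm_sq_to_K] at h1
  have h2 : (∫ s, ((‖x s‖ ^ 2 : ℝ) : ℂ) ∂nu) = ((‖x‖ ^ 2 : ℝ) : ℂ) := by
    push_cast; exact h1
  rw [integral_complex_ofReal] at h2
  exact_mod_cast h2.symm

lemma exists_coeff_ne {f : ℂ → ℂ} (hf : DiffContOnCl ℂ f (ball 0 1)) (hne : ∃ z ∈ uDisc, f z ≠ 0) :
    ∃ n : ℕ, ∫ s, (e s)⁻¹ ^ n * f (e s) ∂nu ≠ 0 := by
  by_contra hcon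
  push Not at hcon
  obtain ⟨z, hz, hfz⟩ := hne
  have h1 : HasFPowerSeriesOnBall f (cauchyPowerSeries f 0 ((1 : NNReal) : ℝ)) 0 (1 : NNReal) :=
    DiffContOnCl.hasFPowerSeriesOnBall (by simpa using hf) one_pos
  have h2 := h1.hasSum (y := z) (by
    have h0 : z ∈ ball (0 : ℂ) ((1 : NNReal) : ℝ) := by simpa using mem_uDisc.1 hz
    rwa [← Metric.eball_coe] at h0)
  rw [zero_add] at h2
  refine hfz (h2.unique ?_)
  have h3 : ∀ n, ((cauchyPowerSeries f 0 ((1 : NNReal) : ℝ) n) fun _ => z) = 0 := fun n => by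
    rw [cauchyPowerSeries_apply]
    have h4 := hcon n
    rw [integral_nu] at h4
    have h5 : (∫ s in (0 : ℝ)..2 * Real.pi, (e s)⁻¹ ^ n * f (e s)) = 0 := by
      refine (smul_eq_zero.1 h4).resolve_left (inv_ne_zero Real.two_pi_pos.ne')
    rw [circleIntegral]
    have h6 : ∀ θ : ℝ, deriv (circleMap 0 ((1 : NNReal) : ℝ)) θ •
        (fun w : ℂ => (z / (w - 0)) ^ n • (w - 0)⁻¹ • f w) (circleMap 0 ((1 : NNReal) : ℝ) θ) =
        (z ^ n * I) * ((e θ)⁻¹ ^ n * f (e θ)) := fun θ => by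
      simp only [deriv_circleMap, NNReal.coe_one, circleMap_one, smul_eq_mul, sub_zero, div_pow, inv_pow]
      have := e_ne_zero θ
      field_simp
    simp only [h6]
    rw [intervalIntegral.integral_const_mul, h5, mul_zero, smul_zero]
  simp only [h3]
  exact hasSum_zero

lemma inner_of_ae_eq {x y : Lp ℂ 2 nu} {v w : ℝ → ℂ} (hy : y =ᵐ[nu] v) (hx : x =ᵐ[nu] w) :
    inner ℂ y x = ∫ s, conj (v s) * w s ∂nu := by
  rw [L2.inner_def]
  refine integral_congr_ae ?_
  filter_upwards [hy, hx] with s h1 h2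
  rw [h1, h2, RCLike.inner_apply, mul_comm]

lemma memA_id {α : ℝ} (hα : 0 < α) (hα1 : α < 1) : MemA α (fun z => z) :=
  memA_of_differentiable hα hα1 differentiable_id

/-- The subspace of `L²` generated by `w · g`, `g ∈ J`. -/
def traceSub {α : ℝ} {J : Set (ℂ → ℂ)} (hJ : IsClosedIdeal α J) (w : ℝ → ℂ) :
    Submodule ℂ (Lp ℂ 2 nu) where
  carrier := {x | ∃ g ∈ J, x =ᵐ[nu] fun s => w s * g (e s)}
  add_mem' := by
    rintro x y ⟨g, hg, hx⟩ ⟨k, hk, hy⟩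
    refine ⟨g + k, hJ.add_mem _ hg _ hk, ?_⟩
    filter_upwards [hx, hy, Lp.coeFn_add x y] with s h1 h2 h3
    rw [h3, Pi.add_apply, h1, h2, Pi.add_apply, mul_add]
  zero_mem' := by
    refine ⟨0, hJ.zero_mem, ?_⟩
    filter_upwards [Lp.coeFn_zero ℂ 2 nu] with s h1
    rw [h1]; simp
  smul_mem' := by
    rintro c x ⟨g, hg, hx⟩
    refine ⟨c • g, hJ.smul_mem c _ hg, ?_⟩
    filter_upwards [hx, Lp.coeFn_smul c x] with s h1 h2
    rw [h2, Pi.smul_apply, h1, Pi.smul_apply, smul_eq_mul, smul_eq_mul]; ring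

lemma beurling_aux {α : ℝ} (hα : 0 < α) (hα1 : α < 1) {J : Set (ℂ → ℂ)}
    (hJ : IsClosedIdeal α J) (hne : ∃ f ∈ J, ∃ z ∈ uDisc, f z ≠ 0) :
    ∃ u : ℝ → ℂ, MemLp u 2 nu ∧ ∫ s, ‖u s‖ ^ 2 ∂nu = 1 ∧
      (∀ g ∈ J, ∫ s, conj (u s) * (e s * g (e s)) ∂nu = 0) ∧
      ∃ x : ℕ → ℂ → ℂ, (∀ n, x n ∈ J) ∧
        Tendsto (fun n => ∫ s, ‖x n (e s) - u s‖ ^ 2 ∂nu) atTop (nhds 0) := by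
  have hcl : ∀ g ∈ J, DiffContOnCl ℂ g (ball 0 1) := fun g hg =>
    diffContOnCl_of (hJ.mem_A g hg).diff (hJ.mem_A g hg).cont
  have hmulid : ∀ g ∈ J, (fun z => z * g z) ∈ J := fun g hg => by
    have := hJ.mul_mem g hg _ (memA_id hα hα1)
    rwa [mul_comm] at this
  have hex : ∃ n : ℕ, ∃ g ∈ J, ∫ s, (e s)⁻¹ ^ n * g (e s) ∂nu ≠ 0 := by
    obtain ⟨f, hf, hz⟩ := hne
    obtain ⟨n, hn⟩ := exists_coeff_ne (hcl f hf) hz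
    exact ⟨n, f, hf, hn⟩
  set n := Nat.find hex with hn
  obtain ⟨g0, hg0, hc0⟩ := Nat.find_spec hex
  have hzero : ∀ g ∈ J, ∫ s, (e s)⁻¹ ^ n * (e s * g (e s)) ∂nu = 0 := fun g hg => by
    rcases Nat.eq_zero_or_pos n with h0 | h0
    · rw [h0]
      simp only [pow_zero, one_mul]
      simpa using mean_value (hcl _ (hmulid g hg))
    · obtain ⟨m, hm⟩ := Nat.exists_eq_succ_of_ne_zero h0.ne'
      by_contra hcon
      refine Nat.find_min hex (m := m) (by rw [← hn, hm]; exact Nat.lt_succ_self m) ⟨g, hg, ?_⟩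
      convert hcon using 2
      ext s
      rw [hm, pow_succ, mul_assoc, inv_mul_cancel_left₀ (e_ne_zero s)]
  have hy : MemLp (fun s => e s ^ n) 2 nu :=
    memLp_of_continuous (continuous_e.pow n) (B := 1) fun s => by rw [norm_pow, norm_e, one_pow]
  set y := hy.toLp _
  have hye : y =ᵐ[nu] fun s => e s ^ n := hy.coeFn_toLp
  have hycoef : ∀ (x : Lp ℂ 2 nu) (v : ℝ → ℂ), x =ᵐ[nu] v →
      inner ℂ y x = ∫ s, (e s)⁻¹ ^ n * v s ∂nu := fun x v hx => by
    rw [inner_of_ae_eq hye hx]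
    simp only [map_pow, conj_e]
  set S := traceSub hJ fun _ => 1
  set S1 := traceSub hJ e
  have hS1S : S1 ≤ S := by
    rintro x ⟨g, hg, hx⟩
    exact ⟨fun z => z * g z, hmulid g hg, by simpa using hx⟩
  have hM1 : S1.topologicalClosure ≤ (Submodule.span ℂ {y})ᗮ := by
    refine Submodule.topologicalClosure_minimal _ ?_ (Submodule.isClosed_orthogonal _)
    rintro x ⟨g, hg, hx⟩
    rw [Submodule.mem_orthogonal_singleton_iff_inner_right, hycoef x _ hx, hzero g hg]
  have hg0L := (hJ.mem_A g0 hg0).memLp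
  set x0 := hg0L.toLp _
  have hx0e : x0 =ᵐ[nu] fun s => g0 (e s) := hg0L.coeFn_toLp
  have hx0S : x0 ∈ S := ⟨g0, hg0, by simpa using hx0e⟩
  have hx0 : x0 ∉ S1.topologicalClosure := fun h => by
    have := hM1 h
    rw [Submodule.mem_orthogonal_singleton_iff_inner_right, hycoef x0 _ hx0e] at this
    exact hc0 this
  have : CompleteSpace S1.topologicalClosure :=
    S1.isClosed_topologicalClosure.completeSpace_coe
  obtain ⟨p, hp, q, hq, hpq⟩ := S1.topologicalClosure.exists_add_mem_mem_orthogonal x0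
  have hq0 : q ≠ 0 := fun h => hx0 (by rw [hpq, h, add_zero]; exact hp)
  have hqS : q ∈ S.topologicalClosure := by
    have h1 : q = x0 - p := by rw [hpq]; abel
    rw [h1]
    exact sub_mem (S.le_topologicalClosure hx0S) (Submodule.topologicalClosure_mono hS1S hp)
  set u := ((‖q‖⁻¹ : ℝ) : ℂ) • q with hu
  have hun : ‖u‖ = 1 := by
    rw [hu, norm_smul, Complex.norm_real, norm_inv, norm_norm, inv_mul_cancel₀ (norm_ne_zero_iff.2 hq0)]
  have huS : u ∈ S.topologicalClosure := Submodule.smul_mem _ _ hqS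
  have huo : u ∈ S1.topologicalClosureᗮ := Submodule.smul_mem _ _ hq
  refine ⟨u, Lp.memLp u, ?_, fun g hg => ?_, ?_⟩
  · rw [← L2_norm_sq, hun, one_pow]
  · have hgL : MemLp (fun s => e s * g (e s)) 2 nu := (hJ.mem_A _ (hmulid g hg)).memLp
    have h1 : hgL.toLp _ ∈ S1 := ⟨g, hg, hgL.coeFn_toLp⟩
    have h2 := (Submodule.mem_orthogonal' _ _).1 huo _ (S1.le_topologicalClosure h1)
    rwa [inner_of_ae_eq (ae_eq_refl _) hgL.coeFn_toLp] at h2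
  · obtain ⟨X, hX, hXu⟩ := mem_closure_iff_seq_limit.1 huS
    choose x hx hxX using fun n => (hX n : ∃ g ∈ J, X n =ᵐ[nu] fun s => 1 * g (e s))
    refine ⟨x, hx, ?_⟩
    have h1 := (tendsto_iff_norm_sub_tendsto_zero.1 hXu).pow 2
    rw [zero_pow two_ne_zero] at h1
    refine h1.congr fun n => ?_
    rw [L2_norm_sq]
    refine integral_congr_ae ?_
    filter_upwards [hxX n, Lp.coeFn_sub (X n) u] with s h2 h3
    rw [h3, Pi.sub_apply, h2, one_mul]

lemma isInner_of_hasBd {U : ℂ → ℂ} {u : ℝ → ℂ} (hU : HasBd U u) (hU1 : ∀ z ∈ uDisc, ‖U z‖ ≤ 1)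
    (hu : ∀ᵐ s ∂nu, ‖u s‖ = 1) : IsInner U := by
  refine ⟨hU.diff, hU1, ae_volume_of_ae_nu (fun t n h => ?_) ?_⟩
  · have h1 : e (t + n * (2 * Real.pi)) = e t := e_periodic.int_mul n t
    have h2 : cexp (((t + n * (2 * Real.pi) : ℝ) : ℂ) * I) = cexp ((t : ℂ) * I) := h1
    rwa [h2] at h
  · filter_upwards [hU.lim, hu] with s h1 h2
    have := h1.norm
    rwa [h2] at this

/-- A Beurling type theorem for closed ideals of `𝒜_α`. -/
theorem beurling {α : ℝ} (hα : 0 < α) (hα1 : α < 1) {J : Set (ℂ → ℂ)}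
    (hJ : IsClosedIdeal α J) (hne : ∃ f ∈ J, ∃ z ∈ uDisc, f z ≠ 0) :
    ∃ (U : ℂ → ℂ) (u : ℝ → ℂ), IsInner U ∧ HasBd U u ∧ (∀ᵐ s ∂nu, ‖u s‖ = 1) ∧
      (∀ g ∈ J, ∃ h, HasBd h (fun s => conj (u s) * g (e s)) ∧ ∀ z ∈ uDisc, g z = U z * h z) ∧
      ∃ x : ℕ → ℂ → ℂ, (∀ n, x n ∈ J) ∧
        Tendsto (fun n => ∫ s, ‖x n (e s) - u s‖ ^ 2 ∂nu) atTop (nhds 0) := by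
  obtain ⟨u, hu2, hu1, huo, x, hx, hxu⟩ := beurling_aux hα hα1 hJ hne
  have hen : ∀ (n : ℕ) s, ‖e s ^ n‖ ≤ 1 := fun n s => by rw [norm_pow, norm_e, one_pow]
  have heL : ∀ n : ℕ, MemLp (fun s => e s ^ n) 2 nu := fun n =>
    memLp_of_continuous (continuous_e.pow n) (hen n)
  have hpowJ : ∀ (n : ℕ), ∀ g ∈ J, (fun z => z ^ n * g z) ∈ J := fun n g hg => by
    have := hJ.mul_mem g hg _ ((memA_id hα hα1).pow hα hα1 n)
    rwa [mul_comm] at this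
  have hui : Integrable u nu := hu2.integrable (by norm_num)
  have hxL : ∀ n, MemLp (fun s => x n (e s)) 2 nu := fun n => (hJ.mem_A _ (hx n)).memLp
  have hconj : MemLp (fun s => conj (u s)) 2 nu := hu2.star
  have hA : ∀ g ∈ J, ∀ n : ℕ, ∫ s, e s ^ (n + 1) * (conj (u s) * g (e s)) ∂nu = 0 :=
    fun g hg n => by
    rw [← huo _ (hpowJ n g hg)]
    congr 1; ext s; ring
  have hB : ∀ n : ℕ, ∫ s, e s ^ (n + 1) * ((‖u s‖ ^ 2 : ℝ) : ℂ) ∂nu = 0 := fun n => by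
    have hw : MemLp (fun s => e s ^ (n + 1) * conj (u s)) 2 nu := by
      refine MemLp.of_le hconj ((continuous_e.pow _).aestronglyMeasurable.mul
        hconj.aestronglyMeasurable) (ae_of_all _ fun s => ?_)
      rw [norm_mul]
      exact mul_le_of_le_one_left (norm_nonneg _) (hen _ s)
    have h1 := L2_tendsto hw hu2 hxL hxu
    have h2 : ∀ k, ∫ s, e s ^ (n + 1) * conj (u s) * x k (e s) ∂nu = 0 := fun k => by
      rw [← hA _ (hx k) n]
      congr 1; ext s; ring
    simp only [h2] at h1
    rw [← tendsto_nhds_unique h1 tendsto_const_nhds]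
    congr 1; ext s
    rw [mul_assoc, Complex.conj_mul', ofReal_pow]
  have hC : ∀ n : ℕ, ∫ s, e s ^ (n + 1) * u s ∂nu = 0 := fun n => by
    have h1 := L2_tendsto (heL (n + 1)) hu2 hxL hxu
    have h2 : ∀ k, ∫ s, e s ^ (n + 1) * x k (e s) ∂nu = 0 := fun k => by
      have h3 := hpowJ (n + 1) _ (hx k)
      have h4 := mean_value (g := fun z => z ^ (n + 1) * x k z)
        (diffContOnCl_of (hJ.mem_A _ h3).diff (hJ.mem_A _ h3).cont)
      simpa using h4
    simp only [h2] at h1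
    exact (tendsto_nhds_unique h1 tendsto_const_nhds)
  have husq : Integrable (fun s => ((‖u s‖ ^ 2 : ℝ) : ℂ)) nu :=
    ((memLp_two_iff_integrable_sq_norm hu2.aestronglyMeasurable).1 hu2).ofReal
  have hPC : ∀ z ∈ uDisc, PI (fun s => ‖u s‖ ^ 2) z = 1 := fun z hz => by
    have hz1 : ‖conj z‖ < 1 := by rw [RCLike.norm_conj]; exact mem_uDisc.1 hz
    have h1 := integral_geom_eq_zero husq hB hz1
    have h2 : ∀ s, ((P z s * ‖u s‖ ^ 2 : ℝ) : ℂ) = ((1 - conj z * e s)⁻¹ - 1) * ((‖u s‖ ^ 2 : ℝ) : ℂ)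
        + conj (((1 - conj z * e s)⁻¹ - 1) * ((‖u s‖ ^ 2 : ℝ) : ℂ)) + ((‖u s‖ ^ 2 : ℝ) : ℂ) :=
      fun s => by
      have h3 : e s / (e s - z) = conj (1 - conj z * e s)⁻¹ := by
        rw [← conj_kernel hz, Complex.conj_conj]
      rw [ofReal_mul, P_eq hz, h3, map_mul, map_sub, map_one, conj_ofReal]
      ring
    have hi : Integrable (fun s => ((1 - conj z * e s)⁻¹ - 1) * ((‖u s‖ ^ 2 : ℝ) : ℂ)) nu := by
      have hc : Continuous fun s => (1 - conj z * e s)⁻¹ - 1 :=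
        ((continuous_const.sub (continuous_const.mul continuous_e)).inv₀
          fun s => one_sub_ne hz (e_mem_closed s)).sub continuous_const
      have hn : ∀ s, conj (e s / (e s - z)) = (1 - conj z * e s)⁻¹ := fun s => conj_kernel hz s
      refine husq.bdd_mul (c := 1 / (1 - ‖z‖) + 1) hc.aestronglyMeasurable (ae_of_all _ fun s => ?_)
      refine (norm_sub_le _ _).trans ?_
      rw [← hn s, RCLike.norm_conj, norm_div, norm_e, norm_one]
      have h5 := mem_uDisc.1 hz
      have h6 := norm_sub_ge z s
      gcongr
    have hi' : Integrable (fun s => conj (((1 - conj z * e s)⁻¹ - 1) * ((‖u s‖ ^ 2 : ℝ) : ℂ))) nu :=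
      hi.mono (Complex.continuous_conj.comp_aestronglyMeasurable hi.1)
        (ae_of_all _ fun s => (RCLike.norm_conj _).le)
    have h4 : ((PI (fun s => ‖u s‖ ^ 2) z : ℝ) : ℂ) = 1 := by
      rw [PI, ← integral_complex_ofReal, integral_congr_ae (ae_of_all _ h2),
        integral_add (f := fun s => _ + _) (hi.add hi') husq, integral_add hi hi', integral_conj, h1,
        integral_complex_ofReal, hu1]
      simp
    exact_mod_cast h4
  have hun : ∀ᵐ s ∂nu, ‖u s‖ = 1 := by
    filter_upwards [fatou ((memLp_two_iff_integrable_sq_norm hu2.aestronglyMeasurable).1 hu2)]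
      with s hs
    have h1 : Tendsto (fun r : ℝ => ∫ t, P (r * e s) t • ‖u t‖ ^ 2 ∂nu) (nhdsWithin 1 (Iio 1))
        (nhds 1) := by
      refine tendsto_const_nhds.congr' ?_
      filter_upwards [Ioo_mem_nhdsLT one_pos] with r hr
      exact (hPC _ (mul_e_mem hr.1.le hr.2 s)).symm
    have h2 := tendsto_nhds_unique hs h1
    exact (pow_eq_one_iff_of_nonneg (norm_nonneg _) two_ne_zero).1 h2
  have hU := hasBd_PC hui hC (hun.mono fun s hs => hs.le)
  refine ⟨PC u, u, isInner_of_hasBd hU (fun z hz => PC_norm_le hui (hun.mono fun s hs => hs.le) hz)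
    hun, hU, hun, fun g hg => ?_, x, hx, hxu⟩
  obtain ⟨B, hB0, hgB⟩ := (hJ.mem_A g hg).exists_norm_le
  have hgi : Integrable (fun s => conj (u s) * g (e s)) nu :=
    MemLp.integrable_mul hconj (hJ.mem_A g hg).memLp
  have hh : HasBd (PC fun s => conj (u s) * g (e s)) fun s => conj (u s) * g (e s) := by
    refine hasBd_PC hgi (hA g hg) (B := B) ?_
    filter_upwards [hun] with s hs
    rw [norm_mul, RCLike.norm_conj, hs, one_mul]
    exact hgB _ (e_mem_closed s)
  refine ⟨_, hh, fun z hz => (hJ.mem_A g hg).hasBd.eq_of_ae_eq (hU.mul hh) ?_ hz⟩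
  filter_upwards [hun] with s hs
  rw [← mul_assoc, Complex.mul_conj', hs]; simp

/-- `s` inverts `l - z` modulo `K`. -/
def Res (α : ℝ) (K : Set (ℂ → ℂ)) (l : ℂ) (s : ℂ → ℂ) : Prop :=
  MemA α s ∧ (fun z => (l - z) * s z - 1) ∈ K

/-- The resolvent transform of a functional annihilating `K`. -/
def Lf (α : ℝ) (K : Set (ℂ → ℂ)) (φ : (ℂ → ℂ) →ₗ[ℂ] ℂ) (l : ℂ) : ℂ :=
  if h : ∃ s, Res α K l s then φ h.choose else 0

lemma Res.unique {α : ℝ} {K : Set (ℂ → ℂ)} (hK : IsClosedIdeal α K) {φ : (ℂ → ℂ) →ₗ[ℂ] ℂ}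
    (hφ : ∀ s ∈ K, φ s = 0) {l : ℂ} {s t : ℂ → ℂ} (hs : Res α K l s) (ht : Res α K l t) :
    φ s = φ t := by
  have h1 := hK.add_mem _ (hK.mul_mem _ hs.2 t ht.1) _
    (hK.smul_mem (-1) _ (hK.mul_mem _ ht.2 s hs.1))
  have h2 : ((fun z => (l - z) * s z - 1) * t + (-1 : ℂ) • ((fun z => (l - z) * t z - 1) * s)) =
      s - t := by
    ext z
    simp only [Pi.add_apply, Pi.mul_apply, Pi.smul_apply, smul_eq_mul, Pi.sub_apply]
    ring
  rw [h2] at h1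
  have h3 := hφ _ h1
  rw [map_sub] at h3
  exact sub_eq_zero.1 h3

lemma Lf_eq {α : ℝ} {K : Set (ℂ → ℂ)} (hK : IsClosedIdeal α K) {φ : (ℂ → ℂ) →ₗ[ℂ] ℂ}
    (hφ : ∀ s ∈ K, φ s = 0) {l : ℂ} {s : ℂ → ℂ} (hs : Res α K l s) : Lf α K φ l = φ s := by
  have h : ∃ s, Res α K l s := ⟨s, hs⟩
  rw [Lf, dif_pos h]
  exact Res.unique hK hφ h.choose_spec hs

lemma one_add_ne {δ t : ℂ} {M : ℝ} (ht : ‖t‖ ≤ M) (hδ : ‖δ‖ * M ≤ 1 / 2) :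
    1 / 2 ≤ ‖1 + δ * t‖ := by
  have h1 : ‖δ * t‖ ≤ 1 / 2 := by
    rw [norm_mul]
    exact (mul_le_mul_of_nonneg_left ht (norm_nonneg _)).trans hδ
  have h2 := norm_sub_norm_le (1 : ℂ) (-(δ * t))
  rw [norm_neg, norm_one, sub_neg_eq_add] at h2
  linarith

lemma Res.perturb {α : ℝ} (hα : 0 < α) (hα1 : α < 1) {K : Set (ℂ → ℂ)} (hK : IsClosedIdeal α K)
    {l : ℂ} {s : ℂ → ℂ} (hs : Res α K l s) {M : ℝ}
    (hM : ∀ z ∈ closedBall (0 : ℂ) 1, ‖s z‖ ≤ M) {δ : ℂ} (hδ : ‖δ‖ * M ≤ 1 / 2) :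
    MemA α (fun z => (1 + δ * s z)⁻¹) ∧ Res α K (l + δ) (fun z => s z * (1 + δ * s z)⁻¹) := by
  have hne : ∀ z ∈ closedBall (0 : ℂ) 1, 1 + δ * s z ≠ 0 := fun z hz h => by
    have := one_add_ne (hM z hz) hδ
    rw [h, norm_zero] at this
    norm_num at this
  have h1 : MemA α fun z => 1 + δ * s z :=
    (memA_const hα hα1 1).add hα hα1 (hs.1.smul hα hα1 δ)
  have h2 : MemA α fun z => (1 + δ * s z)⁻¹ := h1.inv hα hα1 hne
  have h3 : MemA α fun z => s z * (1 + δ * s z)⁻¹ := hs.1.mul hα hα1 h2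
  refine ⟨h2, h3, hK.ext_mem _ (hK.mul_mem _ hs.2 _ h2) _ ?_ fun z hz => ?_⟩
  · have h4 : MemA α fun z => (l + δ) - z :=
      memA_of_differentiable hα hα1 ((differentiable_const _).sub differentiable_id)
    exact (h4.mul hα hα1 h3).sub hα hα1 (memA_const hα hα1 1)
  · have := hne z hz
    simp only [Pi.mul_apply]
    field_simp
    ring

lemma Res.differentiableAt {α : ℝ} (hα : 0 < α) (hα1 : α < 1) {K : Set (ℂ → ℂ)}
    (hK : IsClosedIdeal α K) {φ : (ℂ → ℂ) →ₗ[ℂ] ℂ} (hφb : BddFn α φ) (hφ : ∀ s ∈ K, φ s = 0) {l : ℂ}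
    {s : ℂ → ℂ} (hs : Res α K l s) : DifferentiableAt ℂ (Lf α K φ) l := by
  obtain ⟨M, hM0, hM⟩ := hs.1.exists_norm_le
  obtain ⟨A, hA0, hA⟩ := hs.1.exists_aBd hα hα1
  obtain ⟨C, hC0, hC⟩ := hφb.le_of_aBd
  have hs3 := hs.1.pow hα hα1 3
  have hs2 := hs.1.pow hα hα1 2
  set D : ℝ := 2 * M ^ 3 + 20 * M ^ 2 * (3 * A + 4) with hD
  have hbd : ∀ δ : ℂ, ‖δ‖ * M ≤ 1 / 2 → ‖φ (fun z => s z ^ 3 * (1 + δ * s z)⁻¹)‖ ≤ C * D :=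
    fun δ hδ => by
    have h2 := (hs.perturb hα hα1 hK hM hδ).1
    have h3 : MemA α fun z => s z ^ 3 * (1 + δ * s z)⁻¹ := hs3.mul hα hα1 h2
    refine hC _ _ h3 (ABd.dominated (f := s) (g := s) hα1 (by positivity) hA hA h3.diff
      (fun z hz => ?_) fun z hz => ?_)
    · have h4 := hM z (uDisc_subset hz)
      have h5 := one_add_ne h4 hδ
      rw [norm_mul, norm_pow, norm_inv]
      have h6 : ‖1 + δ * s z‖⁻¹ ≤ 2 := by
        rw [inv_le_comm₀ (by linarith) (by norm_num)]; linarith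
      calc _ ≤ M ^ 3 * 2 := by gcongr
        _ = _ := by ring
    · have h4 := hM z (uDisc_subset hz)
      have h5 := one_add_ne h4 hδ
      have hne : 1 + δ * s z ≠ 0 := fun h => by rw [h, norm_zero] at h5; norm_num at h5
      have h6 := hasDerivAt_of_mem hs.1.diff hz
      have h7 : HasDerivAt (fun z => s z ^ 3 * (1 + δ * s z)⁻¹)
          (deriv s z * (s z ^ 2 * (3 * (1 + δ * s z) - δ * s z) / (1 + δ * s z) ^ 2)) z := by
        refine ((h6.pow 3).mul (((h6.const_mul δ).const_add 1).inv hne)).congr_deriv ?_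
        simp only [Pi.pow_apply, Pi.inv_apply]
        field_simp
        push_cast
        ring
      rw [h7.deriv, norm_mul, norm_div, norm_mul, norm_pow, norm_pow]
      have h8 : ‖3 * (1 + δ * s z) - δ * s z‖ ≤ 5 := by
        have h9 : ‖δ * s z‖ ≤ 1 / 2 := by
          rw [norm_mul]
          exact (mul_le_mul_of_nonneg_left h4 (norm_nonneg _)).trans hδ
        calc ‖3 * (1 + δ * s z) - δ * s z‖ = ‖3 + 2 * (δ * s z)‖ := by congr 1; ring
          _ ≤ ‖(3 : ℂ)‖ + ‖2 * (δ * s z)‖ := norm_add_le _ _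
          _ ≤ 3 + 2 * (1 / 2) := by
            rw [norm_mul 2]
            norm_num at h9 ⊢
            linarith
          _ ≤ 5 := by norm_num
      calc ‖deriv s z‖ * (‖s z‖ ^ 2 * ‖3 * (1 + δ * s z) - δ * s z‖ / ‖1 + δ * s z‖ ^ 2)
          ≤ ‖deriv s z‖ * (M ^ 2 * 5 / (1 / 2) ^ 2) := by gcongr
        _ = 20 * M ^ 2 * ‖deriv s z‖ := by ring
        _ ≤ 20 * M ^ 2 * (‖deriv s z‖ + ‖deriv s z‖ + 1) := by
          gcongr
          linarith [norm_nonneg (deriv s z)]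
  refine HasDerivAt.differentiableAt (f' := -φ (s ^ 2)) ?_
  rw [hasDerivAt_iff_isLittleO_nhds_zero]
  have hO : (fun δ : ℂ => Lf α K φ (l + δ) - Lf α K φ l - δ • -φ (s ^ 2)) =O[nhds 0]
      fun δ : ℂ => δ ^ 2 := by
    refine Asymptotics.IsBigO.of_bound (C * D) ?_
    have hM1 : 0 < 1 / (2 * M) := by positivity
    filter_upwards [ball_mem_nhds (0 : ℂ) hM1] with δ hδ
    have hδ' : ‖δ‖ * M ≤ 1 / 2 := by
      rw [mem_ball_zero_iff, lt_div_iff₀ (by positivity)] at hδ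
      linarith
    have h2 := hs.perturb hα hα1 hK hM hδ'
    have h3 : MemA α fun z => s z ^ 3 * (1 + δ * s z)⁻¹ := hs3.mul hα hα1 h2.1
    have h4 : φ (fun z => s z * (1 + δ * s z)⁻¹) =
        φ (s - δ • s ^ 2 + δ ^ 2 • fun z => s z ^ 3 * (1 + δ * s z)⁻¹) := by
      refine hφb.congr hα hα1 h2.2.1 ((hs.1.sub hα hα1 (hs2.smul hα hα1 _)).add hα hα1
        (h3.smul hα hα1 _)) fun z hz => ?_
      have h5 := one_add_ne (hM z (uDisc_subset hz)) hδ'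
      have hne : 1 + δ * s z ≠ 0 := fun h => by rw [h, norm_zero] at h5; norm_num at h5
      simp only [Pi.add_apply, Pi.sub_apply, Pi.smul_apply, Pi.pow_apply, smul_eq_mul]
      linear_combination (s z - δ * s z ^ 2) * inv_mul_cancel₀ hne
    rw [Lf_eq hK hφ h2.2, Lf_eq hK hφ hs, h4, map_add, map_sub, map_smul, map_smul]
    have h5 : φ s - δ • φ (s ^ 2) + δ ^ 2 • φ (fun z => s z ^ 3 * (1 + δ * s z)⁻¹) - φ s -
        δ • -φ (s ^ 2) = δ ^ 2 * φ (fun z => s z ^ 3 * (1 + δ * s z)⁻¹) := by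
      simp only [smul_eq_mul]; ring
    rw [h5, norm_mul, mul_comm]
    gcongr
    exact hbd δ hδ'
  refine hO.trans_isLittleO ?_
  simpa using Asymptotics.isLittleO_pow_pow (𝕜 := ℂ) (m := 1) (n := 2) (by norm_num)

lemma sub_ne_zero_of_one_lt {l z : ℂ} (hl : 1 < ‖l‖) (hz : z ∈ closedBall (0 : ℂ) 1) :
    l - z ≠ 0 := fun h => by
  rw [sub_eq_zero] at h
  have := mem_cDisc.1 hz
  rw [h] at hl
  linarith

lemma res_outside {α : ℝ} (hα : 0 < α) (hα1 : α < 1) {K : Set (ℂ → ℂ)} (hK : IsClosedIdeal α K)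
    {l : ℂ} (hl : 1 < ‖l‖) : Res α K l (fun z => (l - z)⁻¹) := by
  have h1 : MemA α fun z => l - z :=
    memA_of_differentiable hα hα1 ((differentiable_const _).sub differentiable_id)
  have h2 : MemA α fun z => (l - z)⁻¹ := h1.inv hα hα1 fun z hz => sub_ne_zero_of_one_lt hl hz
  refine ⟨h2, hK.ext_mem _ hK.zero_mem _ ((h1.mul hα hα1 h2).sub hα hα1 (memA_const hα hα1 1))
    fun z hz => ?_⟩
  rw [mul_inv_cancel₀ (sub_ne_zero_of_one_lt hl hz), sub_self, Pi.zero_apply]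

lemma aBd_of_deriv_bdd {α : ℝ} (hα1 : α < 1) {F : ℂ → ℂ} {B D : ℝ} (hD : 0 ≤ D)
    (hF : DifferentiableOn ℂ F uDisc) (hB : ∀ z ∈ uDisc, ‖F z‖ ≤ B)
    (hb : ∀ z ∈ uDisc, ‖deriv F z‖ ≤ D) : ABd α (B + 4 * D) F := by
  have h0 : ABd α 0 (fun _ => (0 : ℂ)) := by
    refine ⟨differentiableOn_const _, fun z _ => by simp, fun z _ => by simp, ?_, by simp⟩
    simp
  have := ABd.dominated hα1 hD h0 h0 hF hB (fun z hz => by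
    simpa using hb z hz)
  simpa [mul_comm] using this

lemma aBd_outside {α : ℝ} (hα1 : α < 1) {l : ℂ} (hl : 1 < ‖l‖) (hl3 : ‖l‖ ≤ 3) :
    ABd α (6 / (‖l‖ - 1) ^ 2) (fun z => (l - z)⁻¹) := by
  have h0 : 0 < ‖l‖ - 1 := by linarith
  have h1 : ∀ z ∈ uDisc, ‖l‖ - 1 ≤ ‖l - z‖ := fun z hz => by
    have := norm_sub_norm_le l z
    have := mem_uDisc.1 hz
    linarith
  have hd : ∀ z ∈ uDisc, HasDerivAt (fun z => (l - z)⁻¹) (1 / (l - z) ^ 2) z := fun z hz => by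
    refine (((hasDerivAt_id z).const_sub l).inv
      (sub_ne_zero_of_one_lt hl (uDisc_subset hz))).congr_deriv ?_
    simp
  refine (aBd_of_deriv_bdd hα1 (B := 1 / (‖l‖ - 1)) (D := 1 / (‖l‖ - 1) ^ 2) (by positivity)
    (fun z hz => (hd z hz).differentiableAt.differentiableWithinAt) (fun z hz => ?_)
    fun z hz => ?_).mono ?_
  · rw [norm_inv, ← one_div]
    exact one_div_le_one_div_of_le h0 (h1 z hz)
  · rw [(hd z hz).deriv, norm_div, norm_one, norm_pow]
    have := h1 z hz
    gcongr
  · have h2 : 1 / (‖l‖ - 1) = (‖l‖ - 1) / (‖l‖ - 1) ^ 2 := by field_simp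
    have h3 : (‖l‖ - 1) / (‖l‖ - 1) ^ 2 ≤ 2 / (‖l‖ - 1) ^ 2 := by gcongr; linarith
    rw [h2]
    calc _ ≤ 2 / (‖l‖ - 1) ^ 2 + 4 * (1 / (‖l‖ - 1) ^ 2) := by gcongr
      _ = _ := by ring

/-- Difference quotients of elements of the algebra at points of the disc. -/
lemma dslope_bound {α : ℝ} (hα : 0 < α) (hα1 : α < 1) {g : ℂ → ℂ} (hg : MemA α g) :
    ∃ C, 0 ≤ C ∧ ∀ l ∈ uDisc, MemA α (dslope g l) ∧ ABd α (C / (1 - ‖l‖)) (dslope g l) := by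
  obtain ⟨B, hB0, hB⟩ := hg.exists_norm_le
  obtain ⟨C, hC0, hC⟩ := toep_bound hα hα1 hg
  refine ⟨C + 2 * B, by positivity, fun l hl => ?_⟩
  have hl1 := mem_uDisc.1 hl
  set y : ℝ := 1 - ‖l‖ with hy
  have hy0 : 0 < y := by linarith
  have hne : ∀ z ∈ closedBall (0 : ℂ) 1, 1 - conj l * z ≠ 0 := fun z hz => one_sub_ne hl hz
  have hnl : closedBall (0 : ℂ) 1 ∈ nhds l :=
    mem_of_superset (isOpen_uDisc.mem_nhds hl) uDisc_subset
  have hdl : DifferentiableAt ℂ g l := hg.diff.differentiableAt (isOpen_uDisc.mem_nhds hl)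
  set h : ℂ → ℂ := fun z => (y : ℂ) * dslope g l z with hh
  set I : ℂ → ℂ := fun z => (y : ℂ) * (z / (1 - conj l * z)) with hI
  have hdd : DifferentiableOn ℂ (dslope g l) uDisc :=
    (differentiableOn_dslope (isOpen_uDisc.mem_nhds hl)).2 hg.diff
  have hdc : ContinuousOn (dslope g l) (closedBall 0 1) :=
    (continuousOn_dslope hnl).2 ⟨hg.cont, hdl⟩
  have hIc : ContinuousOn I (closedBall 0 1) :=
    continuousOn_const.mul (continuousOn_id.div
      (continuousOn_const.sub (continuousOn_const.mul continuousOn_id)) hne)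
  have hId : DifferentiableOn ℂ I uDisc :=
    (differentiableOn_id.div ((differentiableOn_id.const_mul _).const_sub 1)
      fun z hz => hne z (uDisc_subset hz)).const_mul _
  have hIb : ∀ z ∈ uDisc, ‖I z‖ ≤ 1 := fun z hz => by
    have h1 := mem_uDisc.1 hz
    have h2 : y ≤ ‖1 - conj l * z‖ := by
      have h3 := norm_sub_norm_le 1 (conj l * z)
      rw [norm_one, norm_mul, RCLike.norm_conj] at h3
      nlinarith [norm_nonneg l]
    rw [hI, norm_mul, norm_div, norm_real, Real.norm_of_nonneg hy0.le, ← mul_div_assoc, div_le_one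
      (by linarith)]
    nlinarith [norm_nonneg z]
  have hbdry : ∀ s, h (e s) = (y : ℂ) * ((g (e s) - g l) / (e s - l)) := fun s => by
    have h1 : e s ≠ l := fun h => e_sub_ne hl s (by rw [h, sub_self])
    rw [hh]
    simp only
    rw [dslope_of_ne _ h1, slope_def_field]
  have hhb : ∀ z ∈ uDisc, ‖h z‖ ≤ 2 * B := fun z hz => by
    refine Complex.norm_le_of_forall_mem_frontier_norm_le isBounded_ball
      (U := ball (0 : ℂ) 1) (diffContOnCl_of (g := h) (hdd.const_mul _)
      (continuousOn_const.mul hdc)) (fun w hw => ?_) (subset_closure hz)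
    rw [frontier_ball _ one_ne_zero] at hw
    obtain ⟨s, rfl⟩ := exists_e hw
    rw [hbdry, norm_mul, norm_div, norm_real, Real.norm_of_nonneg hy0.le]
    have h1 := norm_sub_ge l s
    have h2 : ‖g (e s) - g l‖ ≤ 2 * B := by
      refine (norm_sub_le _ _).trans ?_
      linarith [hB _ (e_mem_closed s), hB _ (uDisc_subset hl)]
    rw [← mul_div_assoc, div_le_iff₀ (by linarith), mul_comm]
    exact mul_le_mul h2 h1 hy0.le (by positivity)
  have hT : Toep g h I (fun z => -conj (g l) * I z) := by
    refine ⟨hdd.const_mul _, hId, hId.const_mul _, ⟨_, hhb⟩, hIb, ⟨‖g l‖, fun z hz => ?_⟩,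
      ae_of_all _ fun s => ?_⟩
    · rw [norm_mul, norm_neg, RCLike.norm_conj]
      exact mul_le_of_le_one_right (norm_nonneg _) (hIb z hz)
    · have hc : ContinuousOn (fun z => h z - conj (I z) * g z - conj (-conj (g l) * I z))
          (closedBall 0 1) :=
        ((continuousOn_const.mul hdc).sub
          ((Complex.continuous_conj.comp_continuousOn hIc).mul hg.cont)).sub
          (Complex.continuous_conj.comp_continuousOn (continuousOn_const.mul hIc))
      have h1 : h (e s) - conj (I (e s)) * g (e s) - conj (-conj (g l) * I (e s)) = 0 := by
        have h2 : conj (I (e s)) = (y : ℂ) / (e s - l) := by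
          have h3 : e s * (e s)⁻¹ = 1 := mul_inv_cancel₀ (e_ne_zero s)
          have h4 := e_sub_ne hl s
          have h5 : 1 - l * (e s)⁻¹ = (e s - l) * (e s)⁻¹ := by rw [sub_mul, h3]
          rw [hI]
          simp only
          rw [map_mul, map_div₀, map_sub, map_mul, map_one, Complex.conj_conj, conj_ofReal, conj_e,
            h5]
          have := e_ne_zero s
          field_simp
        rw [map_mul conj (-conj (g l)), map_neg, Complex.conj_conj, h2, hbdry]
        ring
      have := tendsto_dilate hc (e_mem_closed s)
      rwa [h1] at this
  have hm := (hT.isA hα hα1 hg).memA hα hα1 (continuousOn_const.mul hdc)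
  have hab := hC h I _ _ hT hhb
  have hy' : (y : ℂ) ≠ 0 := ofReal_ne_zero.2 hy0.ne'
  have heq : dslope g l = (y : ℂ)⁻¹ • h := by
    ext z; simp only [hh, Pi.smul_apply, smul_eq_mul]; field_simp
  refine ⟨heq ▸ hm.smul hα hα1 _, ?_⟩
  have hder : ∀ z ∈ uDisc, deriv h z = y * deriv (dslope g l) z := fun z hz =>
    ((hasDerivAt_of_mem hdd hz).const_mul (y : ℂ)).deriv
  have hn : ∀ z ∈ uDisc, ‖deriv (dslope g l) z‖ = y⁻¹ * ‖deriv h z‖ := fun z hz => by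
    rw [hder z hz, norm_mul, norm_real, Real.norm_of_nonneg hy0.le]; field_simp
  have hsq : EqOn (fun z => ‖deriv (dslope g l) z‖ ^ 2) (fun z => y⁻¹ ^ 2 * ‖deriv h z‖ ^ 2)
      uDisc := fun z hz => by simp only [hn z hz, mul_pow]
  refine ⟨hdd, fun z hz => ?_, fun z hz => ?_, ?_, ?_⟩
  · have h1 := hab.bd z hz
    rw [hh, norm_mul, norm_real, Real.norm_of_nonneg hy0.le] at h1
    rwa [le_div_iff₀ hy0, mul_comm]
  · rw [hn z hz, div_mul_eq_mul_div, inv_mul_eq_div]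
    exact div_le_div_of_nonneg_right (hab.der z hz) hy0.le
  · exact (integrableOn_congr_fun hsq measurableSet_uDisc).2 (hab.dirI.const_mul _)
  · rw [setIntegral_congr_fun measurableSet_uDisc hsq, integral_const_mul, div_pow,
      div_eq_inv_mul, inv_pow]
    exact mul_le_mul_of_nonneg_left hab.dir (by positivity)

lemma ABd.dilate {α C : ℝ} (hα1 : α < 1) {f : ℂ → ℂ} (h : ABd α C f) {r : ℝ} (h0 : 0 < r)
    (h1 : r < 1) : ABd α C (fun z => f (r * z)) := by
  have hC := h.nonneg
  have hball := dilate_differentiableOn h.diff h0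
  have hr1 : 1 < 1 / r := by rw [lt_div_iff₀ h0]; linarith
  have hsub : closedBall (0 : ℂ) 1 ⊆ ball 0 (1 / r) := closedBall_subset_ball hr1
  have hm : ∀ z ∈ uDisc, (r : ℂ) * z ∈ uDisc := fun z hz => smul_mem_uDisc h0.le h1.le hz
  refine ⟨hball.mono (uDisc_subset.trans hsub), fun z hz => h.bd _ (hm z hz), fun z hz => ?_, ?_, ?_⟩
  · have hz1 := mem_uDisc.1 hz
    rw [dilate_deriv h.diff (hm z hz), norm_mul, norm_real, Real.norm_of_nonneg h0.le]
    have h2 := h.der _ (hm z hz)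
    have h3 : (1 - ‖(r : ℂ) * z‖) ^ (α - 1) ≤ (1 - ‖z‖) ^ (α - 1) := by
      refine Real.rpow_le_rpow_of_nonpos (by linarith) ?_ (by linarith)
      rw [norm_mul, norm_real, Real.norm_of_nonneg h0.le]
      nlinarith [norm_nonneg z]
    calc r * ‖deriv f (r * z)‖ ≤ 1 * (C * (1 - ‖(r : ℂ) * z‖) ^ (α - 1)) := by gcongr
      _ ≤ C * (1 - ‖z‖) ^ (α - 1) := by rw [one_mul]; gcongr
  · have hc : ContinuousOn (fun z => ‖deriv (fun z => f (r * z)) z‖ ^ 2) (closedBall 0 1) :=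
      ((hball.deriv isOpen_ball).continuousOn.mono hsub).norm.pow 2
    exact (hc.integrableOn_compact (isCompact_closedBall 0 1)).mono_set uDisc_subset
  · rw [dir_dilate h.diff h0 h1]
    exact (setIntegral_mono_set h.dirI (ae_of_all _ fun z => by positivity)
      (ball_subset_ball h1.le).eventuallyLE).trans h.dir

lemma memA_dilate {α : ℝ} (hα : 0 < α) (hα1 : α < 1) {f : ℂ → ℂ} (h : DifferentiableOn ℂ f uDisc)
    {r : ℝ} (h0 : 0 < r) (h1 : r < 1) : MemA α (fun z => f (r * z)) :=
  memA_of_differentiableOn_ball hα hα1 (by rw [lt_div_iff₀ h0]; linarith)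
    (dilate_differentiableOn h h0)

/-- Evaluation of a functional on dilations. -/
lemma BddFn.tendsto_dilate {α : ℝ} (hα : 0 < α) (hα1 : α < 1) {φ : (ℂ → ℂ) →ₗ[ℂ] ℂ}
    (hφ : BddFn α φ) {f : ℂ → ℂ} (hf : MemA α f) {r : ℕ → ℝ} (hr : ∀ n, 0 < r n ∧ r n < 1)
    (hrt : Tendsto r atTop (nhdsWithin 1 (Iio 1))) :
    Tendsto (fun n => φ (fun z => f (r n * z))) atTop (nhds (φ f)) := by
  obtain ⟨C, hC0, hC⟩ := hf.exists_aBd hα hα1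
  exact hφ.tendsto hα hα1 (fun n => memA_dilate hα hα1 hf.diff (hr n).1 (hr n).2)
    (fun n => hC.dilate hα1 (hr n).1 (hr n).2) hf
    fun z hz => (ClosedIdeals.tendsto_dilate hf.cont (uDisc_subset hz)).comp hrt

lemma exists_res_boundary {α : ℝ} (hα : 0 < α) (hα1 : α < 1) {K : Set (ℂ → ℂ)}
    (hK : IsClosedIdeal α K) {l : ℂ} (hl : l ∈ closedBall (0 : ℂ) 1) {g : ℂ → ℂ} (hg : g ∈ K)
    (hgl : g l ≠ 0) : ∃ s, Res α K l s := by
  have hlin : MemA α fun z => l - z :=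
    memA_of_differentiable hα hα1 ((differentiable_const _).sub differentiable_id)
  have h1A := memA_const hα hα1 (1 : ℂ)
  set S : Set (ℂ → ℂ) := {u | ∃ j ∈ K, ∃ s, MemA α s ∧ u = j + (fun z => l - z) * s} with hS
  have hSA : ∀ u ∈ S, MemA α u := by
    rintro _ ⟨j, hj, s, hs, rfl⟩
    exact (hK.mem_A _ hj).add hα hα1 (hlin.mul hα hα1 hs)
  have hKS : ∀ j ∈ K, j ∈ S := fun j hj =>
    ⟨j, hj, 0, memA_const hα hα1 0, by simp⟩
  have key : ∃ u ∈ S, ANorm α ((fun _ => 1) - u) < 1 / 2 := by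
    by_contra hcon
    push Not at hcon
    obtain ⟨φ, hφ, hφS, hφ1⟩ := exists_separating hα hα1 hSA (hKS 0 hK.zero_mem) (by
      rintro _ ⟨j, hj, s, hs, rfl⟩ _ ⟨j', hj', s', hs', rfl⟩
      refine ⟨j + j', hK.add_mem _ hj _ hj', s + s', hs.add hα hα1 hs', by ring⟩) (by
      rintro c _ ⟨j, hj, s, hs, rfl⟩
      refine ⟨c • j, hK.smul_mem _ _ hj, c • s, hs.smul hα hα1 c, ?_⟩
      rw [smul_add, mul_smul_comm]) h1A (by norm_num : (0 : ℝ) < 1 / 2) hcon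
    obtain ⟨r, hr, hrt⟩ := exists_radii
    have hgA := hK.mem_A g hg
    have h2 := hφ.tendsto_dilate hα hα1 hgA hr hrt
    rw [hφS g (hKS g hg)] at h2
    have h3 : ∀ n, φ (fun z => g (r n * z)) = g (r n * l) * φ (fun _ => 1) := fun n => by
      have hball := dilate_differentiableOn hgA.diff (hr n).1
      have hr1 : 1 < 1 / r n := by rw [lt_div_iff₀ (hr n).1]; linarith [(hr n).2]
      have hlb : l ∈ ball (0 : ℂ) (1 / r n) := closedBall_subset_ball hr1 hl
      set q := dslope (fun z => g (r n * z)) l with hq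
      have hqA : MemA α q := memA_of_differentiableOn_ball hα hα1 hr1
        ((differentiableOn_dslope (isOpen_ball.mem_nhds hlb)).2 hball)
      have h4 : (fun z => g (r n * z)) = g (r n * l) • (fun _ => (1 : ℂ)) +
          (0 + (fun z => l - z) * (-1 : ℂ) • q) := by
        ext z
        have h5 := sub_smul_dslope (fun z => g (r n * z)) l z
        simp only [smul_eq_mul] at h5
        simp only [Pi.add_apply, Pi.mul_apply, Pi.smul_apply, smul_eq_mul, Pi.zero_apply, hq]
        linear_combination -h5
      rw [h4, map_add, map_smul, hφS _ ⟨0, hK.zero_mem, _, hqA.smul hα hα1 (-1), rfl⟩, add_zero,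
        smul_eq_mul]
    simp only [h3] at h2
    have h4 : Tendsto (fun n => g (r n * l) * φ (fun _ => 1)) atTop
        (nhds (g l * φ (fun _ => 1))) :=
      ((ClosedIdeals.tendsto_dilate hgA.cont hl).comp hrt).mul_const _
    exact mul_ne_zero hgl hφ1 (tendsto_nhds_unique h4 h2)
  obtain ⟨_, ⟨j, hj, s, hs, rfl⟩, hu⟩ := key
  set u := j + (fun z => l - z) * s with hudef
  have huA : MemA α u := hSA _ ⟨j, hj, s, hs, rfl⟩
  obtain ⟨a, b, c, ha, hb, hc, habc, hsup, -, -⟩ := (h1A.sub hα hα1 huA).norm_parts hα hα1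
  have h1 : ∀ z ∈ closedBall (0 : ℂ) 1, u z ≠ 0 := fun z hz h => by
    have h2 := le_on_closed (h1A.sub hα hα1 huA).cont hsup z hz
    rw [Pi.sub_apply, h, sub_zero, norm_one] at h2
    linarith
  have huI := huA.inv hα hα1 h1
  have hsu : MemA α (s * u⁻¹) := hs.mul hα hα1 huI
  refine ⟨s * u⁻¹, hsu, hK.ext_mem _ (hK.smul_mem (-1) _ (hK.mul_mem j hj _ huI)) _
    ((hlin.mul hα hα1 hsu).sub hα hα1 h1A) fun z hz => ?_⟩
  have h2 := h1 z hz
  have h3 : u z = j z + (l - z) * s z := rfl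
  simp only [Pi.mul_apply, Pi.inv_apply, Pi.smul_apply, smul_eq_mul]
  field_simp
  rw [h3]; ring

/-- The analytic data attached to a functional annihilating `K`. -/
structure LData (K : Set (ℂ → ℂ)) (φ : (ℂ → ℂ) →ₗ[ℂ] ℂ) (L : ℂ → ℂ) : Prop where
  out_diff : ∀ l, 1 < ‖l‖ → DifferentiableAt ℂ L l
  out_eq : ∀ l, 1 < ‖l‖ → L l = φ (fun z => (l - z)⁻¹)
  out_bd : ∃ C, 0 ≤ C ∧ ∀ l, 1 < ‖l‖ → ‖l‖ ≤ 3 → ‖L l‖ ≤ C / (‖l‖ - 1) ^ 2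
  reg : ∀ l ∈ closedBall (0 : ℂ) 1, ∀ g ∈ K, g l ≠ 0 → DifferentiableAt ℂ L l
  in_bd : ∀ g ∈ K, ∃ C, 0 ≤ C ∧ ∀ l ∈ uDisc, ‖g l * L l‖ ≤ C / (1 - ‖l‖)

lemma exists_lData {α : ℝ} (hα : 0 < α) (hα1 : α < 1) {K : Set (ℂ → ℂ)} (hK : IsClosedIdeal α K)
    {φ : (ℂ → ℂ) →ₗ[ℂ] ℂ} (hφb : BddFn α φ) (hφ : ∀ s ∈ K, φ s = 0) : ∃ L, LData K φ L := by
  obtain ⟨C, hC0, hC⟩ := hφb.le_of_aBd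
  have hout : ∀ l : ℂ, 1 < ‖l‖ → Res α K l (fun z => (l - z)⁻¹) := fun l hl =>
    res_outside hα hα1 hK hl
  refine ⟨Lf α K φ, fun l hl => (hout l hl).differentiableAt hα hα1 hK hφb hφ,
    fun l hl => Lf_eq hK hφ (hout l hl), ⟨C * 6, by positivity, fun l hl hl3 => ?_⟩,
    fun l hl g hg hgl => ?_, fun g hg => ?_⟩
  · rw [Lf_eq hK hφ (hout l hl), mul_div_assoc]
    exact hC _ _ (hout l hl).1 (aBd_outside hα1 hl hl3)
  · obtain ⟨s, hs⟩ := exists_res_boundary hα hα1 hK hl hg hgl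
    exact hs.differentiableAt hα hα1 hK hφb hφ
  · have hgA := hK.mem_A g hg
    obtain ⟨D, hD0, hD⟩ := dslope_bound hα hα1 hgA
    refine ⟨C * D, by positivity, fun l hl => ?_⟩
    have hy : 0 < 1 - ‖l‖ := by linarith [mem_uDisc.1 hl]
    by_cases hgl : g l = 0
    · rw [hgl, zero_mul, norm_zero]; positivity
    obtain ⟨hd, hdb⟩ := hD l hl
    have hres : Res α K l ((g l)⁻¹ • dslope g l) := by
      refine ⟨hd.smul hα hα1 _, ?_⟩
      have h1 := hK.smul_mem (-(g l)⁻¹) g hg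
      convert h1 using 1
      ext z
      have h5 := sub_smul_dslope g l z
      simp only [smul_eq_mul] at h5
      simp only [Pi.smul_apply, smul_eq_mul]
      field_simp
      linear_combination -h5
    rw [Lf_eq hK hφ hres, map_smul, smul_eq_mul, mul_inv_cancel_left₀ hgl, mul_div_assoc]
    exact hC _ _ hd hdb

lemma exists_hold {α : ℝ} (hα : 0 < α) (hα1 : α < 1) {k : ℂ → ℂ} (hk : MemA α k)
    (hk1 : ∀ z ∈ closedBall (0 : ℂ) 1, ‖k z‖ ≤ 1) {q : ℕ} (hq : 1 ≤ q * α) :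
    ∃ c : ℝ, 0 < c ∧ c ≤ 1 / 4 ∧ ∀ a ∈ closedBall (0 : ℂ) 1, ∀ b ∈ closedBall (0 : ℂ) 1,
      ‖a - b‖ ≤ 2 * c * ‖k a‖ ^ q → ‖k b - k a‖ ≤ ‖k a‖ / 2 := by
  obtain ⟨M, hM, hl⟩ := (hk.isA hα hα1).lip hα hα1.le hk.cont one_pos
  have hq1 : 1 ≤ q := by
    by_contra h
    have : q = 0 := by omega
    subst this; norm_num at hq
  set B := 2 * (1 + M) with hB
  have hBp : 2 ≤ B := by linarith
  refine ⟨(1 / B) ^ (1 / α) / 4, by positivity, ?_, fun a ha b hb hab => ?_⟩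
  · have : (1 / B) ^ (1 / α) ≤ 1 := Real.rpow_le_one (by positivity)
      (by rw [div_le_one (by linarith)]; linarith) (by positivity)
    linarith
  · set t := ‖k a‖ with ht
    have ht0 : 0 ≤ t := norm_nonneg _
    have ht1 : t ≤ 1 := hk1 a ha
    have hd0 : 0 ≤ ‖a - b‖ := norm_nonneg _
    have hcle : (1 / B) ^ (1 / α) ≤ 1 := Real.rpow_le_one (by positivity)
      (by rw [div_le_one (by linarith)]; linarith) (by positivity)
    have hd : ‖a - b‖ ≤ (1 / B) ^ (1 / α) * t ^ q := by
      refine hab.trans ?_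
      have : 0 ≤ (1 / B) ^ (1 / α) * t ^ q := by positivity
      nlinarith
    have hd1 : ‖a - b‖ ≤ 1 := hd.trans (by
      have := pow_le_one₀ (n := q) ht0 ht1
      have h2 : 0 ≤ t ^ q := by positivity
      nlinarith)
    have hda : ‖a - b‖ ^ α ≤ (1 / B) * t := by
      calc ‖a - b‖ ^ α ≤ ((1 / B) ^ (1 / α) * t ^ q) ^ α :=
            Real.rpow_le_rpow hd0 hd hα.le
        _ = (1 / B) * t ^ (q * α) := by
            rw [Real.mul_rpow (by positivity) (by positivity), ← Real.rpow_mul (by positivity),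
              one_div_mul_cancel hα.ne', Real.rpow_one, ← Real.rpow_natCast, ← Real.rpow_mul ht0]
        _ ≤ (1 / B) * t := by
            gcongr
            rcases ht0.eq_or_lt with h | h
            · rw [← h, Real.zero_rpow (by linarith)]
            · calc t ^ (q * α) ≤ t ^ (1 : ℝ) := Real.rpow_le_rpow_of_exponent_ge h ht1 hq
                _ = t := Real.rpow_one t
    have hdd : ‖a - b‖ ≤ ‖a - b‖ ^ α := by
      rcases hd0.eq_or_lt with h | h
      · rw [← h, Real.zero_rpow hα.ne']
      · calc ‖a - b‖ = ‖a - b‖ ^ (1 : ℝ) := (Real.rpow_one _).symm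
          _ ≤ _ := Real.rpow_le_rpow_of_exponent_ge h hd1 hα1.le
    have h1 := hl a ha b hb hd1
    rw [norm_sub_rev]
    calc ‖k a - k b‖ ≤ 1 * ‖a - b‖ ^ α + M * ‖a - b‖ := h1
      _ ≤ (1 + M) * ((1 / B) * t) := by nlinarith
      _ = t / 2 := by rw [hB]; field_simp

lemma norm_le_of_strip {f : ℂ → ℂ} {ρ x₀ M : ℝ} (hρ : 0 < ρ)
    (hf : ∀ u : ℂ, ‖u‖ ≤ ρ → DifferentiableAt ℂ f u)
    (hb : ∀ u : ℂ, ‖u‖ = ρ → u.re ≠ x₀ → ‖f u‖ ≤ M / (u.re - x₀) ^ 2) (hM : 0 ≤ M) :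
    ‖f 0‖ ≤ 4 * M / ρ ^ 2 := by
  set F : ℂ → ℂ := fun u => (u ^ 2 - 2 * x₀ * u + ρ ^ 2) ^ 2 * f u with hF
  have hFd : ∀ u : ℂ, ‖u‖ ≤ ρ → DifferentiableAt ℂ F u := fun u hu =>
    DifferentiableAt.mul (by fun_prop) (hf u hu)
  have hbd : ∀ u ∈ frontier (ball (0 : ℂ) ρ), ‖F u‖ ≤ 4 * ρ ^ 2 * M := by
    intro u hu
    rw [frontier_ball _ hρ.ne'] at hu
    have hu' : ‖u‖ = ρ := by simpa using hu
    have hns : u.re ^ 2 + u.im ^ 2 = ρ ^ 2 := by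
      rw [← hu', ← Complex.normSq_eq_norm_sq, Complex.normSq_apply]; ring
    have hQ : u ^ 2 - 2 * x₀ * u + ρ ^ 2 = (2 * (u.re - x₀) : ℝ) * u := by
      apply Complex.ext
      · simp [pow_two, ← Complex.ofReal_mul]; nlinarith
      · simp [pow_two, ← Complex.ofReal_mul]; ring
    have hQn : ‖(u ^ 2 - 2 * x₀ * u + ρ ^ 2) ^ 2‖ = 4 * ρ ^ 2 * (u.re - x₀) ^ 2 := by
      rw [hQ, norm_pow, norm_mul, hu', Complex.norm_real, Real.norm_eq_abs, mul_pow, sq_abs]; ring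
    rw [hF]; simp only [norm_mul]
    rw [hQn]
    by_cases hx : u.re = x₀
    · rw [hx]; simp; positivity
    · have h2 : 0 < (u.re - x₀) ^ 2 := by
        have := sub_ne_zero.mpr hx; positivity
      calc 4 * ρ ^ 2 * (u.re - x₀) ^ 2 * ‖f u‖
          ≤ 4 * ρ ^ 2 * (u.re - x₀) ^ 2 * (M / (u.re - x₀) ^ 2) := by gcongr; exact hb u hu' hx
        _ = 4 * ρ ^ 2 * M := by field_simp
  have hdc : DiffContOnCl ℂ F (ball 0 ρ) := by
    refine ⟨fun u hu => (hFd u ?_).differentiableWithinAt, fun u hu =>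
      (hFd u ?_).continuousAt.continuousWithinAt⟩
    · simpa using (mem_ball_zero_iff.mp hu).le
    · rw [closure_ball _ hρ.ne'] at hu; simpa using hu
  have h0 := Complex.norm_le_of_forall_mem_frontier_norm_le isBounded_ball hdc hbd
    (subset_closure (mem_ball_self hρ))
  have hF0 : ‖F 0‖ = ρ ^ 4 * ‖f 0‖ := by
    simp only [hF]
    rw [norm_mul]; congr 1
    rw [show ((0 : ℂ) ^ 2 - 2 * x₀ * 0 + ρ ^ 2) ^ 2 = ((ρ ^ 4 : ℝ) : ℂ) by push_cast; ring,
      Complex.norm_real, Real.norm_of_nonneg (by positivity)]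
  rw [hF0] at h0
  rw [le_div_iff₀ (by positivity)]
  have : 0 < ρ ^ 2 := by positivity
  nlinarith

lemma half_le_one_sub_exp {s : ℝ} (h0 : 0 ≤ s) (h1 : s ≤ 1) : s / 2 ≤ 1 - Real.exp (-s) := by
  have h := Real.add_one_le_exp s
  have h2 : Real.exp (-s) ≤ 1 / (1 + s) := by
    rw [Real.exp_neg, ← one_div]
    exact one_div_le_one_div_of_le (by linarith) (by linarith)
  have h3 : 1 / (1 + s) ≤ 1 - s / 2 := by
    rw [div_le_iff₀ (by linarith)]; nlinarith
  linarith

lemma neg_log_le {y : ℝ} (h0 : 0 ≤ y) (h1 : y ≤ 1 / 2) : -Real.log (1 - y) ≤ 2 * y := by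
  have h := Real.log_le_sub_one_of_pos (x := (1 - y)⁻¹) (by have : 0 < 1 - y := by linarith
                                                            positivity)
  rw [Real.log_inv] at h
  have h2 : (1 - y)⁻¹ ≤ 1 + 2 * y := by
    rw [inv_le_comm₀ (by linarith) (by linarith), inv_le_iff_one_le_mul₀ (by linarith)]
    nlinarith
  linarith

lemma norm_mul_exp {z : ℂ} (hz : z ≠ 0) (u : ℂ) :
    ‖z * exp u‖ = Real.exp (u.re - -Real.log ‖z‖) := by
  rw [norm_mul, Complex.norm_exp, sub_neg_eq_add, Real.exp_add, Real.exp_log (norm_pos_iff.mpr hz),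
    mul_comm]

lemma LData.aux_bound {α : ℝ} (hα : 0 < α) (hα1 : α < 1) {K : Set (ℂ → ℂ)}
    {φ : (ℂ → ℂ) →ₗ[ℂ] ℂ} {L : ℂ → ℂ} (hL : LData K φ L) {q : ℕ} (hq : 1 ≤ q * α)
    {g : ℂ → ℂ} (hg : g ∈ K) (hgA : MemA α g) (hg1 : ∀ z ∈ closedBall (0 : ℂ) 1, ‖g z‖ ≤ 1) :
    ∃ C, 0 ≤ C ∧ ∀ z ∈ uDisc, ‖g z ^ (2 * q + 1) * L z‖ ≤ C := by
  obtain ⟨c, hc0, hc4, hhold⟩ := exists_hold hα hα1 hgA hg1 hq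
  obtain ⟨C₁, hC₁, hin⟩ := hL.in_bd g hg
  obtain ⟨C₂, hC₂, hout⟩ := hL.out_bd
  refine ⟨4 * C₁ / c + 4 * (C₂ + 4 * C₁) / c ^ 2, by positivity, fun z hz => ?_⟩
  have hzc := uDisc_subset hz
  have hz1 := mem_uDisc.mp hz
  have ht1 := hg1 z hzc
  rw [norm_mul, norm_pow]
  set t := ‖g z‖ with ht
  rcases (norm_nonneg (g z)).eq_or_lt with h0 | h0
  · rw [← ht] at h0
    rw [← h0, zero_pow (by omega), zero_mul]; positivity
  rw [← ht] at h0
  set ρ := c * t ^ q with hρ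
  have hρ0 : 0 < ρ := by positivity
  have hρ4 : ρ ≤ 1 / 4 := by
    have := pow_le_one₀ (n := q) h0.le ht1
    have h3 : 0 ≤ t ^ q := by positivity
    nlinarith
  by_cases hy : ρ / 4 ≤ 1 - ‖z‖
  · have h1 := hin z hz
    rw [norm_mul, ← ht] at h1
    have h2 : t * ‖L z‖ ≤ 4 * C₁ / ρ := h1.trans (by
      rw [show 4 * C₁ / ρ = C₁ / (ρ / 4) by field_simp]
      gcongr)
    have h3 : t ^ (2 * q + 1) * ‖L z‖ ≤ 4 * C₁ / c := by
      calc t ^ (2 * q + 1) * ‖L z‖ = t ^ (2 * q) * (t * ‖L z‖) := by ring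
        _ ≤ t ^ (2 * q) * (4 * C₁ / ρ) := by gcongr
        _ = t ^ q * (4 * C₁ / c) := by rw [hρ]; field_simp; ring
        _ ≤ 1 * (4 * C₁ / c) := by gcongr; exact pow_le_one₀ h0.le ht1
        _ = _ := one_mul _
    have : 0 ≤ 4 * (C₂ + 4 * C₁) / c ^ 2 := by positivity
    linarith
  · push Not at hy
    have hz0 : z ≠ 0 := by
      rintro rfl; simp at hy; linarith
    have hx := neg_log_le (y := 1 - ‖z‖) (by linarith) (by linarith)
    rw [sub_sub_cancel] at hx
    have hxp : 0 < -Real.log ‖z‖ := by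
      have := Real.log_neg (norm_pos_iff.mpr hz0) hz1; linarith
    have hn := norm_mul_exp hz0
    set x₀ := -Real.log ‖z‖ with hx₀
    have hdist : ∀ u : ℂ, ‖u‖ ≤ ρ → ‖z - z * exp u‖ ≤ 2 * c * t ^ q := by
      intro u hu
      rw [show z - z * exp u = -(z * (exp u - 1)) by ring, norm_neg, norm_mul]
      have := Complex.norm_exp_sub_one_le (x := u) (by linarith)
      have h3 := norm_nonneg z
      have h4 := norm_nonneg (exp u - 1)
      nlinarith
    have hge : ∀ u : ℂ, ‖u‖ ≤ ρ → z * exp u ∈ closedBall (0 : ℂ) 1 →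
        t / 2 ≤ ‖g (z * exp u)‖ := by
      intro u hu hm
      have h1 := hhold z hzc _ hm (hdist u hu)
      have h2 := norm_sub_norm_le (g z) (g (z * exp u))
      rw [norm_sub_rev] at h2
      linarith
    have key := norm_le_of_strip (f := fun u => L (z * exp u)) (x₀ := x₀)
      (M := (C₂ + 4 * C₁) / t) hρ0 ?_ ?_ (by positivity)
    · simp only [exp_zero, mul_one] at key
      have h5 : t ^ (2 * q + 1) * ‖L z‖ ≤ 4 * (C₂ + 4 * C₁) / c ^ 2 := by
        calc t ^ (2 * q + 1) * ‖L z‖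
            ≤ t ^ (2 * q + 1) * (4 * ((C₂ + 4 * C₁) / t) / ρ ^ 2) := by gcongr
          _ = _ := by rw [hρ]; field_simp; ring
      have : 0 ≤ 4 * C₁ / c := by positivity
      linarith
    · intro u hu
      refine DifferentiableAt.comp u (g := L) ?_ (by fun_prop)
      by_cases ho : 1 < ‖z * exp u‖
      · exact hL.out_diff _ ho
      · have hm := mem_cDisc.mpr (not_lt.mp ho)
        refine hL.reg _ hm g hg fun h => ?_
        have := hge u hu hm
        rw [h, norm_zero] at this; linarith
    · intro u hu hne
      have hure : |u.re| ≤ ρ := hu ▸ Complex.abs_re_le_norm u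
      rw [abs_le] at hure
      rcases lt_or_gt_of_ne hne with hlt | hgt
      · have hs0 : 0 < x₀ - u.re := by linarith
        have hs1 : x₀ - u.re ≤ 1 := by linarith
        have h1 := half_le_one_sub_exp hs0.le hs1
        rw [neg_sub, ← hn u] at h1
        have hm : z * exp u ∈ uDisc := mem_uDisc.mpr (by linarith)
        have h2 := hin _ hm
        have h3 := hge u hu.le (uDisc_subset hm)
        rw [norm_mul] at h2
        have h4 : C₁ / (1 - ‖z * exp u‖) ≤ C₁ / ((x₀ - u.re) / 2) := by gcongr
        have h5 : t / 2 * ‖L (z * exp u)‖ ≤ C₁ / ((x₀ - u.re) / 2) :=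
          (mul_le_mul_of_nonneg_right h3 (norm_nonneg _)).trans (h2.trans h4)
        have h6 : ‖L (z * exp u)‖ ≤ 4 * C₁ / t / (x₀ - u.re) := by
          rw [le_div_iff₀ hs0, le_div_iff₀ h0]
          rw [le_div_iff₀ (by positivity)] at h5
          linarith
        refine h6.trans (div_le_div₀ (by positivity) ?_ (by nlinarith) (by nlinarith))
        gcongr
        linarith
      · have hs0 : 0 < u.re - x₀ := by linarith
        have h1 := Real.add_one_le_exp (u.re - x₀)
        rw [← hn u] at h1
        have h3 : ‖z * exp u‖ ≤ 3 := by
          rw [hn u]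
          calc Real.exp (u.re - x₀) ≤ Real.exp 1 := Real.exp_le_exp.mpr (by linarith)
            _ ≤ 3 := by have := Real.exp_one_lt_d9; linarith
        refine (hout _ (by linarith) h3).trans
          (div_le_div₀ (by positivity) ?_ (by positivity) (by nlinarith))
        rw [le_div_iff₀ h0]; nlinarith

lemma exists_exponent {α : ℝ} (hα : 0 < α) : ∃ q : ℕ, 1 ≤ q * α := by
  obtain ⟨q, hq⟩ := exists_nat_ge (1 / α)
  exact ⟨q, by rwa [div_le_iff₀ hα] at hq⟩

lemma LData.exists_bound {α : ℝ} (hα : 0 < α) (hα1 : α < 1) {K : Set (ℂ → ℂ)}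
    (hK : IsClosedIdeal α K) {φ : (ℂ → ℂ) →ₗ[ℂ] ℂ} {L : ℂ → ℂ} (hL : LData K φ L) {q : ℕ}
    (hq : 1 ≤ q * α) {g : ℂ → ℂ} (hg : g ∈ K) :
    ∃ C, 0 ≤ C ∧ ∀ z ∈ uDisc, ‖g z ^ (2 * q + 1) * L z‖ ≤ C := by
  obtain ⟨B, hB, hgB⟩ := (hK.mem_A g hg).exists_norm_le
  have hg' := hK.smul_mem (B⁻¹ : ℂ) g hg
  obtain ⟨C, hC, h⟩ := hL.aux_bound hα hα1 hq hg' (hK.mem_A _ hg') (fun z hz => by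
    simp only [Pi.smul_apply, smul_eq_mul, norm_mul, norm_inv, Complex.norm_real,
      Real.norm_of_nonneg hB.le]
    rw [inv_mul_le_iff₀ hB]; simpa using hgB z hz)
  refine ⟨B ^ (2 * q + 1) * C, by positivity, fun z hz => ?_⟩
  have h1 := h z hz
  simp only [Pi.smul_apply, smul_eq_mul] at h1
  rw [mul_pow, mul_assoc, norm_mul, norm_pow, norm_inv, Complex.norm_real,
    Real.norm_of_nonneg hB.le, inv_pow, inv_mul_le_iff₀ (by positivity)] at h1
  exact h1

lemma sq_integral_le {f : ℝ → ℝ} (hf : Continuous f) {B : ℝ} (hB : ∀ s, |f s| ≤ B) :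
    (∫ s, f s ∂nu) ^ 2 ≤ ∫ s, f s ^ 2 ∂nu := by
  have h1 : Integrable f nu := Integrable.of_bound hf.aestronglyMeasurable B (ae_of_all _ hB)
  have h2 : Integrable (fun s => f s ^ 2) nu :=
    Integrable.of_bound (by fun_prop) (B ^ 2) (ae_of_all _ fun s => by
      rw [Real.norm_eq_abs, abs_pow]; gcongr; exact hB s)
  set a := ∫ s, f s ∂nu with ha
  have h3 : 0 ≤ ∫ s, (f s - a) ^ 2 ∂nu := integral_nonneg fun s => sq_nonneg _
  have h4 : ∫ s, (f s - a) ^ 2 ∂nu = (∫ s, f s ^ 2 ∂nu) - a ^ 2 := by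
    have : ∀ s, (f s - a) ^ 2 = (f s ^ 2 - 2 * a * f s) + a ^ 2 := fun s => by ring
    simp_rw [this]
    have h5 := h1.const_mul (2 * a)
    rw [integral_add (f := fun s => f s ^ 2 - 2 * a * f s) (h2.sub h5) (integrable_const _),
      integral_sub h2 h5, integral_const_mul, ← ha]
    simp; ring
  linarith

/-- The functions `g n` tend to `1` in `L²` of the circle. -/
def ToOne (g : ℕ → ℂ → ℂ) : Prop :=
  Tendsto (fun n => ∫ s, ‖g n (e s) - 1‖ ^ 2 ∂nu) atTop (nhds 0)

lemma integrable_norm_sub_one {α : ℝ} {g : ℂ → ℂ} (hg : MemA α g) :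
    Integrable (fun s => ‖g (e s) - 1‖) nu := by
  obtain ⟨B, hB, h⟩ := hg.exists_norm_le
  have hc := continuous_comp_e hg.cont
  exact Integrable.of_bound (hc.sub continuous_const).norm.aestronglyMeasurable (B + 1) (ae_of_all _ fun s => by
    rw [norm_norm]
    calc ‖g (e s) - 1‖ ≤ ‖g (e s)‖ + ‖(1 : ℂ)‖ := norm_sub_le _ _
      _ ≤ B + 1 := by rw [norm_one]; gcongr; exact h _ (e_mem_closed s))

lemma ToOne.tendsto_L1 {α : ℝ} {g : ℕ → ℂ → ℂ} (hg : ∀ n, MemA α (g n)) (h : ToOne g) :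
    Tendsto (fun n => ∫ s, ‖g n (e s) - 1‖ ∂nu) atTop (nhds 0) := by
  have h2 : Tendsto (fun n => (∫ s, ‖g n (e s) - 1‖ ∂nu) ^ 2) atTop (nhds 0) := by
    refine squeeze_zero (fun n => sq_nonneg _) (fun n => ?_) h
    obtain ⟨B, hB, hb⟩ := (hg n).exists_norm_le
    have hc := continuous_comp_e (hg n).cont
    refine sq_integral_le (hc.sub continuous_const).norm (B := B + 1) fun s => ?_
    rw [abs_norm]
    calc ‖g n (e s) - 1‖ ≤ ‖g n (e s)‖ + ‖(1 : ℂ)‖ := norm_sub_le _ _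
      _ ≤ B + 1 := by rw [norm_one]; gcongr; exact hb _ (e_mem_closed s)
  have h3 := h2.sqrt
  rw [Real.sqrt_zero] at h3
  refine h3.congr fun n => Real.sqrt_sq (integral_nonneg fun s => norm_nonneg _)

lemma ToOne.tendsto_at {α : ℝ} {g : ℕ → ℂ → ℂ} (hg : ∀ n, MemA α (g n)) (h : ToOne g) {z : ℂ}
    (hz : z ∈ uDisc) : Tendsto (fun n => g n z) atTop (nhds 1) := by
  rw [tendsto_iff_norm_sub_tendsto_zero]
  have hz1 := mem_uDisc.mp hz
  have h2 := (h.tendsto_L1 hg).const_mul (1 / (1 - ‖z‖))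
  rw [mul_zero] at h2
  refine squeeze_zero (fun n => norm_nonneg _) (fun n => ?_) h2
  have hd : DiffContOnCl ℂ (fun w => g n w - 1) (ball 0 1) :=
    diffContOnCl_of ((hg n).diff.sub_const 1) ((hg n).cont.sub continuousOn_const)
  rw [← cauchy_formula hd hz, ← integral_const_mul]
  refine norm_integral_le_of_norm_le ((integrable_norm_sub_one (hg n)).const_mul _)
    (ae_of_all _ fun s => ?_)
  rw [norm_mul, mul_comm, norm_div, norm_e]
  gcongr
  exact norm_sub_ge z s

lemma ToOne.tendsto_PI {α : ℝ} {g : ℕ → ℂ → ℂ} (hg : ∀ n, MemA α (g n)) (h : ToOne g) {z : ℂ}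
    (hz : z ∈ uDisc) :
    Tendsto (fun n => PI (fun s => ‖g n (e s) - 1‖) z) atTop (nhds 0) := by
  have h2 := (h.tendsto_L1 hg).const_mul (2 / (1 - ‖z‖))
  rw [mul_zero] at h2
  refine squeeze_zero (fun n => PI_nonneg (fun s => norm_nonneg _) hz) (fun n => ?_) h2
  rw [PI, ← integral_const_mul]
  refine integral_mono (integrable_P_mul (integrable_norm_sub_one (hg n)) hz)
    ((integrable_norm_sub_one (hg n)).const_mul _) fun s => ?_
  exact mul_le_mul_of_nonneg_right (P_le hz s) (norm_nonneg _)

/-- The negative part of `log |g|` on the circle. -/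
def logMinus (g : ℂ → ℂ) (s : ℝ) : ℝ := max (-Real.log ‖g (e s)‖) 0

lemma logMinus_nonneg (g : ℂ → ℂ) (s : ℝ) : 0 ≤ logMinus g s := le_max_right _ _

lemma integrable_logMinus {α : ℝ} {g : ℂ → ℂ} (hg : MemA α g) (h0 : ∃ z ∈ uDisc, g z ≠ 0) :
    Integrable (logMinus g) nu := by
  obtain ⟨z, hz, hgz⟩ := h0
  exact (hg.hasBd.log_aux hz hgz).2.neg.pos_part

lemma log_le_norm_sub_one (w : ℂ) : Real.log ‖w‖ ≤ ‖w - 1‖ := by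
  rcases eq_or_ne w 0 with rfl | h
  · simp
  · have h1 := Real.log_le_sub_one_of_pos (norm_pos_iff.mpr h)
    have h2 := norm_sub_norm_le w 1
    rw [norm_one] at h2
    linarith

lemma LData.differentiableOn {α : ℝ} {K : Set (ℂ → ℂ)} {φ : (ℂ → ℂ) →ₗ[ℂ] ℂ} {L : ℂ → ℂ}
    (hK : IsClosedIdeal α K) (hL : LData K φ L) {g : ℕ → ℂ → ℂ} (hg : ∀ n, g n ∈ K)
    (h : ToOne g) : ∀ z ∈ uDisc, DifferentiableAt ℂ L z := by
  intro z hz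
  obtain ⟨n, hn⟩ := ((h.tendsto_at (fun n => hK.mem_A _ (hg n)) hz).eventually_ne
    one_ne_zero).exists
  exact hL.reg z (uDisc_subset hz) _ (hg n) hn

lemma LData.interior_bound {α : ℝ} (hα : 0 < α) (hα1 : α < 1) {K : Set (ℂ → ℂ)}
    (hK : IsClosedIdeal α K) {φ : (ℂ → ℂ) →ₗ[ℂ] ℂ} {L : ℂ → ℂ} (hL : LData K φ L) {q : ℕ}
    (hq : 1 ≤ q * α) {G : ℕ → ℂ → ℂ} (hG : ∀ n, G n ∈ K) (hG1 : ToOne G)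
    {g : ℂ → ℂ} (hg : g ∈ K) (h0 : ∃ z ∈ uDisc, g z ≠ 0) :
    ∃ C, 1 ≤ C ∧ ∀ z ∈ uDisc, ‖L z‖ ≤ C * Real.exp ((2 * q + 1 : ℕ) * PI (logMinus g) z) := by
  obtain ⟨C₁, hC₁, hb⟩ := hL.exists_bound hα hα1 hK hq hg
  set m := 2 * q + 1 with hm
  have hgA := hK.mem_A g hg
  have hGA := fun n => hK.mem_A _ (hG n)
  have hv := integrable_logMinus hgA h0
  have hLd := hL.differentiableOn hK hG hG1
  have hne : ∀ᵐ s ∂nu, g (e s) ≠ 0 := by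
    obtain ⟨z, hz, hgz⟩ := h0
    exact (hgA.hasBd.log_aux hz hgz).1
  have hLlim : ∀ s, g (e s) ≠ 0 →
      Tendsto (fun r : ℝ => L (r * e s)) (nhdsWithin 1 (Iio 1)) (nhds (L (e s))) := fun s hs =>
    tendsto_dilate_disc (hL.reg _ (e_mem_closed s) g hg hs).continuousAt
  have hbL : ∀ᵐ s ∂nu, g (e s) ≠ 0 ∧ ‖g (e s)‖ ^ m * ‖L (e s)‖ ≤ C₁ := by
    filter_upwards [hne, hgA.hasBd.lim] with s hs hlim
    refine ⟨hs, ?_⟩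
    have h1 := ((hlim.pow m).mul (hLlim s hs)).norm
    rw [norm_mul, norm_pow] at h1
    refine le_of_tendsto h1 ?_
    filter_upwards [Ioo_mem_nhdsLT one_pos] with r hr
    exact hb _ (mul_e_mem hr.1.le hr.2 s)
  refine ⟨C₁ + 1, by linarith, fun z hz => ?_⟩
  rcases eq_or_ne (L z) 0 with hLz | hLz
  · rw [hLz, norm_zero]; positivity
  have hmain : ∀ᶠ n in atTop, ‖G n z‖ ^ m * ‖L z‖ ≤
      Real.exp (m * PI (fun s => ‖G n (e s) - 1‖) z + Real.log (C₁ + 1) +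
        m * PI (logMinus g) z) := by
    filter_upwards [(hG1.tendsto_at hGA hz).eventually_ne one_ne_zero] with n hn
    obtain ⟨C₂, hC₂, hb₂⟩ := hL.exists_bound hα hα1 hK hq (hG n)
    have hF : HasBd (fun z => G n z ^ m * L z) (fun s => G n (e s) ^ m * L (e s)) := by
      refine ⟨((hGA n).diff.pow m).mul fun w hw => (hLd w hw).differentiableWithinAt,
        ⟨C₂, hb₂⟩, ?_⟩
      filter_upwards [hne, (hGA n).hasBd.lim] with s hs hlim
      exact (hlim.pow m).mul (hLlim s hs)
    have hFz : G n z ^ m * L z ≠ 0 := mul_ne_zero (pow_ne_zero _ hn) hLz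
    obtain ⟨hn0, hi⟩ := hF.log_aux hz hFz
    have h1 := hF.norm_le_exp_log hn0 hi hz
    rw [norm_mul, norm_pow] at h1
    refine h1.trans (Real.exp_le_exp.mpr ?_)
    have hi1 := (integrable_norm_sub_one (hGA n)).const_mul (m : ℝ)
    have hi2 := hv.const_mul (m : ℝ)
    have hi3 := integrable_const (μ := nu) (Real.log (C₁ + 1))
    have := PI_mono hi ((hi1.add hi3).add hi2) (z := z) ?_ hz
    · refine this.trans_eq ?_
      rw [← PI_smul, ← PI_smul, ← PI_const (Real.log (C₁ + 1)) hz, ← PI_add hi1 hi3 hz,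
        PI_const _ hz]
      exact PI_add (hi1.add hi3) hi2 hz
    · filter_upwards [hn0, hbL] with s hs ⟨hgs, hbs⟩
      have ha : G n (e s) ≠ 0 := fun h => hs (by rw [h, zero_pow (by omega), zero_mul])
      have hl : L (e s) ≠ 0 := fun h => hs (by rw [h, mul_zero])
      rw [norm_mul, norm_pow, Real.log_mul (by positivity) (by positivity), Real.log_pow]
      have h3 : m * Real.log ‖g (e s)‖ + Real.log ‖L (e s)‖ ≤ Real.log (C₁ + 1) := by
        rw [← Real.log_pow, ← Real.log_mul (by positivity) (by positivity)]
        exact Real.log_le_log (by positivity) (by linarith)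
      have h4 := log_le_norm_sub_one (G n (e s))
      have h5 : -Real.log ‖g (e s)‖ ≤ logMinus g s := le_max_left _ _
      have h6 : (m : ℝ) * Real.log ‖G n (e s)‖ ≤ m * ‖G n (e s) - 1‖ := by gcongr
      have h7 : (m : ℝ) * -Real.log ‖g (e s)‖ ≤ m * logMinus g s := by gcongr
      simp only [Pi.add_apply]
      linarith
  have hl1 : Tendsto (fun n => ‖G n z‖ ^ m * ‖L z‖) atTop (nhds (1 * ‖L z‖)) := by
    have := ((hG1.tendsto_at hGA hz).norm.pow m).mul_const ‖L z‖
    simpa using this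
  have hl2 := ((((hG1.tendsto_PI hGA hz).const_mul (m : ℝ)).add_const
    (Real.log (C₁ + 1))).add_const (m * PI (logMinus g) z)).rexp
  have := le_of_tendsto_of_tendsto hl1 hl2 hmain
  rw [one_mul, mul_zero, zero_add, Real.exp_add, Real.exp_log (by linarith)] at this
  exact this

lemma P_zero (s : ℝ) : P 0 s = 1 := by simp [P]

lemma norm_le_exp_circle {f : ℂ → ℂ} (hf : ∀ u : ℂ, ‖u‖ ≤ 1 → DifferentiableAt ℂ f u) {R : ℝ}
    (h0 : 0 ≤ R) (h1 : R ≤ 1) : ‖f 0‖ ≤ Real.exp (∫ s, slog 1 (f (R * e s)) ∂nu) := by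
  have hin : ∀ w : ℂ, ‖w‖ ≤ 1 → ‖(R : ℂ) * w‖ ≤ 1 := fun w hw => by
    rw [norm_mul, Complex.norm_real, Real.norm_of_nonneg h0]
    nlinarith [norm_nonneg w]
  have hd : ∀ w : ℂ, ‖w‖ ≤ 1 → DifferentiableAt ℂ (fun u => f (R * u)) w := fun w hw =>
    DifferentiableAt.comp w (g := f) (hf _ (hin w hw)) (by fun_prop)
  have hB : HasBd (fun u => f (R * u)) (fun s => f (R * e s)) := by
    refine ⟨fun w hw => (hd w (mem_uDisc.mp hw).le).differentiableWithinAt, ?_,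
      ae_of_all _ fun s => tendsto_dilate_disc (hd (e s) (norm_e s).le).continuousAt⟩
    obtain ⟨B, hB⟩ := (isCompact_closedBall (0 : ℂ) 1).exists_bound_of_continuousOn
      (f := fun u => f (R * u))
      fun w hw => (hd w (mem_cDisc.mp hw)).continuousAt.continuousWithinAt
    exact ⟨B, fun z hz => hB z (uDisc_subset hz)⟩
  have := hB.norm_le_exp_slog one_ne_zero zero_mem_uDisc
  simpa [PI, P_zero] using this

lemma slog_one_nonneg (w : ℂ) : 0 ≤ slog 1 w :=
  div_nonneg (Real.log_nonneg (by nlinarith [sq_nonneg ‖w‖])) (by norm_num)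

lemma slog_one_le {w : ℂ} {X : ℝ} (hX : 1 ≤ X) (hw : ‖w‖ ≤ X) :
    slog 1 w ≤ 1 + Real.log X := by
  have h1 : Real.log (‖w‖ ^ 2 + 1 ^ 2) ≤ Real.log (2 * X ^ 2) := by
    refine Real.log_le_log (by positivity) ?_
    have : ‖w‖ ^ 2 ≤ X ^ 2 := by gcongr
    nlinarith
  rw [Real.log_mul two_ne_zero (by positivity), Real.log_pow] at h1
  have := Real.log_two_lt_d9
  unfold slog
  generalize Real.log (‖w‖ ^ 2 + 1 ^ 2) = y at h1 ⊢
  push_cast at h1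
  linarith

lemma norm_le_exp_area {f : ℂ → ℂ} (hf : ∀ u : ℂ, ‖u‖ ≤ 1 → DifferentiableAt ℂ f u) :
    ‖f 0‖ ≤ Real.exp (Real.pi⁻¹ * ∫ u in uDisc, slog 1 (f u)) := by
  rcases eq_or_ne (f 0) 0 with h0 | h0
  · rw [h0, norm_zero]; positivity
  have hfc : ContinuousOn f (closedBall 0 1) := fun u hu =>
    (hf u (mem_cDisc.mp hu)).continuousAt.continuousWithinAt
  have hsc : ContinuousOn (fun u => slog 1 (f u)) (closedBall 0 1) :=
    (continuous_slog one_ne_zero).comp_continuousOn hfc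
  obtain ⟨B, hB⟩ := (isCompact_closedBall (0 : ℂ) 1).exists_bound_of_continuousOn hsc
  have hmem : ∀ r : ℝ, r ∈ Icc (0 : ℝ) 1 → ∀ s, (r : ℂ) * e s ∈ closedBall (0 : ℂ) 1 :=
    fun r hr s => by
      rw [mem_cDisc, norm_mul, norm_e, mul_one, Complex.norm_real, Real.norm_of_nonneg hr.1]
      exact hr.2
  set ℓ : ℝ → ℝ := fun r => ∫ s, slog 1 (f (r * e s)) ∂nu with hℓ
  have hℓc : ContinuousOn ℓ (Icc 0 1) := by
    refine continuousOn_of_dominated (bound := fun _ => B) (fun r hr => ?_) (fun r hr =>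
      ae_of_all _ fun s => hB _ (hmem r hr s)) (integrable_const _) (ae_of_all _ fun s => ?_)
    · exact (hsc.comp_continuous (continuous_const.mul continuous_e)
        (hmem r hr)).aestronglyMeasurable
    · exact hsc.comp (by fun_prop) fun r hr => hmem r hr s
  have hpol : ∫ u in uDisc, slog 1 (f u) = ∫ r in (0 : ℝ)..1, (2 * Real.pi * r) * ℓ r := by
    have h := integral_polar (Φ := fun u => (slog 1 (f u) : ℂ))
      (Complex.continuous_ofReal.comp_continuousOn hsc)
    rw [integral_complex_ofReal] at h
    apply Complex.ofReal_injective
    rw [h, ← intervalIntegral.integral_ofReal]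
    refine intervalIntegral.integral_congr fun r _ => ?_
    simp only [hℓ]
    rw [integral_complex_ofReal, Complex.real_smul]; push_cast; rfl
  have hge : ∀ r ∈ Icc (0 : ℝ) 1, Real.log ‖f 0‖ ≤ ℓ r := fun r hr => by
    rw [Real.log_le_iff_le_exp (norm_pos_iff.mpr h0)]
    exact norm_le_exp_circle hf hr.1 hr.2
  have hint : ∫ r in (0 : ℝ)..1, (2 * Real.pi * r) * Real.log ‖f 0‖ ≤
      ∫ r in (0 : ℝ)..1, (2 * Real.pi * r) * ℓ r := by
    refine intervalIntegral.integral_mono_on zero_le_one ?_ ?_ fun r hr => ?_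
    · exact (by fun_prop : Continuous fun r : ℝ =>
        (2 * Real.pi * r) * Real.log ‖f 0‖).intervalIntegrable _ _
    · refine ContinuousOn.intervalIntegrable ?_
      rw [uIcc_of_le zero_le_one]
      exact (by fun_prop : ContinuousOn (fun r : ℝ => 2 * Real.pi * r) _).mul hℓc
    · have := hr.1
      have := Real.pi_pos
      exact mul_le_mul_of_nonneg_left (hge r hr) (by positivity)
  have hlhs : ∫ r in (0 : ℝ)..1, (2 * Real.pi * r) * Real.log ‖f 0‖ =
      Real.pi * Real.log ‖f 0‖ := by
    rw [intervalIntegral.integral_mul_const, intervalIntegral.integral_const_mul, integral_id]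
    ring
  rw [← Real.log_le_iff_le_exp (norm_pos_iff.mpr h0), hpol, inv_mul_eq_div,
    le_div_iff₀ Real.pi_pos, mul_comm, ← hlhs]
  exact hint

lemma lintegral_neg_log_lt_top : ∫⁻ t : ℝ, ENNReal.ofReal (-Real.log t) < ⊤ := by
  have h : IntegrableOn Real.log (Ioc (-1) 1) volume :=
    (intervalIntegral.intervalIntegrable_log' (a := -1) (b := 1)).1
  refine lt_of_le_of_lt ?_ h.2
  rw [← lintegral_indicator measurableSet_Ioc]
  refine lintegral_mono fun t => ?_
  by_cases ht : t ∈ Ioc (-1 : ℝ) 1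
  · rw [indicator_of_mem ht]
    rw [← ofReal_norm]
    exact ENNReal.ofReal_le_ofReal (neg_le_abs _)
  · rw [indicator_of_notMem ht, ENNReal.ofReal_of_nonpos]
    rw [← Real.log_abs, neg_nonpos]
    refine Real.log_nonneg ?_
    by_contra hlt
    rw [not_le, abs_lt] at hlt
    exact ht ⟨hlt.1, hlt.2.le⟩

lemma exists_log_strip : ∃ A : ℝ, 0 ≤ A ∧ ∀ b : ℝ,
    ∫⁻ u in uDisc, ENNReal.ofReal (-Real.log (u.re - b)) ≤ ENNReal.ofReal A := by
  set I := ∫⁻ t : ℝ, ENNReal.ofReal (-Real.log t) with hI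
  refine ⟨(I * 2).toReal, ENNReal.toReal_nonneg, fun b => ?_⟩
  rw [ENNReal.ofReal_toReal (ENNReal.mul_lt_top lintegral_neg_log_lt_top (by simp)).ne]
  have hm : Measurable fun t : ℝ => ENNReal.ofReal (-Real.log (t - b)) := by fun_prop
  have h1 : ∫⁻ u in uDisc, ENNReal.ofReal (-Real.log (u.re - b)) ≤
      ∫⁻ u : ℂ, (fun p : ℝ × ℝ => ENNReal.ofReal (-Real.log (p.1 - b)) *
        (Ioo (-1 : ℝ) 1).indicator 1 p.2) (Complex.measurableEquivRealProd u) := by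
    rw [← lintegral_indicator measurableSet_uDisc]
    refine lintegral_mono fun u => ?_
    by_cases hu : u ∈ uDisc
    · rw [indicator_of_mem hu]
      simp only [Complex.measurableEquivRealProd_apply]
      have h2 := (Complex.abs_im_le_norm u).trans_lt (mem_uDisc.mp hu)
      rw [abs_lt] at h2
      rw [indicator_of_mem (show u.im ∈ Ioo (-1 : ℝ) 1 from h2)]
      simp
    · rw [indicator_of_notMem hu]; exact zero_le
  refine h1.trans ?_
  have hm2 : Measurable fun p : ℝ × ℝ => ENNReal.ofReal (-Real.log (p.1 - b)) *
        (Ioo (-1 : ℝ) 1).indicator (1 : ℝ → ℝ≥0∞) p.2 :=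
    (hm.comp measurable_fst).mul
      ((measurable_one.indicator measurableSet_Ioo).comp measurable_snd)
  rw [Complex.volume_preserving_equiv_real_prod.lintegral_comp hm2, Measure.volume_eq_prod,
    lintegral_prod_mul hm.aemeasurable (measurable_one.indicator measurableSet_Ioo).aemeasurable,
    lintegral_indicator_one measurableSet_Ioo]
  refine mul_le_mul' (le_of_eq ?_) ?_
  · exact lintegral_sub_right_eq_self (fun t => ENNReal.ofReal (-Real.log t)) b
  · rw [Real.volume_Ioo]; norm_num

lemma lintegral_inv_norm_lt_top :
    ∫⁻ u : ℂ, (ball (0 : ℂ) 1).indicator (fun u => ENNReal.ofReal (1 / ‖u‖)) u < ⊤ := by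
  rw [← Complex.lintegral_comp_polarCoord_symm]
  refine lt_of_le_of_lt (b := ∫⁻ p in Ioo (0 : ℝ) 1 ×ˢ Ioo (-Real.pi) Real.pi, 1) ?_ ?_
  · have hms : MeasurableSet (Ioo (0 : ℝ) 1 ×ˢ Ioo (-Real.pi) Real.pi) :=
      measurableSet_Ioo.prod measurableSet_Ioo
    have hmt : MeasurableSet _root_.polarCoord.target :=
      _root_.polarCoord.open_target.measurableSet
    rw [← lintegral_indicator hmt, ← lintegral_indicator hms]
    refine lintegral_mono fun p => ?_
    by_cases hp : p ∈ _root_.polarCoord.target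
    · rw [indicator_of_mem hp]
      rw [polarCoord_target, mem_prod] at hp
      have hp0 : 0 < p.1 := hp.1
      have hn : ‖Complex.polarCoord.symm p‖ = p.1 := by
        rw [Complex.norm_polarCoord_symm, abs_of_pos hp0]
      by_cases h1 : p.1 < 1
      · rw [indicator_of_mem (show p ∈ Ioo (0 : ℝ) 1 ×ˢ Ioo (-Real.pi) Real.pi from ⟨⟨hp0, h1⟩, hp.2⟩)]
        rw [indicator_of_mem (by rw [mem_ball_zero_iff, hn]; exact h1), hn, smul_eq_mul,
          ← ENNReal.ofReal_mul hp0.le, mul_one_div_cancel hp0.ne']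
        simp
      · rw [indicator_of_notMem (s := ball (0 : ℂ) 1)
          (by rw [mem_ball_zero_iff, hn]; exact h1)]
        simp
    · rw [indicator_of_notMem hp]; exact zero_le
  · rw [setLIntegral_one, Measure.volume_eq_prod, Measure.prod_prod, Real.volume_Ioo,
      Real.volume_Ioo]
    exact ENNReal.mul_lt_top ENNReal.ofReal_lt_top ENNReal.ofReal_lt_top

lemma exists_inv_norm : ∃ A : ℝ, 0 ≤ A ∧ ∀ a : ℂ,
    ∫⁻ u in uDisc, ENNReal.ofReal (1 / ‖a - u‖) ≤ ENNReal.ofReal A := by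
  set I := ∫⁻ u : ℂ, (ball (0 : ℂ) 1).indicator (fun u => ENNReal.ofReal (1 / ‖u‖)) u with hI
  have hIt : volume uDisc + I < ⊤ :=
    ENNReal.add_lt_top.mpr ⟨volume_uDisc_lt_top, lintegral_inv_norm_lt_top⟩
  refine ⟨(volume uDisc + I).toReal, ENNReal.toReal_nonneg, fun a => ?_⟩
  rw [ENNReal.ofReal_toReal hIt.ne]
  calc ∫⁻ u in uDisc, ENNReal.ofReal (1 / ‖a - u‖)
      ≤ ∫⁻ u in uDisc, (1 + (ball (0 : ℂ) 1).indicator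
          (fun u => ENNReal.ofReal (1 / ‖u‖)) (a - u)) := by
        refine lintegral_mono fun u => ?_
        by_cases h : a - u ∈ ball (0 : ℂ) 1
        · rw [indicator_of_mem h]; exact le_add_self
        · refine le_add_right ?_
          rw [mem_ball_zero_iff, not_lt] at h
          rw [ENNReal.ofReal_le_one, div_le_one (by linarith)]
          exact h
    _ = volume uDisc + ∫⁻ u in uDisc, (ball (0 : ℂ) 1).indicator
          (fun u => ENNReal.ofReal (1 / ‖u‖)) (a - u) := by
        rw [lintegral_add_left measurable_const, setLIntegral_one]
    _ ≤ volume uDisc + ∫⁻ u, (ball (0 : ℂ) 1).indicator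
          (fun u => ENNReal.ofReal (1 / ‖u‖)) (a - u) := by
        gcongr
        exact Measure.restrict_le_self
    _ = volume uDisc + I := by
        rw [lintegral_sub_left_eq_self (fun u => (ball (0 : ℂ) 1).indicator
          (fun u => ENNReal.ofReal (1 / ‖u‖)) u) a]

lemma ofReal_integral_le {β : Type*} [MeasurableSpace β] {μ : Measure β} {f : β → ℝ}
    (hf : ∀ x, 0 ≤ f x) : ENNReal.ofReal (∫ x, f x ∂μ) ≤ ∫⁻ x, ENNReal.ofReal (f x) ∂μ := by
  by_cases h : Integrable f μ
  · rw [ofReal_integral_eq_lintegral_ofReal h (ae_of_all _ hf)]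
  · rw [integral_undef h]; simp

lemma norm_le_of_area_bound {A : ℝ}
    (hA : ∀ b : ℝ, ∫⁻ u in uDisc, ENNReal.ofReal (-Real.log (u.re - b)) ≤ ENNReal.ofReal A)
    (hA0 : 0 ≤ A) {f : ℂ → ℂ} (hf : ∀ u : ℂ, ‖u‖ ≤ 1 → DifferentiableAt ℂ f u) {C b m : ℝ}
    (hC : 1 ≤ C) (hm : 0 ≤ m) {v κ : ℝ → ℝ} (hv : Measurable v) (hv0 : ∀ s, 0 ≤ v s)
    (hκ0 : ∀ s, 0 ≤ κ s)
    (hκ : Integrable (fun s => κ s * v s) nu) {K : ℂ → ℝ → ℝ}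
    (hK : Measurable (Function.uncurry K)) (hK0 : ∀ u s, 0 ≤ K u s)
    (hKκ : ∀ s, ∫⁻ u in uDisc, ENNReal.ofReal (K u s) ≤ ENNReal.ofReal (κ s))
    (hb : ∀ u ∈ uDisc, u.re ≠ b → ‖f u‖ ≤
      C * Real.exp (2 * max 0 (-Real.log (u.re - b)) + m * ∫ s, K u s * v s ∂nu)) :
    ‖f 0‖ ≤ Real.exp (1 + Real.log C + 2 * A + m * ∫ s, κ s * v s ∂nu) := by
  have hlog : 0 ≤ Real.log C := Real.log_nonneg hC
  have hnull : ∀ᵐ u ∂(volume.restrict uDisc), u.re ≠ b := by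
    refine ae_restrict_of_ae ?_
    have h1 : ∀ᵐ p : ℝ × ℝ, p.1 ≠ b := by
      rw [Measure.volume_eq_prod]
      have h2 : ∀ᵐ x : ℝ, x ≠ b := by simp [ae_iff]
      exact Measure.quasiMeasurePreserving_fst.ae h2
    exact Complex.volume_preserving_equiv_real_prod.quasiMeasurePreserving.ae h1
  have hpt : ∀ᵐ u ∂(volume.restrict uDisc), ENNReal.ofReal (slog 1 (f u)) ≤
      ENNReal.ofReal (1 + Real.log C) + 2 * ENNReal.ofReal (-Real.log (u.re - b)) +
        ENNReal.ofReal m * ∫⁻ s, ENNReal.ofReal (K u s * v s) ∂nu := by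
    filter_upwards [hnull, ae_restrict_mem measurableSet_uDisc] with u hu hud
    have hi0 : 0 ≤ ∫ s, K u s * v s ∂nu :=
      integral_nonneg fun s => mul_nonneg (hK0 u s) (hv0 s)
    have h1 := slog_one_le (one_le_mul_of_one_le_of_one_le hC (Real.one_le_exp (by positivity)))
      (hb u hud hu)
    rw [Real.log_mul (by positivity) (by positivity), Real.log_exp] at h1
    calc ENNReal.ofReal (slog 1 (f u)) ≤ ENNReal.ofReal ((1 + Real.log C) +
          2 * max 0 (-Real.log (u.re - b)) + m * ∫ s, K u s * v s ∂nu) :=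
          ENNReal.ofReal_le_ofReal (by linarith)
      _ = ENNReal.ofReal (1 + Real.log C) + 2 * ENNReal.ofReal (-Real.log (u.re - b)) +
          ENNReal.ofReal m * ENNReal.ofReal (∫ s, K u s * v s ∂nu) := by
          rw [ENNReal.ofReal_add (by positivity) (by positivity),
            ENNReal.ofReal_add (by positivity) (by positivity), ENNReal.ofReal_mul hm,
            ENNReal.ofReal_mul zero_le_two, ENNReal.ofReal_max]
          simp
      _ ≤ _ := by
          gcongr
          exact ofReal_integral_le fun s => mul_nonneg (hK0 u s) (hv0 s)
  have hmK : Measurable (Function.uncurry fun u s => ENNReal.ofReal (K u s * v s)) :=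
    (hK.mul (hv.comp measurable_snd)).ennreal_ofReal
  have hmlog : Measurable fun u : ℂ => ENNReal.ofReal (-Real.log (u.re - b)) := by fun_prop
  have hIκ : 0 ≤ ∫ s, κ s * v s ∂nu := integral_nonneg fun s => mul_nonneg (hκ0 s) (hv0 s)
  have hswap : ∫⁻ u in uDisc, ∫⁻ s, ENNReal.ofReal (K u s * v s) ∂nu ≤
      ENNReal.ofReal (∫ s, κ s * v s ∂nu) := by
    rw [lintegral_lintegral_swap hmK.aemeasurable, ofReal_integral_eq_lintegral_ofReal hκ
      (ae_of_all _ fun s => mul_nonneg (hκ0 s) (hv0 s))]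
    refine lintegral_mono fun s => ?_
    simp_rw [ENNReal.ofReal_mul (hK0 _ s), ENNReal.ofReal_mul (hκ0 s)]
    have hKs : Measurable fun u => K u s := hK.comp (measurable_id.prodMk measurable_const)
    rw [lintegral_mul_const _ hKs.ennreal_ofReal]
    gcongr
    exact hKκ s
  have hvol : volume uDisc = ENNReal.ofReal Real.pi := by
    rw [← volume_real_uDisc, Measure.real, ENNReal.ofReal_toReal volume_uDisc_lt_top.ne]
  have htot : ∫⁻ u in uDisc, ENNReal.ofReal (slog 1 (f u)) ≤
      ENNReal.ofReal (Real.pi * (1 + Real.log C + 2 * A + m * ∫ s, κ s * v s ∂nu)) := by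
    calc _ ≤ ∫⁻ u in uDisc, (ENNReal.ofReal (1 + Real.log C) +
          2 * ENNReal.ofReal (-Real.log (u.re - b)) +
          ENNReal.ofReal m * ∫⁻ s, ENNReal.ofReal (K u s * v s) ∂nu) := lintegral_mono_ae hpt
      _ = ENNReal.ofReal (1 + Real.log C) * volume uDisc +
          2 * (∫⁻ u in uDisc, ENNReal.ofReal (-Real.log (u.re - b))) +
          ENNReal.ofReal m * ∫⁻ u in uDisc, ∫⁻ s, ENNReal.ofReal (K u s * v s) ∂nu := by
          rw [lintegral_add_left (f := fun u : ℂ => ENNReal.ofReal (1 + Real.log C) +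
            2 * ENNReal.ofReal (-Real.log (u.re - b)))
            (measurable_const.add (hmlog.const_mul 2)), lintegral_add_left measurable_const, setLIntegral_const,
            lintegral_const_mul _ hmlog, lintegral_const_mul _ hmK.lintegral_prod_right]
      _ ≤ ENNReal.ofReal (1 + Real.log C) * ENNReal.ofReal Real.pi +
          ENNReal.ofReal 2 * ENNReal.ofReal A +
          ENNReal.ofReal m * ENNReal.ofReal (∫ s, κ s * v s ∂nu) := by
          rw [hvol]
          gcongr
          · simp
          · exact hA b
      _ = ENNReal.ofReal ((1 + Real.log C) * Real.pi + 2 * A + m * ∫ s, κ s * v s ∂nu) := by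
          rw [← ENNReal.ofReal_mul (by positivity), ← ENNReal.ofReal_mul zero_le_two,
            ← ENNReal.ofReal_mul hm, ← ENNReal.ofReal_add (by positivity) (by positivity),
            ← ENNReal.ofReal_add (by positivity) (by positivity)]
      _ ≤ _ := by
          refine ENNReal.ofReal_le_ofReal ?_
          have h3 := Real.pi_gt_three
          have h4 : 0 ≤ 2 * A + m * ∫ s, κ s * v s ∂nu := by positivity
          nlinarith
  refine (norm_le_exp_area hf).trans (Real.exp_le_exp.mpr ?_)
  rw [inv_mul_le_iff₀ Real.pi_pos]
  refine (ENNReal.ofReal_le_ofReal_iff ?_).mp ((ofReal_integral_le fun u =>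
    slog_one_nonneg (f u)).trans htot)
  have := Real.pi_pos
  positivity

section

/-- A radius `c ‖k z‖ ^ q` within which `k` keeps its order of magnitude. -/
structure HoldData (k : ℂ → ℂ) (q : ℕ) (c : ℝ) : Prop where
  cont : ContinuousOn k (closedBall 0 1)
  le_one : ∀ z ∈ closedBall (0 : ℂ) 1, ‖k z‖ ≤ 1
  pos : 0 < c
  le : c ≤ 1 / 4
  hold : ∀ a ∈ closedBall (0 : ℂ) 1, ∀ b ∈ closedBall (0 : ℂ) 1,
    ‖a - b‖ ≤ 2 * c * ‖k a‖ ^ q → ‖k b - k a‖ ≤ ‖k a‖ / 2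

/-- The square of the radius of `HoldData`. -/
def dl (k : ℂ → ℂ) (q : ℕ) (c : ℝ) (z : ℂ) : ℝ := (c * ‖k z‖ ^ q) ^ 2

/-- The circle pushed outside the disc by `dl`. -/
def ws (k : ℂ → ℂ) (q : ℕ) (c : ℝ) (s : ℝ) : ℂ := e s * (1 + dl k q c (e s) : ℝ)

/-- The Poisson kernel with respect to the points `ws`. -/
def kap (k : ℂ → ℂ) (q : ℕ) (c : ℝ) (z : ℂ) (s : ℝ) : ℝ :=
  (‖ws k q c s‖ ^ 2 - ‖z‖ ^ 2) / ‖ws k q c s - z‖ ^ 2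

variable {k : ℂ → ℂ} {q : ℕ} {c : ℝ}

lemma dl_nonneg (k : ℂ → ℂ) (q : ℕ) (c : ℝ) (z : ℂ) : 0 ≤ dl k q c z := sq_nonneg _

lemma norm_ws (k : ℂ → ℂ) (q : ℕ) (c : ℝ) (s : ℝ) : ‖ws k q c s‖ = 1 + dl k q c (e s) := by
  have := dl_nonneg k q c (e s)
  rw [ws, norm_mul, norm_e, one_mul, Complex.norm_real, Real.norm_of_nonneg (by linarith)]

lemma one_le_norm_ws (k : ℂ → ℂ) (q : ℕ) (c : ℝ) (s : ℝ) : 1 ≤ ‖ws k q c s‖ := by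
  rw [norm_ws]; linarith [dl_nonneg k q c (e s)]

lemma norm_ws_sub_e (k : ℂ → ℂ) (q : ℕ) (c : ℝ) (s : ℝ) :
    ‖ws k q c s - e s‖ = dl k q c (e s) := by
  rw [ws, show e s * ((1 + dl k q c (e s) : ℝ) : ℂ) - e s = e s * (dl k q c (e s) : ℝ) by
    push_cast; ring, norm_mul, norm_e, one_mul, Complex.norm_real,
    Real.norm_of_nonneg (dl_nonneg _ _ _ _)]

lemma le_norm_ws_sub (k : ℂ → ℂ) (q : ℕ) (c : ℝ) (z : ℂ) (s : ℝ) :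
    dl k q c (e s) + (1 - ‖z‖) ≤ ‖ws k q c s - z‖ := by
  have := norm_sub_norm_le (ws k q c s) z
  rw [norm_ws] at this; linarith

lemma norm_ws_sub_le (k : ℂ → ℂ) (q : ℕ) (c : ℝ) (z : ℂ) (s : ℝ) :
    ‖ws k q c s - z‖ ≤ ‖e s - z‖ + dl k q c (e s) := by
  rw [← norm_ws_sub_e k q c s, show ws k q c s - z = (e s - z) + (ws k q c s - e s) by ring]
  exact norm_add_le _ _

lemma kap_ge {z : ℂ} (hz : z ∈ uDisc) (s : ℝ) :
    (dl k q c (e s) + (1 - ‖z‖)) / ‖ws k q c s - z‖ ^ 2 ≤ kap k q c z s := by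
  have hz1 := mem_uDisc.mp hz
  have hd := dl_nonneg k q c (e s)
  rw [kap]
  gcongr
  rw [norm_ws]
  nlinarith [norm_nonneg z]

lemma kap_nonneg {z : ℂ} (hz : z ∈ uDisc) (s : ℝ) : 0 ≤ kap k q c z s := by
  have hz1 := mem_uDisc.mp hz
  have hd := dl_nonneg k q c (e s)
  exact (div_nonneg (by linarith) (by positivity)).trans (kap_ge hz s)

lemma kap_eq (z : ℂ) (s : ℝ) :
    kap k q c z s = ((ws k q c s + z) / (ws k q c s - z)).re := by
  set w := ws k q c s with hw
  rw [kap, ← hw, Complex.div_re, ← add_div, ← Complex.normSq_eq_norm_sq,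
    ← Complex.normSq_eq_norm_sq, ← Complex.normSq_eq_norm_sq]
  congr 1
  simp only [Complex.normSq_apply, Complex.add_re, Complex.add_im, Complex.sub_re, Complex.sub_im]
  ring

namespace HoldData

lemma rad_nonneg (h : HoldData k q c) (z : ℂ) : 0 ≤ c * ‖k z‖ ^ q := by
  have := h.pos
  positivity

lemma rad_le (h : HoldData k q c) {z : ℂ} (hz : z ∈ closedBall (0 : ℂ) 1) :
    c * ‖k z‖ ^ q ≤ 1 / 4 := by
  have h1 := pow_le_one₀ (n := q) (norm_nonneg (k z)) (h.le_one z hz)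
  have := h.le
  have := h.pos
  nlinarith [pow_nonneg (norm_nonneg (k z)) q]

lemma dl_le_rad (h : HoldData k q c) {z : ℂ} (hz : z ∈ closedBall (0 : ℂ) 1) :
    dl k q c z ≤ c * ‖k z‖ ^ q / 4 := by
  rw [dl]; nlinarith [h.rad_le hz, h.rad_nonneg z]

lemma dl_le (h : HoldData k q c) {z : ℂ} (hz : z ∈ closedBall (0 : ℂ) 1) :
    dl k q c z ≤ 1 / 16 := by
  linarith [h.rad_le hz, h.dl_le_rad hz]

lemma dl_pos (h : HoldData k q c) {z : ℂ} (hz : k z ≠ 0) : 0 < dl k q c z := by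
  have := h.pos
  have := norm_pos_iff.mpr hz
  rw [dl]; positivity

lemma dl_comparable (h : HoldData k q c) {a b : ℂ} (ha : a ∈ closedBall (0 : ℂ) 1)
    (hb : b ∈ closedBall (0 : ℂ) 1) (hab : ‖a - b‖ ≤ 2 * (c * ‖k a‖ ^ q)) :
    dl k q c b ≤ 4 ^ q * dl k q c a ∧ dl k q c a ≤ 4 ^ q * dl k q c b := by
  have h1 := h.hold a ha b hb (by linarith)
  have h2 := norm_sub_norm_le (k b) (k a)
  have h3 := norm_sub_norm_le (k a) (k b)
  rw [norm_sub_rev] at h3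
  have hc := h.pos
  have key : ∀ x y : ℝ, 0 ≤ x → x ≤ 2 * y → (c * x ^ q) ^ 2 ≤ 4 ^ q * (c * y ^ q) ^ 2 := by
    intro x y hx hxy
    calc (c * x ^ q) ^ 2 ≤ (c * (2 * y) ^ q) ^ 2 := by gcongr
      _ = 4 ^ q * (c * y ^ q) ^ 2 := by
        rw [mul_pow 2 y, show (4 : ℝ) ^ q = (2 ^ q) ^ 2 by rw [← pow_mul, mul_comm, pow_mul]; norm_num]
        ring
  exact ⟨key _ _ (norm_nonneg _) (by linarith [norm_nonneg (k a)]),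
    key _ _ (norm_nonneg _) (by linarith)⟩

lemma dl_le_add (h : HoldData k q c) {a b : ℂ} (ha : a ∈ closedBall (0 : ℂ) 1)
    (hb : b ∈ closedBall (0 : ℂ) 1) : dl k q c b ≤ 4 ^ q * dl k q c a + ‖a - b‖ := by
  by_cases hab : ‖b - a‖ ≤ 2 * (c * ‖k b‖ ^ q)
  · linarith [(h.dl_comparable hb ha hab).2, norm_nonneg (a - b)]
  · rw [norm_sub_rev] at hab
    have := h.dl_le_rad hb
    have := h.rad_nonneg b
    have : 0 ≤ 4 ^ q * dl k q c a := mul_nonneg (by positivity) (dl_nonneg _ _ _ _)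
    push Not at hab
    linarith

lemma dl_le_norm_sub (h : HoldData k q c) {z : ℂ} (hz : z ∈ closedBall (0 : ℂ) 1) (s : ℝ) :
    dl k q c z ≤ (4 ^ q + 2) * ‖ws k q c s - z‖ := by
  have h1 := h.dl_le_add (e_mem_closed s) hz
  have h2 := le_norm_ws_sub k q c z s
  have h3 := mem_cDisc.mp hz
  have h4 : ‖e s - z‖ ≤ ‖ws k q c s - z‖ + dl k q c (e s) := by
    rw [← norm_ws_sub_e k q c s, norm_sub_rev (ws k q c s) (e s),
      show e s - z = (ws k q c s - z) + (e s - ws k q c s) by ring]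
    exact norm_add_le _ _
  have h5 : dl k q c (e s) ≤ ‖ws k q c s - z‖ := by linarith
  have : (4 : ℝ) ^ q * dl k q c (e s) ≤ 4 ^ q * ‖ws k q c s - z‖ := by gcongr
  linarith

lemma P_le_kap (h : HoldData k q c) {z : ℂ} (hz : z ∈ uDisc) (hy : dl k q c z ≤ 16 * (1 - ‖z‖))
    (s : ℝ) : P z s ≤ 2 * (2 + 16 * 4 ^ q) ^ 2 * kap k q c z s := by
  have hzc := uDisc_subset hz
  have hz1 := mem_uDisc.mp hz
  have h1 := h.dl_le_add hzc (e_mem_closed s)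
  rw [norm_sub_rev] at h1
  have h2 := norm_ws_sub_le k q c z s
  have h3 := norm_sub_ge z s
  have hQ : (0 : ℝ) < 4 ^ q := by positivity
  have h4 : (4 : ℝ) ^ q * dl k q c z ≤ 4 ^ q * (16 * ‖e s - z‖) := by gcongr; linarith
  have hw : ‖ws k q c s - z‖ ≤ (2 + 16 * 4 ^ q) * ‖e s - z‖ := by linarith
  have hd := dl_nonneg k q c (e s)
  have hwp : 0 < ‖ws k q c s - z‖ := by linarith [le_norm_ws_sub k q c z s]
  have hep : 0 < ‖e s - z‖ := by linarith
  have h5 := kap_ge (k := k) (q := q) (c := c) hz s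
  calc P z s ≤ 2 * (1 - ‖z‖) / ‖e s - z‖ ^ 2 := by
        rw [P]; gcongr; nlinarith [norm_nonneg z]
    _ = 2 * (2 + 16 * 4 ^ q) ^ 2 * ((1 - ‖z‖) / ((2 + 16 * 4 ^ q) * ‖e s - z‖) ^ 2) := by
        field_simp
    _ ≤ 2 * (2 + 16 * 4 ^ q) ^ 2 *
          ((dl k q c (e s) + (1 - ‖z‖)) / ‖ws k q c s - z‖ ^ 2) := by
        gcongr ?_ * ?_
        exact div_le_div₀ (by linarith) (by linarith) (by positivity) (by gcongr)
    _ ≤ _ := by gcongr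

lemma P_near_le (h : HoldData k q c) {z ζ : ℂ} (hz : z ∈ uDisc) (hkz : k z ≠ 0)
    (hy : 1 - ‖z‖ ≤ dl k q c z) (hζ : ζ ∈ uDisc) (hζz : ‖ζ - z‖ ≤ dl k q c z) {s : ℝ}
    (hs : 2 * dl k q c z < ‖e s - z‖) :
    P ζ s ≤ 8 + 16 * (4 ^ q * (1 + 4 ^ q) ^ 2) * kap k q c z s := by
  have hzc := uDisc_subset hz
  have hζ1 := mem_uDisc.mp hζ
  have hd := h.dl_pos hkz
  have hr := h.dl_le_rad hzc
  have hκ := kap_nonneg (k := k) (q := q) (c := c) hz s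
  set d := dl k q c z with hdef
  set r := c * ‖k z‖ ^ q with hrdef
  have hdr : d = r ^ 2 := rfl
  have h1 : ‖e s - z‖ ≤ ‖e s - ζ‖ + ‖ζ - z‖ := by
    rw [show e s - z = (e s - ζ) + (ζ - z) by ring]; exact norm_add_le _ _
  have h2 : 1 - ‖ζ‖ ≤ 2 * d := by
    have := norm_sub_norm_le z ζ
    rw [norm_sub_rev] at this; linarith
  have hP : P ζ s ≤ 4 * d / ‖e s - ζ‖ ^ 2 := by
    rw [P]; gcongr; nlinarith [norm_nonneg ζ]
  by_cases hsr : ‖e s - z‖ ≤ 2 * r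
  · have hc := (h.dl_comparable hzc (e_mem_closed s) (by rw [norm_sub_rev]; exact hsr))
    have hw := norm_ws_sub_le k q c z s
    have hQ : (0 : ℝ) < 4 ^ q := by positivity
    have h3 : ‖ws k q c s - z‖ ≤ (1 + 4 ^ q) * ‖e s - z‖ := by nlinarith [hc.1]
    have hwp : 0 < ‖ws k q c s - z‖ := by
      linarith [le_norm_ws_sub k q c z s, dl_nonneg k q c (e s), mem_uDisc.mp hz]
    have hep : 0 < ‖e s - z‖ := by linarith
    have hκ2 : d / 4 ^ q / ((1 + 4 ^ q) * ‖e s - z‖) ^ 2 ≤ kap k q c z s := by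
      refine le_trans ?_ (kap_ge hz s)
      refine div_le_div₀ (by linarith [dl_nonneg k q c (e s), mem_uDisc.mp hz]) ?_
        (by positivity) (by gcongr)
      rw [div_le_iff₀ hQ]
      nlinarith [hc.2, mem_uDisc.mp hz]
    calc P ζ s ≤ 4 * d / ‖e s - ζ‖ ^ 2 := hP
      _ ≤ 4 * d / (‖e s - z‖ / 2) ^ 2 := by gcongr; linarith
      _ = 16 * (4 ^ q * (1 + 4 ^ q) ^ 2) * (d / 4 ^ q / ((1 + 4 ^ q) * ‖e s - z‖) ^ 2) := by
          field_simp; norm_num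
      _ ≤ 16 * (4 ^ q * (1 + 4 ^ q) ^ 2) * kap k q c z s := by gcongr
      _ ≤ _ := by linarith
  · push Not at hsr
    have hr0 : 0 < r := by
      rcases (h.rad_nonneg z).eq_or_lt with h0 | h0
      · rw [hdr, hrdef, ← h0] at hd; simp at hd
      · exact h0
    calc P ζ s ≤ 4 * d / ‖e s - ζ‖ ^ 2 := hP
      _ ≤ 4 * d / r ^ 2 := by gcongr; linarith
      _ = 4 := by rw [hdr]; field_simp
      _ ≤ _ := by
        have : 0 ≤ 16 * ((4 : ℝ) ^ q * (1 + 4 ^ q) ^ 2) * kap k q c z s := by positivity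
        linarith

lemma inv_dl_le (h : HoldData k q c) {z : ℂ} (hz : z ∈ uDisc) (hkz : k z ≠ 0) {s : ℝ}
    (hs : ‖e s - z‖ ≤ 2 * dl k q c z) :
    1 / dl k q c z ≤ 4 ^ q * (2 + 4 ^ q) ^ 2 * kap k q c z s := by
  have hzc := uDisc_subset hz
  have hd := h.dl_pos hkz
  have hr := h.dl_le_rad hzc
  have hr0 := h.rad_nonneg z
  have hQ : (0 : ℝ) < 4 ^ q := by positivity
  have hc := h.dl_comparable hzc (e_mem_closed s) (by rw [norm_sub_rev]; linarith)
  have hw := norm_ws_sub_le k q c z s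
  set d := dl k q c z with hdef
  have h3 : ‖ws k q c s - z‖ ≤ (2 + 4 ^ q) * d := by linarith [hc.1]
  have hwp : 0 < ‖ws k q c s - z‖ := by
    linarith [le_norm_ws_sub k q c z s, dl_nonneg k q c (e s), mem_uDisc.mp hz]
  have hκ2 : d / 4 ^ q / ((2 + 4 ^ q) * d) ^ 2 ≤ kap k q c z s := by
    refine le_trans ?_ (kap_ge hz s)
    refine div_le_div₀ (by linarith [dl_nonneg k q c (e s), mem_uDisc.mp hz]) ?_
      (by positivity) (by gcongr)
    rw [div_le_iff₀ hQ]
    nlinarith [hc.2, mem_uDisc.mp hz]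
  calc 1 / d = 4 ^ q * (2 + 4 ^ q) ^ 2 * (d / 4 ^ q / ((2 + 4 ^ q) * d) ^ 2) := by
        field_simp
    _ ≤ _ := by gcongr

end HoldData

lemma P_le_two_div {z : ℂ} (hz : z ∈ uDisc) (s : ℝ) : P z s ≤ 2 / ‖e s - z‖ := by
  have h1 := norm_sub_ge z s
  have hz1 := mem_uDisc.mp hz
  have hp : 0 < ‖e s - z‖ := by linarith
  have h2 : 1 - ‖z‖ ^ 2 ≤ 2 * ‖e s - z‖ := by nlinarith [norm_nonneg z]
  rw [P, div_le_div_iff₀ (by positivity) hp]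
  nlinarith [mul_le_mul_of_nonneg_right h2 hp.le]

lemma norm_exp_sub_one_ge {x : ℂ} (hx : ‖x‖ ≤ 1 / 2) : ‖x‖ / 2 ≤ ‖exp x - 1‖ := by
  have h1 := Complex.norm_exp_sub_one_sub_id_le (x := x) (by linarith)
  have h2 := norm_sub_norm_le x (x - (exp x - 1))
  rw [sub_sub_cancel, norm_sub_rev x (exp x - 1)] at h2
  nlinarith [norm_nonneg x]

/-- A point of the circle near `z` is `z * exp (ρ a)`; distances transform accordingly. -/
lemma exists_log_center {z : ℂ} (hz : 15 / 16 ≤ ‖z‖) {s ρ : ℝ} (hρ : 0 < ρ) (hρ1 : ρ ≤ 1 / 16)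
    (hs : ‖e s - z‖ ≤ 3 / 16) :
    ∃ a : ℂ, ∀ u ∈ uDisc, ρ * ‖a - u‖ / 2 ≤ ‖e s - z * exp (ρ * u)‖ := by
  have hz0 : z ≠ 0 := norm_pos_iff.mp (by linarith)
  set x := (e s - z) / z with hx
  have hx1 : ‖x‖ ≤ 1 / 5 := by
    rw [hx, norm_div, div_le_iff₀ (by linarith)]; linarith
  have hl := Complex.norm_log_one_add_half_le_self (z := x) (by linarith)
  have h1x : 1 + x = e s / z := by rw [hx]; field_simp; ring
  have hexp : z * exp (Complex.log (1 + x)) = e s := by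
    rw [Complex.exp_log (by rw [h1x]; exact div_ne_zero (e_ne_zero s) hz0), h1x]
    field_simp
  set l := Complex.log (1 + x) with hldef
  refine ⟨l / ρ, fun u hu => ?_⟩
  have hu1 := mem_uDisc.mp hu
  have hn : ‖(ρ : ℂ) * u - l‖ = ρ * ‖l / ρ - u‖ := by
    have hρc : (ρ : ℂ) ≠ 0 := by exact_mod_cast hρ.ne'
    rw [show (ρ : ℂ) * u - l = -(ρ * (l / ρ - u)) by field_simp; ring, norm_neg, norm_mul,
      Complex.norm_real, Real.norm_of_nonneg hρ.le]
  have hle : ‖(ρ : ℂ) * u - l‖ ≤ 1 / 2 := by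
    refine (norm_sub_le _ _).trans ?_
    rw [norm_mul, Complex.norm_real, Real.norm_of_nonneg hρ.le]
    nlinarith [norm_nonneg u]
  have h2 := norm_exp_sub_one_ge hle
  have h3 : e s - z * exp (ρ * u) = -(e s * (exp (ρ * u - l) - 1)) := by
    rw [Complex.exp_sub, ← hexp]
    field_simp
    ring
  rw [h3, norm_neg, norm_mul, norm_e, one_mul, ← hn]
  exact h2

end

section

/-- Growth of a function that is analytic off the boundary zeros of `k`. -/
structure Growth (k L : ℂ → ℂ) (v : ℝ → ℝ) (m C : ℝ) : Prop where
  one_le : 1 ≤ C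
  m_nonneg : 0 ≤ m
  out_diff : ∀ l, 1 < ‖l‖ → DifferentiableAt ℂ L l
  reg : ∀ l ∈ closedBall (0 : ℂ) 1, k l ≠ 0 → DifferentiableAt ℂ L l
  out_bd : ∀ l, 1 < ‖l‖ → ‖l‖ ≤ 3 → ‖L l‖ ≤ C / (‖l‖ - 1) ^ 2
  in_bd : ∀ l ∈ uDisc, ‖L l‖ ≤ C * Real.exp (m * PI v l)

variable {k L : ℂ → ℂ} {q : ℕ} {c m C : ℝ} {v : ℝ → ℝ}

lemma HoldData.continuous_ws (h : HoldData k q c) : Continuous (ws k q c) := by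
  have := continuous_comp_e h.cont
  unfold ws dl
  exact continuous_e.mul (Complex.continuous_ofReal.comp
    (continuous_const.add ((continuous_const.mul (this.norm.pow q)).pow 2)))

lemma HoldData.continuous_kap (h : HoldData k q c) {z : ℂ} (hz : z ∈ uDisc) :
    Continuous (kap k q c z) := by
  have := h.continuous_ws
  unfold kap
  refine Continuous.div (by fun_prop) (by fun_prop) fun s => ?_
  have h1 := le_norm_ws_sub k q c z s
  have h2 := dl_nonneg k q c (e s)
  have h3 := mem_uDisc.mp hz
  have : 0 < ‖ws k q c s - z‖ := by linarith
  positivity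

lemma HoldData.integrable_kap_mul (h : HoldData k q c) {z : ℂ} (hz : z ∈ uDisc)
    (hv : Integrable v nu) : Integrable (fun s => kap k q c z s * v s) nu := by
  refine hv.bdd_mul (c := 2 / (1 - ‖z‖)) (h.continuous_kap hz).aestronglyMeasurable
    (Eventually.of_forall fun s => ?_)
  rw [kap_eq]
  exact (Complex.abs_re_le_norm _).trans
    (norm_herglotz_le (one_le_norm_ws k q c s) (mem_uDisc.mp hz) le_rfl).1

lemma HoldData.ne_zero_of_near (h : HoldData k q c) {z ζ : ℂ} (hz : z ∈ closedBall (0 : ℂ) 1)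
    (hkz : k z ≠ 0) (hζ : ζ ∈ closedBall (0 : ℂ) 1) (hd : ‖ζ - z‖ ≤ dl k q c z) : k ζ ≠ 0 := by
  have h1 := h.dl_le_rad hz
  have h2 := h.rad_nonneg z
  have h3 := h.hold z hz ζ hζ (by rw [norm_sub_rev]; linarith)
  intro h0
  rw [h0, zero_sub, norm_neg] at h3
  linarith [norm_pos_iff.mpr hkz]

/-- Area averages of the Poisson kernel over a disc of radius comparable with `dl`. -/
lemma HoldData.row_bound (h : HoldData k q c) {A : ℝ} (hA0 : 0 ≤ A)
    (hA : ∀ a : ℂ, ∫⁻ u in uDisc, ENNReal.ofReal (1 / ‖a - u‖) ≤ ENNReal.ofReal A)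
    {z zc : ℂ} (hz : z ∈ uDisc) (hkz : k z ≠ 0) (hy : 1 - ‖z‖ ≤ dl k q c z)
    (hzc : 15 / 16 ≤ ‖zc‖) (hzzc : ‖z - zc‖ ≤ dl k q c z)
    (hnear : ∀ u ∈ uDisc, ‖zc * exp ((dl k q c z / 4 : ℝ) * u) - z‖ ≤ dl k q c z) (s : ℝ) :
    ∫⁻ u in uDisc, ENNReal.ofReal (if ‖zc * exp ((dl k q c z / 4 : ℝ) * u)‖ < 1 then
        P (zc * exp ((dl k q c z / 4 : ℝ) * u)) s else 0) ≤
      ENNReal.ofReal ((Real.pi * (8 + 16 * (4 ^ q * (1 + 4 ^ q) ^ 2)) +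
        16 * A * (4 ^ q * (2 + 4 ^ q) ^ 2)) * (1 + kap k q c z s)) := by
  have hd := h.dl_pos hkz
  have hd1 := h.dl_le (uDisc_subset hz)
  have hκ := kap_nonneg (k := k) (q := q) (c := c) hz s
  have hpi := Real.pi_pos
  set B₂ : ℝ := 16 * (4 ^ q * (1 + 4 ^ q) ^ 2) with hB₂
  set B₃ : ℝ := 4 ^ q * (2 + 4 ^ q) ^ 2 with hB₃
  have hB₂0 : 0 ≤ B₂ := by positivity
  have hB₃0 : 0 ≤ B₃ := by positivity
  set κ := kap k q c z s
  by_cases hs : 2 * dl k q c z < ‖e s - z‖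
  · calc _ ≤ ∫⁻ _ in uDisc, ENNReal.ofReal (8 + B₂ * κ) := by
          refine setLIntegral_mono measurable_const fun u hu => ENNReal.ofReal_le_ofReal ?_
          split_ifs with hlt
          · exact h.P_near_le hz hkz hy (mem_uDisc.mpr hlt) (hnear u hu) hs
          · positivity
      _ = ENNReal.ofReal ((8 + B₂ * κ) * Real.pi) := by
          rw [setLIntegral_const, ← volume_real_uDisc, Measure.real,
            ENNReal.ofReal_mul (by positivity), ENNReal.ofReal_toReal volume_uDisc_lt_top.ne]
      _ ≤ _ := by
          apply ENNReal.ofReal_le_ofReal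
          have h1 : 0 ≤ 16 * A * B₃ * (1 + κ) := by positivity
          have h2 : 0 ≤ Real.pi * (8 * κ + B₂) := by positivity
          linarith
  · push Not at hs
    have hsc : ‖e s - zc‖ ≤ 3 / 16 := by
      have := norm_add_le (e s - z) (z - zc)
      rw [sub_add_sub_cancel] at this
      linarith
    obtain ⟨a, ha⟩ := exists_log_center hzc (ρ := dl k q c z / 4) (by positivity) (by linarith) hsc
    have hinv := h.inv_dl_le hz hkz hs
    calc _ ≤ ∫⁻ u in uDisc, ENNReal.ofReal (16 / dl k q c z) * ENNReal.ofReal (1 / ‖a - u‖) := by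
          refine setLIntegral_mono_ae' measurableSet_uDisc ?_
          have : ∀ᵐ u : ℂ, u ≠ a := compl_mem_ae_iff.mpr (measure_singleton a)
          filter_upwards [this] with u hua hu
          rw [← ENNReal.ofReal_mul (by positivity)]
          refine ENNReal.ofReal_le_ofReal ?_
          have hau : 0 < ‖a - u‖ := norm_pos_iff.mpr (sub_ne_zero.mpr hua.symm)
          split_ifs with hlt
          · refine (P_le_two_div (mem_uDisc.mpr hlt) s).trans ?_
            calc _ ≤ 2 / (dl k q c z / 4 * ‖a - u‖ / 2) :=
                  div_le_div_of_nonneg_left (by norm_num) (by positivity) (ha u hu)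
              _ = _ := by field_simp; norm_num
          · positivity
      _ = ENNReal.ofReal (16 / dl k q c z) * ∫⁻ u in uDisc, ENNReal.ofReal (1 / ‖a - u‖) :=
          lintegral_const_mul' _ _ ENNReal.ofReal_ne_top
      _ ≤ ENNReal.ofReal (16 / dl k q c z) * ENNReal.ofReal A := by gcongr; exact hA a
      _ = ENNReal.ofReal (16 * A * (1 / dl k q c z)) := by
          rw [← ENNReal.ofReal_mul (by positivity)]; congr 1; ring
      _ ≤ _ := by
          apply ENNReal.ofReal_le_ofReal
          have h1 : 16 * A * (1 / dl k q c z) ≤ 16 * A * (B₃ * κ) := by gcongr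
          have h2 : 0 ≤ 16 * A * B₃ := by positivity
          have h3 : 0 ≤ Real.pi * (8 + B₂) * (1 + κ) := by positivity
          linarith

/-- The bound for a point closer to the circle than `dl`. -/
lemma Growth.near_bound (h : HoldData k q c) (hL : Growth k L v m C) {A₁ A₂ : ℝ} (hA₁ : 0 ≤ A₁)
    (hlog : ∀ b : ℝ, ∫⁻ u in uDisc, ENNReal.ofReal (-Real.log (u.re - b)) ≤ ENNReal.ofReal A₁)
    (hA₂ : 0 ≤ A₂)
    (hinv : ∀ a : ℂ, ∫⁻ u in uDisc, ENNReal.ofReal (1 / ‖a - u‖) ≤ ENNReal.ofReal A₂)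
    (hvm : Measurable v) (hv0 : ∀ s, 0 ≤ v s) (hvi : Integrable v nu)
    {z : ℂ} (hz : z ∈ uDisc) (hkz : k z ≠ 0) (hy : 16 * (1 - ‖z‖) < dl k q c z) {t : ℝ}
    (ht0 : 0 ≤ t) (ht : t ≤ 2 * -Real.log ‖z‖) :
    ‖L (z * exp t)‖ ≤ Real.exp (1 + Real.log (16 * C / dl k q c z ^ 2) + 2 * A₁ +
      m * ((Real.pi * (8 + 16 * (4 ^ q * (1 + 4 ^ q) ^ 2)) +
        16 * A₂ * (4 ^ q * (2 + 4 ^ q) ^ 2)) *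
          ((∫ s, v s ∂nu) + ∫ s, kap k q c z s * v s ∂nu))) := by
  have hzc := uDisc_subset hz
  have hz1 := mem_uDisc.mp hz
  have hd := h.dl_pos hkz
  have hd1 := h.dl_le hzc
  have hd2 : dl k q c z ^ 2 ≤ 1 := pow_le_one₀ hd.le (by linarith)
  have hC := hL.one_le
  set d := dl k q c z with hdd
  have hη := neg_log_le (y := 1 - ‖z‖) (by linarith) (by linarith)
  rw [sub_sub_cancel] at hη
  set η := -Real.log ‖z‖ with hηd
  have hz0 : z ≠ 0 := norm_pos_iff.mp (by linarith)
  set R : ℝ := Real.pi * (8 + 16 * (4 ^ q * (1 + 4 ^ q) ^ 2)) +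
        16 * A₂ * (4 ^ q * (2 + 4 ^ q) ^ 2) with hR
  have hR0 : 0 ≤ R := by have := Real.pi_pos; positivity
  set ζ : ℂ → ℂ := fun u => z * exp t * exp ((d / 4 : ℝ) * u) with hζ
  have hζe : ∀ u, ζ u = z * exp (t + (d / 4 : ℝ) * u) := fun u => by
    rw [hζ]; simp only [mul_assoc, Complex.exp_add]
  have hζc : Continuous ζ := by rw [hζ]; fun_prop
  have hnear : ∀ u : ℂ, ‖u‖ ≤ 1 → ‖ζ u - z‖ ≤ d := by
    intro u hu
    have h1 : ‖(t : ℂ) + (d / 4 : ℝ) * u‖ ≤ d / 2 := by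
      refine (norm_add_le _ _).trans ?_
      rw [norm_mul, Complex.norm_real, Complex.norm_real, Real.norm_of_nonneg ht0,
        Real.norm_of_nonneg (by positivity)]
      nlinarith
    rw [hζe, show z * exp (t + (d / 4 : ℝ) * u) - z = z * (exp (t + (d / 4 : ℝ) * u) - 1) by ring,
      norm_mul]
    have h2 := Complex.norm_exp_sub_one_le (x := (t : ℂ) + (d / 4 : ℝ) * u) (by linarith)
    nlinarith [norm_nonneg (exp ((t : ℂ) + (d / 4 : ℝ) * u) - 1), norm_nonneg z]
  have hnormζ : ∀ u, ‖ζ u‖ = Real.exp (d / 4 * (u.re - (η - t) / (d / 4))) := by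
    intro u
    rw [hζe, norm_mul_exp hz0]
    congr 1
    rw [mul_sub, mul_div_cancel₀ _ (by positivity : d / 4 ≠ 0)]
    simp
    ring
  have key := norm_le_of_area_bound (A := A₁) hlog hA₁ (f := fun u => L (ζ u))
    (C := 16 * C / d ^ 2) (b := (η - t) / (d / 4)) (m := m) (v := v)
    (κ := fun s => R * (1 + kap k q c z s)) (K := fun u s => if ‖ζ u‖ < 1 then P (ζ u) s else 0)
    ?_ ?_ hL.m_nonneg hvm hv0 ?_ ?_ ?_ ?_ ?_ ?_
  · have e0 : ζ 0 = z * exp t := by simp [hζ]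
    have e1 : ∫ s, R * (1 + kap k q c z s) * v s ∂nu =
        R * ((∫ s, v s ∂nu) + ∫ s, kap k q c z s * v s ∂nu) := by
      rw [← integral_add hvi (h.integrable_kap_mul hz hvi), ← integral_const_mul]
      refine integral_congr_ae (Eventually.of_forall fun s => ?_)
      simp only; ring
    simp only [e0, e1] at key
    exact key
  · intro u hu
    have h1 : DifferentiableAt ℂ ζ u := by rw [hζ]; fun_prop
    refine DifferentiableAt.comp u ?_ h1
    by_cases h2 : 1 < ‖ζ u‖
    · exact hL.out_diff _ h2
    · have h3 := mem_cDisc.mpr (not_lt.mp h2)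
      exact hL.reg _ h3 (h.ne_zero_of_near hzc hkz h3 (hnear u hu))
  · rw [le_div_iff₀ (by positivity)]; nlinarith
  · intro s
    have := kap_nonneg (k := k) (q := q) (c := c) hz s
    positivity
  · refine ((hvi.add (h.integrable_kap_mul hz hvi)).const_mul R).congr
      (Eventually.of_forall fun s => ?_)
    simp only [Pi.add_apply]; ring
  · refine Measurable.ite (measurableSet_lt (by fun_prop) measurable_const) ?_ measurable_const
    have := continuous_e
    unfold P
    fun_prop
  · intro u s
    split_ifs with hlt
    · exact P_nonneg (mem_uDisc.mpr hlt) s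
    · exact le_rfl
  · refine h.row_bound hA₂ hinv hz hkz (by linarith) ?_ ?_ (fun u hu =>
      hnear u (mem_uDisc.mp hu).le)
    · have : ‖z * exp t‖ = ‖z‖ * Real.exp t := by simp [Complex.norm_exp]
      rw [this]
      have := Real.one_le_exp ht0
      nlinarith
    · have := hnear 0 (by simp)
      rw [norm_sub_rev]
      simpa [hζ] using this
  · intro u hu hub
    have hK0 : 0 ≤ ∫ s, (if ‖ζ u‖ < 1 then P (ζ u) s else 0) * v s ∂nu :=
      integral_nonneg fun s => mul_nonneg (by
        split_ifs with hlt
        · exact P_nonneg (mem_uDisc.mpr hlt) s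
        · exact le_rfl) (hv0 s)
    have hm := hL.m_nonneg
    set x := u.re - (η - t) / (d / 4) with hx
    rcases lt_or_gt_of_ne (sub_ne_zero.mpr hub) with hneg | hpos
    · have hlt : ‖ζ u‖ < 1 := by
        rw [hnormζ, Real.exp_lt_one_iff]
        exact mul_neg_of_pos_of_neg (by positivity) hneg
      refine (hL.in_bd _ (mem_uDisc.mpr hlt)).trans ?_
      simp only [hlt, if_true]
      have h1 : C ≤ 16 * C / d ^ 2 := by
        rw [le_div_iff₀ (by positivity)]; nlinarith [mul_le_mul_of_nonneg_left hd2 (by linarith : 0 ≤ C)]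
      have h2 : m * PI v (ζ u) ≤ 2 * max 0 (-Real.log x) + m * ∫ s, P (ζ u) s * v s ∂nu := by
        rw [PI]; linarith [le_max_left 0 (-Real.log x)]
      gcongr
    · have hgt : 1 < ‖ζ u‖ := by
        rw [hnormζ, Real.one_lt_exp_iff]
        exact mul_pos (by positivity) hpos
      have h3 : ‖ζ u‖ ≤ 3 := by
        have := norm_sub_norm_le (ζ u) z
        linarith [hnear u (mem_uDisc.mp hu).le]
      have hge : d / 4 * x ≤ ‖ζ u‖ - 1 := by
        rw [hnormζ, ← hx]; linarith [Real.add_one_le_exp (d / 4 * x)]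
      have hdx : 0 < d / 4 * x := mul_pos (by positivity) hpos
      calc _ ≤ C / (‖ζ u‖ - 1) ^ 2 := hL.out_bd _ hgt h3
        _ ≤ C / (d / 4 * x) ^ 2 := by
            apply div_le_div_of_nonneg_left (by linarith) (by positivity)
            exact pow_le_pow_left₀ hdx.le hge 2
        _ = 16 * C / d ^ 2 * Real.exp (2 * -Real.log x) := by
            rw [show 2 * -Real.log x = -(Real.log x + Real.log x) by ring, Real.exp_neg,
              Real.exp_add, Real.exp_log hpos]
            have : ∀ y : ℝ, y ≠ 0 → C / (d / 4 * y) ^ 2 = 16 * C / d ^ 2 * (y * y)⁻¹ := fun y hy => by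
              field_simp
              norm_num
            exact this x hpos.ne'
        _ ≤ _ := by
            have := le_max_right 0 (-Real.log x)
            gcongr
            nlinarith [mul_nonneg hm hK0]

/-- Bounds for `L` at a point of the disc and at its reflection in the circle. -/
theorem exists_growth_bound (q : ℕ) {m : ℝ} (hm : 0 ≤ m) : ∃ C₀ C₁ : ℝ, 0 ≤ C₀ ∧ 0 ≤ C₁ ∧
    ∀ (k : ℂ → ℂ) (c : ℝ) (L : ℂ → ℂ) (v : ℝ → ℝ) (C : ℝ), HoldData k q c → Growth k L v m C →
      Measurable v → (∀ s, 0 ≤ v s) → Integrable v nu →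
      ∀ z ∈ uDisc, 1 / 2 ≤ ‖z‖ → k z ≠ 0 → ∀ t : ℝ, (t = 0 ∨ t = 2 * -Real.log ‖z‖) →
        ‖L (z * exp t)‖ ≤ C₁ * C * Real.exp (C₀ * ∫ s, v s ∂nu) / dl k q c z ^ 2 *
          Real.exp (C₀ * ∫ s, kap k q c z s * v s ∂nu) := by
  obtain ⟨A₁, hA₁, hlog⟩ := exists_log_strip
  obtain ⟨A₂, hA₂, hinv⟩ := exists_inv_norm
  set R : ℝ := Real.pi * (8 + 16 * (4 ^ q * (1 + 4 ^ q) ^ 2)) +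
        16 * A₂ * (4 ^ q * (2 + 4 ^ q) ^ 2) with hR
  have hR0 : 0 ≤ R := by have := Real.pi_pos; positivity
  set B : ℝ := 2 * (2 + 16 * 4 ^ q) ^ 2 with hB
  have hB0 : 0 ≤ B := by positivity
  refine ⟨m * (R + B), 256 * Real.exp (1 + 2 * A₁), by positivity, by positivity, ?_⟩
  intro k c L v C h hL hvm hv0 hvi z hz hz2 hkz t ht
  have hzc := uDisc_subset hz
  have hz1 := mem_uDisc.mp hz
  have hz0 : z ≠ 0 := norm_pos_iff.mp (by linarith)
  have hd := h.dl_pos hkz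
  have hd1 := h.dl_le hzc
  have hd2 : dl k q c z ^ 2 ≤ 1 := pow_le_one₀ hd.le (by linarith)
  have hC := hL.one_le
  have hV : 0 ≤ ∫ s, v s ∂nu := integral_nonneg hv0
  have hI : 0 ≤ ∫ s, kap k q c z s * v s ∂nu :=
    integral_nonneg fun s => mul_nonneg (kap_nonneg hz s) (hv0 s)
  have hlog0 : 0 ≤ -Real.log ‖z‖ := by linarith [Real.log_nonpos (norm_nonneg z) hz1.le]
  set d := dl k q c z with hdd
  set V := ∫ s, v s ∂nu
  set I := ∫ s, kap k q c z s * v s ∂nu with hId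
  have he : 1 ≤ Real.exp (1 + 2 * A₁) := Real.one_le_exp (by linarith)
  have hmV : 0 ≤ m * (R + B) * V := by positivity
  have hmI : 0 ≤ m * (R + B) * I := by positivity
  by_cases hy : d ≤ 16 * (1 - ‖z‖)
  · have hC1 : ∀ x : ℝ, x ≤ m * (R + B) * I → ∀ y : ℝ, y ≤ 256 * C / d ^ 2 →
        y * Real.exp x ≤ 256 * Real.exp (1 + 2 * A₁) * C * Real.exp (m * (R + B) * V) / d ^ 2 *
          Real.exp (m * (R + B) * I) := by
      intro x hx y hy
      have h1 := Real.one_le_exp hmV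
      calc y * Real.exp x ≤ 256 * C / d ^ 2 * Real.exp (m * (R + B) * I) := by gcongr
        _ = 256 * 1 * C * 1 / d ^ 2 * Real.exp (m * (R + B) * I) := by ring
        _ ≤ _ := by gcongr
    rcases ht with rfl | rfl
    · simp only [Complex.ofReal_zero, Complex.exp_zero, mul_one]
      refine (hL.in_bd z hz).trans (hC1 _ ?_ _ ?_)
      · have h1 : PI v z ≤ B * I := by
          rw [PI, hId, ← integral_const_mul]
          refine integral_mono (integrable_P_mul hvi hz)
            ((h.integrable_kap_mul hz hvi).const_mul B) fun s => ?_
          have := mul_le_mul_of_nonneg_right (h.P_le_kap hz hy s) (hv0 s)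
          simp only; linarith
        have h2 : m * PI v z ≤ m * (B * I) := by gcongr
        have h3 : 0 ≤ m * (R * I) := by positivity
        linarith
      · rw [le_div_iff₀ (by positivity)]
        nlinarith [mul_le_mul_of_nonneg_left hd2 (by linarith : 0 ≤ C)]
    · have hn : ‖z * exp ((2 * -Real.log ‖z‖ : ℝ) : ℂ)‖ = ‖z‖⁻¹ := by
        rw [norm_mul_exp hz0, Complex.ofReal_re, show 2 * -Real.log ‖z‖ - -Real.log ‖z‖ =
          -Real.log ‖z‖ by ring, Real.exp_neg, Real.exp_log (by linarith)]
      have hzp : 0 < ‖z‖ := by linarith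
      have h1 : 1 < ‖z‖⁻¹ := (one_lt_inv₀ hzp).mpr hz1
      have h2 : ‖z‖⁻¹ ≤ 2 := by
        rw [inv_le_comm₀ hzp (by norm_num)]; linarith
      have h3 : d / 16 ≤ ‖z‖⁻¹ - 1 := by
        have : (1 - ‖z‖) * 1 ≤ (1 - ‖z‖) * ‖z‖⁻¹ := by
          gcongr
        rw [mul_one, sub_mul, one_mul, mul_inv_cancel₀ hzp.ne'] at this
        linarith
      have h4 := hL.out_bd (z * exp ((2 * -Real.log ‖z‖ : ℝ) : ℂ)) (by rw [hn]; exact h1)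
        (by rw [hn]; linarith)
      rw [hn] at h4
      have h5 := hC1 0 hmI (C / (‖z‖⁻¹ - 1) ^ 2) ?_
      · rw [Real.exp_zero, mul_one] at h5
        exact h4.trans h5
      · calc C / (‖z‖⁻¹ - 1) ^ 2 ≤ C / (d / 16) ^ 2 := by
              apply div_le_div_of_nonneg_left (by linarith) (by positivity)
              exact pow_le_pow_left₀ (by positivity) h3 2
          _ = 256 * C / d ^ 2 := by field_simp; norm_num
  · have h1 := hL.near_bound h hA₁ hlog hA₂ hinv hvm hv0 hvi hz hkz (not_le.mp hy) (t := t)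
      (by rcases ht with rfl | rfl <;> linarith) (by rcases ht with rfl | rfl <;> linarith)
    refine h1.trans ?_
    rw [show 1 + Real.log (16 * C / d ^ 2) + 2 * A₁ + m * (R * (V + I)) =
      Real.log (16 * C / d ^ 2) + (1 + 2 * A₁) + m * R * V + m * R * I by ring,
      Real.exp_add, Real.exp_add, Real.exp_add, Real.exp_log (by positivity)]
    have h2 : m * R * V ≤ m * (R + B) * V := by
      have : 0 ≤ m * B * V := by positivity
      linarith
    have h3 : m * R * I ≤ m * (R + B) * I := by
      have : 0 ≤ m * B * I := by positivity
      linarith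
    calc _ ≤ 256 * C / d ^ 2 * Real.exp (1 + 2 * A₁) * Real.exp (m * (R + B) * V) *
          Real.exp (m * (R + B) * I) := by gcongr; norm_num
      _ = _ := by ring

end

lemma aBd_pow {α : ℝ} (hα1 : α < 1) (n : ℕ) :
    ABd α (1 + 4 * n) (fun z => z ^ n) := by
  refine aBd_of_deriv_bdd hα1 (by positivity) (by fun_prop) (fun z hz => ?_) fun z hz => ?_
  · rw [norm_pow]; exact pow_le_one₀ (norm_nonneg _) (mem_uDisc.mp hz).le
  · rw [deriv_pow_field, norm_mul, norm_pow, Complex.norm_natCast]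
    exact mul_le_of_le_one_right (by positivity)
      (pow_le_one₀ (norm_nonneg _) (mem_uDisc.mp hz).le)

lemma summable_coe_geometric {ρ : ℝ} (h0 : 0 ≤ ρ) (h1 : ρ < 1) :
    Summable (fun n : ℕ => (n : ℝ) * ρ ^ n) :=
  (hasSum_coe_mul_geometric_of_norm_lt_one (by rwa [Real.norm_of_nonneg h0])).summable

/-- A bounded functional may be applied termwise to a power series of radius above one. -/
lemma BddFn.hasSum {α : ℝ} (hα : 0 < α) (hα1 : α < 1) {φ : (ℂ → ℂ) →ₗ[ℂ] ℂ} (hφ : BddFn α φ)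
    {ρ : ℝ} (h0 : 0 ≤ ρ) (h1 : ρ < 1) :
    Summable (fun n : ℕ => ‖(ρ : ℂ) ^ n * φ (fun z => z ^ n)‖) ∧
    ∀ (b : ℕ → ℂ) (M : ℝ), (∀ n, ‖b n‖ ≤ M) → ∀ f, MemA α f →
      (∀ z ∈ uDisc, HasSum (fun n => b n * (ρ : ℂ) ^ n * z ^ n) (f z)) →
      HasSum (fun n => b n * ((ρ : ℂ) ^ n * φ (fun z => z ^ n))) (φ f) := by
  have hgeo := summable_geometric_of_lt_one h0 h1
  have hcoe := summable_coe_geometric h0 h1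
  obtain ⟨C, hC, hle⟩ := hφ.le_of_aBd
  have hsum : Summable (fun n : ℕ => ‖(ρ : ℂ) ^ n * φ (fun z => z ^ n)‖) := by
    refine Summable.of_nonneg_of_le (fun n => norm_nonneg _) (fun n => ?_)
      ((hgeo.add (hcoe.mul_left 4)).mul_left C)
    have := hle _ _ (memA_of_differentiable hα hα1 (by fun_prop)) (aBd_pow hα1 n)
    rw [norm_mul, norm_pow, Complex.norm_real, Real.norm_of_nonneg h0]
    calc ρ ^ n * ‖φ fun z => z ^ n‖ ≤ ρ ^ n * (C * (1 + 4 * n)) := by gcongr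
      _ = _ := by ring
  refine ⟨hsum, fun b M hb f hf hsf => ?_⟩
  have hM : 0 ≤ M := (norm_nonneg _).trans (hb 0)
  set x : ℕ → ℂ → ℂ := fun N z => ∑ n ∈ Finset.range N, b n * (ρ : ℂ) ^ n * z ^ n with hx
  have hxd : ∀ N, Differentiable ℂ (x N) := fun N => by rw [hx]; fun_prop
  have hnp : ∀ n : ℕ, ‖b n * (ρ : ℂ) ^ n‖ ≤ M * ρ ^ n := fun n => by
    rw [norm_mul, norm_pow, Complex.norm_real, Real.norm_of_nonneg h0]
    have := hb n
    gcongr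
  have hxb : ∀ N, ABd α (M * (∑' n, ρ ^ n) + 4 * (M * ρ⁻¹ * ∑' n : ℕ, (n : ℝ) * ρ ^ n)) (x N) := by
    intro N
    have hS : 0 ≤ ∑' n : ℕ, (n : ℝ) * ρ ^ n := tsum_nonneg fun n => by positivity
    refine aBd_of_deriv_bdd hα1 (by positivity) (hxd N).differentiableOn (fun z hz => ?_)
      fun z hz => ?_
    · calc ‖x N z‖ ≤ ∑ n ∈ Finset.range N, M * ρ ^ n := by
            refine (norm_sum_le _ _).trans (Finset.sum_le_sum fun n _ => ?_)
            rw [norm_mul, norm_pow]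
            exact (mul_le_of_le_one_right (norm_nonneg _)
              (pow_le_one₀ (norm_nonneg _) (mem_uDisc.mp hz).le)).trans (hnp n)
        _ = M * ∑ n ∈ Finset.range N, ρ ^ n := by rw [Finset.mul_sum]
        _ ≤ _ := by
            gcongr
            exact hgeo.sum_le_tsum _ fun n _ => by positivity
    · have hd : deriv (x N) z = ∑ n ∈ Finset.range N, b n * (ρ : ℂ) ^ n * (n * z ^ (n - 1)) := by
        rw [hx]
        refine HasDerivAt.deriv (HasDerivAt.fun_sum fun n _ => ?_)
        exact (hasDerivAt_pow n z).const_mul _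
      rw [hd]
      calc _ ≤ ∑ n ∈ Finset.range N, M * ρ⁻¹ * (n * ρ ^ n) := by
            refine (norm_sum_le _ _).trans (Finset.sum_le_sum fun n _ => ?_)
            have h2 : ‖(n : ℂ) * z ^ (n - 1)‖ ≤ n := by
              rw [norm_mul, norm_pow, Complex.norm_natCast]
              exact mul_le_of_le_one_right (by positivity)
                (pow_le_one₀ (norm_nonneg _) (mem_uDisc.mp hz).le)
            have h3 : ρ ^ n * n ≤ ρ⁻¹ * (n * ρ ^ n) := by
              rcases Nat.eq_zero_or_pos n with rfl | hn
              · simp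
              · rcases h0.eq_or_lt with rfl | hρ
                · simp [hn.ne']
                · have : 1 ≤ ρ⁻¹ := (one_le_inv₀ hρ).mpr h1.le
                  nlinarith [show 0 ≤ ρ ^ n * n by positivity]
            rw [norm_mul]
            calc _ ≤ M * ρ ^ n * n := mul_le_mul (hnp n) h2 (norm_nonneg _) (by positivity)
              _ = M * (ρ ^ n * n) := by ring
              _ ≤ M * (ρ⁻¹ * (n * ρ ^ n)) := by gcongr
              _ = _ := by ring
        _ = M * ρ⁻¹ * ∑ n ∈ Finset.range N, (n * ρ ^ n) := by rw [Finset.mul_sum]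
        _ ≤ _ := by
            gcongr
            exact hcoe.sum_le_tsum _ fun n _ => by positivity
  have hlim := hφ.tendsto hα hα1 (fun N => memA_of_differentiable hα hα1 (hxd N)) hxb hf
    fun z hz => (hsf z hz).tendsto_sum_nat
  have hφx : ∀ N, φ (x N) =
      ∑ n ∈ Finset.range N, b n * ((ρ : ℂ) ^ n * φ (fun z => z ^ n)) := by
    intro N
    have : x N = ∑ n ∈ Finset.range N, (b n * (ρ : ℂ) ^ n) • (fun z : ℂ => z ^ n) := by
      ext z; simp [hx]
    rw [this, map_sum]
    refine Finset.sum_congr rfl fun n _ => ?_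
    rw [map_smul, smul_eq_mul, mul_assoc]
  have hs : Summable (fun n => b n * ((ρ : ℂ) ^ n * φ (fun z => z ^ n))) := by
    refine Summable.of_norm_bounded (hsum.mul_left M) fun n => ?_
    rw [norm_mul]
    have := hb n
    gcongr
  have := hs.hasSum.tendsto_sum_nat
  simp only [hφx] at hlim
  rw [tendsto_nhds_unique hlim this]
  exact hs.hasSum

lemma norm_conj_e_pow (s : ℝ) (n : ℕ) : ‖conj (e s) ^ n‖ = 1 := by
  rw [norm_pow, Complex.norm_conj, norm_e, one_pow]

/-- Termwise integration against a bounded continuous function. -/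
lemma hasSum_integral_conj {G : ℝ → ℂ} (hG : Continuous G) {M : ℝ} (hM : ∀ s, ‖G s‖ ≤ M)
    {b : ℕ → ℂ} (hb : Summable fun n => ‖b n‖) :
    HasSum (fun n => (∫ s, G s * conj (e s) ^ n ∂nu) * b n)
      (∫ s, ∑' n, G s * conj (e s) ^ n * b n ∂nu) := by
  have hc : ∀ n, Continuous fun s => G s * conj (e s) ^ n * b n := fun n =>
    (hG.mul ((Complex.continuous_conj.comp continuous_e).pow n)).mul continuous_const
  have h0 : 0 ≤ M := (norm_nonneg _).trans (hM 0)
  have hn : ∀ n s, ‖G s * conj (e s) ^ n * b n‖ ≤ M * ‖b n‖ := fun n s => by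
    rw [norm_mul, norm_mul, norm_conj_e_pow, mul_one]
    have := hM s
    gcongr
  have := hasSum_integral_of_summable_integral_norm (μ := nu)
    (F := fun n s => G s * conj (e s) ^ n * b n) (fun n => integrable_of_continuous (hc n)) ?_
  · simpa only [integral_mul_const] using this
  · refine Summable.of_nonneg_of_le (fun n => integral_nonneg fun s => norm_nonneg _) (fun n => ?_)
      (hb.mul_left M)
    calc _ ≤ ∫ _, M * ‖b n‖ ∂nu :=
          integral_mono (integrable_of_continuous (hc n).norm) (integrable_const _) (hn n)
      _ = _ := by simp

/-- A functional evaluated on a dilate, as a contour integral of its Cauchy transform. -/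
lemma BddFn.dilate_eq {α : ℝ} (hα : 0 < α) (hα1 : α < 1) {φ : (ℂ → ℂ) →ₗ[ℂ] ℂ} (hφ : BddFn α φ)
    {L : ℂ → ℂ} (hL : ∀ l, 1 < ‖l‖ → L l = φ (fun z => (l - z)⁻¹)) {F : ℂ → ℂ}
    (hF : DifferentiableOn ℂ F uDisc) {ρ : ℝ} (h0 : 0 < ρ) (h1 : ρ < 1) :
    φ (fun z => F ((ρ * ρ : ℝ) * z)) =
      ∫ s, F (ρ * e s) * (L (e s / ρ) * (e s / ρ)) ∂nu := by
  have hρc : (ρ : ℂ) ≠ 0 := by exact_mod_cast h0.ne'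
  have hdc := dilate_diffContOnCl hF h0 h1
  have hGc : Continuous fun s => F (ρ * e s) := continuous_comp_e hdc.contClosed
  obtain ⟨M, hM⟩ := (isCompact_closedBall (0 : ℂ) 1).exists_bound_of_continuousOn hdc.contClosed
  have hMs : ∀ s, ‖F (ρ * e s)‖ ≤ M := fun s => hM _ (e_mem_closed s)
  obtain ⟨hsum, hhas⟩ := hφ.hasSum hα hα1 h0.le h1
  have hee : ∀ s, e s * conj (e s) = 1 := fun s => by
    rw [Complex.mul_conj, Complex.normSq_eq_norm_sq, norm_e]; simp
  have hρρ : ρ * ρ < 1 := by nlinarith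
  have hMem : MemA α (fun z => F ((ρ * ρ : ℝ) * z)) := memA_dilate hα hα1 hF (by positivity) hρρ
  set a : ℕ → ℂ := fun n => ∫ s, F (ρ * e s) * conj (e s) ^ n ∂nu with ha
  have haM : ∀ n, ‖a n‖ ≤ M := fun n => by
    refine (norm_integral_le_of_norm_le_const (C := M) (Eventually.of_forall fun s => ?_)).trans
      (by simp)
    rw [norm_mul, norm_conj_e_pow, mul_one]
    exact hMs s
  have hser : ∀ z ∈ uDisc, HasSum (fun n => a n * (ρ : ℂ) ^ n * z ^ n) (F ((ρ * ρ : ℝ) * z)) := by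
    intro z hz
    have hz1 := mem_uDisc.mp hz
    have hn : ‖(ρ : ℂ) * z‖ < 1 := by
      rw [norm_mul, Complex.norm_real, Real.norm_of_nonneg h0.le]
      nlinarith [norm_nonneg z]
    have h2 := hasSum_integral_conj hGc hMs (b := fun n => ((ρ : ℂ) * z) ^ n)
      (by simpa only [norm_pow] using summable_geometric_of_lt_one (norm_nonneg _) hn)
    have h3 := cauchy_formula hdc (mem_uDisc.mpr hn)
    rw [show F ((ρ * ρ : ℝ) * z) = F (ρ * (ρ * z)) by push_cast; ring_nf, ← h3]
    convert h2 using 1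
    · ext n; rw [ha, mul_pow]; ring
    · refine integral_congr_ae (Eventually.of_forall fun s => ?_)
      simp only [mul_assoc]
      rw [tsum_mul_left]
      congr 1
      simp only [← mul_pow]
      rw [tsum_geometric_of_norm_lt_one (by rwa [norm_mul, Complex.norm_conj, norm_e, one_mul]),
        div_eq_iff (e_sub_ne (mem_uDisc.mpr hn) s), inv_mul_eq_div, eq_div_iff]
      · linear_combination (-(ρ : ℂ) * z) * hee s
      · intro h
        have h5 : ‖conj (e s) * (ρ * z)‖ = 1 := by rw [← sub_eq_zero.mp h, norm_one]
        rw [norm_mul, Complex.norm_conj, norm_e, one_mul] at h5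
        linarith
  have h4 := hhas a M haM _ hMem hser
  have h5 := hasSum_integral_conj hGc hMs hsum
  rw [h4.unique h5]
  refine integral_congr_ae (Eventually.of_forall fun s => ?_)
  simp only [mul_assoc]
  rw [tsum_mul_left]
  congr 1
  have hl : 1 < ‖e s / ρ‖ := by
    rw [norm_div, norm_e, Complex.norm_real, Real.norm_of_nonneg h0.le]
    exact (one_lt_div h0).mpr h1
  have hl0 : e s / ρ ≠ 0 := norm_pos_iff.mp (by linarith)
  have h6 := hhas (fun n => conj (e s) ^ n) 1 (fun n => (norm_conj_e_pow s n).le)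
    ((e s / ρ) • (fun z => (e s / ρ - z)⁻¹))
    (((memA_of_differentiable hα hα1 ((differentiable_const _).sub differentiable_id)).inv hα hα1
      fun z hz => sub_ne_zero_of_one_lt hl hz).smul hα hα1 _) ?_
  · rw [h6.tsum_eq, map_smul, smul_eq_mul, hL _ hl, mul_comm]
  · intro z hz
    have hz1 := mem_uDisc.mp hz
    have hn : ‖conj (e s) * ρ * z‖ < 1 := by
      rw [norm_mul, norm_mul, Complex.norm_conj, norm_e, one_mul, Complex.norm_real,
        Real.norm_of_nonneg h0.le]
      nlinarith [norm_nonneg z]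
    have h9 : ((e s / ρ) • (fun z => (e s / ρ - z)⁻¹)) z = (1 - conj (e s) * ρ * z)⁻¹ := by
      have h7 := sub_ne_zero_of_one_lt hl (uDisc_subset hz)
      have h8 : 1 - conj (e s) * ρ * z ≠ 0 := by
        intro h
        rw [← sub_eq_zero.mp h, norm_one] at hn
        exact lt_irrefl _ hn
      rw [Pi.smul_apply, smul_eq_mul, ← div_eq_mul_inv, div_eq_iff h7, inv_mul_eq_div, eq_div_iff h8]
      field_simp
      linear_combination (-(ρ : ℂ) * z) * hee s
    rw [h9]
    simpa only [mul_pow] using hasSum_geometric_of_norm_lt_one hn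

lemma norm_mul_e {ρ : ℝ} (h : 0 ≤ ρ) (s : ℝ) : ‖(ρ : ℂ) * e s‖ = ρ := by
  rw [norm_mul, norm_e, mul_one, Complex.norm_real, Real.norm_of_nonneg h]

lemma norm_e_div {ρ : ℝ} (h : 0 ≤ ρ) (s : ℝ) : ‖e s / (ρ : ℂ)‖ = ρ⁻¹ := by
  rw [norm_div, norm_e, Complex.norm_real, Real.norm_of_nonneg h, one_div]

/-- If the Cauchy transform `L` of `φ` extends across almost all of the circle and `F * L` is
bounded on both sides of it, then `φ` annihilates `F`. -/
theorem BddFn.eq_zero_of_bounded {α : ℝ} (hα : 0 < α) (hα1 : α < 1) {φ : (ℂ → ℂ) →ₗ[ℂ] ℂ}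
    (hφ : BddFn α φ) {L : ℂ → ℂ} (hL : ∀ l, 1 < ‖l‖ → L l = φ (fun z => (l - z)⁻¹))
    (hLo : ∀ l, 1 < ‖l‖ → DifferentiableAt ℂ L l) (hLd : ∀ z ∈ uDisc, DifferentiableAt ℂ L z)
    (hLc : ∀ᵐ s ∂nu, ContinuousAt L (e s)) {F : ℂ → ℂ} (hF : MemA α F) {M : ℝ}
    (hb : ∀ s, ∀ ρ : ℝ, 1 / 2 ≤ ρ → ρ < 1 →
      ‖F (ρ * e s)‖ * ‖L (ρ * e s)‖ ≤ M ∧ ‖F (ρ * e s)‖ * ‖L (e s / ρ)‖ ≤ M) : φ F = 0 := by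
  set ρ : ℕ → ℝ := fun n => 1 - 1 / (n + 2) with hρ
  have hpos : ∀ n : ℕ, (0 : ℝ) < 1 / (n + 2) := fun n => by positivity
  have hρ1 : ∀ n, ρ n < 1 := fun n => by rw [hρ]; linarith [hpos n]
  have hρ2 : ∀ n, 1 / 2 ≤ ρ n := fun n => by
    have : (1 : ℝ) / (n + 2) ≤ 1 / 2 := by
      apply one_div_le_one_div_of_le (by norm_num)
      linarith [n.cast_nonneg (α := ℝ)]
    rw [hρ]; linarith
  have hρ0 : ∀ n, 0 < ρ n := fun n => by linarith [hρ2 n]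
  have hρt : Tendsto ρ atTop (nhds 1) := by
    have h1 : Tendsto (fun n : ℕ => (1 : ℝ) / (n + 2)) atTop (nhds 0) := by
      have := (tendsto_one_div_add_atTop_nhds_zero_nat (𝕜 := ℝ)).comp (tendsto_add_atTop_nat 1)
      refine this.congr fun n => ?_
      simp only [Function.comp]; push_cast; ring
    simpa [hρ] using h1.const_sub 1
  have hρρ : ∀ n, 0 < ρ n * ρ n ∧ ρ n * ρ n < 1 := fun n =>
    ⟨mul_pos (hρ0 n) (hρ0 n), by nlinarith [hρ1 n, hρ0 n]⟩
  have hlim := hφ.tendsto_dilate hα hα1 hF (r := fun n => ρ n * ρ n) hρρ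
    (tendsto_nhdsWithin_iff.mpr ⟨by simpa using hρt.mul hρt, Eventually.of_forall fun n =>
      (hρρ n).2⟩)
  have hin : ∀ n s, (ρ n : ℂ) * e s ∈ uDisc := fun n s => by
    rw [mem_uDisc, norm_mul_e (hρ0 n).le]; exact hρ1 n
  have hFc : ∀ n, Continuous fun s => F (ρ n * e s) := fun n =>
    continuous_comp_e (dilate_diffContOnCl hF.diff (hρ0 n) (hρ1 n)).contClosed
  have hLdiff : DifferentiableOn ℂ L uDisc := fun z hz => (hLd z hz).differentiableWithinAt
  have hinner : ∀ n, ∫ s, F (ρ n * e s) * (L (ρ n * e s) * (ρ n * e s)) ∂nu = 0 := by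
    intro n
    have h1 := mean_value (((dilate_diffContOnCl hF.diff (hρ0 n) (hρ1 n)).smul
      ((dilate_diffContOnCl hLdiff (hρ0 n) (hρ1 n)).smul
        (diffContOnCl_of (by fun_prop) (by fun_prop : ContinuousOn (fun z : ℂ => (ρ n : ℂ) * z) _)))))
    simpa [smul_eq_mul] using h1
  have hLic : ∀ n, Continuous fun s => L (ρ n * e s) := fun n =>
    continuous_comp_e (dilate_diffContOnCl hLdiff (hρ0 n) (hρ1 n)).contClosed
  have hLoc : ∀ n, Continuous fun s => L (e s / ρ n) := fun n => by
    refine continuous_iff_continuousAt.mpr fun s => ?_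
    have h1 : ContinuousAt (fun s => e s / (ρ n : ℂ)) s :=
      (continuous_e.div_const _).continuousAt
    have h2 : ContinuousAt L (e s / (ρ n : ℂ)) := (hLo _ (by
      rw [norm_e_div (hρ0 n).le]; exact (one_lt_inv₀ (hρ0 n)).mpr (hρ1 n))).continuousAt
    exact ContinuousAt.comp (f := fun s => e s / (ρ n : ℂ)) h2 h1
  set D : ℕ → ℝ → ℂ := fun n s => F (ρ n * e s) * (L (e s / ρ n) * (e s / ρ n) -
    L (ρ n * e s) * (ρ n * e s)) with hD
  have hc1 : ∀ n, Continuous fun s => F (ρ n * e s) * (L (e s / ρ n) * (e s / ρ n)) := fun n =>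
    (hFc n).mul ((hLoc n).mul (continuous_e.div_const _))
  have hc2 : ∀ n, Continuous fun s => F (ρ n * e s) * (L (ρ n * e s) * (ρ n * e s)) := fun n =>
    (hFc n).mul ((hLic n).mul (continuous_const.mul continuous_e))
  have hDc : ∀ n, Continuous (D n) := fun n => by
    refine ((hc1 n).sub (hc2 n)).congr fun s => ?_
    simp only [hD, Pi.sub_apply]; ring
  have heq : ∀ n, φ (fun z => F ((ρ n * ρ n : ℝ) * z)) = ∫ s, D n s ∂nu := by
    intro n
    rw [hφ.dilate_eq hα hα1 hL hF.diff (hρ0 n) (hρ1 n), ← sub_zero (∫ s, _ ∂nu), ← hinner n,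
      ← integral_sub (integrable_of_continuous (hc1 n)) (integrable_of_continuous (hc2 n))]
    refine integral_congr_ae (Eventually.of_forall fun s => ?_)
    rw [hD]; simp only; ring
  have hM : 0 ≤ M := (mul_nonneg (norm_nonneg _) (norm_nonneg _)).trans (hb 0 (1 / 2) le_rfl
    (by norm_num)).1
  obtain ⟨B, hB⟩ := (isCompact_closedBall (0 : ℂ) 1).exists_bound_of_continuousOn hF.cont
  have hzero : Tendsto (fun n => ∫ s, D n s ∂nu) atTop (nhds (∫ _, (0 : ℂ) ∂nu)) := by
    refine tendsto_integral_of_dominated_convergence (fun _ => 3 * M)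
      (fun n => (hDc n).aestronglyMeasurable) (integrable_const _)
      (fun n => Eventually.of_forall fun s => ?_) ?_
    · obtain ⟨h1, h2⟩ := hb s (ρ n) (hρ2 n) (hρ1 n)
      have h3 : (ρ n)⁻¹ ≤ 2 := by
        rw [inv_le_comm₀ (hρ0 n) (by norm_num)]; linarith [hρ2 n]
      have h4 : ‖D n s‖ ≤ ‖F (ρ n * e s)‖ * (‖L (e s / ρ n)‖ * (ρ n)⁻¹ + ‖L (ρ n * e s)‖ * ρ n) := by
        rw [hD]
        simp only
        rw [norm_mul]
        gcongr
        refine (norm_sub_le _ _).trans_eq ?_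
        rw [norm_mul, norm_mul, norm_mul_e (hρ0 n).le, norm_e_div (hρ0 n).le]
      have h5 : ‖F (ρ n * e s)‖ * ‖L (e s / ρ n)‖ * (ρ n)⁻¹ ≤ M * 2 := by
        have := inv_pos.mpr (hρ0 n)
        gcongr
      have h6 : ‖F (ρ n * e s)‖ * ‖L (ρ n * e s)‖ * ρ n ≤ M * 1 := by
        have := hρ0 n
        have := (hρ1 n).le
        gcongr
      linarith
    · filter_upwards [hLc] with s hs
      have hρC : Tendsto (fun n => (ρ n : ℂ)) atTop (nhds 1) := by
        have := (Complex.continuous_ofReal.tendsto 1).comp hρt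
        simpa [Function.comp_def] using this
      have t1 : Tendsto (fun n => (ρ n : ℂ) * e s) atTop (nhds (e s)) := by
        simpa using hρC.mul_const (e s)
      have t2 : Tendsto (fun n => e s / (ρ n : ℂ)) atTop (nhds (e s)) := by
        simpa [Pi.div_def] using (tendsto_const_nhds (x := e s)).div hρC one_ne_zero
      have t3 := ((hs.tendsto.comp t2).mul t2).sub ((hs.tendsto.comp t1).mul t1)
      rw [sub_self] at t3
      refine squeeze_zero_norm (a := fun n => B * ‖L (e s / ρ n) * (e s / ρ n) -
        L (ρ n * e s) * (ρ n * e s)‖) (fun n => ?_) (by simpa using t3.norm.const_mul B)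
      rw [hD]
      simp only
      rw [norm_mul]
      gcongr
      exact hB _ (uDisc_subset (hin n s))
  simp only [heq] at hlim
  simpa using tendsto_nhds_unique hlim hzero

section

/-- The Herglotz integral with respect to the points `ws`. -/
def HW (k : ℂ → ℂ) (q : ℕ) (c : ℝ) (v : ℝ → ℝ) (z : ℂ) : ℂ :=
  ∫ s, (ws k q c s + z) / (ws k q c s - z) * (v s : ℂ) ∂nu

variable {k : ℂ → ℂ} {q : ℕ} {c : ℝ} {v : ℝ → ℝ}

lemma dl_sq (k : ℂ → ℂ) (q : ℕ) (c : ℝ) (z : ℂ) :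
    dl k q c z ^ 2 = c ^ 4 * ‖k z‖ ^ (4 * q) := by
  rw [dl, ← pow_mul, mul_pow, ← pow_mul, mul_comm q]

lemma norm_kernel_le (k : ℂ → ℂ) (q : ℕ) (c : ℝ) {z : ℂ} (hz : z ∈ uDisc) (s : ℝ) :
    ‖(ws k q c s + z) / (ws k q c s - z)‖ ≤ 2 / (1 - ‖z‖) :=
  (norm_herglotz_le (one_le_norm_ws k q c s) (mem_uDisc.mp hz) le_rfl).1

lemma norm_HW_le (hv : Integrable v nu) (hv0 : ∀ s, 0 ≤ v s) {z : ℂ}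
    (hz : z ∈ uDisc) : ‖HW k q c v z‖ ≤ 2 / (1 - ‖z‖) * ∫ s, v s ∂nu := by
  rw [HW, ← integral_const_mul]
  refine norm_integral_le_of_norm_le (hv.const_mul _) (Eventually.of_forall fun s => ?_)
  rw [norm_mul, Complex.norm_real, Real.norm_of_nonneg (hv0 s)]
  exact mul_le_mul_of_nonneg_right (norm_kernel_le k q c hz s) (hv0 s)

namespace HoldData

lemma continuous_kernel (h : HoldData k q c) {z : ℂ} (hz : z ∈ uDisc) :
    Continuous fun s => (ws k q c s + z) / (ws k q c s - z) := by
  have hw := h.continuous_ws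
  refine (hw.add continuous_const).div (hw.sub continuous_const) fun s => ?_
  have h1 := le_norm_ws_sub k q c z s
  have h2 := dl_nonneg k q c (e s)
  have h3 := mem_uDisc.mp hz
  exact norm_pos_iff.mp (by linarith)

lemma HW_re (h : HoldData k q c) (hv : Integrable v nu) {z : ℂ} (hz : z ∈ uDisc) :
    (HW k q c v z).re = ∫ s, kap k q c z s * v s ∂nu := by
  have hi : Integrable (fun s => (ws k q c s + z) / (ws k q c s - z) * (v s : ℂ)) nu :=
    hv.ofReal.bdd_mul (c := 2 / (1 - ‖z‖)) (h.continuous_kernel hz).aestronglyMeasurable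
      (Eventually.of_forall fun s => norm_kernel_le k q c hz s)
  have := Complex.reCLM.integral_comp_comm hi
  rw [HW, ← Complex.reCLM_apply, ← this]
  refine integral_congr_ae (Eventually.of_forall fun s => ?_)
  simp only [Complex.reCLM_apply]
  rw [Complex.re_mul_ofReal, kap_eq]

lemma exists_hasDerivAt_HW (h : HoldData k q c) (hv : Integrable v nu) (hv0 : ∀ s, 0 ≤ v s)
    {z : ℂ} (hz : z ∈ uDisc) : ∃ H', HasDerivAt (HW k q c v) H' z ∧
      (k z ≠ 0 → ‖H'‖ ≤ 4 * (4 ^ q + 2) ^ 2 / dl k q c z ^ 2 * ∫ s, v s ∂nu) := by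
  refine ⟨_, herglotz_hasDerivAt h.continuous_ws (one_le_norm_ws k q c) hv.ofReal hz,
    fun hkz => ?_⟩
  rw [← integral_const_mul]
  refine norm_integral_le_of_norm_le (hv.const_mul _) (Eventually.of_forall fun s => ?_)
  have hd := h.dl_pos hkz
  have h1 := h.dl_le_norm_sub (uDisc_subset hz) s
  have h2 := h.dl_le (e_mem_closed s)
  have hw := norm_ws k q c s
  rw [norm_mul]
  change _ * ‖((v s : ℝ) : ℂ)‖ ≤ _
  rw [Complex.norm_real, Real.norm_of_nonneg (hv0 s)]
  refine mul_le_mul_of_nonneg_right ?_ (hv0 s)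
  have h3 : dl k q c z / (4 ^ q + 2) ≤ ‖ws k q c s - z‖ := by
    rw [div_le_iff₀ (by positivity)]; linarith
  rw [norm_div, norm_mul, norm_pow]
  calc _ ≤ 4 / (dl k q c z / (4 ^ q + 2)) ^ 2 := by
        refine div_le_div₀ (by norm_num) ?_ (by positivity) (by gcongr)
        simp only [Complex.norm_ofNat]
        linarith
    _ = _ := by field_simp

/-- The damped power of `k` belongs to the algebra, with uniform bounds. -/
lemma exists_damped {α : ℝ} (hα : 0 < α) (hα1 : α < 1) (hk : MemA α k) (h : HoldData k q c)
    {C₀ : ℝ} (hC₀ : 0 ≤ C₀) {V : ℝ} (hV : 0 ≤ V) : ∃ B, ∀ v : ℝ → ℝ, (∀ s, 0 ≤ v s) →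
      Integrable v nu → ∫ s, v s ∂nu ≤ V → ∃ F, MemA α F ∧ ABd α B F ∧
        ∀ z ∈ uDisc, F z = k z ^ (4 * q + 1) * exp (-C₀ * HW k q c v z) := by
  obtain ⟨C, hC, hkC⟩ := hk.exists_aBd hα hα1
  have hc := h.pos
  set D : ℝ := C₀ * (4 * (4 ^ q + 2) ^ 2 / c ^ 4 * V) with hD
  have hD0 : 0 ≤ D := by positivity
  set B : ℝ := (4 * q + 1 : ℕ) + D with hB
  have hB0 : 0 ≤ B := by positivity
  refine ⟨1 + B * (3 * C + 4), fun v hv0 hv hvV => ?_⟩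
  set F₀ : ℂ → ℂ := fun z => k z ^ (4 * q + 1) * exp (-C₀ * HW k q c v z) with hF₀
  have hE : ∀ z ∈ uDisc, ‖exp (-C₀ * HW k q c v z)‖ ≤ 1 := by
    intro z hz
    have h1 : 0 ≤ ∫ s, kap k q c z s * v s ∂nu :=
      integral_nonneg fun s => mul_nonneg (kap_nonneg hz s) (hv0 s)
    rw [Complex.norm_exp, ← Complex.ofReal_neg, Complex.re_ofReal_mul, h.HW_re hv hz,
      Real.exp_le_one_iff]
    nlinarith
  have hder : ∀ z ∈ uDisc, ∃ F', HasDerivAt F₀ F' z ∧ ‖F'‖ ≤ B * (‖deriv k z‖ + ‖deriv k z‖ + 1) := by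
    intro z hz
    obtain ⟨H', hH', hb⟩ := h.exists_hasDerivAt_HW hv hv0 hz
    have hk' := hasDerivAt_of_mem hk.diff hz
    have hk1 := h.le_one z (uDisc_subset hz)
    refine ⟨_, (hk'.pow (4 * q + 1)).mul ((hH'.const_mul (-C₀ : ℂ)).cexp), ?_⟩
    have hEz := hE z hz
    have t1 : ‖((4 * q + 1 : ℕ) : ℂ) * k z ^ (4 * q + 1 - 1) * deriv k z *
        exp (-C₀ * HW k q c v z)‖ ≤ (4 * q + 1 : ℕ) * ‖deriv k z‖ := by
      rw [norm_mul, norm_mul, norm_mul, norm_pow, Complex.norm_natCast]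
      have := pow_le_one₀ (n := 4 * q + 1 - 1) (norm_nonneg (k z)) hk1
      calc _ ≤ ((4 * q + 1 : ℕ) : ℝ) * 1 * ‖deriv k z‖ * 1 := by gcongr
        _ = _ := by ring
    have t2 : ‖(k ^ (4 * q + 1)) z * (exp (-C₀ * HW k q c v z) * (-C₀ * H'))‖ ≤ D := by
      rw [Pi.pow_apply]
      by_cases hkz : k z = 0
      · simp [hkz, hD0]
      · have h2 := hb hkz
        rw [dl_sq] at h2
        have hp := norm_pos_iff.mpr hkz
        rw [norm_mul, norm_mul, norm_mul, norm_neg, Complex.norm_real, Real.norm_of_nonneg hC₀,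
          norm_pow]
        calc _ ≤ ‖k z‖ ^ (4 * q + 1) * (1 * (C₀ * (4 * (4 ^ q + 2) ^ 2 /
              (c ^ 4 * ‖k z‖ ^ (4 * q)) * V))) := by
              gcongr
              exact h2.trans (by gcongr)
          _ = D * ‖k z‖ := by rw [hD]; field_simp; ring
          _ ≤ D := mul_le_of_le_one_right hD0 hk1
    refine (norm_add_le _ _).trans ?_
    have t3 : 0 ≤ ‖deriv k z‖ := norm_nonneg _
    have : 0 ≤ D * (‖deriv k z‖ + ‖deriv k z‖) := by positivity
    have : (0 : ℝ) ≤ (4 * q + 1 : ℕ) * (‖deriv k z‖ + 1) := by positivity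
    rw [hB]
    nlinarith [t1, t2]
  have hF₀d : DifferentiableOn ℂ F₀ uDisc := fun z hz =>
    (hder z hz).choose_spec.1.differentiableAt.differentiableWithinAt
  have hF₀b : ∀ z ∈ uDisc, ‖deriv F₀ z‖ ≤ B * (‖deriv k z‖ + ‖deriv k z‖ + 1) := fun z hz => by
    rw [(hder z hz).choose_spec.1.deriv]; exact (hder z hz).choose_spec.2
  have hF₀1 : ∀ z ∈ uDisc, ‖F₀ z‖ ≤ 1 := fun z hz => by
    rw [hF₀]
    simp only
    rw [norm_mul, norm_pow]
    exact mul_le_one₀ (pow_le_one₀ (norm_nonneg _) (h.le_one z (uDisc_subset hz)))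
      (norm_nonneg _) (hE z hz)
  have hkA := hk.isA hα hα1
  obtain ⟨F, hF, hFF⟩ := (IsA.dominated hα1 hkA hkA hF₀d hF₀b).exists_extension hα hα1
  have hdF : ∀ z ∈ uDisc, deriv F z = deriv F₀ z := fun z hz =>
    (Filter.eventuallyEq_of_mem (isOpen_uDisc.mem_nhds hz) hFF).deriv_eq
  exact ⟨F, hF, ABd.dominated hα1 hB0 hkC hkC hF.diff (fun z hz => by
    rw [hFF z hz]; exact hF₀1 z hz) (fun z hz => by rw [hdF z hz]; exact hF₀b z hz), hFF⟩

end HoldData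

end

lemma measurable_logMinus {α : ℝ} {g : ℂ → ℂ} (hg : MemA α g) : Measurable (logMinus g) :=
  ((Real.measurable_log.comp (continuous_comp_e hg.cont).norm.measurable).neg).max measurable_const

lemma integral_logMinus_le {α : ℝ} {g : ℂ → ℂ} (hg : MemA α g) (h0 : g 0 ≠ 0) :
    ∫ s, logMinus g s ∂nu ≤ ∫ s, ‖g (e s) - 1‖ ∂nu - Real.log ‖g 0‖ := by
  obtain ⟨hn, hi⟩ := hg.hasBd.log_aux zero_mem_uDisc h0
  have h1 := hg.hasBd.norm_le_exp_log hn hi zero_mem_uDisc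
  have h2 : Real.log ‖g 0‖ ≤ ∫ s, Real.log ‖g (e s)‖ ∂nu := by
    rw [Real.log_le_iff_le_exp (norm_pos_iff.mpr h0)]
    simpa [PI, P_zero] using h1
  have h3 : ∫ s, logMinus g s ∂nu ≤ ∫ s, ‖g (e s) - 1‖ - Real.log ‖g (e s)‖ ∂nu := by
    refine integral_mono (integrable_logMinus hg ⟨0, zero_mem_uDisc, h0⟩)
      ((integrable_norm_sub_one hg).sub hi) fun s => max_le ?_ ?_
    · linarith [norm_nonneg (g (e s) - 1)]
    · linarith [log_le_norm_sub_one (g (e s))]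
  rw [integral_sub (integrable_norm_sub_one hg) hi] at h3
  linarith

lemma ToOne.tendsto_logMinus {α : ℝ} {g : ℕ → ℂ → ℂ} (hg : ∀ n, MemA α (g n)) (h : ToOne g) :
    Tendsto (fun n => ∫ s, logMinus (g n) s ∂nu) atTop (nhds 0) := by
  have h1 := h.tendsto_at hg zero_mem_uDisc
  have h2 := (h.tendsto_L1 hg).sub (h1.norm.log (by simp))
  rw [norm_one, Real.log_one, sub_zero] at h2
  refine squeeze_zero' (Eventually.of_forall fun n =>
    integral_nonneg fun s => logMinus_nonneg _ s) ?_ h2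
  filter_upwards [h1.eventually_ne one_ne_zero] with n hn
  exact integral_logMinus_le (hg n) hn

/-- The damped function is annihilated by every functional whose transform has the
growth described by `Growth`. -/
lemma BddFn.damped_eq_zero {α : ℝ} (hα : 0 < α) (hα1 : α < 1) {φ : (ℂ → ℂ) →ₗ[ℂ] ℂ}
    (hφ : BddFn α φ) {k L F : ℂ → ℂ} {q : ℕ} {c C C₀ C₁ : ℝ} {v : ℝ → ℝ}
    (hL : ∀ l, 1 < ‖l‖ → L l = φ (fun z => (l - z)⁻¹))
    (hLo : ∀ l, 1 < ‖l‖ → DifferentiableAt ℂ L l) (hLd : ∀ z ∈ uDisc, DifferentiableAt ℂ L z)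
    (hLc : ∀ᵐ s ∂nu, ContinuousAt L (e s)) (hF : MemA α F) (hh : HoldData k q c)
    (hC : 0 ≤ C) (hC₁ : 0 ≤ C₁) (hv : Integrable v nu)
    (hFz : ∀ z ∈ uDisc, F z = k z ^ (4 * q + 1) * exp (-C₀ * HW k q c v z))
    (hb : ∀ z ∈ uDisc, 1 / 2 ≤ ‖z‖ → k z ≠ 0 → ∀ t : ℝ, (t = 0 ∨ t = 2 * -Real.log ‖z‖) →
        ‖L (z * exp t)‖ ≤ C₁ * C * Real.exp (C₀ * ∫ s, v s ∂nu) / dl k q c z ^ 2 *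
          Real.exp (C₀ * ∫ s, kap k q c z s * v s ∂nu)) : φ F = 0 := by
  have hc := hh.pos
  have key : ∀ z ∈ uDisc, 1 / 2 ≤ ‖z‖ → ∀ t : ℝ, (t = 0 ∨ t = 2 * -Real.log ‖z‖) →
      ‖F z‖ * ‖L (z * exp t)‖ ≤ C₁ * C * Real.exp (C₀ * ∫ s, v s ∂nu) / c ^ 4 := by
    intro z hz hz2 t ht
    by_cases hkz : k z = 0
    · rw [hFz z hz, hkz]
      simp only [zero_pow (Nat.succ_ne_zero _), zero_mul, norm_zero]
      positivity
    have hp := norm_pos_iff.mpr hkz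
    have h1 := hb z hz hz2 hkz t ht
    rw [dl_sq] at h1
    rw [hFz z hz, norm_mul, norm_pow, Complex.norm_exp, ← Complex.ofReal_neg,
      Complex.re_ofReal_mul, hh.HW_re hv hz, neg_mul, Real.exp_neg]
    refine (mul_le_mul_of_nonneg_left h1 (by positivity)).trans ?_
    have hk1 := hh.le_one z (uDisc_subset hz)
    calc _ = ‖k z‖ * (C₁ * C * Real.exp (C₀ * ∫ s, v s ∂nu) / c ^ 4) := by field_simp; ring
      _ ≤ _ := mul_le_of_le_one_left (by positivity) hk1
  refine hφ.eq_zero_of_bounded hα hα1 hL hLo hLd hLc hF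
    (M := C₁ * C * Real.exp (C₀ * ∫ s, v s ∂nu) / c ^ 4) fun s ρ h0 h1 => ?_
  have hρ : 0 < ρ := by linarith
  have hn := norm_mul_e hρ.le s
  have hz : (ρ * e s : ℂ) ∈ uDisc := mem_uDisc.mpr (by rw [hn]; exact h1)
  constructor
  · simpa using key _ hz (by rw [hn]; exact h0) 0 (Or.inl rfl)
  · have h2 := key _ hz (by rw [hn]; exact h0) _ (Or.inr rfl)
    have h3 : (ρ * e s : ℂ) * exp ((2 * -Real.log ‖(ρ * e s : ℂ)‖ : ℝ) : ℂ) = e s / ρ := by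
      rw [hn, ← Complex.ofReal_exp, mul_neg, Real.exp_neg, two_mul, Real.exp_add,
        Real.exp_log hρ]
      have : (ρ : ℂ) ≠ 0 := Complex.ofReal_ne_zero.mpr hρ.ne'
      push_cast
      field_simp
    rwa [h3] at h2

lemma exists_pow_mem_of_le_one {α : ℝ} (hα : 0 < α) (hα1 : α < 1) {K : Set (ℂ → ℂ)}
    (hK : IsClosedIdeal α K) {G : ℕ → ℂ → ℂ} (hG : ∀ n, G n ∈ K) (hG1 : ToOne G) {k : ℂ → ℂ}
    (hk : MemA α k) (hk1 : ∀ z ∈ closedBall (0 : ℂ) 1, ‖k z‖ ≤ 1)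
    (hk0 : ∀ ξ ∈ uCircle, (∀ g ∈ K, g ξ = 0) → k ξ = 0) : ∃ N : ℕ, k ^ N ∈ K := by
  obtain ⟨q, hq⟩ := exists_exponent hα
  obtain ⟨c, hc, hc4, hh⟩ := exists_hold hα hα1 hk hk1 hq
  have hD : HoldData k q c := ⟨hk.cont, hk1, hc, hc4, hh⟩
  refine ⟨4 * q + 1, ?_⟩
  by_contra hnot
  obtain ⟨φ, hφ, hφK, hne⟩ := separate_ideal hα hα1 hK (hk.pow hα hα1 _) hnot
  obtain ⟨L, hL⟩ := exists_lData hα hα1 hK hφ hφK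
  have hGA := fun n => hK.mem_A _ (hG n)
  have hLd := hL.differentiableOn hK hG hG1
  obtain ⟨C₀, C₁, hC₀, hC₁, hgb⟩ := exists_growth_bound q (m := (2 * q + 1 : ℕ)) (by positivity)
  obtain ⟨B, hB⟩ := HoldData.exists_damped hα hα1 hk hD hC₀ zero_le_one
  have hev : ∀ᶠ n in atTop, G n 0 ≠ 0 ∧ ∫ s, logMinus (G n) s ∂nu ≤ 1 :=
    ((hG1.tendsto_at hGA zero_mem_uDisc).eventually_ne one_ne_zero).and
      ((hG1.tendsto_logMinus hGA).eventually_le_const one_pos)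
  obtain ⟨n₀, hn₀⟩ := eventually_atTop.mp hev
  have hint : ∀ n, Integrable (logMinus (G (n + n₀))) nu := fun n =>
    integrable_logMinus (hGA _) ⟨0, zero_mem_uDisc, (hn₀ _ (Nat.le_add_left _ _)).1⟩
  choose F hFA hFB hFz using fun n => hB (logMinus (G (n + n₀))) (logMinus_nonneg _)
    (hint n) (hn₀ _ (Nat.le_add_left _ _)).2
  have hzero : ∀ n, φ (F n) = 0 := fun n => by
    have h0 : ∃ z ∈ uDisc, G (n + n₀) z ≠ 0 :=
      ⟨0, zero_mem_uDisc, (hn₀ _ (Nat.le_add_left _ _)).1⟩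
    obtain ⟨C, hC, hCb⟩ := hL.interior_bound hα hα1 hK hq hG hG1 (hG (n + n₀)) h0
    obtain ⟨C', hC', hCo⟩ := hL.out_bd
    have hgr : Growth k L (logMinus (G (n + n₀))) (2 * q + 1 : ℕ) (C + C') := by
      refine ⟨by linarith, by positivity, hL.out_diff, fun l hl hkl => ?_, fun l h1 h3 => ?_,
        fun l hl => ?_⟩
      · rcases (mem_cDisc.mp hl).lt_or_eq with h | h
        · exact hLd l (mem_uDisc.mpr h)
        · by_contra hnd
          refine hkl (hk0 l (mem_uCircle.mpr h) fun g hg => ?_)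
          by_contra hgl
          exact hnd (hL.reg l hl g hg hgl)
      · exact (hCo l h1 h3).trans (by gcongr; linarith)
      · exact (hCb l hl).trans (by gcongr; linarith)
    refine hφ.damped_eq_zero hα hα1 hL.out_eq hL.out_diff hLd ?_ (hFA n) hD
      (C := C + C') (by linarith) hC₁ (hint n) (hFz n)
      (hgb k c L _ _ hD hgr (measurable_logMinus (hGA _)) (logMinus_nonneg _) (hint n))
    filter_upwards [ae_ne (hGA (n + n₀)) h0] with s hs
    exact (hL.reg _ (e_mem_closed s) _ (hG _) hs).continuousAt
  have hlim := hφ.tendsto hα hα1 hFA hFB (hk.pow hα hα1 (4 * q + 1)) fun z hz => by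
    have h1 : Tendsto (fun n => HW k q c (logMinus (G (n + n₀))) z) atTop (nhds 0) := by
      have h2 := (((hG1.tendsto_logMinus hGA).comp (tendsto_add_atTop_nat n₀)).const_mul
        (2 / (1 - ‖z‖)))
      rw [mul_zero] at h2
      exact squeeze_zero_norm (fun n => norm_HW_le (hint n) (logMinus_nonneg _) hz) h2
    have h2 := ((h1.const_mul (-C₀ : ℂ)).cexp).const_mul (k z ^ (4 * q + 1))
    rw [mul_zero, exp_zero, mul_one] at h2
    exact h2.congr fun n => (hFz n z hz).symm
  simp only [hzero] at hlim
  exact hne (tendsto_nhds_unique hlim tendsto_const_nhds)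

/-- Some power of `k` belongs to a closed ideal containing functions close to `1` in the mean,
provided `k` vanishes on the boundary zero set of the ideal. -/
theorem exists_pow_mem {α : ℝ} (hα : 0 < α) (hα1 : α < 1) {K : Set (ℂ → ℂ)}
    (hK : IsClosedIdeal α K) {G : ℕ → ℂ → ℂ} (hG : ∀ n, G n ∈ K) (hG1 : ToOne G) {k : ℂ → ℂ}
    (hk : MemA α k) (hk0 : ∀ ξ ∈ uCircle, (∀ g ∈ K, g ξ = 0) → k ξ = 0) :
    ∃ N : ℕ, k ^ N ∈ K := by
  obtain ⟨C, hC, hb⟩ := hk.exists_norm_le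
  have hC0 : (C : ℂ) ≠ 0 := Complex.ofReal_ne_zero.mpr hC.ne'
  obtain ⟨N, hN⟩ := exists_pow_mem_of_le_one hα hα1 hK hG hG1 (hk.smul hα hα1 (C : ℂ)⁻¹)
    (fun z hz => by
      rw [Pi.smul_apply, norm_smul, norm_inv, Complex.norm_real, Real.norm_of_nonneg hC.le,
        inv_mul_le_iff₀ hC, mul_one]
      exact hb z hz)
    (fun ξ hξ h => by rw [Pi.smul_apply, hk0 ξ hξ h, smul_zero])
  refine ⟨N, ?_⟩
  have := hK.smul_mem ((C : ℂ) ^ N) _ hN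
  rwa [smul_pow, smul_smul, ← mul_pow, mul_inv_cancel₀ hC0, one_pow, one_smul] at this

section

/-- The ideal quotient of a closed ideal by a function is a closed ideal. -/
lemma isClosedIdeal_quotient {α : ℝ} (hα : 0 < α) (hα1 : α < 1) {J : Set (ℂ → ℂ)}
    (hJ : IsClosedIdeal α J) {p : ℂ → ℂ} (hp : MemA α p) :
    IsClosedIdeal α {k | MemA α k ∧ k * p ∈ J} where
  mem_A _ h := h.1
  zero_mem := ⟨hJ.mem_A _ hJ.zero_mem, by rw [zero_mul]; exact hJ.zero_mem⟩
  add_mem f hf g hg := ⟨hf.1.add hα hα1 hg.1, by rw [add_mul]; exact hJ.add_mem _ hf.2 _ hg.2⟩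
  smul_mem c f hf := ⟨hf.1.smul hα hα1 c, by rw [smul_mul_assoc]; exact hJ.smul_mem c _ hf.2⟩
  mul_mem f hf g hg := ⟨hf.1.mul hα hα1 hg, by
    rw [mul_right_comm]; exact hJ.mul_mem _ hf.2 g hg⟩
  ext_mem f hf g hg h := ⟨hg, hJ.ext_mem _ hf.2 _ (hg.mul hα hα1 hp) fun z hz => by
    rw [Pi.mul_apply, Pi.mul_apply, h z hz]⟩
  closed F f hF hf hlim := by
    refine ⟨hf, ?_⟩
    have hd := fun n => (hF n).1.sub hα hα1 hf
    obtain ⟨M, hM⟩ := hlim.bddAbove_range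
    obtain ⟨D, hD, hpD⟩ := hp.exists_aBd hα hα1
    have hFb : ∀ n, ABd α (2 * (M + ANorm α f)) (F n) := fun n => by
      refine ((hF n).1.aBd hα hα1).mono ?_
      have h1 := aNorm_add_le hα hα1 (hd n) hf
      rw [sub_add_cancel] at h1
      linarith [hM (mem_range_self n)]
    refine mem_of_bounded_limit hα hα1 hJ (fun n => (hF n).2) (fun n => ?_)
      (hf.mul hα hα1 hp) (fun z hz => ?_)
      (C := max (2 * (M + ANorm α f)) D * max (2 * (M + ANorm α f)) D +
        max (2 * (M + ANorm α f)) D * (3 * max (2 * (M + ANorm α f)) D + 4))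
    · obtain ⟨K, hK, hKb⟩ := (hFb n).mul hα1 hpD
      rw [← hK]; exact hKb
    · have h1 : Tendsto (fun n => F n z - f z) atTop (nhds 0) := by
        have h2 := hlim.const_mul 2
        rw [mul_zero] at h2
        exact squeeze_zero_norm (fun n => ((hd n).aBd hα hα1).bd z hz) h2
      have h3 := (h1.add_const (f z)).mul_const (p z)
      simpa using h3

variable {α : ℝ} {U : ℂ → ℂ} {u : ℝ → ℂ}

/-- Division by an inner function preserves the algebra. -/
lemma exists_quotient (hα : 0 < α) (hα1 : α < 1) (hU : IsInner U) (hUu : HasBd U u)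
    {f h : ℂ → ℂ} (hf : MemA α f) (hh : HasBd h fun s => conj (u s) * f (e s)) :
    ∃ p, MemA α p ∧ (∀ z ∈ uDisc, p z = h z) ∧ ∀ᵐ s ∂nu, p (e s) = conj (u s) * f (e s) := by
  have hT : Toep f h U 0 := by
    refine ⟨hh.diff, hU.1, differentiableOn_const 0, hh.bdd, hU.2.1, ⟨0, by simp⟩, ?_⟩
    filter_upwards [hh.lim, hUu.lim, hf.hasBd.lim] with s h1 h2 h3
    have h4 := (h1.sub (((Complex.continuous_conj.tendsto _).comp h2).mul h3)).sub_const
      (conj (0 : ℂ))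
    simpa using h4
  obtain ⟨p, hp, hph⟩ := (hT.isA hα hα1 hf).exists_extension hα hα1
  refine ⟨p, hp, hph, ?_⟩
  filter_upwards [hh.lim, hp.hasBd.lim] with s h1 h2
  refine tendsto_nhds_unique h2 (h1.congr' ?_)
  filter_upwards [Ioo_mem_nhdsLT one_pos] with r hr
  exact (hph _ (mem_uDisc.mpr (by rw [norm_mul_e hr.1.le]; exact hr.2))).symm

lemma hasBd_quotient (hUu : HasBd U u) (hu : ∀ᵐ s ∂nu, ‖u s‖ = 1) {f h : ℂ → ℂ}
    (hf : MemA α f) (hh : DifferentiableOn ℂ h uDisc) (hb : ∃ B : ℝ, ∀ z ∈ uDisc, ‖h z‖ ≤ B)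
    (hfU : ∀ z ∈ uDisc, f z = U z * h z) : HasBd h fun s => conj (u s) * f (e s) := by
  refine ⟨hh, hb, ?_⟩
  filter_upwards [hu, hUu.lim, hf.hasBd.lim] with s h1 h2 h3
  have hu0 : u s ≠ 0 := norm_ne_zero_iff.mp (by rw [h1]; exact one_ne_zero)
  have h4 : f (e s) / u s = conj (u s) * f (e s) := by
    rw [div_eq_mul_inv, Complex.inv_def, Complex.normSq_eq_norm_sq, h1]
    simp [mul_comm]
  rw [← h4]
  refine (h3.div h2 hu0).congr' ?_
  filter_upwards [Ioo_mem_nhdsLT one_pos, h2.eventually_ne hu0] with r hr hr0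
  simp only [Pi.div_apply]
  rw [hfU _ (mem_uDisc.mpr (by rw [norm_mul_e hr.1.le]; exact hr.2)), mul_div_cancel_left₀ _ hr0]

lemma mem_of_standard (hα : 0 < α) (hα1 : α < 1) {J : Set (ℂ → ℂ)} (hJ : IsClosedIdeal α J)
    (hU : IsInner U) (hUu : HasBd U u) (hu : ∀ᵐ s ∂nu, ‖u s‖ = 1)
    (hJU : ∀ g ∈ J, ∃ h, HasBd h (fun s => conj (u s) * g (e s)) ∧ ∀ z ∈ uDisc, g z = U z * h z)
    {x : ℕ → ℂ → ℂ} (hx : ∀ n, x n ∈ J)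
    (hxu : Tendsto (fun n => ∫ s, ‖x n (e s) - u s‖ ^ 2 ∂nu) atTop (nhds 0)) {f h : ℂ → ℂ}
    (hf : MemA α f) (hf0 : ∀ ξ ∈ uCircle, (∀ g ∈ J, g ξ = 0) → f ξ = 0)
    (hh : DifferentiableOn ℂ h uDisc) (hb : ∃ B : ℝ, ∀ z ∈ uDisc, ‖h z‖ ≤ B)
    (hfU : ∀ z ∈ uDisc, f z = U z * h z) : f ∈ J := by
  by_cases hne : ∃ z ∈ uDisc, f z ≠ 0
  swap
  · push Not at hne
    exact hJ.ext_mem 0 hJ.zero_mem f hf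
      (eqOn_closed hf.cont continuousOn_const fun z hz => hne z hz)
  obtain ⟨p, hp, hph, -⟩ := exists_quotient hα hα1 hU hUu hf (hasBd_quotient hUu hu hf hh hb hfU)
  have hK := isClosedIdeal_quotient hα hα1 hJ hf
  have hquot : ∀ g ∈ J, ∃ G ∈ {k | MemA α k ∧ k * f ∈ J},
      ∀ᵐ s ∂nu, G (e s) = conj (u s) * g (e s) := fun g hg => by
    have hgA := hJ.mem_A g hg
    obtain ⟨hg', hgb, hgU⟩ := hJU g hg
    obtain ⟨G, hG, hGh, hGe⟩ := exists_quotient hα hα1 hU hUu hgA hgb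
    refine ⟨G, ⟨hG, ?_⟩, hGe⟩
    refine hJ.ext_mem _ (hJ.mul_mem g hg p hp) _ (hG.mul hα hα1 hf)
      (eqOn_closed (hG.mul hα hα1 hf).cont (hgA.mul hα hα1 hp).cont fun z hz => ?_)
    simp only [Pi.mul_apply]
    rw [hGh z hz, hph z hz, hfU z hz, hgU z hz]
    ring
  choose G hG hGe using fun n => hquot (x n) (hx n)
  have hG1 : ToOne G := hxu.congr fun n => integral_congr_ae <| by
    filter_upwards [hGe n, hu] with s h1 h2
    have h3 : conj (u s) * u s = 1 := by
      rw [mul_comm, Complex.mul_conj, Complex.normSq_eq_norm_sq, h2]; simp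
    have h4 : conj (u s) * x n (e s) - 1 = conj (u s) * (x n (e s) - u s) := by
      rw [mul_sub, h3]
    rw [h1, h4, norm_mul, RCLike.norm_conj, h2, one_mul]
  obtain ⟨O, hO, hOe, hcancel⟩ := exists_outer_cancel hα hα1 hf hne
  obtain ⟨N, hN⟩ := exists_pow_mem hα hα1 hK hG hG1 hO fun ξ hξ h => by
    obtain ⟨s, rfl⟩ := exists_e hξ
    rw [← norm_eq_zero, hOe, norm_eq_zero]
    exact hf0 _ hξ fun g hg => h g ⟨hJ.mem_A g hg, hJ.mul_mem g hg f hf⟩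
  exact hcancel J hJ N (by rw [mul_comm]; exact hN.2)

end

end ClosedIdeals

end

/-- Every nonzero closed ideal of `𝒜_α` (0 < α ≤ 1/2) is standard:
there is an inner function `U` with
`ℐ = {f ∈ 𝒜_α : f = 0 on E_ℐ and f/U is bounded analytic on 𝔻}`. -/
theorem closed_ideals_standard (α : ℝ) (hα0 : 0 < α) (hα1 : α ≤ 1/2)
    (J : Set (ℂ → ℂ)) (hJ : IsClosedIdeal α J)
    (hJne : ∃ f ∈ J, ∃ z ∈ Metric.closedBall (0:ℂ) 1, f z ≠ 0) :
    ∃ U : ℂ → ℂ, IsInner U ∧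
      J = {f | MemA α f ∧
        (∀ ξ ∈ uCircle, (∀ g ∈ J, g ξ = 0) → f ξ = 0) ∧
        ∃ h : ℂ → ℂ, DifferentiableOn ℂ h uDisc ∧ (∃ B : ℝ, ∀ z ∈ uDisc, ‖h z‖ ≤ B) ∧
          ∀ z ∈ uDisc, f z = U z * h z} := by
  have hα1' : α < 1 := by linarith
  obtain ⟨f, hf, z, hz, hfz⟩ := hJne
  have hne : ∃ f ∈ J, ∃ z ∈ uDisc, f z ≠ 0 := by
    by_contra hcon
    push Not at hcon
    exact hfz (ClosedIdeals.eqOn_closed (hJ.mem_A f hf).cont continuousOn_const (hcon f hf) z hz)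
  obtain ⟨U, u, hU, hUu, hu, hJU, x, hx, hxu⟩ := ClosedIdeals.beurling hα0 hα1' hJ hne
  refine ⟨U, hU, Set.ext fun f => ⟨fun hf => ?_, ?_⟩⟩
  · obtain ⟨h, hh, hfh⟩ := hJU f hf
    exact ⟨hJ.mem_A f hf, fun ξ _ h0 => h0 f hf, h, hh.diff, hh.bdd, hfh⟩
  · rintro ⟨hf, hf0, h, hh, hb, hfU⟩
    exact ClosedIdeals.mem_of_standard hα0 hα1' hJ hU hUu hu hJU hx hxu hf hf0 hh hb hfU
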